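/- Let M be a (d+9)-vertex combinatorial d-manifold whose geometric carrier is a Z₂-homology d-sphere. If M is not a combinatorial d-sphere, then M does not admit any bistellar i-move for any i < d. -/

import Mathlib

/- Formalization of definitions from:
   B. Bagchi, B. Datta, "Combinatorial triangulations of homology spheres". -/

open Finset

noncomputable section

attribute [local instance] Classical.propDecidable

namespace HomologySpheres

variable {V : Type*} [DecidableEq V] {W : Type*} [DecidableEq W]

/-- The vertex set of a finite family of finite sets. -/
def verts (K : Finset (Finset V)) : Finset V := K.sup id

/-- An (abstract, finite) simplicial complex: a nonempty collection of nonempty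
finite sets closed under taking nonempty subsets. -/
def IsComplex (K : Finset (Finset V)) : Prop :=
  K.Nonempty ∧ ∅ ∉ K ∧ ∀ s ∈ K, ∀ t : Finset V, t ⊆ s → t.Nonempty → t ∈ K

/-- The facets (maximal faces) of `K`. -/
def facets (K : Finset (Finset V)) : Finset (Finset V) :=
  K.filter fun s => ∀ t ∈ K, s ⊆ t → t = s

/-- `K` is pure of dimension `d`: every maximal face has `d + 1` vertices. -/
def IsPure (d : ℕ) (K : Finset (Finset V)) : Prop :=
  ∀ s ∈ facets K, s.card = d + 1

/-- The link of a face `σ` in `K`. -/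
def link (K : Finset (Finset V)) (σ : Finset V) : Finset (Finset V) :=
  K.filter fun τ => Disjoint τ σ ∧ τ ∪ σ ∈ K

/-- `L` is an induced (full) subcomplex of `K`. -/
def IsInduced (K L : Finset (Finset V)) : Prop :=
  L ⊆ K ∧ ∀ s ∈ K, s ⊆ verts L → s ∈ L

/-- The simplicial complement `C(L, K)`: the induced subcomplex of `K` on
`V(K) \ V(L)`. -/
def simpComplement (L K : Finset (Finset V)) : Finset (Finset V) :=
  K.filter fun s => s ⊆ verts K \ verts L

/-- The simplicial neighbourhood `N(L, K)`: the subcomplex of `K` whose maximal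
faces are the maximal faces of `K` meeting `V(L)`. -/
def simpNbhd (L K : Finset (Finset V)) : Finset (Finset V) :=
  K.filter fun s => ∃ t ∈ facets K, s ⊆ t ∧ (t ∩ verts L).Nonempty

/-- `fvec K i` is the number of `i`-dimensional faces of `K`. -/
def fvec (K : Finset (Finset V)) (i : ℕ) : ℕ :=
  (K.filter fun s => s.card = i + 1).card

/-- The number of facets of cardinality `d + 1` containing a given `(d-1)`-face
(the degree of the face in a (weak) pseudomanifold of dimension `d`). -/
def degOf (K : Finset (Finset V)) (d : ℕ) (s : Finset V) : ℕ :=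
  (K.filter fun t => s ⊆ t ∧ t.card = d + 1).card

/-- Simplicial isomorphism (via a vertex bijection carrying faces to faces). -/
def Iso (K : Finset (Finset V)) (L : Finset (Finset W)) : Prop :=
  ∃ f : V → W, Set.InjOn f ↑(verts K) ∧ L = K.image (Finset.image f)

/-- The join of two simplicial complexes (on disjoint vertex sets). -/
def sjoin (K L : Finset (Finset V)) : Finset (Finset V) :=
  K ∪ L ∪ (K ×ˢ L).image fun p => p.1 ∪ p.2

/-- The standard ball on vertex set `A`: all nonempty subsets of `A`. -/
def stdBall (A : Finset V) : Finset (Finset V) := A.powerset.erase ∅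

/-- The standard sphere on vertex set `A`: all nonempty proper subsets of `A`. -/
def stdSphere (A : Finset V) : Finset (Finset V) := (A.powerset.erase ∅).erase A

/-- `τ` is a free face of `K`, with `σ` the unique face properly containing it. -/
def IsFreeFace (K : Finset (Finset V)) (τ σ : Finset V) : Prop :=
  τ ∈ K ∧ σ ∈ K ∧ τ ⊂ σ ∧ ∀ ρ ∈ K, τ ⊂ ρ → ρ = σ

/-- An elementary collapse removes a free face together with the unique face
properly containing it. -/
def ElemCollapse (K K' : Finset (Finset V)) : Prop :=
  ∃ τ σ : Finset V, IsFreeFace K τ σ ∧ K' = (K.erase τ).erase σ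

/-- `K` collapses to `L` by a sequence of elementary collapses. -/
def CollapsesTo (K L : Finset (Finset V)) : Prop :=
  Relation.ReflTransGen ElemCollapse K L

/-- `K` is collapsible: it collapses to a single vertex. -/
def Collapsible (K : Finset (Finset V)) : Prop :=
  ∃ v : V, CollapsesTo K {{v}}

/-! ### Simplicial homology with `ℤ/2` coefficients (augmented chain complex).
A chain of level `n` is a `ZMod 2`-valued function supported on the faces of
cardinality `n` (the empty set, of cardinality `0`, serves as the `(-1)`-simplex
of the augmented complex).  Reduced homology in dimension `q` lives at level
`q + 1`. -/

/-- `c` is a chain of level `n` of `K` (over `ℤ/2`). -/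
def z2chainOK (K : Finset (Finset V)) (n : ℕ) (c : Finset V → ZMod 2) : Prop :=
  ∀ s : Finset V, c s ≠ 0 → s.card = n ∧ (s ∈ K ∨ s = ∅)

/-- The mod-2 boundary operator. -/
def z2bdry (K : Finset (Finset V)) (c : Finset V → ZMod 2) : Finset V → ZMod 2 :=
  fun t => ∑ v ∈ verts K \ t, c (insert v t)

/-- `K` is `ℤ/2`-acyclic: all reduced homology with `ℤ/2` coefficients vanishes,
i.e. in the augmented mod-2 chain complex every cycle is a boundary. -/
def Z2Acyclic (K : Finset (Finset V)) : Prop :=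
  ∀ (n : ℕ) (c : Finset V → ZMod 2), z2chainOK K n c → z2bdry K c = 0 →
    ∃ c', z2chainOK K (n + 1) c' ∧ z2bdry K c' = c

/-- `K` has the reduced `ℤ/2`-homology of the `d`-sphere: reduced homology
vanishes in all dimensions except `d` (level `d + 1`), where it is `ℤ/2`
(there is a cycle `z` which is not a boundary, and modulo boundaries every
cycle is `0` or `z`). -/
def Z2HomologySphere (d : ℕ) (K : Finset (Finset V)) : Prop :=
  (∀ (n : ℕ) (c : Finset V → ZMod 2), n ≠ d + 1 → z2chainOK K n c →
    z2bdry K c = 0 → ∃ c', z2chainOK K (n + 1) c' ∧ z2bdry K c' = c) ∧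
  (∃ z : Finset V → ZMod 2, z2chainOK K (d + 1) z ∧ z2bdry K z = 0 ∧
    (∀ c', z2chainOK K (d + 2) c' → z2bdry K c' ≠ z) ∧
    (∀ z', z2chainOK K (d + 1) z' → z2bdry K z' = 0 →
      (∃ c', z2chainOK K (d + 2) c' ∧ z2bdry K c' = z') ∨
      (∃ c', z2chainOK K (d + 2) c' ∧ z2bdry K c' = z + z')))

/-! ### Integral simplicial homology via ordered chains (Munkres §13: ordered
simplicial homology, allowing repeated vertices, agrees with simplicial
homology). An ordered `m`-tuple chain corresponds to dimension `m - 1`; the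
unique `0`-tuple is the `(-1)`-simplex of the augmented complex. -/

/-- `c` is an ordered chain of `K` over `ℤ`: supported on tuples whose image is
a face (the empty tuple being allowed in level `0`). -/
def zchainOK (K : Finset (Finset V)) {m : ℕ} (c : (Fin m → V) → ℤ) : Prop :=
  ∀ x : Fin m → V, c x ≠ 0 → (Finset.univ.image x ∈ K ∨ m = 0)

/-- The integral boundary operator on ordered chains. -/
def zbdry (K : Finset (Finset V)) {m : ℕ} (c : (Fin (m + 1) → V) → ℤ) :
    (Fin m → V) → ℤ :=
  fun y => ∑ i : Fin (m + 1), (-1 : ℤ) ^ (i : ℕ) * ∑ v ∈ verts K, c (i.insertNth v y)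

/-- `K` has the reduced integral homology of the `d`-sphere: reduced homology
vanishes in all dimensions except `d`, where it is infinite cyclic (there is a
cycle `z` such that every cycle is, modulo boundaries, a unique multiple of `z`). -/
def ZHomologySphere (d : ℕ) (K : Finset (Finset V)) : Prop :=
  (∀ c : (Fin 0 → V) → ℤ, ∃ c' : (Fin 1 → V) → ℤ, zchainOK K c' ∧ zbdry K c' = c) ∧
  (∀ (m : ℕ) (c : (Fin (m + 1) → V) → ℤ), m ≠ d → zchainOK K c → zbdry K c = 0 →
    ∃ c' : (Fin (m + 2) → V) → ℤ, zchainOK K c' ∧ zbdry K c' = c) ∧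
  (∃ z : (Fin (d + 1) → V) → ℤ, zchainOK K z ∧ zbdry K z = 0 ∧
    ∀ z' : (Fin (d + 1) → V) → ℤ, zchainOK K z' → zbdry K z' = 0 →
      ∃! k : ℤ, ∃ c'' : (Fin (d + 2) → V) → ℤ,
        zchainOK K c'' ∧ zbdry K c'' = z' - k • z)

/-- A weak pseudomanifold of dimension `d`: pure, and every `(d-1)`-face is in
exactly two facets. -/
def IsWeakPseudomanifold (d : ℕ) (K : Finset (Finset V)) : Prop :=
  IsComplex K ∧ IsPure d K ∧ ∀ s ∈ K, s.card = d → degOf K d s = 2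

/-- Adjacency of facets along a common `(d-1)`-face. -/
def FacetAdj (d : ℕ) (K : Finset (Finset V)) (s t : Finset V) : Prop :=
  s ∈ K ∧ t ∈ K ∧ s.card = d + 1 ∧ t.card = d + 1 ∧ (s ∩ t).card = d

/-- A pseudomanifold: a weak pseudomanifold in which any two facets are joined
by a chain of facets, consecutive ones sharing a `(d-1)`-face. -/
def IsPseudomanifold (d : ℕ) (K : Finset (Finset V)) : Prop :=
  IsWeakPseudomanifold d K ∧ ∀ s ∈ K, ∀ t ∈ K, s.card = d + 1 → t.card = d + 1 →
    Relation.ReflTransGen (FacetAdj d K) s t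

/-- A weak pseudomanifold with boundary. -/
def IsWeakPseudomanifoldWithBdry (d : ℕ) (K : Finset (Finset V)) : Prop :=
  IsComplex K ∧ IsPure d K ∧
  (∀ s ∈ K, s.card = d → degOf K d s = 1 ∨ degOf K d s = 2) ∧
  (∃ s ∈ K, s.card = d ∧ degOf K d s = 1)

/-- The boundary complex: all faces of degree-one `(d-1)`-faces. -/
def bdryComplex (d : ℕ) (K : Finset (Finset V)) : Finset (Finset V) :=
  K.filter fun t => ∃ s ∈ K, t ⊆ s ∧ s.card = d ∧ degOf K d s = 1

/-- `K` is connected (any two vertices joined by a path of edges). -/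
def SConnected (K : Finset (Finset V)) : Prop :=
  ∀ u ∈ verts K, ∀ v ∈ verts K,
    Relation.ReflTransGen (fun a b : V => ({a, b} : Finset V) ∈ K) u v

/-! ### Geometric realizations, subdivisions and combinatorial equivalence. -/

/-- A geometric simplicial complex in `ℝ^ℕ`: finitely many geometric simplices
(affinely independent vertex sets), closed under faces, any two of which meet
in a common face. -/
structure GComplex where
  faces : Finset (Finset (ℕ → ℝ))
  nonempty : faces.Nonempty
  empty_not_mem : ∅ ∉ faces
  down_closed : ∀ s ∈ faces, ∀ t : Finset (ℕ → ℝ), t ⊆ s → t.Nonempty → t ∈ faces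
  indep : ∀ s ∈ faces,
    AffineIndependent ℝ (fun x : {y : ℕ → ℝ // y ∈ s} => (x : ℕ → ℝ))
  glue : ∀ s ∈ faces, ∀ t ∈ faces,
    convexHull ℝ (s : Set (ℕ → ℝ)) ∩ convexHull ℝ (t : Set (ℕ → ℝ)) =
      convexHull ℝ ((s ∩ t : Finset (ℕ → ℝ)) : Set (ℕ → ℝ))

/-- The geometric carrier (underlying polyhedron) of a geometric complex. -/
def GComplex.carrier (G : GComplex) : Set (ℕ → ℝ) :=
  ⋃ s ∈ G.faces, convexHull ℝ (s : Set (ℕ → ℝ))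

/-- `G` realizes the abstract complex `K` via the vertex map `f`. -/
def RealizesMap (G : GComplex) (K : Finset (Finset V)) (f : V → ℕ → ℝ) : Prop :=
  Set.InjOn f ↑(verts K) ∧ G.faces = K.image (Finset.image f)

/-- `G` is a geometric realization of the abstract complex `K`. -/
def Realizes (G : GComplex) (K : Finset (Finset V)) : Prop :=
  ∃ f : V → ℕ → ℝ, RealizesMap G K f

/-- `G'` is a subdivision of `G`: same carrier, and every simplex of `G'` is
contained in a simplex of `G`. -/
def Subdivides (G' G : GComplex) : Prop :=
  G'.carrier = G.carrier ∧
  ∀ s ∈ G'.faces, ∃ t ∈ G.faces,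
    convexHull ℝ (s : Set (ℕ → ℝ)) ⊆ convexHull ℝ (t : Set (ℕ → ℝ))

/-- Combinatorial equivalence: `K` and `L` admit isomorphic subdivisions. -/
def CombEquiv (K : Finset (Finset V)) (L : Finset (Finset W)) : Prop :=
  ∃ G1 G1' G2 G2' : GComplex, Realizes G1 K ∧ Realizes G2 L ∧
    Subdivides G1' G1 ∧ Subdivides G2' G2 ∧ Iso G1'.faces G2'.faces

/-- A combinatorial `d`-ball: combinatorially equivalent to the standard ball. -/
def IsCombBall (d : ℕ) (K : Finset (Finset V)) : Prop :=
  ∃ A : Finset ℕ, A.card = d + 1 ∧ CombEquiv K (stdBall A)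

/-- A combinatorial `d`-sphere: combinatorially equivalent to the standard sphere. -/
def IsCombSphere (d : ℕ) (K : Finset (Finset V)) : Prop :=
  ∃ A : Finset ℕ, A.card = d + 2 ∧ CombEquiv K (stdSphere A)

/-- A combinatorial `d`-manifold: every vertex link is a combinatorial
`(d-1)`-sphere. -/
def IsCombManifold (d : ℕ) (K : Finset (Finset V)) : Prop :=
  IsComplex K ∧ ∀ v ∈ verts K, IsCombSphere (d - 1) (link K {v})

/-- A combinatorial `d`-manifold with boundary. -/
def IsCombManifoldWithBdry (d : ℕ) (K : Finset (Finset V)) : Prop :=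
  IsComplex K ∧
  (∀ v ∈ verts K, IsCombSphere (d - 1) (link K {v}) ∨
    IsCombBall (d - 1) (link K {v})) ∧
  (∃ v ∈ verts K, IsCombBall (d - 1) (link K {v}))

/-- A pl `k`-ball: a polyhedron carried by some geometric complex whose face
structure is a combinatorial `k`-ball. -/
def IsPLBall (k : ℕ) (P : Set (ℕ → ℝ)) : Prop :=
  ∃ G : GComplex, G.carrier = P ∧ IsCombBall k G.faces

/-- Elementary polyhedral collapse: `P = P' ∪ B` with `B` a pl `k`-ball and
`P' ∩ B` a pl `(k-1)`-ball. -/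
def PolyElemCollapse (P P' : Set (ℕ → ℝ)) : Prop :=
  ∃ k : ℕ, 1 ≤ k ∧ ∃ B : Set (ℕ → ℝ),
    IsPLBall k B ∧ P = P' ∪ B ∧ IsPLBall (k - 1) (P' ∩ B)

/-- Polyhedral collapse. -/
def PolyCollapsesTo (P Q : Set (ℕ → ℝ)) : Prop :=
  Relation.ReflTransGen PolyElemCollapse P Q

/-- Carrier of a subcomplex under a vertex realization map `f`. -/
def subCarrier (f : V → ℕ → ℝ) (L : Finset (Finset V)) : Set (ℕ → ℝ) :=
  ⋃ s ∈ L, convexHull ℝ ((s.image f : Finset (ℕ → ℝ)) : Set (ℕ → ℝ))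

/-! ### Bistellar moves. -/

/-- The core `β = {x ∈ A : A \ {x} ∈ X}` of a `(d+2)`-set `A`. -/
def bcore (X : Finset (Finset V)) (A : Finset V) : Finset V :=
  A.filter fun x => A.erase x ∈ X

/-- `κ_A` is a bistellar `i`-move on the `d`-dimensional complex `X`:
`A` has `d + 2` elements and contains at least one and at most `d + 1` facets
of `X`; with `β` the core of `A` and `α = A \ β` an `i`-face of `X`, one has
`β ∉ X`, and either `α` is a facet of `X` or `Lk_X(α)` has vertex set `β`. -/
def BistellarIMove (d i : ℕ) (X : Finset (Finset V)) (A : Finset V) : Prop :=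
  A.card = d + 2 ∧
  0 < ((facets X).filter fun σ => σ ⊆ A).card ∧
  ((facets X).filter fun σ => σ ⊆ A).card ≤ d + 1 ∧
  bcore X A ∉ X ∧
  A \ bcore X A ∈ X ∧ (A \ bcore X A).card = i + 1 ∧
  (A \ bcore X A ∈ facets X ∨ verts (link X (A \ bcore X A)) = bcore X A)

/-! ### The explicit small complexes of the paper. -/

/-- The complex generated by a list of facets: all nonempty subsets thereof. -/
def genBy (F : Finset (Finset ℕ)) : Finset (Finset ℕ) :=
  F.sup fun s => s.powerset.erase ∅

/-- The standard 2-sphere `S²₄`. -/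
def S24 : Finset (Finset ℕ) := stdSphere {1, 2, 3, 4}

/-- The join `S¹₃ * S⁰₂`. -/
def S13S02 : Finset (Finset ℕ) := sjoin (stdSphere {1, 2, 3}) (stdSphere {4, 5})

/-- The octahedron `S⁰₂ * S⁰₂ * S⁰₂`. -/
def Octa : Finset (Finset ℕ) :=
  sjoin (stdSphere {1, 2}) (sjoin (stdSphere {3, 4}) (stdSphere {5, 6}))

/-- The 6-vertex real projective plane `ℝP²₆`. -/
def RP26 : Finset (Finset ℕ) :=
  genBy {{1, 2, 3}, {1, 2, 4}, {1, 3, 5}, {1, 4, 6}, {1, 5, 6},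
         {2, 3, 6}, {2, 4, 5}, {2, 5, 6}, {3, 4, 5}, {3, 4, 6}}

/-- `Σ₁`: the 6-vertex 2-sphere with a vertex of degree 3 and one of degree 5. -/
def Sigma1 : Finset (Finset ℕ) :=
  genBy {{1, 2, 5}, {1, 2, 6}, {1, 5, 6}, {2, 3, 5},
         {2, 3, 6}, {3, 4, 5}, {3, 4, 6}, {4, 5, 6}}

/-- The double pyramid `S¹₅ * S⁰₂`. -/
def S15S02 : Finset (Finset ℕ) :=
  sjoin (genBy {{1, 2}, {2, 3}, {3, 4}, {4, 5}, {1, 5}}) (stdSphere {6, 7})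

/-- `Σ₂` (7-vertex 2-sphere with 10 triangles). -/
def Sigma2 : Finset (Finset ℕ) :=
  genBy {{1, 2, 6}, {1, 2, 7}, {1, 6, 7}, {2, 3, 6}, {2, 3, 7},
         {3, 4, 6}, {3, 4, 7}, {4, 5, 6}, {4, 5, 7}, {5, 6, 7}}

/-- `Σ₃` (7-vertex 2-sphere with 10 triangles). -/
def Sigma3 : Finset (Finset ℕ) :=
  genBy {{1, 2, 6}, {1, 2, 7}, {1, 6, 7}, {2, 3, 4}, {2, 3, 7},
         {2, 4, 6}, {3, 4, 7}, {4, 5, 6}, {4, 5, 7}, {5, 6, 7}}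

/-- `Σ₄` (7-vertex 2-sphere with 10 triangles). -/
def Sigma4 : Finset (Finset ℕ) :=
  genBy {{1, 2, 4}, {1, 2, 7}, {1, 4, 5}, {1, 5, 6}, {1, 6, 7},
         {2, 3, 4}, {2, 3, 7}, {3, 4, 7}, {4, 5, 7}, {5, 6, 7}}

/-- `Σ₅` (7-vertex 2-sphere with 10 triangles). -/
def Sigma5 : Finset (Finset ℕ) :=
  genBy {{1, 2, 3}, {1, 2, 6}, {1, 3, 5}, {1, 5, 6}, {2, 3, 4},
         {2, 4, 6}, {3, 4, 5}, {4, 5, 7}, {4, 6, 7}, {5, 6, 7}}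

/-- `Υ₁ = S²₄ ∪ S²₄`: two tetrahedral spheres sharing exactly one vertex. -/
def Upsilon1 : Finset (Finset ℕ) :=
  stdSphere {1, 2, 3, 7} ∪ stdSphere {4, 5, 6, 7}

/-- `Υ₂ = S²₄ ∪ (S⁰₂ * S¹₃)`: a tetrahedral sphere and a join, where the two
common vertices span an edge of the `S²₄`. -/
def Upsilon2 : Finset (Finset ℕ) :=
  stdSphere {4, 5, 6, 7} ∪ sjoin (stdSphere {6, 7}) (stdSphere {1, 2, 3})

/-- The complex `R` obtained from `ℝP²₆` by the generalized bistellar 1-move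
`κ_A`, `A = {1, 2, 5, 6}` (all such choices of `A` yield isomorphic complexes). -/
def Rcomplex : Finset (Finset ℕ) :=
  genBy {{1, 2, 3}, {1, 2, 4}, {1, 2, 5}, {1, 2, 6}, {1, 3, 5},
         {1, 4, 6}, {2, 3, 6}, {2, 4, 5}, {3, 4, 5}, {3, 4, 6}}


end HomologySpheres

end

set_option linter.unusedVariables false

section
namespace HomologySpheres
namespace Dfs
noncomputable def iff0 {α : Type} (n : Nat) (x y : α) : α := Nat.rec (motive := fun _ => α) x (fun _ _ => y) n
noncomputable def force {α : Type} (n : Nat) (k : Nat → α) : α :=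
  Nat.rec (motive := fun _ => α) (k 0) (fun m _ => k (Nat.succ m)) n
noncomputable def low (n : Nat) : Nat := Nat.xor n (Nat.land n (Nat.pred n))

noncomputable def acc (k : Nat → Nat → Nat → Bool) (c : List (Nat × Nat)) : Nat → Nat → Nat → Bool :=
  List.rec (motive := fun _ => Nat → Nat → Nat → Bool) k (fun x _ ih A1 A2 A3 =>
    force (Nat.land A1 x.1) fun e => force (Nat.lor A3 (Nat.land A2 x.1)) fun A3 =>
      force (Nat.lor A2 e) fun A2 => force (Nat.lor A1 x.1) fun A1 => ih A1 A2 A3) c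

noncomputable def upd (p v : Nat) (l : List (Nat × Nat)) : List (Nat × Nat) :=
  List.rec (motive := fun _ => List (Nat × Nat)) [] (fun x _ ih =>
   iff0 (Nat.land x.2 p) (x :: ih) (force (Nat.xor x.2 v) fun y => iff0 y ih ((x.1, y) :: ih))) l
noncomputable def pick (b : Nat) (l : List (Nat × Nat)) : Nat × Nat :=
  List.rec (motive := fun _ => Nat × Nat) (0,0) (fun x _ ih => iff0 (Nat.land x.1 b) ih x) l
noncomputable def del (b : Nat) (l : List (Nat × Nat)) : List (Nat × Nat) :=
  List.rec (motive := fun _ => List (Nat × Nat)) [] (fun x _ ih => bif Nat.beq x.1 b then ih else x :: ih) l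

noncomputable def target (q A2 A3 : Nat) : Nat :=
  force (Nat.xor q (Nat.land q A2)) fun u => iff0 u
    (force (Nat.xor q (Nat.land q A3)) fun u => iff0 u (low q) (low u)) (low u)

/-- take candidate `(i,v)` and continue -/
noncomputable def inc (k : Nat → Nat → List (Nat × Nat) → Bool) (D1 D2 : Nat) (c : List (Nat × Nat))
    (i v : Nat) : Bool :=
  force (Nat.lor D1 i) fun D1' => force (Nat.lor D2 (Nat.land D1 i)) fun D2' =>
      k D1' D2' (upd (low v) v (del i c))

noncomputable def dfs (f : Nat) : Nat → Nat → List (Nat × Nat) → Bool :=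
  Nat.rec (motive := fun _ => Nat → Nat → List (Nat × Nat) → Bool) (fun _ _ _ => false) (fun _ ih D1 D2 c =>
   force (Nat.xor D1 D2) fun q =>
   acc (fun A1 A2 A3 => iff0 (Nat.xor q (Nat.land q A1)) (
    Prod.rec (motive := fun _ => Bool) (fun i v => force i fun i => force v fun v => iff0 i false <|
      bif inc ih D1 D2 c i v then ih D1 D2 (del i c) else false)
     (pick (target q A2 A3) c)) true) c 0 0 0) f

/-- decisions first -/
noncomputable def asg (k : Nat → Nat → List (Nat × Nat) → Bool) :
    List (Nat × Bool) → Nat → Nat → List (Nat × Nat) → Bool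
  | [], D1, D2, c => k D1 D2 c
  | (b, true) :: l, D1, D2, c =>
    Prod.rec (motive := fun _ => Bool) (fun i v => bif Nat.beq i b then
      force i fun i => force v fun v => inc (asg k l) D1 D2 c i v else bif Nat.beq i 0 then true else false) (pick b (c.filter fun x => Nat.beq x.1 b))
  | (b, false) :: l, D1, D2, c => asg k l D1 D2 (del b c)

def rk (m : Nat) : Nat := ((List.range m).filter fun j => ((List.range 7).filter fun i => j.testBit i).length == ((List.range 7).filter fun i => m.testBit i).length).length
def bdm (m : Nat) : Nat := (List.range 7).foldr (fun i a => bif m.testBit i then 2^(rk (m-2^i)) ||| a else a) 0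
def pcn (m : Nat) : Nat := ((List.range 7).filter fun i => m.testBit i).length
def subs (k : Nat) : List Nat := (List.range 128).filter fun m => pcn m == k
def init (k : Nat) : List (Nat × Nat) := (subs (k+1)).map fun m => (bdm m, bdm m)

/-- patterns: monotone lists with values in `[lo,4)` of length n -/
def mono : Nat → Nat → List (List Nat)
  | 0, _ => [[]]
  | n+1, lo => (List.range 4).flatMap fun a => bif Nat.ble lo a then (mono n a).map (a :: ·) else []

/-- mask of sigma (k-1 elements) -/
def base (k : Nat) : Nat := 2^(k-1) - 1
def decs (k : Nat) (e : Bool) (l : List Nat) : List (Nat × Bool) :=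
  (bdm (2^(k+1)-1), e) :: (l.zipIdx.flatMap fun x =>
    [(bdm (base k + 2^(k-1) + 2^(x.2+k+1)), x.1.testBit 0), (bdm (base k + 2^k + 2^(x.2+k+1)), x.1.testBit 1)])
def cnt (e : Bool) (j : Nat) (l : List Nat) : Nat := e.toNat + (l.filter fun a => a.testBit j).length
def okp (e : Bool) (l : List Nat) : Bool := cnt e 0 l % 2 == 1 && cnt e 0 l != 1 && cnt e 1 l % 2 == 1 && cnt e 1 l != 1
noncomputable def runAll (k : Nat) : Bool :=
  [true, false].all fun e => (mono (6-k) 0).all fun l => !okp e l || asg (dfs 60) (decs k e l) 0 0 (init k)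
end Dfs
end HomologySpheres

end

section
namespace HomologySpheres
namespace Dfs
open Finset

theorem iff0_eq {α : Type} (n : Nat) (x y : α) : iff0 n x y = if n = 0 then x else y := by
  cases n <;> simp [iff0]
theorem force_eq {α : Type} (n : Nat) (k : Nat → α) : force n k = k n := by
  cases n <;> simp [force]

theorem acc_spec (k : Nat → Nat → Nat → Bool) (c : List (Nat × Nat)) (A1 A2 A3 : Nat) :
    ∃ B1 B2 B3, acc k c A1 A2 A3 = k B1 B2 B3 ∧
      ∀ r, B1.testBit r = true ↔ (A1.testBit r = true ∨ ∃ x ∈ c, x.1.testBit r = true) := by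
  induction c generalizing A1 A2 A3 with
  | nil => exact ⟨A1, A2, A3, rfl, by simp⟩
  | cons x l ih =>
    obtain ⟨B1, B2, B3, h1, h2⟩ := ih (A1 ||| x.1) (A2 ||| (A1 &&& x.1)) (A3 ||| (A2 &&& x.1))
    refine ⟨B1, B2, B3, ?_, ?_⟩
    · rw [← h1]; simp only [acc, force_eq]; rfl
    · intro r; rw [h2]; simp [or_assoc]

theorem del_eq (b : Nat) (l : List (Nat × Nat)) : del b l = l.filter fun x => x.1 ≠ b := by
  induction l with
  | nil => rfl
  | cons x l ih =>
    have : del b (x :: l) = bif Nat.beq x.1 b then del b l else x :: del b l := rfl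
    rw [this, ih]
    by_cases h : x.1 = b
    · simp [h]
    · have : Nat.beq x.1 b = false := Bool.eq_false_iff.2 (fun hc => h (Nat.eq_of_beq_eq_true hc))
      simp [h, this]

theorem pick_mem (b : Nat) (l : List (Nat × Nat)) : pick b l = (0,0) ∨ pick b l ∈ l := by
  induction l with
  | nil => left; rfl
  | cons x l ih =>
    have : pick b (x :: l) = iff0 (Nat.land x.1 b) (pick b l) x := rfl
    rw [this, iff0_eq]
    split_ifs
    · rcases ih with h | h
      · exact Or.inl h
      · exact Or.inr (List.mem_cons_of_mem _ h)
    · simp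

theorem upd_cons (p v : Nat) (x : Nat × Nat) (l) : upd p v (x :: l) =
    if x.2 &&& p = 0 then x :: upd p v l else if x.2 ^^^ v = 0 then upd p v l else (x.1, x.2 ^^^ v) :: upd p v l := by
  have : upd p v (x :: l) = iff0 (Nat.land x.2 p) (x :: upd p v l) (force (Nat.xor x.2 v) fun y => iff0 y (upd p v l) ((x.1, y) :: upd p v l)) := rfl
  rw [this, iff0_eq, force_eq, iff0_eq]; rfl

theorem upd_mem (p v : Nat) (l : List (Nat × Nat)) (y) (hy : y ∈ upd p v l) :
    y ∈ l ∨ ∃ x ∈ l, y = (x.1, x.2 ^^^ v) := by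
  induction l with
  | nil => simp [upd] at hy
  | cons x l ih =>
    rw [upd_cons] at hy
    split_ifs at hy
    · rcases List.mem_cons.1 hy with h | h
      · simp [h]
      · rcases ih h with h | ⟨x, h, e⟩
        · simp [h]
        · exact Or.inr ⟨x, by simp [h], e⟩
    · rcases ih hy with h | ⟨x, h, e⟩
      · simp [h]
      · exact Or.inr ⟨x, by simp [h], e⟩
    · rcases List.mem_cons.1 hy with h | h
      · exact Or.inr ⟨x, by simp, h⟩
      · rcases ih h with h | ⟨x, h, e⟩
        · simp [h]
        · exact Or.inr ⟨x, by simp [h], e⟩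

theorem upd_cov (p v : Nat) (l : List (Nat × Nat)) (x) (hx : x ∈ l) :
    (∃ y ∈ upd p v l, y.1 = x.1) ∨ x.2 = v := by
  induction l with
  | nil => simp at hx
  | cons z l ih =>
    rw [upd_cons]
    rcases List.mem_cons.1 hx with rfl | h
    · split_ifs with h1 h2
      · left; exact ⟨x, by simp, rfl⟩
      · right; exact Nat.xor_eq_zero_iff.1 h2
      · left; exact ⟨_, List.mem_cons_self, rfl⟩
    · rcases ih h with ⟨y, hy, e⟩ | h
      · left
        split_ifs
        · exact ⟨y, by simp [hy], e⟩
        · exact ⟨y, by simp [hy], e⟩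
        · exact ⟨y, by simp [hy], e⟩
      · exact Or.inr h

def sem (v : Nat) (W : Finset Nat) : Prop := ∀ r, v.testBit r = decide (Odd #{b ∈ W | b.testBit r = true})

theorem sem_xor {v w : Nat} {W X : Finset Nat} (h : sem v W) (h' : sem w X) : sem (v ^^^ w) (symmDiff W X) := by
  intro r
  rw [Nat.testBit_xor, h r, h' r]
  have h1 : #{b ∈ symmDiff W X | b.testBit r = true} + 2 * #{b ∈ W ∩ X | b.testBit r = true} =
     #{b ∈ W | b.testBit r = true} + #{b ∈ X | b.testBit r = true} := by
    rw [show symmDiff W X = (W \ X) ∪ (X \ W) from rfl, filter_union, card_union_of_disjoint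
      (disjoint_filter_filter disjoint_sdiff_sdiff)]
    have e1 : #{b ∈ W | b.testBit r = true} = #{b ∈ W \ X | b.testBit r = true} + #{b ∈ W ∩ X | b.testBit r = true} := by
      rw [← card_union_of_disjoint (disjoint_filter_filter (disjoint_sdiff_inter W X)), ← filter_union, sdiff_union_inter]
    have e2 : #{b ∈ X | b.testBit r = true} = #{b ∈ X \ W | b.testBit r = true} + #{b ∈ W ∩ X | b.testBit r = true} := by
      rw [inter_comm, ← card_union_of_disjoint (disjoint_filter_filter (disjoint_sdiff_inter X W)), ← filter_union, sdiff_union_inter]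
    omega
  generalize #{b ∈ symmDiff W X | b.testBit r = true} = a at *
  generalize #{b ∈ W ∩ X | b.testBit r = true} = b at *
  generalize #{b ∈ W | b.testBit r = true} = c at *
  generalize #{b ∈ X | b.testBit r = true} = d at *
  by_cases hc : Odd c <;> by_cases hd : Odd d <;> simp [hc, hd] <;> grind

structure Inv (T : Nat → Prop) (J : Finset Nat) (D1 D2 : Nat) (c : List (Nat × Nat)) : Prop where
  sub : ∀ b ∈ J, T b
  cov : ∀ b, T b → b ∈ J ∨ ∃ x ∈ c, x.1 = b
  d1 : ∀ r, D1.testBit r = true → ∃ b ∈ J, b.testBit r = true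
  d1' : ∀ r, ∀ b ∈ J, b.testBit r = true → D1.testBit r = true
  d2 : ∀ r, D2.testBit r ≠ true → ∀ b ∈ J, ∀ b' ∈ J, b.testBit r = true → b'.testBit r = true → b = b'
  d21 : ∀ r, D2.testBit r = true → D1.testBit r = true
  cand : ∀ x ∈ c, x.1 ∉ J ∧ ∃ W : Finset Nat, x.1 ∈ W ∧ W ⊆ insert x.1 J ∧ sem x.2 W

structure Hyp (T : Nat → Prop) : Prop where
  h1 : ∀ r, ¬ ∃! b, T b ∧ b.testBit r = true
  h2 : ∀ W : Finset Nat, W.Nonempty → (∀ b ∈ W, T b) → ¬ sem 0 W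

theorem Inv.excl {T J D1 D2 c} (h : Inv T J D1 D2 c) (i : Nat) (hi : ¬ T i) : Inv T J D1 D2 (del i c) := by
  rw [del_eq]
  refine ⟨h.sub, ?_, h.d1, h.d1', h.d2, h.d21, ?_⟩
  · intro b hb
    rcases h.cov b hb with h | ⟨x, hx, rfl⟩
    · exact Or.inl h
    · refine Or.inr ⟨x, ?_, rfl⟩
      simp only [List.mem_filter, hx, true_and]
      simp only [decide_eq_true_eq]; rintro rfl; exact hi hb
  · intro x hx
    exact h.cand x (List.mem_of_mem_filter hx)

theorem Inv.incl {T J D1 D2 c} (H : Hyp T) (h : Inv T J D1 D2 c) (i v p : Nat) (hm : (i, v) ∈ c) (hi : T i) :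
    Inv T (insert i J) (D1 ||| i) (D2 ||| (D1 &&& i)) (upd p v (del i c)) := by
  obtain ⟨hiJ, W, hiW, hWJ, hsem⟩ := h.cand _ hm
  simp only at hiJ hiW hWJ hsem
  refine ⟨?_, ?_, ?_, ?_, ?_, ?_, ?_⟩
  · intro b hb
    rcases mem_insert.1 hb with rfl | hb
    · exact hi
    · exact h.sub b hb
  · intro b hb
    by_cases hbi : b = i
    · left; simp [hbi]
    rcases h.cov b hb with h' | ⟨x, hx, rfl⟩
    · left; simp [h']
    have hx' : x ∈ del i c := by rw [del_eq]; simp [hx, hbi]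
    rcases upd_cov p v _ x hx' with h' | h'
    · exact Or.inr h'
    · exfalso
      obtain ⟨hxJ, W', hxW', hWJ', hsem'⟩ := h.cand _ hx
      rw [h'] at hsem'
      have := sem_xor hsem hsem'
      rw [Nat.xor_self] at this
      refine H.h2 _ ⟨i, ?_⟩ ?_ this
      · rw [mem_symmDiff]; left; refine ⟨hiW, fun hc => ?_⟩
        rcases mem_insert.1 (hWJ' hc) with h | h
        · exact hbi h.symm
        · exact hiJ h
      · intro b hb'
        have : b ∈ W ∨ b ∈ W' := by rw [mem_symmDiff] at hb'; tauto
        rcases this with h1 | h1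
        · rcases mem_insert.1 (hWJ h1) with rfl | h2
          · exact hi
          · exact h.sub _ h2
        · rcases mem_insert.1 (hWJ' h1) with rfl | h2
          · exact hb
          · exact h.sub _ h2
  · intro r hr
    simp only [Nat.testBit_or, Bool.or_eq_true] at hr
    rcases hr with hr | hr
    · obtain ⟨b, hb, hb'⟩ := h.d1 r hr; exact ⟨b, by simp [hb], hb'⟩
    · exact ⟨i, by simp, hr⟩
  · intro r b hb hbr
    simp only [Nat.testBit_or, Bool.or_eq_true]
    rcases mem_insert.1 hb with rfl | hb
    · exact Or.inr hbr
    · exact Or.inl (h.d1' r b hb hbr)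
  · intro r hr b hb b' hb' hbr hbr'
    simp only [Nat.testBit_or, Nat.testBit_and, Bool.or_eq_true, Bool.and_eq_true, ne_eq, not_or, not_and] at hr
    obtain ⟨hr1, hr2⟩ := hr
    rcases mem_insert.1 hb with e | hb
    · rcases mem_insert.1 hb' with e' | hb'
      · rw [e, e']
      · exact absurd (e ▸ hbr) (hr2 (h.d1' r _ hb' hbr'))
    · rcases mem_insert.1 hb' with e | hb'
      · exact absurd (e ▸ hbr') (hr2 (h.d1' r _ hb hbr))
      · exact h.d2 r hr1 b hb b' hb' hbr hbr'
  · intro r hr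
    simp only [Nat.testBit_or, Nat.testBit_and, Bool.or_eq_true, Bool.and_eq_true] at hr ⊢
    rcases hr with hr | hr
    · exact Or.inl (h.d21 r hr)
    · exact Or.inl hr.1
  · intro y hy
    rcases upd_mem _ _ _ _ hy with hy | ⟨x, hx, rfl⟩
    · rw [del_eq] at hy
      have h1 := List.mem_filter.1 hy
      obtain ⟨a, W', b1, b2, b3⟩ := h.cand y h1.1
      have h2 : y.1 ≠ i := by simpa using h1.2
      refine ⟨by simp [a, h2], W', b1, b2.trans (insert_subset_insert _ (subset_insert _ _)), b3⟩
    · rw [del_eq] at hx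
      have h1 := List.mem_filter.1 hx
      obtain ⟨a, W', b1, b2, b3⟩ := h.cand x h1.1
      have h2 : x.1 ≠ i := by simpa using h1.2
      refine ⟨by simp [a, h2], symmDiff W' W, ?_, ?_, sem_xor b3 hsem⟩
      · rw [mem_symmDiff]; left; refine ⟨b1, fun hc => ?_⟩
        rcases mem_insert.1 (hWJ hc) with h | h
        · exact h2 h
        · exact a h
      · intro z hz
        have : z ∈ W ∨ z ∈ W' := by rw [mem_symmDiff] at hz; tauto
        rcases this with h | h
        · exact mem_insert_of_mem (hWJ h)
        · exact insert_subset_insert _ (subset_insert _ _) (b2 h)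

theorem inc_eq (k D1 D2 c i v) : inc k D1 D2 c i v = k (D1 ||| i) (D2 ||| (D1 &&& i)) (upd (low v) v (del i c)) := by
  simp only [inc, force_eq]; rfl

theorem dfs_sound {T} (H : Hyp T) (f : Nat) : ∀ J D1 D2 c, Inv T J D1 D2 c → dfs f D1 D2 c = true → False := by
  induction f with
  | zero => intro J D1 D2 c _ h; simp [dfs] at h
  | succ f ih =>
    intro J D1 D2 c hI h
    have e : dfs (f+1) D1 D2 c = force (Nat.xor D1 D2) fun q =>
      acc (fun A1 A2 A3 => iff0 (Nat.xor q (Nat.land q A1)) (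
      Prod.rec (motive := fun _ => Bool) (fun i v => force i fun i => force v fun v => iff0 i false <|
      bif inc (dfs f) D1 D2 c i v then dfs f D1 D2 (del i c) else false)
      (pick (target q A2 A3) c)) true) c 0 0 0 := rfl
    rw [e, force_eq] at h
    obtain ⟨B1, B2, B3, h1, h2⟩ := acc_spec (fun A1 A2 A3 => iff0 (Nat.xor (Nat.xor D1 D2) (Nat.land (Nat.xor D1 D2) A1)) (
      Prod.rec (motive := fun _ => Bool) (fun i v => force i fun i => force v fun v => iff0 i false <|
      bif inc (dfs f) D1 D2 c i v then dfs f D1 D2 (del i c) else false)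
      (pick (target (Nat.xor D1 D2) A2 A3) c)) true) c 0 0 0
    rw [h1, iff0_eq] at h
    clear h1 e
    split_ifs at h with hz
    · simp only [force_eq, iff0_eq, inc_eq] at h
      rcases pick_mem (target (Nat.xor D1 D2) B2 B3) c with hp | hp
      · rw [hp] at h; simp at h
      · generalize pick (target (Nat.xor D1 D2) B2 B3) c = x at h hp
        obtain ⟨i, v⟩ := x
        simp only at h
        split_ifs at h
        by_cases hi : T i
        · cases hd : dfs f (D1 ||| i) (D2 ||| (D1 &&& i)) (upd (low v) v (del i c)) with
          | false => rw [hd] at h; simp at h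
          | true => exact ih _ _ _ _ (hI.incl H i v (low v) hp hi) hd
        · cases hd : dfs f D1 D2 (del i c) with
          | false => rw [hd] at h; simp at h
          | true => exact ih _ _ _ _ (hI.excl i hi) hd
    · have hz' : (D1 ^^^ D2) ^^^ ((D1 ^^^ D2) &&& B1) ≠ 0 := hz
      obtain ⟨r, hr⟩ := Nat.exists_testBit_of_ne_zero hz'
      simp only [Nat.testBit_xor, Nat.testBit_and] at hr
      have h2r := h2 r
      have hd := hI.d21 r
      have g1 : D1.testBit r = true := by
        by_contra hc
        simp only [Bool.not_eq_true] at hc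
        simp [hc] at hr hd; simp [hd] at hr
      have g2 : D2.testBit r ≠ true := by
        intro hc; simp [hc, g1] at hr
      have g3 : B1.testBit r ≠ true := by
        intro hc; simp only [hc, g1, Bool.true_xor] at hr; simp at g2; simp [g2] at hr
      rw [ne_eq, h2r] at g3
      simp at g3
      obtain ⟨b, hb, hbr⟩ := hI.d1 r g1
      refine H.h1 r ⟨b, ⟨hI.sub b hb, hbr⟩, ?_⟩
      rintro b' ⟨hT, hbr'⟩
      rcases hI.cov b' hT with h' | ⟨x, hx, rfl⟩
      · exact hI.d2 r g2 _ h' _ hb hbr' hbr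
      · have := g3 _ _ hx; rw [hbr'] at this; simp at this

theorem asg_sound {T} (H : Hyp T) (f : Nat) (l : List (Nat × Bool)) : ∀ J D1 D2 c, Inv T J D1 D2 c →
    (∀ x ∈ l, x.1 ≠ 0 ∧ (T x.1 ↔ x.2 = true)) → (∀ x ∈ l, x.1 ∉ J) → (l.map Prod.fst).Nodup →
    asg (dfs f) l D1 D2 c = true → False := by
  induction l with
  | nil => intro J D1 D2 c hI _ _ _ h; exact dfs_sound H f J D1 D2 c hI h
  | cons x l ih =>
    intro J D1 D2 c hI hl hJ hnd h
    obtain ⟨b, t⟩ := x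
    simp only [List.map_cons, List.nodup_cons] at hnd
    have hb := hl (b, t) (by simp)
    cases t with
    | false =>
      exact ih J D1 D2 _ (hI.excl b (by simpa using hb.2)) (fun x hx => hl x (by simp [hx]))
        (fun x hx => hJ x (by simp [hx])) hnd.2 h
    | true =>
      have hTb : T b := by simpa using hb.2
      have hbJ : b ∉ J := hJ _ List.mem_cons_self
      obtain ⟨x, hx, hxb⟩ := (hI.cov b hTb).resolve_left hbJ
      rw [asg] at h
      rcases pick_mem b (c.filter fun x => Nat.beq x.1 b) with hp | hp
      · exfalso
        -- some element is in the filtered list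
        have hne : ∀ l : List (Nat × Nat), (∀ y ∈ l, y.1 = b) → pick b l = (0,0) → l = [] := by
          intro l
          induction l with
          | nil => simp
          | cons y l ihl =>
            intro hy hpk
            have e : pick b (y :: l) = iff0 (Nat.land y.1 b) (pick b l) y := rfl
            rw [e, iff0_eq, if_neg] at hpk
            · have := hy y (by simp); rw [hpk] at this; exact absurd this.symm hb.1
            · rw [hy y (by simp)]
              change b &&& b ≠ 0
              rw [Nat.and_self]; exact hb.1
        have := hne _ (by intro y hy; simpa using (List.mem_filter.1 hy).2) hp
        have hx' : x ∈ c.filter fun x => Nat.beq x.1 b := by simp [hx, hxb]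
        rw [this] at hx'; simp at hx'
      · generalize pick b (c.filter fun x => Nat.beq x.1 b) = y at h hp
        obtain ⟨i, v⟩ := y
        have hp' := List.mem_filter.1 hp
        have hib : i = b := by simpa using hp'.2
        subst hib
        simp only [Nat.beq_eq_true_eq, force_eq, inc_eq] at h
        simp only [decide_true, cond_true, Nat.beq_eq, Nat.beq_refl] at h
        refine ih _ _ _ _ (hI.incl H i v (low v) hp'.1 hTb) (fun x hx => hl x (by simp [hx])) ?_ hnd.2 h
        intro x hx hc
        rcases mem_insert.1 hc with e | hc
        · exact hnd.1 (by rw [← e]; exact List.mem_map_of_mem hx)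
        · exact hJ x (by simp [hx]) hc
end Dfs
end HomologySpheres

end

section
namespace HomologySpheres
namespace Dfs
open Finset
set_option maxRecDepth 100000
theorem a1 : runAll 1 = true := by decide +kernel
theorem a4 : runAll 4 = true := by decide +kernel
theorem a5 : runAll 5 = true := by decide +kernel
theorem a6 : runAll 6 = true := by decide +kernel
theorem a3 : runAll 3 = true := by decide +kernel
theorem a2 : runAll 2 = true := by decide +kernel

theorem run_all {k : Nat} (h1 : 1 ≤ k) (h6 : k ≤ 6) : runAll k = true := by
  interval_cases k
  exacts [a1, a2, a3, a4, a5, a6]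

theorem b1 : ∀ k ∈ List.range 7, ∀ m ∈ subs (k+1), ∀ p ∈ subs k,
    (bdm m).testBit (rk p) = Nat.beq (p &&& m) p := by decide +kernel
theorem b2 : ∀ k ∈ List.range 7, ∀ m ∈ subs (k+1), bdm m < 2^35 ∧ ∀ j ∈ List.range 35, (bdm m).testBit j = true →
    ∃ p ∈ subs k, j = rk p := by decide +kernel
theorem b3 : ∀ k ∈ List.range 7, 1 ≤ k → ∀ m ∈ subs (k+1), ∀ m' ∈ subs (k+1), bdm m = bdm m' → m = m' := by decide +kernel
theorem b4 : ∀ k ∈ List.range 7, 1 ≤ k → ∀ l ∈ mono (6-k) 0, ∀ e ∈ [true, false],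
    ((decs k e l).map Prod.fst).Nodup ∧ ∀ x ∈ decs k e l, x.1 ≠ 0 := by decide +kernel
theorem b5 : ∀ k ∈ List.range 7, 1 ≤ k → ∀ j ∈ List.range (6-k),
   (base k + 2^(k-1) + 2^(j+k+1) ∈ subs (k+1) ∧ ∀ i ∈ List.range 7, (base k + 2^(k-1) + 2^(j+k+1)).testBit i = (decide (i < k-1) || decide (i = k-1) || decide (i = j+k+1))) ∧
   (base k + 2^k + 2^(j+k+1) ∈ subs (k+1) ∧ ∀ i ∈ List.range 7, (base k + 2^k + 2^(j+k+1)).testBit i = (decide (i < k-1) || decide (i = k) || decide (i = j+k+1))) := by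
  decide +kernel
theorem b6 : ∀ k ∈ List.range 7, 1 ≤ k →
   (2^(k+1)-1) ∈ subs (k+1) ∧ ∀ i ∈ List.range 7, (2^(k+1)-1).testBit i = (decide (i < k-1) || decide (i = k-1) || decide (i = k)) := by
  decide +kernel

theorem mem_mono (n lo : Nat) (l : List Nat) (hl : l.length = n) (hs : l.Pairwise (· ≤ ·)) (h4 : ∀ a ∈ l, lo ≤ a ∧ a < 4) :
    l ∈ mono n lo := by
  induction l generalizing n lo with
  | nil => subst hl; simp [mono]
  | cons a l ih =>
    subst hl
    simp only [List.length_cons, mono, List.mem_flatMap, List.mem_range]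
    have ha := h4 a (by simp)
    refine ⟨a, ha.2, ?_⟩
    rw [Nat.ble_eq_true_of_le ha.1]
    simp only [cond_true, List.mem_map]
    rw [List.pairwise_cons] at hs
    exact ⟨l, ih _ _ rfl hs.2 (fun b hb => ⟨hs.1 b hb, (h4 b (by simp [hb])).2⟩), rfl⟩

theorem mem_subs (k m : Nat) : m ∈ subs k ↔ m < 128 ∧ pcn m = k := by simp [subs]

section
variable (x : Nat → Nat)
def F (m : Nat) : Finset Nat := ((range 7).filter fun i => m.testBit i = true).image x

variable {x}
theorem card_F (hx : Set.InjOn x (range 7)) (m : Nat) : (F x m).card = pcn m := by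
  rw [F, card_image_of_injOn (hx.mono (by intro i hi; simpa using (mem_filter.1 (mem_coe.1 hi)).1))]
  simp [pcn, Finset.card, Finset.filter, Finset.range, Multiset.range, List.filter_congr]

theorem F_sub (hx : Set.InjOn x (range 7)) (m m' : Nat) (hm : m < 128) : F x m ⊆ F x m' ↔ Nat.beq (m &&& m') m = true := by
  rw [Nat.beq_eq]
  constructor
  · intro h
    apply Nat.eq_of_testBit_eq
    intro i
    rw [Nat.testBit_and]
    by_cases hi : m.testBit i = true
    · have h7 : i < 7 := by
        by_contra hc
        have : m < 2^i := lt_of_lt_of_le hm (by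
          calc 128 = 2^7 := by norm_num
            _ ≤ 2^i := Nat.pow_le_pow_right (by norm_num) (by omega))
        rw [Nat.testBit_lt_two_pow this] at hi; simp at hi
      have := h (mem_image_of_mem x (mem_filter.2 ⟨mem_range.2 h7, hi⟩))
      obtain ⟨j, hj, e⟩ := mem_image.1 this
      have hj' := mem_filter.1 hj
      have := hx (by simpa using hj'.1) (by simpa using h7) e
      subst this
      simp [hi, hj'.2]
    · simp only [Bool.not_eq_true] at hi; simp [hi]
  · intro h y hy
    obtain ⟨j, hj, rfl⟩ := mem_image.1 hy
    have hj' := mem_filter.1 hj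
    refine mem_image_of_mem x (mem_filter.2 ⟨hj'.1, ?_⟩)
    have h2 := hj'.2
    rw [← h, Nat.testBit_and] at h2
    simpa using (Bool.and_eq_true _ _ ▸ h2 : _ ∧ _).2

theorem F_inj (hx : Set.InjOn x (range 7)) {m m' : Nat} (hm : m < 128) (hm' : m' < 128) (h : F x m = F x m') : m = m' := by
  have h1 := (F_sub hx m m' hm).1 h.subset
  have h2 := (F_sub hx m' m hm').1 h.symm.subset
  rw [Nat.beq_eq] at h1 h2
  rw [← h1, Nat.and_comm, h2]

theorem F_surj {B : Finset Nat} (hB : B = (range 7).image x) {s : Finset Nat} (hs : s ⊆ B) : ∃ m < 128, F x m = s := by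
  refine ⟨Nat.ofBits (fun i : Fin 7 => decide (x i ∈ s)), Nat.ofBits_lt_two_pow _, ?_⟩
  ext y
  simp only [F, mem_image, mem_filter, mem_range]
  constructor
  · rintro ⟨i, ⟨hi, h⟩, rfl⟩
    rw [Nat.testBit_ofBits_lt _ _ hi] at h
    simpa using h
  · intro hy
    have := hs hy
    rw [hB] at this
    obtain ⟨i, hi, rfl⟩ := mem_image.1 this
    rw [mem_range] at hi
    exact ⟨i, ⟨hi, by rw [Nat.testBit_ofBits_lt _ _ hi]; simpa using hy⟩, rfl⟩
end

theorem F_eq {x : Nat → Nat} {m k a b : Nat} (h : ∀ i ∈ List.range 7, m.testBit i = (decide (i < k-1) || decide (i = a) || decide (i = b)))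
    (hk : k ≤ 7) (ha : a < 7) (hb : b < 7) : F x m = insert (x a) (insert (x b) ((range (k-1)).image x)) := by
  ext y
  simp only [F, mem_image, mem_filter, mem_range, mem_insert]
  constructor
  · rintro ⟨i, ⟨hi, h'⟩, rfl⟩
    rw [h i (by simpa using hi)] at h'
    simp only [Bool.or_eq_true, decide_eq_true_eq] at h'
    rcases h' with (h' | h') | h'
    · exact Or.inr (Or.inr ⟨i, h', rfl⟩)
    · left; rw [h']
    · right; left; rw [h']
  · rintro (rfl | rfl | ⟨i, hi, rfl⟩)
    · exact ⟨a, ⟨ha, by rw [h a (by simpa using ha)]; simp⟩, rfl⟩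
    · exact ⟨b, ⟨hb, by rw [h b (by simpa using hb)]; simp⟩, rfl⟩
    · exact ⟨i, ⟨by omega, by rw [h i (by simp; omega)]; simp [hi]⟩, rfl⟩

/-- core: pattern given -/
theorem core {k : Nat} (h1 : 1 ≤ k) (h6 : k ≤ 6) {x : Nat → Nat} (hx : Set.InjOn x (range 7)) {B : Finset Nat}
    (hB : B = (range 7).image x) (T : Finset (Finset Nat)) (hTB : ∀ t ∈ T, t ⊆ B ∧ t.card = k + 1)
    (hdeg : ∀ r : Finset Nat, r.card = k → #{t ∈ T | r ⊆ t} ≠ 1)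
    (hno : ∀ W ⊆ T, W.Nonempty → ∃ r : Finset Nat, r.card = k ∧ Odd #{t ∈ W | r ⊆ t})
    (σ : Finset Nat) (hσ : σ = (range (k-1)).image x) (e : Bool) (l : List Nat)
    (he : insert (x (k-1)) (insert (x k) σ) ∈ T ↔ e = true)
    (hl : l ∈ mono (6-k) 0) (hlen : l.length = 6 - k)
    (hl0 : ∀ j (hj : j < l.length), insert (x (k-1)) (insert (x (j+k+1)) σ) ∈ T ↔ l[j].testBit 0 = true)
    (hl1 : ∀ j (hj : j < l.length), insert (x k) (insert (x (j+k+1)) σ) ∈ T ↔ l[j].testBit 1 = true)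
    (hok : okp e l = true) : False := by
  have hk7 : k ∈ List.range 7 := by simp; omega
  set T' : Nat → Prop := fun b => ∃ m ∈ subs (k+1), bdm m = b ∧ F x m ∈ T with hT'
  have T'b : ∀ m ∈ subs (k+1), (T' (bdm m) ↔ F x m ∈ T) := by
    intro m hm
    constructor
    · rintro ⟨m', hm', e, h⟩
      rw [b3 k hk7 h1 m' hm' m hm e] at h; exact h
    · intro h; exact ⟨m, hm, rfl, h⟩
  have surjT : ∀ t ⊆ B, ∀ n, t.card = n → ∃ m ∈ subs n, F x m = t := by
    intro t ht n hn
    obtain ⟨m, hm, e⟩ := F_surj hB ht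
    refine ⟨m, (mem_subs _ _).2 ⟨hm, ?_⟩, e⟩
    rw [← card_F hx, e, hn]
  have bit : ∀ m ∈ subs (k+1), ∀ p ∈ subs k, ((bdm m).testBit (rk p) = true ↔ F x p ⊆ F x m) := by
    intro m hm p hp
    rw [b1 k hk7 m hm p hp, F_sub hx _ _ ((mem_subs _ _).1 hp).1]
  have H : Hyp T' := by
    constructor
    · rintro r ⟨b, ⟨⟨m, hm, rfl, hmT⟩, hr⟩, huniq⟩
      obtain ⟨hlt, hb⟩ := b2 k hk7 m hm
      have hr35 : r < 35 := by
        by_contra hc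
        rw [Nat.testBit_lt_two_pow (lt_of_lt_of_le hlt (Nat.pow_le_pow_right (by norm_num) (by omega)))] at hr
        simp at hr
      obtain ⟨p, hp, rfl⟩ := hb r (by simpa using hr35) hr
      apply hdeg (F x p) (by rw [card_F hx, ((mem_subs _ _).1 hp).2])
      rw [card_eq_one]
      refine ⟨F x m, ?_⟩
      ext t
      simp only [mem_filter, mem_singleton]
      constructor
      · rintro ⟨ht, hpt⟩
        obtain ⟨m', hm', rfl⟩ := surjT t (hTB t ht).1 _ (hTB t ht).2
        have := huniq (bdm m') ⟨(T'b m' hm').2 ht, (bit m' hm' p hp).2 hpt⟩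
        rw [b3 k hk7 h1 m' hm' m hm this]
      · rintro rfl
        exact ⟨hmT, (bit m hm p hp).1 hr⟩
    · intro W hW hWT hsem
      classical
      set M := (range 128).filter fun m => m ∈ subs (k+1) ∧ bdm m ∈ W with hM
      obtain ⟨r, hr, hodd⟩ := hno (M.image (F x)) (by
        intro t ht
        obtain ⟨m, hm, rfl⟩ := mem_image.1 ht
        have := (mem_filter.1 hm).2
        exact (T'b m this.1).1 (hWT _ this.2)) (by
        obtain ⟨b, hb⟩ := hW
        obtain ⟨m, hm, e, _⟩ := hWT b hb
        exact ⟨F x m, mem_image_of_mem _ (mem_filter.2 ⟨mem_range.2 ((mem_subs _ _).1 hm).1, hm, by rw [e]; exact hb⟩)⟩)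
      have hrB : r ⊆ B := by
        have : 0 < #{t ∈ M.image (F x) | r ⊆ t} := hodd.pos
        obtain ⟨t, ht⟩ := card_pos.1 this
        have ht := mem_filter.1 ht
        obtain ⟨m, hm, rfl⟩ := mem_image.1 ht.1
        refine ht.2.trans ?_
        rw [hB, F]; exact image_subset_image (filter_subset _ _)
      obtain ⟨p, hp, rfl⟩ := surjT r hrB _ hr
      have h0 := hsem (rk p)
      simp only [Nat.zero_testBit] at h0
      have h0' : ¬ Odd #{b ∈ W | b.testBit (rk p) = true} := by simpa using h0.symm
      apply h0'
      convert hodd using 1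
      symm
      apply card_bij' (fun t _ => bdm (if h : ∃ m ∈ subs (k+1), F x m = t then h.choose else 0))
        (fun b _ => F x (if h : ∃ m ∈ subs (k+1), bdm m = b then h.choose else 0))
      · intro t ht
        have ht := mem_filter.1 ht
        obtain ⟨m, hm, rfl⟩ := mem_image.1 ht.1
        have hm := (mem_filter.1 hm).2
        have ex : ∃ m' ∈ subs (k+1), F x m' = F x m := ⟨m, hm.1, rfl⟩
        have e1 : ex.choose = m := F_inj hx ((mem_subs _ _).1 ex.choose_spec.1).1 ((mem_subs _ _).1 hm.1).1 ex.choose_spec.2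
        rw [dif_pos ex, e1, mem_filter]
        exact ⟨hm.2, (bit m hm.1 p hp).2 ht.2⟩
      · intro b hb
        have hb := mem_filter.1 hb
        obtain ⟨m, hm, rfl, hT⟩ := hWT b hb.1
        have ex : ∃ m' ∈ subs (k+1), bdm m' = bdm m := ⟨m, hm, rfl⟩
        have e1 : ex.choose = m := b3 k hk7 h1 _ ex.choose_spec.1 _ hm ex.choose_spec.2
        rw [dif_pos ex, e1, mem_filter]
        exact ⟨mem_image_of_mem _ (mem_filter.2 ⟨mem_range.2 ((mem_subs _ _).1 hm).1, hm, hb.1⟩), (bit m hm p hp).1 hb.2⟩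
      · intro t ht
        have ht := mem_filter.1 ht
        obtain ⟨m, hm, rfl⟩ := mem_image.1 ht.1
        have hm := (mem_filter.1 hm).2
        have ex : ∃ m' ∈ subs (k+1), F x m' = F x m := ⟨m, hm.1, rfl⟩
        have e1 : ex.choose = m := F_inj hx ((mem_subs _ _).1 ex.choose_spec.1).1 ((mem_subs _ _).1 hm.1).1 ex.choose_spec.2
        have ex2 : ∃ m' ∈ subs (k+1), bdm m' = bdm m := ⟨m, hm.1, rfl⟩
        have e2 : ex2.choose = m := b3 k hk7 h1 _ ex2.choose_spec.1 _ hm.1 ex2.choose_spec.2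
        simp only [dif_pos ex, e1, dif_pos ex2, e2]
      · intro b hb
        have hb := mem_filter.1 hb
        obtain ⟨m, hm, rfl, hT⟩ := hWT b hb.1
        have ex : ∃ m' ∈ subs (k+1), F x m' = F x m := ⟨m, hm, rfl⟩
        have e1 : ex.choose = m := F_inj hx ((mem_subs _ _).1 ex.choose_spec.1).1 ((mem_subs _ _).1 hm).1 ex.choose_spec.2
        have ex2 : ∃ m' ∈ subs (k+1), bdm m' = bdm m := ⟨m, hm, rfl⟩
        have e2 : ex2.choose = m := b3 k hk7 h1 _ ex2.choose_spec.1 _ hm ex2.choose_spec.2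
        simp only [dif_pos ex2, e2, dif_pos ex, e1]
  have hI : Inv T' ∅ 0 0 (init k) := by
    refine ⟨by simp, ?_, by simp, by simp, by simp, by simp, ?_⟩
    · rintro b ⟨m, hm, rfl, _⟩
      exact Or.inr ⟨(bdm m, bdm m), List.mem_map.2 ⟨m, hm, rfl⟩, rfl⟩
    · intro y hy
      obtain ⟨m, hm, rfl⟩ := List.mem_map.1 hy
      refine ⟨by simp, {bdm m}, by simp, by simp, ?_⟩
      intro r
      by_cases h : (bdm m).testBit r = true <;> simp [filter_singleton, h]
  have hrun := run_all h1 h6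
  rw [runAll, List.all_eq_true] at hrun
  have hrun := hrun e (by cases e <;> simp)
  rw [List.all_eq_true] at hrun
  have hrun := hrun l hl
  rw [hok] at hrun
  simp only [Bool.not_true, Bool.false_or] at hrun
  obtain ⟨hnd, hne⟩ := b4 k hk7 h1 l hl e (by cases e <;> simp)
  refine asg_sound H 60 (decs k e l) ∅ 0 0 (init k) hI ?_ (by simp) hnd hrun
  intro y hy
  refine ⟨hne y hy, ?_⟩
  rw [decs, List.mem_cons] at hy
  rcases hy with rfl | hy
  · obtain ⟨c1, c2⟩ := b6 k hk7 h1
    simp only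
    rw [T'b _ c1, F_eq c2 (by omega) (by omega) (by omega), ← hσ]; exact he
  · rw [List.mem_flatMap] at hy
    obtain ⟨⟨a, j⟩, ha, hy⟩ := hy
    have ha' := List.mem_zipIdx ha
    simp only [zero_add, Nat.sub_zero] at ha'
    obtain ⟨-, hj, ha2⟩ := ha'
    rw [ha2] at hy
    obtain ⟨⟨c1, c2⟩, c3, c4⟩ := b5 k hk7 h1 j (by simp; omega)
    simp only [List.mem_cons, List.not_mem_nil, or_false] at hy
    rcases hy with rfl | rfl
    · simp only
      rw [T'b _ c1, F_eq c2 (by omega) (by omega) (by omega), ← hσ]; exact hl0 j hj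
    · simp only
      rw [T'b _ c3, F_eq c4 (by omega) (by omega) (by omega), ← hσ]; exact hl1 j hj
end Dfs
end HomologySpheres

end

section
namespace HomologySpheres
namespace Dfs
open Finset

theorem deg_eq {k : Nat} {B : Finset Nat} {T : Finset (Finset Nat)} (hTB : ∀ t ∈ T, t ⊆ B ∧ t.card = k + 1)
    {r : Finset Nat} (hr : r.card = k) : #{t ∈ T | r ⊆ t} = #{z ∈ B \ r | insert z r ∈ T} := by
  symm
  apply card_bij (fun z _ => insert z r)
  · intro z hz
    simp only [mem_filter] at hz ⊢
    exact ⟨hz.2, subset_insert _ _⟩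
  · intro z hz w hw e
    simp only [mem_filter, mem_sdiff] at hz hw
    have : z ∈ insert w r := e ▸ mem_insert_self z r
    rcases mem_insert.1 this with h | h
    · exact h
    · exact absurd h hz.1.2
  · intro t ht
    simp only [mem_filter] at ht
    have h1 : (t \ r).card = 1 := by rw [card_sdiff_of_subset ht.2, (hTB t ht.1).2, hr]; omega
    obtain ⟨z, hz⟩ := card_eq_one.1 h1
    have hz' : z ∈ t \ r := by rw [hz]; simp
    have e : insert z r = t := by
      rw [insert_eq, ← hz, sdiff_union_of_subset ht.2]
    refine ⟨z, ?_, e⟩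
    simp only [mem_filter, mem_sdiff] at hz' ⊢
    exact ⟨⟨(hTB t ht.1).1 hz'.1, hz'.2⟩, e ▸ ht.1⟩

theorem exists_odd2 {k : Nat} (h1 : 1 ≤ k) {B : Finset Nat} {T : Finset (Finset Nat)} (hTB : ∀ t ∈ T, t ⊆ B ∧ t.card = k + 1)
    {σ : Finset Nat} (hσ : σ.card + 1 = k) {p : Nat} (hp : p ∈ B \ σ) (hodd : Odd #{t ∈ T | insert p σ ⊆ t}) :
    ∃ q ∈ B \ σ, q ≠ p ∧ Odd #{t ∈ T | insert q σ ⊆ t} := by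
  by_contra hc
  push Not at hc
  have key : ∑ y ∈ B \ σ, #{t ∈ T | insert y σ ⊆ t} = 2 * #{t ∈ T | σ ⊆ t} := by
    have := sum_card_bipartiteAbove_eq_sum_card_bipartiteBelow (s := B \ σ) (t := T) (fun y t => insert y σ ⊆ t)
    simp only [bipartiteAbove, bipartiteBelow] at this
    rw [this]
    have : ∀ t ∈ T, #{a ∈ B \ σ | insert a σ ⊆ t} = if σ ⊆ t then 2 else 0 := by
      intro t ht
      split_ifs with h
      · have : ({a ∈ B \ σ | insert a σ ⊆ t} : Finset Nat) = t \ σ := by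
          ext a
          simp only [mem_filter, mem_sdiff, insert_subset_iff]
          constructor
          · rintro ⟨⟨_, h2⟩, h3, _⟩; exact ⟨h3, h2⟩
          · rintro ⟨h2, h3⟩; exact ⟨⟨(hTB t ht).1 h2, h3⟩, h2, h⟩
        rw [this, card_sdiff_of_subset h, (hTB t ht).2]; omega
      · rw [card_eq_zero, filter_eq_empty_iff]
        intro a _ h'
        exact h ((subset_insert _ _).trans h')
    rw [sum_congr rfl this, ← sum_filter, sum_const, smul_eq_mul, mul_comm]
  rw [← add_sum_erase _ _ hp] at key
  have : Even (∑ y ∈ (B \ σ).erase p, #{t ∈ T | insert y σ ⊆ t}) := by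
    apply even_sum
    intro y hy
    have := hc y (mem_of_mem_erase hy) (ne_of_mem_erase hy)
    simpa using this
  rcases hodd with ⟨a, ha⟩
  rcases this with ⟨b, hb⟩
  omega

theorem C7aux {k : Nat} {B : Finset Nat} (hB : B.card = 7) {T : Finset (Finset Nat)} (hT : T.Nonempty)
    (hTB : ∀ t ∈ T, t ⊆ B ∧ t.card = k + 1)
    (hdeg : ∀ r : Finset Nat, r.card = k → #{t ∈ T | r ⊆ t} ≠ 1)
    (hno : ∀ W ⊆ T, W.Nonempty → ∃ r : Finset Nat, r.card = k ∧ Odd #{t ∈ W | r ⊆ t}) : False := by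
  have h6 : k ≤ 6 := by
    obtain ⟨t, ht⟩ := hT
    have := card_le_card (hTB t ht).1
    rw [(hTB t ht).2] at this; omega
  rcases Nat.eq_zero_or_pos k with rfl | h1
  · have h := hdeg ∅ rfl
    simp only [empty_subset, filter_true] at h
    obtain ⟨t1, ht1⟩ := hT
    obtain ⟨t2, ht2, hne⟩ : ∃ t2 ∈ T, t2 ≠ t1 := by
      by_contra hc
      push Not at hc
      exact h (card_eq_one.2 ⟨t1, eq_singleton_iff_unique_mem.2 ⟨ht1, hc⟩⟩)
    obtain ⟨r, hr, ho⟩ := hno {t1, t2} (by intro t; simp; rintro (rfl | rfl) <;> assumption) (by simp)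
    rw [card_eq_zero] at hr
    subst hr
    simp only [empty_subset, filter_true] at ho
    rw [card_pair hne.symm] at ho
    exact absurd ho (by decide)
  obtain ⟨r, hr, ho⟩ := hno T subset_rfl hT
  have hrB : r ⊆ B := by
    obtain ⟨t, ht⟩ := card_pos.1 ho.pos
    exact (mem_filter.1 ht).2.trans (hTB t (mem_filter.1 ht).1).1
  obtain ⟨p, hp⟩ := card_pos.1 (hr.symm ▸ h1 : 0 < r.card)
  set σ := r.erase p with hσ
  have hcσ : σ.card + 1 = k := by rw [hσ, card_erase_of_mem hp]; omega
  have hrσ : insert p σ = r := insert_erase hp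
  have hpσ : p ∉ σ := notMem_erase p r
  have hpB := hrB hp
  obtain ⟨q, hq, hqp, hqo⟩ := exists_odd2 h1 hTB hcσ (mem_sdiff.2 ⟨hpB, hpσ⟩) (hrσ ▸ ho)
  rw [mem_sdiff] at hq
  set Y := B \ insert p (insert q σ) with hY
  classical
  set key : Nat → Nat := fun y => (if insert p (insert y σ) ∈ T then 1 else 0) + (if insert q (insert y σ) ∈ T then 2 else 0) with hkey
  have key0 : ∀ y, ((key y).testBit 0 = true ↔ insert p (insert y σ) ∈ T) := by
    intro y
    simp only [hkey]
    split_ifs with h1 h2 <;> simp [h1, Nat.testBit]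
  have key1 : ∀ y, ((key y).testBit 1 = true ↔ insert q (insert y σ) ∈ T) := by
    intro y
    simp only [hkey]
    split_ifs with h1 h2 h2 <;> simp [h2, Nat.testBit]
  have keylt : ∀ y, key y < 4 := by
    intro y; simp only [hkey]; split_ifs <;> norm_num
  set Yl := Y.toList.insertionSort (fun a b => key a ≤ key b) with hYl
  haveI : Std.Total (fun a b => key a ≤ key b) := ⟨fun a b => le_total _ _⟩
  haveI : IsTrans Nat (fun a b => key a ≤ key b) := ⟨fun a b c => le_trans⟩
  have hsort : Yl.Pairwise (fun a b => key a ≤ key b) := List.pairwise_insertionSort _ _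
  have hperm : Yl.Perm Y.toList := List.perm_insertionSort _ _
  have hcY : Y.card = 6 - k := by
    rw [hY, card_sdiff_of_subset (by
      intro a; simp only [mem_insert]; rintro (rfl | rfl | h)
      · exact hpB
      · exact hq.1
      · exact hrB (mem_of_mem_erase h)), card_insert_of_notMem (by simp [hpσ, hqp.symm]), card_insert_of_notMem hq.2, hB]
    omega
  have hlY : Yl.length = 6 - k := by rw [hperm.length_eq, length_toList, hcY]
  set Ls := σ.toList ++ (p :: q :: Yl) with hLs
  have hlen : Ls.length = 7 := by
    rw [hLs]; simp only [List.length_append, length_toList, List.length_cons, hlY]; omega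
  have hnd : Ls.Nodup := by
    rw [hLs, List.nodup_append']
    refine ⟨nodup_toList _, ?_, ?_⟩
    · simp only [List.nodup_cons, List.mem_cons, hperm.mem_iff, mem_toList, hperm.nodup_iff, nodup_toList, and_true]
      refine ⟨?_, ?_⟩
      · rintro (h | h)
        · exact hqp h.symm
        · simp [hY] at h
      · simp [hY]
    · intro a ha hb
      rw [mem_toList] at ha
      simp only [List.mem_cons, hperm.mem_iff, mem_toList] at hb
      rcases hb with rfl | rfl | hb
      · exact hpσ ha
      · exact hq.2 ha
      · simp [hY, ha] at hb
  set x : Nat → Nat := fun i => Ls.getD i 0 with hx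
  have xlt : ∀ i (h : i < 7), x i = Ls[i]'(by omega) := by
    intro i h; rw [hx]; simp [hlen, h]
  have xinj : Set.InjOn x (range 7) := by
    intro i hi j hj e
    simp only [coe_range, Set.mem_Iio] at hi hj
    rw [xlt i hi, xlt j hj] at e
    exact (List.Nodup.getElem_inj_iff hnd).1 e
  have xσ : σ = (range (k-1)).image x := by
    ext a
    rw [← mem_toList, List.mem_iff_getElem]
    simp only [mem_image, mem_range, length_toList]
    constructor
    · rintro ⟨i, hi, rfl⟩
      refine ⟨i, by omega, ?_⟩
      rw [xlt i (by omega)]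
      simp only [hLs]
      rw [List.getElem_append_left]
    · rintro ⟨i, hi, rfl⟩
      refine ⟨i, by omega, ?_⟩
      rw [xlt i (by omega)]
      simp only [hLs]
      rw [List.getElem_append_left]
  have xp : x (k-1) = p := by
    rw [xlt _ (by omega)]
    simp only [hLs]
    rw [List.getElem_append_right (by simp; omega)]
    simp [show k - 1 - σ.card = 0 by omega]
  have xq : x k = q := by
    rw [xlt _ (by omega)]
    simp only [hLs]
    rw [List.getElem_append_right (by simp; omega)]
    simp [show k - σ.card = 1 by omega]
  have xY : ∀ j (hj : j < Yl.length), x (j+k+1) = Yl[j] := by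
    intro j hj
    rw [xlt _ (by omega)]
    simp only [hLs]
    rw [List.getElem_append_right (by simp; omega)]
    simp [show j + k + 1 - σ.card = j + 1 + 1 by omega]
  have xB : B = (range 7).image x := by
    symm
    apply eq_of_subset_of_card_le
    · intro a ha
      obtain ⟨i, hi, rfl⟩ := mem_image.1 ha
      rw [mem_range] at hi
      rw [xlt i hi]
      have hm := List.getElem_mem (l := Ls) (n := i) (by omega)
      generalize Ls[i]'_ = b at *
      rw [hLs] at hm
      simp only [List.mem_append, List.mem_cons, hperm.mem_iff, mem_toList] at hm
      rcases hm with h | rfl | rfl | h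
      · exact hrB (mem_of_mem_erase h)
      · exact hpB
      · exact hq.1
      · exact (mem_sdiff.1 h).1
    · rw [card_image_of_injOn xinj, hB]; simp
  set e : Bool := decide (insert p (insert q σ) ∈ T) with he
  have cntY : ∀ (c : Nat) (o : Nat) (u : Nat) (_ : c ∉ σ) (_ : ∀ y, ((key y).testBit o = true ↔ insert c (insert y σ) ∈ T))
      (_ : B \ insert c σ = insert u Y) (_ : u ∉ Y) (_ : insert c (insert u σ) = insert p (insert q σ)),
      cnt e o (Yl.map key) = #{t ∈ T | insert c σ ⊆ t} := by
    intro c o u hcσ' hk hu huY hcu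
    rw [deg_eq hTB (by rw [card_insert_of_notMem hcσ']; exact hcσ), hu, filter_insert]
    have e1 : insert u (insert c σ) = insert p (insert q σ) := by rw [Finset.insert_comm, hcu]
    rw [e1]
    have e2 : ((Yl.map key).filter fun a => a.testBit o).length = #{y ∈ Y | insert y (insert c σ) ∈ T} := by
      rw [List.filter_map, List.length_map, (hperm.filter _).length_eq, ← List.countP_eq_length_filter]
      rw [← length_toList, ← Multiset.coe_card, coe_toList, filter_val, ← Multiset.countP_eq_card_filter]
      conv_rhs => rw [← coe_toList Y]
      rw [Multiset.coe_countP]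
      apply List.countP_congr
      intro y _
      simp only [Function.comp, hk y, decide_eq_true_eq]
      rw [Finset.insert_comm]
    rw [cnt, e2]
    split_ifs with h
    · rw [card_insert_of_notMem (by simp [huY])]; simp [he, h]; omega
    · simp [he, h]
  have c0 : cnt e 0 (Yl.map key) = #{t ∈ T | insert p σ ⊆ t} := by
    apply cntY p 0 q hpσ key0
    · rw [hY]; ext a; simp only [mem_sdiff, mem_insert]
      by_cases ha : a = q
      · subst ha; simp [hq.1, hq.2, hqp]
      · simp [ha]
    · simp [hY]
    · rfl
  have c1 : cnt e 1 (Yl.map key) = #{t ∈ T | insert q σ ⊆ t} := by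
    apply cntY q 1 p hq.2 key1
    · rw [hY]; ext a; simp only [mem_sdiff, mem_insert]
      by_cases ha : a = p
      · subst ha; simp [hpB, hpσ, hqp.symm]
      · simp [ha]
    · simp [hY]
    · rw [Finset.insert_comm]
  refine core h1 h6 xinj xB T hTB hdeg hno σ xσ e (Yl.map key) ?_ ?_ (by simpa using hlY) ?_ ?_ ?_
  · rw [xp, xq]; simp [he]
  · apply mem_mono _ _ _ (by simpa using hlY)
    · rw [List.pairwise_map]; exact hsort
    · intro a ha
      obtain ⟨y, _, rfl⟩ := List.mem_map.1 ha
      exact ⟨Nat.zero_le _, keylt y⟩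
  · intro j hj
    rw [List.length_map] at hj
    rw [xp, xY j hj, List.getElem_map, key0]
  · intro j hj
    rw [List.length_map] at hj
    rw [xq, xY j hj, List.getElem_map, key1]
  · have d0 := hdeg (insert p σ) (by rw [card_insert_of_notMem hpσ]; exact hcσ)
    have d1 := hdeg (insert q σ) (by rw [card_insert_of_notMem hq.2]; exact hcσ)
    rw [hrσ] at c0 d0
    simp [okp, c0, c1, d0, d1, Nat.odd_iff.1 ho, Nat.odd_iff.1 hqo]

end Dfs
open Finset
theorem C7 {k : Nat} {B : Finset Nat} (hB : B.card ≤ 7) {T : Finset (Finset Nat)} (hT : T.Nonempty)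
    (hTB : ∀ t ∈ T, t ⊆ B ∧ t.card = k + 1)
    (hdeg : ∀ r : Finset Nat, r.card = k → #{t ∈ T | r ⊆ t} ≠ 1) :
    ∃ W ⊆ T, W.Nonempty ∧ ∀ r : Finset Nat, r.card = k → Even #{t ∈ W | r ⊆ t} := by
  by_contra hc
  push Not at hc
  obtain ⟨B', hBB', hB'⟩ := Infinite.exists_superset_card_eq B 7 hB
  refine Dfs.C7aux hB' hT (fun t ht => ⟨(hTB t ht).1.trans hBB', (hTB t ht).2⟩) hdeg ?_
  intro W hW hne
  obtain ⟨r, hr, h⟩ := hc W hW hne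
  exact ⟨r, hr, by simpa using h⟩
end HomologySpheres

end

open Finset
noncomputable section
namespace HomologySpheres
namespace PL
variable {E : Type*} [AddCommGroup E] [Module ℝ E] {F : Type*} [AddCommGroup F] [Module ℝ F]
  {G : Type*} [AddCommGroup G] [Module ℝ G]

def Polytope (P : Set E) : Prop := ∃ A : Set E, A.Finite ∧ P = convexHull ℝ A

theorem Polytope.convex {P : Set E} (h : Polytope P) : Convex ℝ P := by
  obtain ⟨A, _, rfl⟩ := h; exact convex_convexHull _ _

theorem Polytope.image {P : Set E} (h : Polytope P) (f : E →ₗ[ℝ] F) : Polytope (f '' P) := by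
  obtain ⟨A, hA, rfl⟩ := h
  exact ⟨f '' A, hA.image _, by rw [LinearMap.image_convexHull]⟩

theorem Polytope.prod {P : Set E} {Q : Set F} (h : Polytope P) (h' : Polytope Q) : Polytope (P ×ˢ Q) := by
  obtain ⟨A, hA, rfl⟩ := h
  obtain ⟨B, hB, rfl⟩ := h'
  exact ⟨A ×ˢ B, hA.prod hB, by rw [convexHull_prod]⟩

theorem simplex_inter_ker {ι : Type*} [Fintype ι] (K : Submodule ℝ (ι → ℝ)) :
    Polytope (stdSimplex ℝ ι ∩ K) := by
  set S := stdSimplex ℝ ι ∩ (K : Set (ι → ℝ)) with hS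
  have hc : IsCompact S := (isCompact_stdSimplex ℝ ι).inter_right K.closed_of_finiteDimensional
  have hconv : Convex ℝ S := (convex_stdSimplex ℝ ι).inter K.convex
  have hfin : (S.extremePoints ℝ).Finite := by
    classical
    apply Set.Finite.of_injOn (f := fun x : ι → ℝ => (univ.filter fun i => x i ≠ 0)) (t := Set.univ)
      (fun _ _ => Set.mem_univ _) ?_ Set.finite_univ
    intro x hx y hy hxy
    by_contra hne
    have hxS := hx.1
    have hyS := hy.1
    simp only at hxy
    have hz : ∀ i, x i = 0 → y i = 0 := by
      intro i hi
      by_contra h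
      have : i ∈ univ.filter fun i => y i ≠ 0 := by simp [h]
      rw [← hxy] at this
      simp [hi] at this
    have hev : ∀ᶠ ε in nhdsWithin (0:ℝ) (Set.Ioi 0), ∀ i, ε * y i ≤ x i := by
      rw [Filter.eventually_all]
      intro i
      rcases eq_or_ne (x i) 0 with h | h
      · simp [h, hz i h]
      · have hpos : 0 < x i := lt_of_le_of_ne (hxS.1.1 i) (Ne.symm h)
        have : Filter.Tendsto (fun ε : ℝ => ε * y i) (nhdsWithin 0 (Set.Ioi 0)) (nhds 0) := by
          have : Continuous fun ε : ℝ => ε * y i := by fun_prop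
          have := this.tendsto 0
          simp only [zero_mul] at this
          exact this.mono_left nhdsWithin_le_nhds
        exact (this.eventually_lt_const hpos).mono fun _ h => h.le
    have hev2 : ∀ᶠ ε in nhdsWithin (0:ℝ) (Set.Ioi 0), 0 < ε ∧ ε < 1 :=
      Ioo_mem_nhdsGT (by norm_num : (0:ℝ) < 1)
    obtain ⟨ε, h1, h0, h2⟩ := (hev.and hev2).exists
    have m1 : x + ε • (x - y) ∈ S := by
      refine ⟨⟨fun i => ?_, ?_⟩, K.add_mem hxS.2 (K.smul_mem _ (K.sub_mem hxS.2 hyS.2))⟩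
      · have := h1 i; have := hxS.1.1 i
        simp only [Pi.add_apply, Pi.smul_apply, Pi.sub_apply, smul_eq_mul]
        nlinarith
      · simp only [Pi.add_apply, Pi.smul_apply, Pi.sub_apply, smul_eq_mul, sum_add_distrib, ← mul_sum, sum_sub_distrib, hxS.1.2, hyS.1.2]
        ring
    have m2 : x - ε • (x - y) ∈ S := by
      refine ⟨⟨fun i => ?_, ?_⟩, K.sub_mem hxS.2 (K.smul_mem _ (K.sub_mem hxS.2 hyS.2))⟩
      · have := hyS.1.1 i; have := hxS.1.1 i
        simp only [Pi.sub_apply, Pi.smul_apply, smul_eq_mul]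
        nlinarith
      · simp only [Pi.smul_apply, Pi.sub_apply, smul_eq_mul, ← mul_sum, sum_sub_distrib, hxS.1.2, hyS.1.2]
        ring
    have := hx.2 m1 m2 ⟨1/2, 1/2, by norm_num, by norm_num, by norm_num, by
      rw [← smul_add]; ext i; simp; ring⟩
    have h3 : ε • (x - y) = 0 := by simpa using this
    rcases smul_eq_zero.1 h3 with h | h
    · exact h0.ne' h
    · exact hne (sub_eq_zero.1 h)
  refine ⟨_, hfin, ?_⟩
  conv_lhs => rw [← closure_convexHull_extremePoints hc hconv]
  exact (hfin.isClosed_convexHull (𝕜 := ℝ)).closure_eq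

theorem Polytope.inter_ker {P : Set E} (h : Polytope P) (T : E →ₗ[ℝ] G) : Polytope (P ∩ {x | T x = 0}) := by
  classical
  obtain ⟨A, hA, rfl⟩ := h
  rw [hA.convexHull_eq_image]
  letI := hA.fintype
  set Φ : (A → ℝ) →ₗ[ℝ] E := ∑ x : A, (LinearMap.proj x).smulRight x.1 with hΦ
  have := (simplex_inter_ker (LinearMap.ker (T ∘ₗ Φ))).image Φ
  convert this using 1
  ext x
  simp only [Set.mem_image, Set.mem_inter_iff, Set.mem_ofPred_eq, SetLike.mem_coe, LinearMap.mem_ker, LinearMap.comp_apply]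
  constructor
  · rintro ⟨⟨w, h1, rfl⟩, h2⟩
    refine ⟨w, ⟨?_, ?_⟩, ?_⟩
    · exact h1
    · exact h2
    · convert rfl
  · rintro ⟨w, ⟨h1, h2⟩, rfl⟩
    refine ⟨⟨w, ?_, ?_⟩, h2⟩
    · exact h1
    · convert rfl

theorem Polytope.inter {P Q : Set E} (h : Polytope P) (h' : Polytope Q) : Polytope (P ∩ Q) := by
  have := ((h.prod h').inter_ker (LinearMap.fst ℝ E E - LinearMap.snd ℝ E E)).image (LinearMap.fst ℝ E E)
  convert this using 1
  ext x
  simp only [Set.mem_inter_iff, Set.mem_image, Set.mem_prod, Set.mem_ofPred_eq, LinearMap.sub_apply, LinearMap.fst_apply, LinearMap.snd_apply, Prod.exists, sub_eq_zero]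
  constructor
  · rintro ⟨h1, h2⟩; exact ⟨x, x, ⟨⟨h1, h2⟩, rfl⟩, rfl⟩
  · rintro ⟨a, b, ⟨⟨h1, h2⟩, rfl⟩, rfl⟩; exact ⟨h1, h2⟩

theorem Polytope.cjoin {P Q : Set E} (h : Polytope P) (h' : Polytope Q) (hP : P.Nonempty) (hQ : Q.Nonempty) :
    Polytope (convexJoin ℝ P Q) := by
  obtain ⟨A, hA, rfl⟩ := h
  obtain ⟨B, hB, rfl⟩ := h'
  exact ⟨A ∪ B, hA.union hB, by rw [convexHull_union (convexHull_nonempty_iff.1 hP) (convexHull_nonempty_iff.1 hQ)]⟩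

def Poly (P : Set E) : Prop := ∃ S : Set (Set E), S.Finite ∧ (∀ Q ∈ S, Polytope Q) ∧ P = ⋃₀ S

theorem Polytope.poly {P : Set E} (h : Polytope P) : Poly P := ⟨{P}, by simp, by simpa using h, by simp⟩
theorem Poly.hull {A : Set E} (hA : A.Finite) : Poly (convexHull ℝ A) := Polytope.poly ⟨A, hA, rfl⟩
theorem Poly.empty : Poly (∅ : Set E) := ⟨∅, by simp, by simp, by simp⟩
theorem Poly.union {P Q : Set E} (h : Poly P) (h' : Poly Q) : Poly (P ∪ Q) := by
  obtain ⟨S, a, b, rfl⟩ := h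
  obtain ⟨T, c, d, rfl⟩ := h'
  refine ⟨S ∪ T, a.union c, ?_, by rw [Set.sUnion_union]⟩
  rintro X (h | h)
  exacts [b X h, d X h]
theorem Poly.biUnion {ι : Type*} {s : Set ι} (hs : s.Finite) {f : ι → Set E} (h : ∀ i ∈ s, Poly (f i)) : Poly (⋃ i ∈ s, f i) := by
  classical
  induction s, hs using Set.Finite.induction_on with
  | empty => simpa using Poly.empty
  | insert _ _ ih =>
    rw [Set.biUnion_insert]
    exact (h _ (by simp)).union (ih fun i hi => h i (by simp [hi]))
/-- operations on polytopes extend to `Poly` -/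
theorem Poly.lift1 {P : Set E} (h : Poly P) (op : Set E → Set F) (hop : ∀ S : Set (Set E), op (⋃₀ S) = ⋃ Q ∈ S, op Q)
    (hp : ∀ Q, Polytope Q → Poly (op Q)) : Poly (op P) := by
  obtain ⟨S, a, b, rfl⟩ := h
  rw [hop]
  exact Poly.biUnion a fun i hi => hp i (b i hi)
theorem Poly.image {P : Set E} (h : Poly P) (f : E →ₗ[ℝ] F) : Poly (f '' P) :=
  h.lift1 _ (fun S => by rw [Set.image_sUnion, Set.sUnion_image]) fun Q hQ => (hQ.image f).poly
theorem Poly.prod {P : Set E} {Q : Set F} (h : Poly P) (h' : Poly Q) : Poly (P ×ˢ Q) :=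
  h.lift1 (fun P => P ×ˢ Q) (fun S => by ext; simp <;> grind) fun P hP =>
    h'.lift1 (fun Q => P ×ˢ Q) (fun S => by ext; simp <;> grind) fun Q hQ => (hP.prod hQ).poly
theorem Poly.inter {P Q : Set E} (h : Poly P) (h' : Poly Q) : Poly (P ∩ Q) :=
  h.lift1 (fun P => P ∩ Q) (fun S => by ext; simp <;> grind) fun P hP =>
    h'.lift1 (fun Q => P ∩ Q) (fun S => by ext; simp <;> grind) fun Q hQ => (hP.inter hQ).poly
theorem Poly.inter_ker {P : Set E} (h : Poly P) (T : E →ₗ[ℝ] G) : Poly (P ∩ {x | T x = 0}) :=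
  h.lift1 (fun P => P ∩ {x | T x = 0}) (fun S => by ext; simp <;> grind) fun P hP => (hP.inter_ker T).poly
theorem Poly.cjoin {P Q : Set E} (h : Poly P) (h' : Poly Q) : Poly (convexJoin ℝ P Q) :=
  h.lift1 (fun P => convexJoin ℝ P Q) (fun S => by ext; simp only [mem_convexJoin, Set.mem_sUnion, Set.mem_iUnion]; grind) fun P hP =>
    h'.lift1 (fun Q => convexJoin ℝ P Q) (fun S => by ext; simp only [mem_convexJoin, Set.mem_sUnion, Set.mem_iUnion]; grind) fun Q hQ => by
      rcases P.eq_empty_or_nonempty with rfl | h1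
      · simpa using Poly.empty
      rcases Q.eq_empty_or_nonempty with rfl | h2
      · simpa using Poly.empty
      exact (hP.cjoin hQ h1 h2).poly

def rcomp (Γ : Set (E × F)) (Δ : Set (F × G)) : Set (E × G) := {x | ∃ y, (x.1, y) ∈ Γ ∧ (y, x.2) ∈ Δ}

theorem poly_rcomp {Γ : Set (E × F)} {Δ : Set (F × G)} (h : Poly Γ) (h' : Poly Δ) : Poly (rcomp Γ Δ) := by
  have := ((h.prod h').inter_ker (LinearMap.snd ℝ E F ∘ₗ LinearMap.fst ℝ (E × F) (F × G) - LinearMap.fst ℝ F G ∘ₗ LinearMap.snd ℝ (E × F) (F × G))).image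
    ((LinearMap.fst ℝ E F ∘ₗ LinearMap.fst ℝ (E × F) (F × G)).prod (LinearMap.snd ℝ F G ∘ₗ LinearMap.snd ℝ (E × F) (F × G)))
  convert this using 1
  ext ⟨a, c⟩
  simp [rcomp, sub_eq_zero]

/-- graph of a function on a set -/
def gr (f : E → F) (P : Set E) : Set (E × F) := (fun x => (x, f x)) '' P

theorem poly_gr {P : Set E} (h : Poly P) (f : E →ₗ[ℝ] F) : Poly (gr f P) :=
  h.image (LinearMap.id.prod f)


/-- `f` is piecewise linear on `P` -/
def PLf (f : E → F) (P : Set E) : Prop := Poly (gr f P)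

theorem PLf.linear {P : Set E} (h : Poly P) (f : E →ₗ[ℝ] F) : PLf f P := poly_gr h f
theorem PLf.idm {P : Set E} (h : Poly P) : PLf (fun x => x) P := poly_gr h LinearMap.id

theorem PLf.congr {P : Set E} {f g : E → F} (h : PLf f P) (e : Set.EqOn f g P) : PLf g P := by
  have : gr g P = gr f P := by
    apply Set.image_congr; intro x hx; simp [e hx]
  rw [PLf, this]; exact h

theorem PLf.union {P Q : Set E} {f : E → F} (h : PLf f P) (h' : PLf f Q) : PLf f (P ∪ Q) := by
  rw [PLf, gr, Set.image_union]; exact Poly.union h h'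

theorem PLf.biUnion {ι : Type*} {s : Set ι} (hs : s.Finite) {P : ι → Set E} {f : E → F} (h : ∀ i ∈ s, PLf f (P i)) :
    PLf f (⋃ i ∈ s, P i) := by
  rw [PLf, gr, Set.image_iUnion₂]; exact Poly.biUnion hs h

theorem PLf.comp {P : Set E} {Q : Set F} {f : E → F} {g : F → G} (h' : PLf g Q) (h : PLf f P) (hm : Set.MapsTo f P Q) :
    PLf (fun x => g (f x)) P := by
  have := poly_rcomp h h'
  unfold PLf
  convert this using 1
  ext ⟨a, c⟩
  simp only [gr, rcomp, Set.mem_image, Set.mem_ofPred_eq, Prod.mk.injEq]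
  constructor
  · rintro ⟨x, hx, rfl, rfl⟩; exact ⟨f x, ⟨x, hx, rfl, rfl⟩, f x, hm hx, rfl, rfl⟩
  · rintro ⟨y, ⟨x, hx, rfl, rfl⟩, z, hz, rfl, rfl⟩; exact ⟨x, hx, rfl, rfl⟩

theorem PLf.mono {P P' : Set E} {f : E → F} (h : PLf f P) (hP : Poly P') (hs : P' ⊆ P) : PLf f P' :=
  PLf.comp h (PLf.idm hP) hs

theorem PLf.poly {P : Set E} {f : E → F} (h : PLf f P) : Poly P := by
  have := Poly.image h (LinearMap.fst ℝ E F)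
  convert this using 1
  rw [gr, Set.image_image]; simp

theorem PLf.poly_image {P : Set E} {f : E → F} (h : PLf f P) : Poly (f '' P) := by
  have := Poly.image h (LinearMap.snd ℝ E F)
  convert this using 1
  rw [gr, Set.image_image]; simp

/-- PL homeomorphism -/
def PLeq (f : E → F) (P : Set E) (Q : Set F) : Prop := PLf f P ∧ Set.BijOn f P Q

theorem PLeq.of_linear {P : Set E} {Q : Set F} (h : Poly P) (f : E →ₗ[ℝ] F) (hb : Set.BijOn f P Q) : PLeq f P Q :=
  ⟨PLf.linear h f, hb⟩
theorem PLeq.refl {P : Set E} (h : Poly P) : PLeq (fun x => x) P P := ⟨PLf.idm h, Set.bijOn_id _⟩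
theorem PLeq.trans {P : Set E} {Q : Set F} {R : Set G} {f : E → F} {g : F → G} (h : PLeq f P Q) (h' : PLeq g Q R) :
    PLeq (fun x => g (f x)) P R := ⟨PLf.comp h'.1 h.1 h.2.mapsTo, h'.2.comp h.2⟩
theorem PLeq.congr {P : Set E} {Q : Set F} {f g : E → F} (h : PLeq f P Q) (e : Set.EqOn f g P) : PLeq g P Q :=
  ⟨h.1.congr e, h.2.congr e⟩
theorem PLeq.restrict {P P' : Set E} {Q : Set F} {f : E → F} (h : PLeq f P Q) (hP : Poly P') (hs : P' ⊆ P) :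
    PLeq f P' (f '' P') := ⟨h.1.mono hP hs, (h.2.injOn.mono hs).bijOn_image⟩
theorem PLeq.poly {P : Set E} {Q : Set F} {f : E → F} (h : PLeq f P Q) : Poly P := h.1.poly
theorem PLeq.poly' {P : Set E} {Q : Set F} {f : E → F} (h : PLeq f P Q) : Poly Q := h.2.image_eq ▸ h.1.poly_image

theorem PLeq.of_inv {P : Set E} {Q : Set F} {f : E → F} {g : F → E} (h : PLeq f P Q) (hg : Set.LeftInvOn g f P) :
    PLeq g Q P := by
  have e : gr g Q = (LinearEquiv.prodComm ℝ E F : (E × F) →ₗ[ℝ] (F × E)) '' gr f P := by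
    ext ⟨a, b⟩
    simp only [gr, Set.mem_image, Prod.mk.injEq]
    constructor
    · rintro ⟨x, hx, rfl, rfl⟩
      obtain ⟨p, hp, rfl⟩ := h.2.surjOn hx
      exact ⟨_, ⟨p, hp, rfl⟩, by simp [hg hp]⟩
    · rintro ⟨_, ⟨x, hx, rfl⟩, e⟩
      simp at e
      exact ⟨a, by rw [← e.1]; exact h.2.mapsTo hx, rfl, by rw [← e.1, ← e.2, hg hx]⟩
  refine ⟨?_, ?_⟩
  · rw [PLf, e]; exact Poly.image h.1 _
  · refine ⟨?_, ?_, ?_⟩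
    · intro y hy
      obtain ⟨p, hp, rfl⟩ := h.2.surjOn hy
      rw [hg hp]; exact hp
    · intro y hy y' hy' e
      obtain ⟨p, hp, rfl⟩ := h.2.surjOn hy
      obtain ⟨p', hp', rfl⟩ := h.2.surjOn hy'
      rw [hg hp, hg hp'] at e; rw [e]
    · intro p hp
      exact ⟨f p, h.2.mapsTo hp, hg hp⟩

theorem PLeq.symm {P : Set E} {Q : Set F} {f : E → F} (h : PLeq f P Q) :
    ∃ g, PLeq g Q P ∧ Set.LeftInvOn g f P ∧ Set.RightInvOn g f Q := by
  have : Nonempty E := ⟨0⟩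
  exact ⟨Function.invFunOn f P, h.of_inv h.2.injOn.leftInvOn_invFunOn, h.2.injOn.leftInvOn_invFunOn, h.2.surjOn.rightInvOn_invFunOn⟩

end PL
end HomologySpheres

end

open Finset
noncomputable section
namespace HomologySpheres
namespace PL

abbrev Vec := ℕ →₀ ℝ

def mass : Vec →ₗ[ℝ] ℝ := Finsupp.linearCombination ℝ (fun _ => (1:ℝ))

theorem mass_eq {w : Vec} {s : Finset ℕ} (h : w.support ⊆ s) : mass w = ∑ i ∈ s, w i := by
  rw [mass, Finsupp.linearCombination_apply, Finsupp.sum_of_support_subset _ h] <;> simp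

def dl (i : ℕ) : Vec := Finsupp.single i 1
theorem dl_apply (i j : ℕ) : dl i j = if i = j then 1 else 0 := Finsupp.single_apply

theorem sum_single {w : Vec} {s : Finset ℕ} (h : w.support ⊆ s) : w = ∑ i ∈ s, w i • dl i := by
  conv_lhs => rw [← Finsupp.sum_single w]
  rw [Finsupp.sum_of_support_subset _ h] <;> simp [dl]


@[simp] theorem mass_dl (i : ℕ) : mass (dl i) = 1 := by simp [mass, dl]

def Cx (K : Set (Finset ℕ)) : Prop := K.Finite ∧ ∀ s ∈ K, ∀ t ⊆ s, t ∈ K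

def R (K : Set (Finset ℕ)) : Set Vec := {w | (∀ i, 0 ≤ w i) ∧ mass w = 1 ∧ w.support ∈ K}

def full (s : Finset ℕ) : Set (Finset ℕ) := {t | t ⊆ s}
def bd (s : Finset ℕ) : Set (Finset ℕ) := {t | t ⊂ s}

theorem cx_full (s : Finset ℕ) : Cx (full s) := ⟨by
  have : full s = (s.powerset : Set (Finset ℕ)) := by ext; simp [full]
  rw [this]; exact Finset.finite_toSet _, fun a ha t ht => ht.trans ha⟩
theorem cx_bd (s : Finset ℕ) : Cx (bd s) := ⟨(cx_full s).1.subset fun _ h => h.1, fun _ ha _ ht => lt_of_le_of_lt ht ha⟩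

theorem R_mono {K L : Set (Finset ℕ)} (h : K ⊆ L) : R K ⊆ R L := fun _ hw => ⟨hw.1, hw.2.1, h hw.2.2⟩

theorem mem_R_full {s : Finset ℕ} {w : Vec} : w ∈ R (full s) ↔ (∀ i, 0 ≤ w i) ∧ mass w = 1 ∧ w.support ⊆ s := Iff.rfl

theorem supp_dl (i : ℕ) : (dl i).support = {i} := by simp [dl, Finsupp.support_single]

theorem dl_mem {K : Set (Finset ℕ)} {i : ℕ} : dl i ∈ R K ↔ {i} ∈ K := by
  simp only [R, Set.mem_ofPred_eq, supp_dl, mass_dl, true_and]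
  refine and_iff_right_of_imp fun _ j => ?_
  rw [dl_apply]; split_ifs <;> norm_num

theorem R_full (s : Finset ℕ) : R (full s) = convexHull ℝ (dl '' (s : Set ℕ)) := by
  classical
  ext w
  constructor
  · intro hw
    have h1 := mem_R_full.1 hw
    rw [sum_single h1.2.2]
    have := (convex_convexHull ℝ (dl '' (s : Set ℕ)))
    apply this.sum_mem (fun i _ => h1.1 i) (by rw [← mass_eq h1.2.2]; exact h1.2.1)
    intro i hi
    exact subset_convexHull _ _ ⟨i, hi, rfl⟩
  · intro hw
    have hc : Convex ℝ (R (full s)) := by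
      intro x hx y hy a b ha hb hab
      refine ⟨fun i => ?_, ?_, ?_⟩
      · have := hx.1 i; have := hy.1 i
        simp only [Finsupp.add_apply, Finsupp.smul_apply, smul_eq_mul]; positivity
      · simp [hx.2.1, hy.2.1, hab]
      · refine (Finsupp.support_add).trans (union_subset ?_ ?_)
        · exact (Finsupp.support_smul).trans hx.2.2
        · exact (Finsupp.support_smul).trans hy.2.2
    refine convexHull_min ?_ hc hw
    rintro _ ⟨i, hi, rfl⟩
    exact dl_mem.2 (by simpa [full] using hi)

theorem convex_full (s : Finset ℕ) : Convex ℝ (R (full s)) := by rw [R_full]; exact convex_convexHull _ _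

theorem polytope_full (s : Finset ℕ) : Polytope (R (full s)) := ⟨_, s.finite_toSet.image _, R_full s⟩

theorem R_eq {K : Set (Finset ℕ)} (hK : Cx K) : R K = ⋃ s ∈ K, R (full s) := by
  ext w
  simp only [Set.mem_iUnion]
  constructor
  · intro hw; exact ⟨w.support, hw.2.2, hw.1, hw.2.1, fun _ h => h⟩
  · rintro ⟨s, hs, hw⟩; exact ⟨hw.1, hw.2.1, hK.2 s hs _ hw.2.2⟩

theorem poly_R {K : Set (Finset ℕ)} (hK : Cx K) : Poly (R K) := by
  rw [R_eq hK]
  exact Poly.biUnion hK.1 fun s _ => (polytope_full s).poly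

theorem le_one_R {K : Set (Finset ℕ)} {w : Vec} (hw : w ∈ R K) (i : ℕ) : w i ≤ 1 := by
  by_cases h : i ∈ w.support
  · rw [← hw.2.1, mass_eq (le_refl w.support)]
    exact single_le_sum (f := fun i => w i) (fun j _ => hw.1 j) h
  · rw [Finsupp.notMem_support_iff.1 h]; norm_num

theorem ne_zero_R {K : Set (Finset ℕ)} {w : Vec} (hw : w ∈ R K) : w ≠ 0 := by
  rintro rfl; have := hw.2.1; simp at this

/-- carrier-in-simplex facts -/
theorem R_bd_iff {s : Finset ℕ} {w : Vec} (hw : w ∈ R (full s)) : w ∈ R (bd s) ↔ ∃ i ∈ s, w i = 0 := by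
  have : w ∈ R (bd s) ↔ w.support ⊂ s := ⟨fun h => h.2.2, fun h => ⟨hw.1, hw.2.1, h⟩⟩
  rw [this, ssubset_iff_of_subset hw.2.2]
  simp

theorem exists_fresh {K : Set (Finset ℕ)} (hK : K.Finite) (N : Finset ℕ) : ∃ m, (∀ s ∈ K, m ∉ s) ∧ m ∉ N := by
  classical
  obtain ⟨m, hm⟩ := Infinite.exists_notMem_finset (hK.toFinset.sup id ∪ N)
  refine ⟨m, fun s hs hms => hm ?_, fun h => hm (by simp [h])⟩
  simp only [mem_union, mem_sup]
  exact Or.inl ⟨s, by simpa using hs, hms⟩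

/-! ### Starring -/

def Star (K : Set (Finset ℕ)) (τ : Finset ℕ) (m : ℕ) : Set (Finset ℕ) :=
  {s | ¬ τ ⊆ s ∧ ((m ∉ s ∧ s ∈ K) ∨ (m ∈ s ∧ s.erase m ∪ τ ∈ K))}

theorem Star_mono {K L : Set (Finset ℕ)} (h : K ⊆ L) (τ : Finset ℕ) (m : ℕ) : Star K τ m ⊆ Star L τ m :=
  fun _ hs => ⟨hs.1, hs.2.imp (fun a => ⟨a.1, h a.2⟩) fun a => ⟨a.1, h a.2⟩⟩

theorem cx_star {K : Set (Finset ℕ)} (hK : Cx K) (τ : Finset ℕ) (m : ℕ) : Cx (Star K τ m) := by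
  constructor
  · have : Star K τ m ⊆ K ∪ ((fun s : Finset ℕ × Finset ℕ => insert m s.2) '' {q : Finset ℕ × Finset ℕ | q.1 ∈ K ∧ q.2 ∈ K}) := by
      rintro s ⟨h1, (h | h)⟩
      · exact Or.inl h.2
      · refine Or.inr ⟨(s.erase m ∪ τ, s.erase m), ⟨h.2, hK.2 _ h.2 _ subset_union_left⟩, insert_erase h.1⟩
    refine (hK.1.union (Set.Finite.image _ ?_)).subset this
    exact (hK.1.prod hK.1).subset fun q hq => ⟨hq.1, hq.2⟩
  · rintro s ⟨h1, h⟩ t ht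
    refine ⟨fun h' => h1 (h'.trans ht), ?_⟩
    by_cases hmt : m ∈ t
    · right
      refine ⟨hmt, ?_⟩
      rcases h with h | h
      · exact absurd (ht hmt) h.1
      · exact hK.2 _ h.2 _ (union_subset_union (erase_subset_erase _ ht) le_rfl)
    · left
      refine ⟨hmt, ?_⟩
      rcases h with h | h
      · exact hK.2 _ h.2 _ ht
      · exact hK.2 _ h.2 _ (fun x hx => mem_union_left _ (mem_erase.2 ⟨fun e => hmt (e ▸ hx), ht hx⟩))

/-- substitute the point `p` for the vertex `m` -/
def sub (m : ℕ) (p : Vec) : Vec →ₗ[ℝ] Vec := LinearMap.id + (Finsupp.lapply m).smulRight (p - dl m)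

theorem sub_apply (m : ℕ) (p w : Vec) : sub m p w = w + w m • (p - dl m) := by simp [sub]

theorem sub_of_zero {m : ℕ} {p w : Vec} (h : w m = 0) : sub m p w = w := by simp [sub_apply, h]
theorem sub_dl_self (m : ℕ) (p : Vec) : sub m p (dl m) = p := by simp [sub_apply, dl_apply]
theorem sub_dl_ne {m i : ℕ} (p : Vec) (h : i ≠ m) : sub m p (dl i) = dl i := by
  apply sub_of_zero; simp [dl_apply, h]

theorem sub_coord {m : ℕ} {p : Vec} (w : Vec) (i : ℕ) : sub m p w i = if i = m then w m * p m else w i + w m * p i := by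
  rw [sub_apply]
  simp only [Finsupp.add_apply, Finsupp.smul_apply, Finsupp.sub_apply, smul_eq_mul, dl_apply]
  split_ifs <;> simp_all <;> ring

theorem mass_sub {m : ℕ} {p : Vec} (hp : mass p = 1) (w : Vec) : mass (sub m p w) = mass w := by
  simp [sub_apply, hp]

theorem star_bij {K : Set (Finset ℕ)} (hK : Cx K) {τ : Finset ℕ} {m : ℕ} (hm : ∀ s ∈ K, m ∉ s) (hτ : m ∉ τ) {p : Vec}
    (hp : p ∈ R (full τ)) (hs : p.support = τ) : Set.BijOn (sub m p) (R (Star K τ m)) (R K) := by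
  have hpm : p m = 0 := by rw [← Finsupp.notMem_support_iff, hs]; exact hτ
  have hpp : ∀ x ∈ τ, 0 < p x := fun x hx => lt_of_le_of_ne (hp.1 x) (Ne.symm (by rw [← hs] at hx; exact Finsupp.mem_support_iff.1 hx))
  have hne : τ.Nonempty := by
    rw [← hs, Finsupp.support_nonempty_iff]; exact ne_zero_R hp
  refine ⟨?_, ?_, ?_⟩
  · intro w hw
    refine ⟨fun i => ?_, by rw [mass_sub hp.2.1]; exact hw.2.1, ?_⟩
    · rw [sub_coord]; split_ifs
      · exact mul_nonneg (hw.1 _) (hp.1 _)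
      · exact add_nonneg (hw.1 _) (mul_nonneg (hw.1 _) (hp.1 _))
    · rcases hw.2.2.2 with h | h
      · rw [sub_of_zero (Finsupp.notMem_support_iff.1 h.1)]; exact h.2
      · refine hK.2 _ h.2 _ fun i hi => ?_
        rw [Finsupp.mem_support_iff, sub_coord] at hi
        simp only [mem_union, mem_erase, Finsupp.mem_support_iff, ← hs]
        split_ifs at hi with e
        · simp [hpm] at hi
        · by_contra hc
          push Not at hc
          exact hi (by rw [hc.1 e, hc.2]; ring)
  · have key : ∀ w ∈ R (Star K τ m), ∀ w' ∈ R (Star K τ m), sub m p w = sub m p w' → w' m ≤ w m := by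
      intro w hw w' hw' e
      obtain ⟨x, hx, hxw⟩ := not_subset.1 hw.2.2.1
      have hxm : x ≠ m := fun h => hτ (h ▸ hx)
      have := DFunLike.congr_fun e x
      rw [sub_coord, sub_coord, if_neg hxm, if_neg hxm, Finsupp.notMem_support_iff.1 hxw, zero_add] at this
      have h1 := hw'.1 x
      have h2 := hpp x hx
      nlinarith
    intro w hw w' hw' e
    have h1 : w m = w' m := le_antisymm (key _ hw' _ hw e.symm) (key _ hw _ hw' e)
    rw [sub_apply, sub_apply, h1] at e
    exact add_right_cancel e
  · intro w hw
    obtain ⟨x0, hx0, hmin⟩ := exists_min_image τ (fun x => w x / p x) hne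
    set c := w x0 / p x0 with hc
    have hc0 : 0 ≤ c := div_nonneg (hw.1 _) (hp.1 _)
    have hwm : w m = 0 := by rw [← Finsupp.notMem_support_iff]; exact hm _ hw.2.2
    have hcoord : ∀ i, (w + c • (dl m - p)) i = if i = m then c else w i - c * p i := by
      intro i
      simp only [Finsupp.add_apply, Finsupp.smul_apply, Finsupp.sub_apply, smul_eq_mul, dl_apply]
      by_cases e : i = m
      · subst e; simp [hwm, hpm]
      · simp [e, Ne.symm e]; ring
    have hle : ∀ x, c * p x ≤ w x := by
      intro x
      by_cases hx : x ∈ τ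
      · have := hmin x hx
        rwa [le_div_iff₀ (hpp x hx)] at this
      · have : p x = 0 := by rw [← Finsupp.notMem_support_iff, hs]; exact hx
        rw [this, mul_zero]; exact hw.1 x
    refine ⟨w + c • (dl m - p), ⟨fun i => ?_, ?_, ?_, ?_⟩, ?_⟩
    · rw [hcoord]; split_ifs
      · exact hc0
      · linarith [hle i]
    · simp [hp.2.1, hw.2.1]
    · intro h
      have := h hx0
      rw [Finsupp.mem_support_iff, hcoord, if_neg (fun e => hτ (by rw [← e]; exact hx0)), hc, div_mul_cancel₀ _ (hpp x0 hx0).ne'] at this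
      simp at this
    · rcases hc0.eq_or_lt with h | h
      · left
        rw [← h]; simp only [zero_smul, add_zero]
        exact ⟨hm _ hw.2.2, hw.2.2⟩
      · right
        constructor
        · rw [Finsupp.mem_support_iff, hcoord, if_pos rfl]; exact h.ne'
        · refine hK.2 _ hw.2.2 _ fun i hi => ?_
          rw [mem_union, mem_erase, Finsupp.mem_support_iff, hcoord] at hi
          rw [Finsupp.mem_support_iff]
          rcases hi with ⟨e, hi⟩ | hi
          · rw [if_neg e] at hi
            intro h0
            have := hle i
            rw [h0] at this hi
            have := mul_nonneg hc0 (hp.1 i)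
            apply hi; linarith
          · have := hle i
            have := mul_pos h (hpp i hi)
            intro h0; linarith
    · rw [sub_apply, hcoord, if_pos rfl]
      rw [add_assoc, ← smul_add]; simp

end PL
end HomologySpheres

end

open Finset
noncomputable section
namespace HomologySpheres
namespace PL

theorem lin_sum {F : Type*} [AddCommGroup F] [Module ℝ F] (g : Vec →ₗ[ℝ] F) {w : Vec} {s : Finset ℕ} (h : w.support ⊆ s) :
    g w = ∑ i ∈ s, w i • g (dl i) := by
  conv_lhs => rw [sum_single h]
  simp

/-! ### Fourier–Motzkin -/

def coneOf (A : Finset Vec) : Set Vec := {x | ∃ w : Vec → ℝ, (∀ a ∈ A, 0 ≤ w a) ∧ ∑ a ∈ A, w a • a = x}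

theorem coneOf_insert {A : Finset Vec} {a : Vec} (ha : a ∉ A) (x : Vec) :
    x ∈ coneOf (insert a A) ↔ ∃ c : ℝ, 0 ≤ c ∧ x - c • a ∈ coneOf A := by
  classical
  constructor
  · rintro ⟨w, h1, h2⟩
    refine ⟨w a, h1 a (by simp), w, fun b hb => h1 b (by simp [hb]), ?_⟩
    rw [← h2, sum_insert ha]; simp
  · rintro ⟨c, hc, w, h1, h2⟩
    refine ⟨Function.update w a c, ?_, ?_⟩
    · intro b hb
      by_cases e : b = a
      · subst e; simpa using hc
      · simp only [mem_insert, e, false_or] at hb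
        simpa [e] using h1 b hb
    · rw [sum_insert ha]
      simp only [Function.update_self]
      rw [sum_congr rfl (g := fun b => w b • b), h2]
      · abel
      · intro b hb
        rw [Function.update_of_ne]; rintro rfl; exact ha hb

theorem hrep (W : Finset ℕ) (A : Finset Vec) (hA : ∀ a ∈ A, a.support ⊆ W) :
    ∃ Φ : Set (Vec →ₗ[ℝ] ℝ), Φ.Finite ∧ ∀ x : Vec, x.support ⊆ W → (x ∈ coneOf A ↔ ∀ φ ∈ Φ, 0 ≤ φ x) := by
  classical
  induction A using Finset.induction_on with
  | empty =>
    refine ⟨(fun i => (Finsupp.lapply i : Vec →ₗ[ℝ] ℝ)) '' (W : Set ℕ) ∪ (fun i => -(Finsupp.lapply i : Vec →ₗ[ℝ] ℝ)) '' (W : Set ℕ),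
      (W.finite_toSet.image _).union (W.finite_toSet.image _), fun x hx => ?_⟩
    have : x ∈ coneOf ∅ ↔ x = 0 := by simp [coneOf, eq_comm]
    rw [this]
    constructor
    · rintro rfl; simp
    · intro h
      ext i
      by_cases hi : i ∈ W
      · have h1 := h _ (Or.inl ⟨i, hi, rfl⟩)
        have h2 := h _ (Or.inr ⟨i, hi, rfl⟩)
        simp at h1 h2
        exact le_antisymm h2 h1
      · simpa using fun h' => hi (hx (Finsupp.mem_support_iff.2 h'))
  | insert a A ha ih =>
    obtain ⟨Φ, hf, hΦ⟩ := ih fun b hb => hA b (by simp [hb])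
    refine ⟨{φ ∈ Φ | 0 ≤ φ a} ∪ (fun q : (Vec →ₗ[ℝ] ℝ) × (Vec →ₗ[ℝ] ℝ) => (-(q.2 a)) • q.1 + (q.1 a) • q.2) '' ({φ ∈ Φ | 0 < φ a} ×ˢ {φ ∈ Φ | φ a < 0}),
      (hf.subset (Set.sep_subset _ _)).union (Set.Finite.image _ ((hf.subset (Set.sep_subset _ _)).prod (hf.subset (Set.sep_subset _ _)))), fun x hx => ?_⟩
    rw [coneOf_insert ha]
    have hsup : ∀ c : ℝ, (x - c • a).support ⊆ W := fun c =>
      (Finsupp.support_sub).trans (union_subset hx (Finsupp.support_smul.trans (hA a (by simp))))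
    have : (∃ c : ℝ, 0 ≤ c ∧ x - c • a ∈ coneOf A) ↔ ∃ c : ℝ, 0 ≤ c ∧ ∀ φ ∈ Φ, c * φ a ≤ φ x := by
      refine exists_congr fun c => and_congr_right fun _ => ?_
      rw [hΦ _ (hsup c)]
      refine forall₂_congr fun φ _ => ?_
      rw [map_sub, map_smul, smul_eq_mul, sub_nonneg]
    rw [this]
    constructor
    · rintro ⟨c, hc, h⟩ φ (hφ | ⟨⟨φ1, φ2⟩, ⟨⟨h1, h1'⟩, h2, h2'⟩, rfl⟩)
      · exact (mul_nonneg hc hφ.2).trans (h φ hφ.1)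
      · have e1 := h _ h1
        have e2 := h _ h2
        simp only at h1' h2' e1 e2
        simp only [LinearMap.add_apply, LinearMap.smul_apply, smul_eq_mul]
        nlinarith
    · intro h
      set N := insert (0:ℝ) ((hf.toFinset.filter fun φ => φ a < 0).image fun φ => φ x / φ a) with hN
      have hNe : N.Nonempty := ⟨0, by simp [hN]⟩
      refine ⟨N.max' hNe, N.le_max' 0 (by simp [hN]), fun φ hφ => ?_⟩
      rcases lt_trichotomy (φ a) 0 with h0 | h0 | h0
      · have : φ x / φ a ≤ N.max' hNe := N.le_max' _ (by
          rw [hN, mem_insert]; right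
          exact mem_image_of_mem _ (by simp [hφ, h0]))
        rwa [div_le_iff_of_neg h0] at this
      · rw [h0, mul_zero]; exact h φ (Or.inl ⟨hφ, h0.ge⟩)
      · have : N.max' hNe = 0 ∨ _ := mem_insert.1 (N.max'_mem hNe)
        rw [mem_image] at this
        rw [← le_div_iff₀ h0]
        rcases this with e | ⟨ψ, hψ, e⟩
        · rw [e]; exact div_nonneg (h φ (Or.inl ⟨hφ, h0.le⟩)) h0.le
        · rw [← e]
          simp only [mem_filter, Set.Finite.mem_toFinset] at hψ
          have := h _ (Or.inr ⟨(φ, ψ), ⟨⟨hφ, h0⟩, hψ.1, hψ.2⟩, rfl⟩)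
          simp only [LinearMap.add_apply, LinearMap.smul_apply, smul_eq_mul] at this
          rw [le_div_iff₀ h0, div_mul_eq_mul_div, div_le_iff_of_neg hψ.2]
          linarith

/-- points of a polytope in the mass-one hyperplane -/
theorem hrep_polytope (W : Finset ℕ) {P : Set Vec} (hP : Polytope P) (hPW : P ⊆ R (full W)) :
    ∃ Φ : Set (Vec →ₗ[ℝ] ℝ), Φ.Finite ∧ ∀ x ∈ R (full W), (x ∈ P ↔ ∀ φ ∈ Φ, 0 ≤ φ x) := by
  classical
  obtain ⟨A, hA, rfl⟩ := hP
  lift A to Finset Vec using hA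
  have hA1 : ∀ a ∈ A, a ∈ R (full W) := fun a ha => hPW (subset_convexHull _ _ ha)
  obtain ⟨Φ, hf, h⟩ := hrep W A fun a ha => (hA1 a ha).2.2
  refine ⟨Φ, hf, fun x hx => ?_⟩
  rw [← h x hx.2.2, Finset.mem_convexHull']
  constructor
  · rintro ⟨w, h1, h2, h3⟩; exact ⟨w, h1, h3⟩
  · rintro ⟨w, h1, h3⟩
    refine ⟨w, h1, ?_, h3⟩
    have := congrArg mass h3
    rw [hx.2.1, map_sum] at this
    rw [← this]
    refine sum_congr rfl fun a ha => ?_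
    rw [map_smul, (hA1 a ha).2.1, smul_eq_mul, mul_one]

/-! ### iterated edge starring -/

inductive ES (K : Set (Finset ℕ)) : Set (Finset ℕ) → (Vec →ₗ[ℝ] Vec) → Prop
  | refl : ES K K LinearMap.id
  | step {K1 r} (x y m : ℕ) (c : ℝ) : ES K K1 r → x ≠ y → {x, y} ∈ K1 → (∀ s ∈ K1, m ∉ s) → 0 < c → c < 1 →
      ES K (Star K1 {x, y} m) (r ∘ₗ sub m (c • dl x + (1 - c) • dl y))

theorem edge_pt {x y : ℕ} (h : x ≠ y) {c : ℝ} (h0 : 0 < c) (h1 : c < 1) :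
    c • dl x + (1 - c) • dl y ∈ R (full {x, y}) ∧ (c • dl x + (1 - c) • dl y).support = {x, y} := by
  have e : (c • dl x + (1 - c) • dl y).support = {x, y} := by
    ext i
    simp only [Finsupp.mem_support_iff, Finsupp.add_apply, Finsupp.smul_apply, dl_apply, smul_eq_mul, mem_insert, mem_singleton]
    have : (1 - c) ≠ 0 := by linarith
    by_cases hx : x = i
    · subst hx; simp [Ne.symm h, h0.ne']
    · by_cases hy : y = i
      · subst hy; simp [h, this]
      · simp [hx, hy, Ne.symm hx, Ne.symm hy]
  refine ⟨⟨fun i => ?_, by simp, e.le⟩, e⟩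
  simp only [Finsupp.add_apply, Finsupp.smul_apply, dl_apply, smul_eq_mul]
  have : 0 ≤ 1 - c := by linarith
  split_ifs <;> simp <;> linarith

theorem ES.cx {K K1 : Set (Finset ℕ)} {r} (hK : Cx K) (h : ES K K1 r) : Cx K1 := by
  induction h with
  | refl => exact hK
  | step x y m c _ _ _ _ _ _ ih => exact cx_star ih _ _

theorem ES.bij {K K1 : Set (Finset ℕ)} {r} (hK : Cx K) (h : ES K K1 r) : Set.BijOn r (R K1) (R K) := by
  induction h with
  | refl => exact Set.bijOn_id _
  | step x y m c h hxy he hm h0 h1 ih =>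
    rw [LinearMap.coe_comp]
    refine Set.BijOn.comp ih (star_bij (h.cx hK) hm ?_ (edge_pt hxy h0 h1).1 (edge_pt hxy h0 h1).2)
    exact hm _ he

theorem ES.vert {K K1 : Set (Finset ℕ)} {r} (h : ES K K1 r) {i : ℕ} (hi : {i} ∈ K) : {i} ∈ K1 ∧ r (dl i) = dl i := by
  induction h with
  | refl => exact ⟨hi, rfl⟩
  | step x y m c h hxy he hm h0 h1 ih =>
    have him : i ≠ m := fun e => hm _ ih.1 (by simp [e])
    refine ⟨⟨fun h => ?_, Or.inl ⟨by simpa using him.symm, ih.1⟩⟩, ?_⟩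
    · have h1 := h (mem_insert_self x _)
      have h2 := h (mem_insert_of_mem (mem_singleton_self y))
      rw [mem_singleton] at h1 h2
      exact hxy (h1.trans h2.symm)
    · rw [LinearMap.comp_apply, sub_dl_ne _ him, ih.2]

theorem ES.trans {K K1 K2 : Set (Finset ℕ)} {r r'} (h : ES K K1 r) (h' : ES K1 K2 r') : ES K K2 (r ∘ₗ r') := by
  induction h' with
  | refl => exact h
  | step x y m c _ hxy he hm h0 h1 ih => exact ES.step x y m c ih hxy he hm h0 h1

def NC (φ : Vec →ₗ[ℝ] ℝ) (K1 : Set (Finset ℕ)) (r : Vec →ₗ[ℝ] Vec) : Prop :=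
  ∀ x y, {x, y} ∈ K1 → 0 ≤ φ (r (dl x)) * φ (r (dl y))

theorem star_pair {K : Set (Finset ℕ)} (hK : Cx K) {x y m a b : ℕ} (h : {a, b} ∈ Star K {x, y} m) :
    (a ≠ m ∧ b ≠ m ∧ {a, b} ∈ K ∧ ¬ (a = x ∧ b = y)) ∨ (a = m ∧ b = m) ∨
      (a = m ∧ b ≠ m ∧ {x, b} ∈ K ∧ {y, b} ∈ K) ∨ (b = m ∧ a ≠ m ∧ {x, a} ∈ K ∧ {y, a} ∈ K) := by
  by_cases ha : a = m <;> by_cases hb : b = m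
  · right; left; exact ⟨ha, hb⟩
  · right; right; left
    rcases h.2 with h' | h'
    · exact absurd ha (by have := h'.1; simp at this; tauto)
    · exact ⟨ha, hb, hK.2 _ h'.2 _ (by grind), hK.2 _ h'.2 _ (by grind)⟩
  · right; right; right
    rcases h.2 with h' | h'
    · exact absurd hb (by have := h'.1; simp at this; tauto)
    · exact ⟨hb, ha, hK.2 _ h'.2 _ (by grind), hK.2 _ h'.2 _ (by grind)⟩
  · left
    rcases h.2 with h' | h'
    · refine ⟨ha, hb, h'.2, ?_⟩
      rintro ⟨rfl, rfl⟩
      exact h.1 le_rfl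
    · have := h'.1; simp at this; tauto

theorem NC.star {φ : Vec →ₗ[ℝ] ℝ} {K1 : Set (Finset ℕ)} {r : Vec →ₗ[ℝ] Vec} (hK : Cx K1) (h : NC φ K1 r) {x y m : ℕ} {c : ℝ}
    (h0 : 0 < c) (h1 : c < 1) : NC φ (Star K1 {x, y} m) (r ∘ₗ sub m (c • dl x + (1 - c) • dl y)) := by
  have key : ∀ b, {x, b} ∈ K1 → {y, b} ∈ K1 →
      0 ≤ φ (r (c • dl x + (1 - c) • dl y)) * φ (r (dl b)) := by
    intro b hx hy
    have e1 := h _ _ hx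
    have e2 := h _ _ hy
    simp only [map_add, map_smul, smul_eq_mul]
    nlinarith [mul_nonneg h0.le e1, mul_nonneg (by linarith : 0 ≤ 1 - c) e2]
  intro a b hab
  simp only [LinearMap.comp_apply]
  rcases star_pair hK hab with ⟨ha, hb, hab, _⟩ | ⟨rfl, rfl⟩ | ⟨rfl, hb, h2, h3⟩ | ⟨rfl, hb, h2, h3⟩
  · rw [sub_dl_ne _ ha, sub_dl_ne _ hb]; exact h _ _ hab
  · exact mul_self_nonneg _
  · rw [sub_dl_self, sub_dl_ne _ hb]; exact key _ h2 h3
  · rw [sub_dl_self, sub_dl_ne _ hb, mul_comm]; exact key _ h2 h3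

theorem exists_NC1 (K : Set (Finset ℕ)) (hK : Cx K) (φ : Vec →ₗ[ℝ] ℝ) : ∀ (n : ℕ) K1 r, ES K K1 r →
    {p : ℕ × ℕ | {p.1, p.2} ∈ K1 ∧ φ (r (dl p.1)) * φ (r (dl p.2)) < 0}.ncard ≤ n →
    ∃ K2 r', ES K K2 r' ∧ NC φ K2 r' ∧ ∀ ψ, NC ψ K1 r → NC ψ K2 r' := by
  intro n
  have hfin : ∀ K1 : Set (Finset ℕ), ∀ r : Vec →ₗ[ℝ] Vec, Cx K1 → {p : ℕ × ℕ | {p.1, p.2} ∈ K1 ∧ φ (r (dl p.1)) * φ (r (dl p.2)) < 0}.Finite := by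
    intro K1 r h1
    have : {i : ℕ | {i} ∈ K1}.Finite :=
      Set.Finite.of_finite_image (f := fun i : ℕ => ({i} : Finset ℕ)) (h1.1.subset (by rintro _ ⟨i, hi, rfl⟩; exact hi))
        (fun a _ b _ e => by simpa using e)
    refine (this.prod this).subset ?_
    rintro ⟨a, b⟩ ⟨h, -⟩
    exact ⟨h1.2 _ h _ (by simp), h1.2 _ h _ (by simp)⟩
  induction n with
  | zero =>
    intro K1 r h hc
    refine ⟨K1, r, h, ?_, fun _ h => h⟩
    intro x y hxy
    by_contra hneg
    push Not at hneg
    rw [Nat.le_zero, Set.ncard_eq_zero (hfin _ _ (h.cx hK))] at hc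
    have : (x, y) ∈ (∅ : Set (ℕ × ℕ)) := by rw [← hc]; exact ⟨hxy, hneg⟩
    exact this
  | succ n ih =>
    intro K1 r h hc
    by_cases hnc : NC φ K1 r
    · exact ⟨K1, r, h, hnc, fun _ h => h⟩
    unfold NC at hnc
    push Not at hnc
    obtain ⟨x, y, he, hlt⟩ := hnc
    have hxy : x ≠ y := by rintro rfl; exact absurd hlt (not_lt.2 (mul_self_nonneg _))
    obtain ⟨m, hm, -⟩ := exists_fresh (h.cx hK).1 ∅
    set a := φ (r (dl x)) with ha
    set b := φ (r (dl y)) with hb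
    have hab : a - b ≠ 0 := by
      intro e
      have : a = b := by linarith
      rw [this] at hlt; nlinarith [mul_self_nonneg b]
    -- zero point
    obtain ⟨c, h0, h1, hz⟩ : ∃ c : ℝ, 0 < c ∧ c < 1 ∧ c * a + (1 - c) * b = 0 := by
      refine ⟨-b / (a - b), ?_, ?_, by field_simp; ring⟩
      · rcases lt_trichotomy b 0 with h | h | h
        · have : 0 < a := by nlinarith
          exact div_pos (by linarith) (by linarith)
        · rw [h] at hlt; simp at hlt
        · have : a < 0 := by nlinarith
          exact div_pos_of_neg_of_neg (by linarith) (by linarith)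
      · rcases lt_trichotomy b 0 with h | h | h
        · have : 0 < a := by nlinarith
          rw [div_lt_one (by linarith)]; linarith
        · rw [h] at hlt; simp at hlt
        · have : a < 0 := by nlinarith
          rw [div_lt_one_of_neg (by linarith)]; linarith
    have hES := ES.step x y m c h hxy he hm h0 h1
    have hmz : φ ((r ∘ₗ sub m (c • dl x + (1 - c) • dl y)) (dl m)) = 0 := by
      rw [LinearMap.comp_apply, sub_dl_self]; simp only [map_add, map_smul, smul_eq_mul]; exact hz
    have hss : {p : ℕ × ℕ | {p.1, p.2} ∈ Star K1 {x, y} m ∧ φ ((r ∘ₗ sub m (c • dl x + (1 - c) • dl y)) (dl p.1)) * φ ((r ∘ₗ sub m (c • dl x + (1 - c) • dl y)) (dl p.2)) < 0}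
        ⊂ {p : ℕ × ℕ | {p.1, p.2} ∈ K1 ∧ φ (r (dl p.1)) * φ (r (dl p.2)) < 0} := by
      refine (Set.ssubset_iff_of_subset ?_).2 ⟨(x, y), ⟨he, hlt⟩, ?_⟩
      · rintro ⟨p, q⟩ ⟨h1, h2⟩
        simp only at h1 h2
        rcases star_pair (h.cx hK) h1 with ⟨ha, hb, hab, _⟩ | ⟨rfl, rfl⟩ | ⟨rfl, hb, h3, h4⟩ | ⟨rfl, hb, h3, h4⟩
        · refine ⟨hab, ?_⟩
          rwa [LinearMap.comp_apply, LinearMap.comp_apply, sub_dl_ne _ ha, sub_dl_ne _ hb] at h2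
        · rw [hmz] at h2; simp at h2
        · rw [hmz] at h2; simp at h2
        · rw [hmz] at h2; simp at h2
      · rintro ⟨h1, -⟩
        exact h1.1 le_rfl
    have := Set.ncard_lt_ncard hss (hfin _ _ (h.cx hK))
    obtain ⟨K2, r', h2, h3, h4⟩ := ih _ _ hES (by omega)
    exact ⟨K2, r', h2, h3, fun ψ hψ => h4 ψ (hψ.star (h.cx hK) h0 h1)⟩

theorem exists_NC {K : Set (Finset ℕ)} (hK : Cx K) {Φ : Set (Vec →ₗ[ℝ] ℝ)} (hΦ : Φ.Finite) :
    ∃ K1 r, ES K K1 r ∧ ∀ φ ∈ Φ, NC φ K1 r := by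
  induction Φ, hΦ using Set.Finite.induction_on with
  | empty => exact ⟨K, _, ES.refl, by simp⟩
  | @insert φ Φ _ _ ih =>
    obtain ⟨K1, r, h1, h2⟩ := ih
    obtain ⟨K2, r', h3, h4, h5⟩ := exists_NC1 K hK φ _ K1 r h1 le_rfl
    refine ⟨K2, r', h3, ?_⟩
    rintro ψ (rfl | hψ)
    · exact h4
    · exact h5 ψ (h2 ψ hψ)

/-- Linear refinement: `g` is a linear bijection, each simplex goes into a simplex -/
structure Ref (K1 L : Set (Finset ℕ)) (g : Vec →ₗ[ℝ] Vec) : Prop where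
  bij : Set.BijOn g (R K1) (R L)
  simp : ∀ s ∈ K1, s.Nonempty → ∃ t ∈ L, ∀ v ∈ s, (g (dl v)).support ⊆ t

theorem theoremR {K L : Set (Finset ℕ)} (hK : Cx K) (hL : Cx L) {f : Vec → Vec} (hf : PLeq f (R K) (R L)) :
    ∃ (K1 : Set (Finset ℕ)) (r g : Vec →ₗ[ℝ] Vec), ES K K1 r ∧ Set.EqOn (fun x => f (r x)) g (R K1) ∧ Ref K1 L g := by
  classical
  obtain ⟨S, hS, hSp, hSe⟩ := hf.1
  -- the finite family of pieces
  let J : Set (Set (Vec × Vec) × Finset ℕ × Finset ℕ) := S ×ˢ (K ×ˢ L)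
  have hJ : J.Finite := hS.prod (hK.1.prod hL.1)
  let P : Set (Vec × Vec) × Finset ℕ × Finset ℕ → Set (Vec × Vec) := fun j => j.1 ∩ (R (full j.2.1) ×ˢ R (full j.2.2))
  have hP : ∀ j ∈ J, Polytope (P j) := fun j hj =>
    (hSp _ hj.1).inter ((polytope_full _).prod (polytope_full _))
  have hPs : ∀ j ∈ J, P j ⊆ gr f (R K) := fun j hj x hx => by
    rw [hSe]; exact ⟨_, hj.1, hx.1⟩
  let W : Finset ℕ := hK.1.toFinset.sup id
  have hW : ∀ s ∈ K, s ⊆ W := fun s hs => le_sup (f := id) (by simpa using hs)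
  have hRW : R K ⊆ R (full W) := R_mono fun s hs => hW s hs
  have hex : ∀ j : Set (Vec × Vec) × Finset ℕ × Finset ℕ, ∃ Φ : Set (Vec →ₗ[ℝ] ℝ), Φ.Finite ∧ (j ∈ J → ∀ x ∈ R (full W), (x ∈ Prod.fst '' P j ↔ ∀ φ ∈ Φ, 0 ≤ φ x)) := by
    intro j
    by_cases hj : j ∈ J
    · obtain ⟨Φ, h1, h2⟩ := hrep_polytope W ((hP j hj).image (LinearMap.fst ℝ Vec Vec)) (by
        rintro _ ⟨x, hx, rfl⟩
        exact R_mono (fun t ht => (show t ⊆ W from ht.trans (hW _ hj.2.1))) hx.2.1)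
      exact ⟨Φ, h1, fun _ => h2⟩
    · exact ⟨∅, Set.finite_empty, fun h => absurd h hj⟩
  choose Φ hΦ1 hΦ2 using hex
  obtain ⟨K1, r, hES, hNC⟩ := exists_NC hK (hJ.biUnion fun j _ => hΦ1 j)
  have hbij := hES.bij hK
  have hcx := hES.cx hK
  have key : ∀ s ∈ K1, s.Nonempty → ∃ j ∈ J, ∀ v ∈ s, (r (dl v), f (r (dl v))) ∈ P j := by
    intro s hs hne
    set n : ℝ := (s.card : ℝ) with hn
    have hnpos : 0 < n := by rw [hn]; exact_mod_cast hne.card_pos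
    let bary : Vec := ∑ v ∈ s, n⁻¹ • dl v
    have hvR : ∀ v ∈ s, dl v ∈ R K1 := fun v hv => dl_mem.2 (hcx.2 s hs _ (by simpa using hv))
    have hbR : bary ∈ R K1 := by
      refine R_mono (fun t ht => hcx.2 s hs t ht) ?_
      refine (convex_full s).sum_mem (fun _ _ => by positivity) ?_ fun v hv => dl_mem.2 (by simpa [full] using hv)
      rw [sum_const, nsmul_eq_mul, ← hn]; field_simp
    have hrb := hbij.mapsTo hbR
    have hgr : (r bary, f (r bary)) ∈ gr f (R K) := ⟨_, hrb, rfl⟩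
    have hgr' := hgr
    rw [hSe] at hgr'
    obtain ⟨Q, hQS, hQ⟩ := hgr'
    have hfb := hf.2.mapsTo hrb
    have hj : (Q, (r bary).support, (f (r bary)).support) ∈ J := ⟨hQS, hrb.2.2, hfb.2.2⟩
    refine ⟨_, hj, fun v hv => ?_⟩
    have hb : r bary ∈ Prod.fst '' P (Q, (r bary).support, (f (r bary)).support) :=
      ⟨_, ⟨hQ, ⟨hrb.1, hrb.2.1, fun _ h => h⟩, ⟨hfb.1, hfb.2.1, fun _ h => h⟩⟩, rfl⟩
    rw [hΦ2 _ hj _ (hRW hrb)] at hb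
    have hv' : r (dl v) ∈ Prod.fst '' P (Q, (r bary).support, (f (r bary)).support) := by
      rw [hΦ2 _ hj _ (hRW (hbij.mapsTo (hvR v hv)))]
      intro φ hφ
      have hbφ := hb φ hφ
      by_contra hneg
      push Not at hneg
      have hnc := hNC φ (by simp only [Set.mem_iUnion]; exact ⟨_, hj, hφ⟩)
      have : φ (r bary) < 0 := by
        simp only [bary, map_sum, map_smul, smul_eq_mul]
        apply sum_neg' 
        · intro u hu
          have := hnc u v (hcx.2 s hs _ (by intro z; simp; rintro (rfl | rfl) <;> assumption))
          have : φ (r (dl u)) ≤ 0 := by nlinarith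
          exact mul_nonpos_of_nonneg_of_nonpos (by positivity) this
        · exact ⟨v, hv, mul_neg_of_pos_of_neg (by positivity) hneg⟩
      linarith
    obtain ⟨⟨a, b⟩, hab, e⟩ := hv'
    simp only at e
    subst e
    obtain ⟨z, hz, e⟩ := hPs _ hj hab
    simp only [Prod.mk.injEq] at e
    rw [← e.1, e.2, e.1]
    exact hab
  refine ⟨K1, r, Finsupp.linearCombination ℝ (fun v => f (r (dl v))), hES, ?_, ?_, ?_⟩
  · intro w hw
    have hne : w.support.Nonempty := Finsupp.support_nonempty_iff.2 (ne_zero_R hw)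
    obtain ⟨j, hj, h⟩ := key _ hw.2.2 hne
    have hm : ∑ v ∈ w.support, w v • (r (dl v), f (r (dl v))) ∈ P j :=
      (hP j hj).convex.sum_mem (fun i _ => hw.1 i) (by rw [← mass_eq le_rfl]; exact hw.2.1) h
    obtain ⟨z, hz, e⟩ := hPs _ hj hm
    have e1 := congrArg Prod.fst e
    have e2 := congrArg Prod.snd e
    simp only [Prod.fst_sum, Prod.snd_sum, Prod.smul_fst, Prod.smul_snd] at e1 e2
    rw [← lin_sum r le_rfl] at e1
    simp only
    rw [← e1, e2, Finsupp.linearCombination_apply, Finsupp.sum]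
  · have hc : Set.BijOn (fun x => f (r x)) (R K1) (R L) := hf.2.comp hbij
    refine hc.congr ?_
    intro w hw
    have hne : w.support.Nonempty := Finsupp.support_nonempty_iff.2 (ne_zero_R hw)
    obtain ⟨j, hj, h⟩ := key _ hw.2.2 hne
    have hm : ∑ v ∈ w.support, w v • (r (dl v), f (r (dl v))) ∈ P j :=
      (hP j hj).convex.sum_mem (fun i _ => hw.1 i) (by rw [← mass_eq le_rfl]; exact hw.2.1) h
    obtain ⟨z, hz, e⟩ := hPs _ hj hm
    have e1 := congrArg Prod.fst e
    have e2 := congrArg Prod.snd e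
    simp only [Prod.fst_sum, Prod.snd_sum, Prod.smul_fst, Prod.smul_snd] at e1 e2
    rw [← lin_sum r le_rfl] at e1
    simp only
    rw [← e1, e2, Finsupp.linearCombination_apply, Finsupp.sum]
  · intro s hs hne
    obtain ⟨j, hj, h⟩ := key s hs hne
    refine ⟨j.2.2, hj.2.2, fun v hv => ?_⟩
    simp only [dl, Finsupp.linearCombination_single, one_smul]
    exact (h v hv).2.2.2.2

end PL
end HomologySpheres

end

open Finset
noncomputable section
namespace HomologySpheres
namespace PL

def prI (A : Finset ℕ) (w : Vec) : Vec := w.filter (· ∈ A)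
def prO (A : Finset ℕ) (w : Vec) : Vec := w.filter (· ∉ A)

theorem prI_add_prO (A : Finset ℕ) (w : Vec) : prI A w + prO A w = w := Finsupp.filter_add_filter_not _ _
theorem prI_apply (A : Finset ℕ) (w : Vec) (i : ℕ) : prI A w i = if i ∈ A then w i else 0 := Finsupp.filter_apply _ _ _
theorem prO_apply (A : Finset ℕ) (w : Vec) (i : ℕ) : prO A w i = if i ∈ A then 0 else w i := by
  rw [prO, Finsupp.filter_apply]; split_ifs <;> simp_all
theorem supp_prI (A : Finset ℕ) (w : Vec) : (prI A w).support = w.support ∩ A := by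
  ext i; simp [prI_apply]; tauto
theorem supp_prO (A : Finset ℕ) (w : Vec) : (prO A w).support = w.support \ A := by
  ext i; simp [prO_apply]; tauto

/-- outer mass -/
def om (A : Finset ℕ) (w : Vec) : ℝ := mass (prO A w)

/-- join of a full simplex `A` with `X` -/
def jn (A : Finset ℕ) (X : Set (Finset ℕ)) : Set (Finset ℕ) := {s | s \ A ∈ X}

theorem cx_jn {A : Finset ℕ} {X : Set (Finset ℕ)} (hX : Cx X) : Cx (jn A X) := by
  constructor
  · refine (((cx_full A).1.prod hX.1).image (fun q => q.1 ∪ q.2)).subset ?_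
    intro s hs
    exact ⟨(s ∩ A, s \ A), ⟨inter_subset_right, hs⟩, by ext i; simp; tauto⟩
  · intro s hs t ht
    exact hX.2 _ hs _ (sdiff_subset_sdiff ht le_rfl)

/-- extend `f` over the join with `A` -/
def jmap (A : Finset ℕ) (f : Vec → Vec) (w : Vec) : Vec := prI A w + om A w • f ((om A w)⁻¹ • prO A w)

def Av (A : Finset ℕ) (X : Set (Finset ℕ)) : Prop := ∀ s ∈ X, Disjoint s A

theorem mass_nonneg {w : Vec} (h : ∀ i, 0 ≤ w i) : 0 ≤ mass w := by
  rw [mass_eq le_rfl]; exact sum_nonneg fun i _ => h i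
theorem mass_eq_zero {w : Vec} (h : ∀ i, 0 ≤ w i) (h0 : mass w = 0) : w = 0 := by
  rw [mass_eq le_rfl, sum_eq_zero_iff_of_nonneg fun i _ => h i] at h0
  ext i
  by_cases hi : i ∈ w.support
  · exact h0 i hi
  · simpa using hi

theorem prO_nonneg {A : Finset ℕ} {w : Vec} (h : ∀ i, 0 ≤ w i) (i : ℕ) : 0 ≤ prO A w i := by
  rw [prO_apply]; split_ifs; exacts [le_rfl, h i]

theorem om_nonneg {A : Finset ℕ} {w : Vec} (h : ∀ i, 0 ≤ w i) : 0 ≤ om A w := mass_nonneg (prO_nonneg h)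

theorem om_zero {A : Finset ℕ} {w : Vec} (h : ∀ i, 0 ≤ w i) (h0 : om A w = 0) : prO A w = 0 ∧ prI A w = w := by
  have := mass_eq_zero (prO_nonneg h) h0
  refine ⟨this, ?_⟩
  have h1 := prI_add_prO A w
  rwa [this, add_zero] at h1

theorem norm_mem {A : Finset ℕ} {w : Vec} (h : ∀ i, 0 ≤ w i) (h0 : om A w ≠ 0) {X : Set (Finset ℕ)} (hX : w.support \ A ∈ X) :
    (om A w)⁻¹ • prO A w ∈ R X ∧ ((om A w)⁻¹ • prO A w).support = w.support \ A := by
  have hs : ((om A w)⁻¹ • prO A w).support = w.support \ A := by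
    rw [Finsupp.support_smul_eq (inv_ne_zero h0), supp_prO]
  refine ⟨⟨fun i => ?_, ?_, by rwa [hs]⟩, hs⟩
  · exact mul_nonneg (inv_nonneg.2 (om_nonneg h)) (prO_nonneg h i)
  · rw [map_smul, smul_eq_mul]; exact inv_mul_cancel₀ h0

theorem jmap_zero {A : Finset ℕ} {f : Vec → Vec} {w : Vec} (h : ∀ i, 0 ≤ w i) (h0 : om A w = 0) : jmap A f w = w := by
  rw [jmap, h0, zero_smul, add_zero, (om_zero h h0).2]

theorem prI_jmap {A : Finset ℕ} {f : Vec → Vec} {w : Vec} (h : om A w ≠ 0 → Disjoint (f ((om A w)⁻¹ • prO A w)).support A) :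
    prI A (jmap A f w) = prI A w := by
  ext i
  rw [prI_apply, prI_apply]
  split_ifs with hi
  · rw [jmap, Finsupp.add_apply, prI_apply, if_pos hi, Finsupp.smul_apply]
    by_cases h0 : om A w = 0
    · simp [h0]
    · have : (f ((om A w)⁻¹ • prO A w)) i = 0 := by
        rw [← Finsupp.notMem_support_iff]; exact fun h' => disjoint_left.1 (h h0) h' hi
      rw [this]; simp
  · rfl

theorem prO_jmap {A : Finset ℕ} {f : Vec → Vec} {w : Vec} (h : om A w ≠ 0 → Disjoint (f ((om A w)⁻¹ • prO A w)).support A) :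
    prO A (jmap A f w) = om A w • f ((om A w)⁻¹ • prO A w) := by
  have h1 := prI_add_prO A (jmap A f w)
  rw [prI_jmap h] at h1
  conv_rhs at h1 => rw [jmap]
  exact add_left_cancel h1

section
variable {A : Finset ℕ} {X Y : Set (Finset ℕ)} {f : Vec → Vec}

theorem jmap_disj (hf : Set.MapsTo f (R X) (R Y)) (hY : Av A Y) {w : Vec} (hw : w ∈ R (jn A X)) :
    om A w ≠ 0 → Disjoint (f ((om A w)⁻¹ • prO A w)).support A := fun h0 =>
  hY _ (hf (norm_mem hw.1 h0 hw.2.2).1).2.2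

theorem om_jmap (hf : Set.MapsTo f (R X) (R Y)) (hY : Av A Y) {w : Vec} (hw : w ∈ R (jn A X)) : om A (jmap A f w) = om A w := by
  conv_lhs => rw [om]
  rw [prO_jmap (jmap_disj hf hY hw), map_smul, smul_eq_mul]
  by_cases h0 : om A w = 0
  · simp [h0]
  · rw [(hf (norm_mem hw.1 h0 hw.2.2).1).2.1, mul_one]

theorem supp_jmap (hf : Set.MapsTo f (R X) (R Y)) (hY : Av A Y) {w : Vec} (hw : w ∈ R (jn A X)) (h0 : om A w ≠ 0) :
    (jmap A f w).support = (w.support ∩ A) ∪ (f ((om A w)⁻¹ • prO A w)).support := by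
  have h1 : (jmap A f w).support = (prI A (jmap A f w)).support ∪ (prO A (jmap A f w)).support := by
    rw [supp_prI, supp_prO]; ext i; simp; tauto
  rw [h1, prI_jmap (jmap_disj hf hY hw), prO_jmap (jmap_disj hf hY hw), supp_prI, Finsupp.support_smul_eq h0]

theorem jmap_mem (hf : Set.MapsTo f (R X) (R Y)) (hY : Av A Y) (hY0 : ∅ ∈ Y) {w : Vec} (hw : w ∈ R (jn A X)) :
    jmap A f w ∈ R (jn A Y) := by
  by_cases h0 : om A w = 0
  · rw [jmap_zero hw.1 h0]
    refine ⟨hw.1, hw.2.1, ?_⟩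
    have : w.support \ A = ∅ := by rw [← supp_prO, (om_zero hw.1 h0).1]; simp
    show w.support \ A ∈ Y
    rw [this]; exact hY0
  · have hn := hf (norm_mem hw.1 h0 hw.2.2).1
    refine ⟨fun i => ?_, ?_, ?_⟩
    · rw [jmap, Finsupp.add_apply, Finsupp.smul_apply, prI_apply]
      have := mul_nonneg (om_nonneg (A := A) hw.1) (hn.1 i)
      have := hw.1 i
      rw [smul_eq_mul]
      split_ifs <;> linarith
    · rw [jmap, map_add, map_smul, hn.2.1, smul_eq_mul, mul_one]
      have := congrArg mass (prI_add_prO A w)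
      rw [map_add, hw.2.1] at this
      exact this
    · rw [supp_jmap hf hY hw h0]
      show _ ∈ Y
      have : ((w.support ∩ A) ∪ (f ((om A w)⁻¹ • prO A w)).support) \ A = (f ((om A w)⁻¹ • prO A w)).support := by
        have := hY _ hn.2.2
        rw [disjoint_left] at this
        ext i; simp only [mem_sdiff, mem_union, mem_inter]; have := @this i; tauto
      rw [this]; exact hn.2.2

theorem jmap_inv {g : Vec → Vec} (hf : Set.MapsTo f (R X) (R Y)) (hY : Av A Y) (hg : Set.LeftInvOn g f (R X)) {w : Vec} (hw : w ∈ R (jn A X)) :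
    jmap A g (jmap A f w) = w := by
  by_cases h0 : om A w = 0
  · rw [jmap_zero hw.1 h0, jmap_zero hw.1 h0]
  · conv_lhs => rw [jmap]
    rw [om_jmap hf hY hw, prI_jmap (jmap_disj hf hY hw), prO_jmap (jmap_disj hf hY hw), smul_smul, inv_mul_cancel₀ h0, one_smul,
      hg (norm_mem hw.1 h0 hw.2.2).1, smul_smul, mul_inv_cancel₀ h0, one_smul, prI_add_prO]

/-- value of `jmap` on an explicit combination -/
theorem jmap_combo {a x : Vec} (ha : a.support ⊆ A) (hx : Disjoint x.support A) {t : ℝ} (ht : t ≠ 0) (hm : mass x = 1) {s : ℝ} :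
    jmap A f (s • a + t • x) = s • a + t • f x := by
  have h1 : prI A (s • a + t • x) = s • a := by
    ext i; rw [prI_apply]
    split_ifs with hi
    · have : x i = 0 := by rw [← Finsupp.notMem_support_iff]; exact fun h => disjoint_left.1 hx h hi
      simp [this]
    · have : a i = 0 := by rw [← Finsupp.notMem_support_iff]; exact fun h => hi (ha h)
      simp [this]
  have h2 : prO A (s • a + t • x) = t • x := by
    have := prI_add_prO A (s • a + t • x)
    rw [h1] at this
    exact add_left_cancel this
  have h3 : om A (s • a + t • x) = t := by rw [om, h2, map_smul, hm, smul_eq_mul, mul_one]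
  rw [jmap, h1, h2, h3, smul_smul, inv_mul_cancel₀ ht, one_smul]

theorem jmap_of_out {x : Vec} (hx : Disjoint x.support A) (hm : mass x = 1) : jmap A f x = f x := by
  have := jmap_combo (A := A) (f := f) (a := 0) (by simp) hx one_ne_zero hm (s := 0)
  simpa using this

theorem jmap_pl (hX : Cx X) (hXA : Av A X) (hX0 : ∅ ∈ X) (hf : PLf f (R X)) : PLf (jmap A f) (R (jn A X)) := by
  have hid : PLf (fun x : Vec => x) (R (full A)) := PLf.idm (poly_R (cx_full A))
  have : gr (jmap A f) (R (jn A X)) = gr (fun x => x) (R (full A)) ∪ gr f (R X) ∪ convexJoin ℝ (gr (fun x => x) (R (full A))) (gr f (R X)) := by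
    ext ⟨p, q⟩
    constructor
    · rintro ⟨w, hw, e⟩
      simp only [Prod.mk.injEq] at e
      obtain ⟨rfl, rfl⟩ := e
      by_cases h0 : om A w = 0
      · left; left
        refine ⟨w, ⟨hw.1, hw.2.1, ?_⟩, by rw [jmap_zero hw.1 h0]⟩
        rw [← (om_zero hw.1 h0).2, supp_prI]; exact inter_subset_right
      have hn := (norm_mem hw.1 h0 hw.2.2).1
      set x := (om A w)⁻¹ • prO A w with hx
      have hox : om A w • x = prO A w := by rw [hx, smul_smul, mul_inv_cancel₀ h0, one_smul]
      have hmass : mass (prI A w) + om A w = 1 := by rw [← hw.2.1, om, ← map_add, prI_add_prO]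
      by_cases h1 : om A w = 1
      · left; right
        have : prI A w = 0 := by
          apply mass_eq_zero
          · intro i; rw [prI_apply]; split_ifs; exacts [hw.1 i, le_rfl]
          · linarith
        have hxw : x = w := by
          rw [h1, one_smul] at hox
          rw [hox]; have := prI_add_prO A w; rwa [‹prI A w = 0›, zero_add] at this
        refine ⟨w, hxw ▸ hn, ?_⟩
        rw [jmap, this, h1, ← h1, ← hx, hxw, h1]; simp
      · right
        have hlt : 0 < 1 - om A w := by
          have : 0 ≤ mass (prI A w) := mass_nonneg fun i => by rw [prI_apply]; split_ifs; exacts [hw.1 i, le_rfl]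
          rcases lt_or_eq_of_le (show om A w ≤ 1 by linarith) with h | h
          · linarith
          · exact absurd h h1
        rw [mem_convexJoin]
        have ha : (1 - om A w)⁻¹ • prI A w ∈ R (full A) := by
          refine ⟨fun i => ?_, ?_, ?_⟩
          · rw [Finsupp.smul_apply, prI_apply]; refine mul_nonneg (by positivity) ?_; split_ifs; exacts [hw.1 i, le_rfl]
          · rw [map_smul, smul_eq_mul, show mass (prI A w) = 1 - om A w by linarith, inv_mul_cancel₀ hlt.ne']
          · refine Finsupp.support_smul.trans ?_
            rw [supp_prI]; exact inter_subset_right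
        refine ⟨_, ⟨_, ha, rfl⟩, _, ⟨x, hn, rfl⟩, 1 - om A w, om A w, hlt.le, om_nonneg hw.1, by ring, ?_⟩
        simp only [Prod.smul_mk, Prod.mk_add_mk, smul_smul, mul_inv_cancel₀ hlt.ne', one_smul, hox, prI_add_prO, Prod.mk.injEq, true_and]
        rw [jmap]
    · rintro ((⟨w, hw, e⟩ | ⟨w, hw, e⟩) | h)
      · simp only [Prod.mk.injEq] at e
        obtain ⟨rfl, rfl⟩ := e
        refine ⟨w, ⟨hw.1, hw.2.1, ?_⟩, ?_⟩
        · show w.support \ A ∈ X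
          rw [sdiff_eq_empty_iff_subset.2 hw.2.2]; exact hX0
        · have : om A w = 0 := by
            rw [om]
            have : prO A w = 0 := by
              rw [← Finsupp.support_eq_empty, supp_prO]; exact sdiff_eq_empty_iff_subset.2 hw.2.2
            rw [this, map_zero]
          beta_reduce; rw [jmap_zero hw.1 this]
      · simp only [Prod.mk.injEq] at e
        obtain ⟨rfl, rfl⟩ := e
        refine ⟨w, ⟨hw.1, hw.2.1, ?_⟩, ?_⟩
        · show w.support \ A ∈ X
          rw [sdiff_eq_self_of_disjoint (hXA _ hw.2.2)]; exact hw.2.2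
        · beta_reduce; rw [jmap_of_out (hXA _ hw.2.2) hw.2.1]
      · rw [mem_convexJoin] at h
        obtain ⟨_, ⟨a, ha, rfl⟩, _, ⟨x, hx, rfl⟩, s, t, hs, ht, hst, e⟩ := h
        simp only [Prod.smul_mk, Prod.mk_add_mk, Prod.mk.injEq] at e
        obtain ⟨rfl, rfl⟩ := e
        have hR : s • a + t • x ∈ R (jn A X) := by
          refine ⟨fun i => ?_, by simp [ha.2.1, hx.2.1, hst], ?_⟩
          · have := ha.1 i; have := hx.1 i
            simp only [Finsupp.add_apply, Finsupp.smul_apply, smul_eq_mul]; positivity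
          · refine hX.2 _ hx.2.2 _ fun i hi => ?_
            rw [mem_sdiff] at hi
            have := Finsupp.support_add hi.1
            rw [mem_union] at this
            rcases this with h | h
            · exact absurd (ha.2.2 (Finsupp.support_smul h)) hi.2
            · exact Finsupp.support_smul h
        refine ⟨_, hR, ?_⟩
        rcases ht.eq_or_lt with h | h
        · subst h
          rw [add_zero] at hst
          subst hst
          have : om A ((1:ℝ) • a + (0:ℝ) • x) = 0 := by
            have : prO A ((1:ℝ) • a + (0:ℝ) • x) = 0 := by
              rw [← Finsupp.support_eq_empty, supp_prO]; simp only [one_smul, zero_smul, add_zero]; exact sdiff_eq_empty_iff_subset.2 ha.2.2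
            rw [om, this, map_zero]
          beta_reduce; rw [jmap_zero hR.1 this]; simp
        · beta_reduce; rw [jmap_combo ha.2.2 (hXA _ hx.2.2) h.ne' hx.2.1]
  rw [PLf, this]
  exact (Poly.union hid hf).union (Poly.cjoin hid hf)

/-- The general join lemma, for subcomplexes. -/
theorem jmap_eq (hX : Cx X) (hXA : Av A X) (hX0 : ∅ ∈ X) (hYA : Av A Y) (hY0 : ∅ ∈ Y) (hf : PLeq f (R X) (R Y))
    {Q Q' : Set (Finset ℕ)} (hQ : Cx Q) (hQX : Q ⊆ jn A X) (hQY : Q' ⊆ jn A Y)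
    (h0 : ∀ a ⊆ A, a ∈ Q ↔ a ∈ Q') (h1 : ∀ a ⊆ A, ∀ x ∈ R X, a ∪ x.support ∈ Q ↔ a ∪ (f x).support ∈ Q') :
    PLeq (jmap A f) (R Q) (R Q') := by
  obtain ⟨g, hg, hgf, hfg⟩ := hf.symm
  have key : ∀ w ∈ R (jn A X), w ∈ R Q ↔ jmap A f w ∈ R Q' := by
    intro w hw
    have hm := jmap_mem hf.2.mapsTo hYA hY0 hw
    have e1 : w ∈ R Q ↔ w.support ∈ Q := ⟨fun h => h.2.2, fun h => ⟨hw.1, hw.2.1, h⟩⟩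
    have e2 : jmap A f w ∈ R Q' ↔ (jmap A f w).support ∈ Q' := ⟨fun h => h.2.2, fun h => ⟨hm.1, hm.2.1, h⟩⟩
    rw [e1, e2]
    by_cases h : om A w = 0
    · rw [jmap_zero hw.1 h]
      refine h0 _ ?_
      rw [← (om_zero hw.1 h).2, supp_prI]; exact inter_subset_right
    · obtain ⟨hn, hs⟩ := norm_mem hw.1 h hw.2.2
      rw [supp_jmap hf.2.mapsTo hYA hw h, ← h1 _ inter_subset_right _ hn, hs]
      have : w.support ∩ A ∪ w.support \ A = w.support := by ext i; simp; tauto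
      rw [this]
  refine ⟨(jmap_pl hX hXA hX0 hf.1).mono (poly_R hQ) (R_mono hQX), ?_, ?_, ?_⟩
  · intro w hw; exact (key w (R_mono hQX hw)).1 hw
  · intro w hw w' hw' e
    rw [← jmap_inv hf.2.mapsTo hYA hgf (R_mono hQX hw), ← jmap_inv hf.2.mapsTo hYA hgf (R_mono hQX hw'), e]
  · intro w hw
    have h2 := jmap_mem hg.2.mapsTo hXA hX0 (R_mono hQY hw)
    have h3 := jmap_inv hg.2.mapsTo hXA hfg (R_mono hQY hw)
    refine ⟨jmap A g w, ?_, h3⟩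
    rw [key _ h2, h3]; exact hw
end

/-- gluing -/
theorem PLeq.glue {E F : Type*} [AddCommGroup E] [Module ℝ E] [AddCommGroup F] [Module ℝ F] {P1 P2 : Set E} {Q1 Q2 : Set F} {f : E → F}
    (h1 : PLeq f P1 Q1) (h2 : PLeq f P2 Q2) (h : Q1 ∩ Q2 ⊆ f '' (P1 ∩ P2)) : PLeq f (P1 ∪ P2) (Q1 ∪ Q2) := by
  have key : ∀ x ∈ P1, ∀ y ∈ P2, f x = f y → x = y := by
    intro x hx y hy e
    obtain ⟨z, ⟨hz1, hz2⟩, hz⟩ := h ⟨h1.2.mapsTo hx, e ▸ h2.2.mapsTo hy⟩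
    rw [h1.2.injOn hx hz1 hz.symm, h2.2.injOn hy hz2 (e.symm.trans hz.symm)]
  refine ⟨h1.1.union h2.1, ?_, ?_, ?_⟩
  · rintro x (hx | hx)
    exacts [Or.inl (h1.2.mapsTo hx), Or.inr (h2.2.mapsTo hx)]
  · rintro x (hx | hx) y (hy | hy) e
    exacts [h1.2.injOn hx hy e, key x hx y hy e, (key y hy x hx e.symm).symm, h2.2.injOn hx hy e]
  · rintro y (hy | hy)
    · obtain ⟨x, hx, rfl⟩ := h1.2.surjOn hy; exact ⟨x, Or.inl hx, rfl⟩
    · obtain ⟨x, hx, rfl⟩ := h2.2.surjOn hy; exact ⟨x, Or.inr hx, rfl⟩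

theorem R_union (K L : Set (Finset ℕ)) : R (K ∪ L) = R K ∪ R L := by
  ext w; simp only [R, Set.mem_ofPred_eq, Set.mem_union]; tauto
theorem R_inter (K L : Set (Finset ℕ)) : R (K ∩ L) = R K ∩ R L := by
  ext w; simp only [R, Set.mem_ofPred_eq, Set.mem_inter_iff]; tauto
theorem cx_union {K L : Set (Finset ℕ)} (hK : Cx K) (hL : Cx L) : Cx (K ∪ L) :=
  ⟨hK.1.union hL.1, fun s hs t ht => hs.imp (fun h => hK.2 s h t ht) fun h => hL.2 s h t ht⟩
theorem cx_inter {K L : Set (Finset ℕ)} (hK : Cx K) (hL : Cx L) : Cx (K ∩ L) :=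
  ⟨hK.1.subset Set.inter_subset_left, fun s hs t ht => ⟨hK.2 s hs.1 t ht, hL.2 s hs.2 t ht⟩⟩

end PL
end HomologySpheres

end

open Finset
noncomputable section
namespace HomologySpheres
namespace PL

/-- PL homeomorphism of complexes -/
def Heq (K L : Set (Finset ℕ)) : Prop := ∃ f, PLeq f (R K) (R L)
/-- PL homeomorphism of pairs -/
def Peq (K Λ L M : Set (Finset ℕ)) : Prop := ∃ f, PLeq f (R K) (R L) ∧ f '' R Λ = R M

theorem Heq.refl {K : Set (Finset ℕ)} (hK : Cx K) : Heq K K := ⟨_, PLeq.refl (poly_R hK)⟩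
theorem Heq.symm {K L : Set (Finset ℕ)} (h : Heq K L) : Heq L K := by
  obtain ⟨f, hf⟩ := h; obtain ⟨g, hg, _⟩ := hf.symm; exact ⟨g, hg⟩
theorem Heq.trans {K L M : Set (Finset ℕ)} (h : Heq K L) (h' : Heq L M) : Heq K M := by
  obtain ⟨f, hf⟩ := h; obtain ⟨g, hg⟩ := h'; exact ⟨_, hf.trans hg⟩

theorem Peq.heq {K Λ L M : Set (Finset ℕ)} (h : Peq K Λ L M) : Heq K L := by
  obtain ⟨f, hf, _⟩ := h; exact ⟨f, hf⟩
theorem Peq.symm {K Λ L M : Set (Finset ℕ)} (hΛ : Λ ⊆ K) (h : Peq K Λ L M) : Peq L M K Λ := by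
  obtain ⟨f, hf, e⟩ := h; obtain ⟨g, hg, h1, h2⟩ := hf.symm
  refine ⟨g, hg, ?_⟩
  rw [← e, Set.image_image]
  ext w; constructor
  · rintro ⟨x, hx, rfl⟩; beta_reduce; rw [h1 (R_mono hΛ hx)]; exact hx
  · intro hw; exact ⟨w, hw, h1 (R_mono hΛ hw)⟩
theorem Peq.trans {K Λ L M N O : Set (Finset ℕ)} (h : Peq K Λ L M) (h' : Peq L M N O) : Peq K Λ N O := by
  obtain ⟨f, hf, e⟩ := h; obtain ⟨g, hg, e'⟩ := h'
  exact ⟨_, hf.trans hg, by rw [← e', ← e, Set.image_image]⟩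
theorem Peq.heq' {K Λ L M : Set (Finset ℕ)} (hΛ : Cx Λ) (hs : Λ ⊆ K) (h : Peq K Λ L M) : Heq Λ M := by
  obtain ⟨f, hf, e⟩ := h
  refine ⟨f, hf.1.mono (poly_R hΛ) (R_mono hs), ?_⟩
  rw [← e]
  exact (hf.2.injOn.mono (R_mono hs)).bijOn_image

/-! ### relabelling -/
def img (φ : ℕ → ℕ) (K : Set (Finset ℕ)) : Set (Finset ℕ) := (fun s => s.image φ) '' K

def lm (φ : ℕ → ℕ) : Vec →ₗ[ℝ] Vec := Finsupp.lmapDomain ℝ ℝ φ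

theorem lm_dl (φ : ℕ → ℕ) (i : ℕ) : lm φ (dl i) = dl (φ i) := by simp [lm, dl, Finsupp.mapDomain_single]

theorem mass_lm (φ : ℕ → ℕ) (w : Vec) : mass (lm φ w) = mass w := by
  rw [lin_sum (lm φ) (le_refl w.support), map_sum]
  simp only [map_smul, lm_dl, mass_dl]
  conv_rhs => rw [lin_sum mass (le_refl w.support)]
  simp

theorem supp_lm {φ : ℕ → ℕ} (h : Function.Injective φ) (w : Vec) : (lm φ w).support = w.support.image φ :=
  Finsupp.mapDomain_support_of_injective h w

theorem lm_app {φ : ℕ → ℕ} (h : Function.Injective φ) (w : Vec) (i : ℕ) : lm φ w (φ i) = w i :=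
  Finsupp.mapDomain_apply h w i

theorem cx_img {φ : ℕ → ℕ} {K : Set (Finset ℕ)} (hK : Cx K) : Cx (img φ K) := by
  refine ⟨hK.1.image _, ?_⟩
  rintro _ ⟨s, hs, rfl⟩ t ht
  obtain ⟨u, hu, rfl⟩ := subset_image_iff.1 ht
  exact ⟨u, hK.2 s hs u hu, rfl⟩

theorem mem_img {φ : ℕ → ℕ} (h : Function.Injective φ) {K : Set (Finset ℕ)} {s : Finset ℕ} : s.image φ ∈ img φ K ↔ s ∈ K :=
  ⟨by rintro ⟨t, ht, e⟩; rwa [← Finset.image_injective h e], fun hs => ⟨s, hs, rfl⟩⟩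

theorem lm_image {φ : ℕ → ℕ} (h : Function.Injective φ) (K : Set (Finset ℕ)) : lm φ '' R K = R (img φ K) := by
  ext w
  constructor
  · rintro ⟨w, hw, rfl⟩
    refine ⟨fun i => ?_, by rw [mass_lm]; exact hw.2.1, ?_⟩
    · by_cases hi : i ∈ Set.range φ
      · obtain ⟨j, rfl⟩ := hi; rw [lm_app h]; exact hw.1 j
      · exact (Finsupp.mapDomain_of_notMem_range w i hi).ge
    · rw [supp_lm h]; exact ⟨_, hw.2.2, rfl⟩
  · rintro ⟨h1, h2, s, hs, e⟩
    have : w ∈ Set.range (lm φ) := by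
      refine ⟨Finsupp.comapDomain φ w h.injOn, ?_⟩
      refine Finsupp.mapDomain_comapDomain φ h w ?_
      intro i hi; rw [mem_coe, ← e] at hi; simp only [mem_image] at hi; obtain ⟨j, _, rfl⟩ := hi; exact ⟨j, rfl⟩
    obtain ⟨v, rfl⟩ := this
    refine ⟨v, ⟨fun i => ?_, by rwa [mass_lm] at h2, ?_⟩, rfl⟩
    · rw [← lm_app h]; exact h1 _
    · rw [supp_lm h] at e; rwa [← Finset.image_injective h e]

theorem lm_eq {φ : ℕ → ℕ} (h : Function.Injective φ) {K : Set (Finset ℕ)} (hK : Cx K) : PLeq (lm φ) (R K) (R (img φ K)) := by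
  refine PLeq.of_linear (poly_R hK) _ ?_
  rw [← lm_image h]
  exact (Function.Injective.injOn (Finsupp.mapDomain_injective h)).bijOn_image

theorem peq_img {φ : ℕ → ℕ} (h : Function.Injective φ) {K : Set (Finset ℕ)} (hK : Cx K) (Λ : Set (Finset ℕ)) :
    Peq K Λ (img φ K) (img φ Λ) := ⟨lm φ, lm_eq h hK, lm_image h Λ⟩

theorem img_full {φ : ℕ → ℕ} (s : Finset ℕ) : img φ (full s) = full (s.image φ) := by
  ext t; simp only [img, full, Set.mem_image, Set.mem_ofPred_eq, subset_image_iff]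
theorem img_bd {φ : ℕ → ℕ} (h : Function.Injective φ) (s : Finset ℕ) : img φ (bd s) = bd (s.image φ) := by
  ext t
  constructor
  · rintro ⟨u, hu, rfl⟩; exact (image_ssubset_image h).2 hu
  · intro ht
    obtain ⟨u, hu, rfl⟩ := subset_image_iff.1 (show t ⊂ _ from ht).1
    exact ⟨u, (image_ssubset_image h).1 ht, rfl⟩

theorem shift_off (Ω N : Finset ℕ) : ∃ φ : ℕ → ℕ, Function.Injective φ ∧ Disjoint (Ω.image φ) N := by
  refine ⟨fun i => i + (N.sup id + 1), fun a b h => by simpa using h, ?_⟩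
  rw [disjoint_left]
  intro i hi hN
  obtain ⟨j, _, rfl⟩ := mem_image.1 hi
  have : j + (N.sup id + 1) ≤ N.sup id := le_sup (f := id) hN
  omega

/-- combinatorial balls with their boundary -/
def BP (D Λ : Set (Finset ℕ)) : Prop := ∃ Ω : Finset ℕ, Ω.Nonempty ∧ Peq D Λ (full Ω) (bd Ω)

structure Sph (k : ℕ) (S : Set (Finset ℕ)) : Prop where
  cx : Cx S
  emp : ∅ ∈ S
  pos : 1 ≤ k
  eqv : ∃ Ω : Finset ℕ, Ω.card = k ∧ Heq S (bd Ω)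

theorem BP.off {D Λ : Set (Finset ℕ)} (h : BP D Λ) (N : Finset ℕ) :
    ∃ Ω : Finset ℕ, Ω.Nonempty ∧ Disjoint Ω N ∧ Peq D Λ (full Ω) (bd Ω) := by
  obtain ⟨Ω, h1, h2⟩ := h
  obtain ⟨φ, hφ, hN⟩ := shift_off Ω N
  refine ⟨_, h1.image φ, hN, h2.trans ?_⟩
  rw [← img_full, ← img_bd hφ]; exact peq_img hφ (cx_full _) _

theorem Sph.off {k : ℕ} {S : Set (Finset ℕ)} (h : Sph k S) (N : Finset ℕ) :
    ∃ Ω : Finset ℕ, Ω.card = k ∧ Disjoint Ω N ∧ Heq S (bd Ω) := by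
  obtain ⟨Ω, h1, h2⟩ := h.eqv
  obtain ⟨φ, hφ, hN⟩ := shift_off Ω N
  refine ⟨_, by rw [card_image_of_injective _ hφ, h1], hN, h2.trans ?_⟩
  rw [← img_bd hφ]; exact ⟨_, lm_eq hφ (cx_bd _)⟩

theorem Sph.of_heq {k : ℕ} {S T : Set (Finset ℕ)} (h : Sph k S) (hT : Cx T) (h0 : ∅ ∈ T) (e : Heq T S) : Sph k T := by
  obtain ⟨Ω, h1, h2⟩ := h.eqv
  exact ⟨hT, h0, h.pos, Ω, h1, e.trans h2⟩

theorem BP.of_peq {D Λ D' Λ' : Set (Finset ℕ)} (h : BP D Λ) (e : Peq D' Λ' D Λ) : BP D' Λ' := by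
  obtain ⟨Ω, h1, h2⟩ := h
  exact ⟨Ω, h1, e.trans h2⟩

theorem exists_pt {s : Finset ℕ} (hs : s.Nonempty) : ∃ p ∈ R (full s), p.support = s := by
  have hc : (s.card : ℝ) ≠ 0 := by simpa using hs.ne_empty
  let p : Vec := Finsupp.indicator s (fun _ _ => (s.card : ℝ)⁻¹)
  have hp : ∀ i, p i = if i ∈ s then (s.card : ℝ)⁻¹ else 0 := fun i => by simp [p, Finsupp.indicator_apply]
  have hsup : p.support = s := by ext i; simp [hp, hs.ne_empty]
  refine ⟨p, ⟨fun i => ?_, ?_, hsup.le⟩, hsup⟩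
  · rw [hp]; split_ifs <;> positivity
  · rw [mass_eq hsup.le, sum_congr rfl (fun i hi => by rw [hp, if_pos hi])]
    simp [hc]

theorem star_image {K : Set (Finset ℕ)} (hK : Cx K) {τ : Finset ℕ} {m : ℕ} (hm : ∀ s ∈ K, m ∉ s) (hτ : m ∉ τ) {p : Vec}
    (hp : p ∈ R (full τ)) (hs : p.support = τ) : PLeq (sub m p) (R (Star K τ m)) (R K) :=
  PLeq.of_linear (poly_R (cx_star hK _ _)) _ (star_bij hK hm hτ hp hs)

theorem star_peq {K Λ : Set (Finset ℕ)} (hK : Cx K) (hΛ : Cx Λ) (hs : Λ ⊆ K) {τ : Finset ℕ} (hτ0 : τ.Nonempty) {m : ℕ}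
    (hm : ∀ s ∈ K, m ∉ s) (hτ : m ∉ τ) : Peq (Star K τ m) (Star Λ τ m) K Λ := by
  obtain ⟨p, hp, hps⟩ := exists_pt hτ0
  exact ⟨_, star_image hK hm hτ hp hps, (star_bij hΛ (fun s h => hm s (hs h)) hτ hp hps).image_eq⟩

theorem bp_join {σ τ : Finset ℕ} (hσ : σ.Nonempty) (hτ : τ.Nonempty) (hd : Disjoint σ τ) :
    ∃ Ω : Finset ℕ, Ω.card + 1 = σ.card + τ.card ∧
    Peq {s | s ⊆ σ ∪ τ ∧ ¬ σ ⊆ s} {s | s ⊆ σ ∪ τ ∧ ¬ σ ⊆ s ∧ ¬ τ ⊆ s} (full Ω) (bd Ω) := by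
  obtain ⟨m, hm⟩ := hτ
  have hmσ : m ∉ σ := fun h => disjoint_left.1 hd h hm
  refine ⟨σ ∪ τ.erase m, ?_, ?_⟩
  · rw [card_union_of_disjoint (hd.mono_right (erase_subset _ _)), card_erase_of_mem hm]
    have := card_pos.2 ⟨m, hm⟩; omega
  · have h := star_peq (cx_full (σ ∪ τ.erase m)) (cx_bd _) (fun _ h => h.1) hσ (m := m)
      (fun s hs h => by have := hs h; simp [hmσ] at this) hmσ
    convert h using 1
    · ext s
      simp only [Star, full, Set.mem_ofPred_eq]
      rw [and_comm]
      refine and_congr_right fun _ => ?_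
      by_cases hms : m ∈ s
      · simp only [hms, not_true, false_and, true_and, false_or]
        constructor
        · intro h; refine union_subset (fun i hi => ?_) subset_union_left
          have := h (mem_of_mem_erase hi); have := ne_of_mem_erase hi; simp_all
        · intro h i hi
          by_cases e : i = m
          · subst e; simp [hm]
          · have := h (mem_union_left _ (mem_erase.2 ⟨e, hi⟩)); simp_all
      · simp only [hms, not_false_eq_true, true_and, false_and, or_false]
        constructor
        · intro h i hi
          have := h hi; have : i ≠ m := fun e => hms (e ▸ hi); simp_all
        · intro h; exact h.trans (union_subset_union_right (erase_subset _ _))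
    · ext s
      simp only [Star, bd, Set.mem_ofPred_eq]
      constructor
      · rintro ⟨h1, h2, h3⟩
        refine ⟨h2, ?_⟩
        by_cases hms : m ∈ s
        · right; refine ⟨hms, Finset.ssubset_iff_subset_ne.2 ⟨?_, fun e => ?_⟩⟩
          · refine union_subset (fun i hi => ?_) subset_union_left
            have := h1 (mem_of_mem_erase hi); have := ne_of_mem_erase hi; simp_all
          · apply h3; intro i hi
            by_cases e' : i = m
            · rwa [e']
            · have : i ∈ σ ∪ τ.erase m := by simp [hi, e']
              rw [← e] at this
              have hh : i ∉ σ := fun h => disjoint_left.1 hd h hi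
              exact mem_of_mem_erase ((mem_union.1 this).resolve_right hh)
        · left; refine ⟨hms, Finset.ssubset_iff_subset_ne.2 ⟨?_, fun e => h2 (e ▸ subset_union_left)⟩⟩
          intro i hi
          have := h1 hi; have : i ≠ m := fun e => hms (e ▸ hi); simp_all
      · rintro ⟨h2, (⟨hms, h⟩ | ⟨hms, h⟩)⟩
        · exact ⟨h.1.trans (union_subset_union_right (erase_subset _ _)), h2, fun h' => hms (h' hm)⟩
        · refine ⟨fun i hi => ?_, h2, fun h' => ?_⟩
          · by_cases e : i = m
            · subst e; simp [hm]
            · have := h.1 (mem_union_left _ (mem_erase.2 ⟨e, hi⟩)); simp_all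
          · apply h.2; refine union_subset subset_union_right fun i hi => ?_
            rw [mem_erase] at hi
            exact mem_union_left _ (mem_erase.2 ⟨hi.1, h' hi.2⟩)
end PL
end HomologySpheres

end

open Finset
noncomputable section
namespace HomologySpheres
namespace PL

def lk (K : Set (Finset ℕ)) (v : ℕ) : Set (Finset ℕ) := {τ | v ∉ τ ∧ insert v τ ∈ K}
def del (K : Set (Finset ℕ)) (v : ℕ) : Set (Finset ℕ) := {τ | v ∉ τ ∧ τ ∈ K}

theorem cx_del {K : Set (Finset ℕ)} (hK : Cx K) (v : ℕ) : Cx (del K v) :=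
  ⟨hK.1.subset fun _ h => h.2, fun s hs t ht => ⟨fun h => hs.1 (ht h), hK.2 s hs.2 t ht⟩⟩
theorem lk_sub {K : Set (Finset ℕ)} (hK : Cx K) (v : ℕ) : lk K v ⊆ K := fun s hs => hK.2 _ hs.2 _ (subset_insert _ _)
theorem lk_sub_del {K : Set (Finset ℕ)} (hK : Cx K) (v : ℕ) : lk K v ⊆ del K v := fun s hs => ⟨hs.1, lk_sub hK v hs⟩
theorem cx_lk {K : Set (Finset ℕ)} (hK : Cx K) (v : ℕ) : Cx (lk K v) :=
  ⟨hK.1.subset (lk_sub hK v), fun s hs t ht => ⟨fun h => hs.1 (ht h), hK.2 _ hs.2 _ (insert_subset_insert _ ht)⟩⟩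
theorem emp_lk {K : Set (Finset ℕ)} {v : ℕ} (h : {v} ∈ K) : ∅ ∈ lk K v := ⟨by simp, by simpa using h⟩

def Q1 (D Λ : Set (Finset ℕ)) (u v : ℕ) : Set (Finset ℕ) := {s | s \ {u, v} ∈ D ∧ (v ∈ s → s \ {u, v} ∈ Λ)}
def Q2 (D : Set (Finset ℕ)) (u v : ℕ) : Set (Finset ℕ) := {s | u ∉ s ∧ s \ {u, v} ∈ D}

theorem cx_Q1 {D Λ : Set (Finset ℕ)} (hD : Cx D) (hΛ : Cx Λ) (u v : ℕ) : Cx (Q1 D Λ u v) :=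
  ⟨(cx_jn (A := {u, v}) hD).1.subset fun _ h => h.1, fun s hs t ht =>
    ⟨hD.2 _ hs.1 _ (sdiff_subset_sdiff ht (le_refl _)), fun h => hΛ.2 _ (hs.2 (ht h)) _ (sdiff_subset_sdiff ht (le_refl _))⟩⟩
theorem cx_Q2 {D : Set (Finset ℕ)} (hD : Cx D) (u v : ℕ) : Cx (Q2 D u v) :=
  ⟨(cx_jn (A := {u, v}) hD).1.subset fun _ h => h.2, fun s hs t ht =>
    ⟨fun h => hs.1 (ht h), hD.2 _ hs.2 _ (sdiff_subset_sdiff ht (le_refl _))⟩⟩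

theorem cone_lemma {D Λ : Set (Finset ℕ)} (hD : Cx D) (hΛ : Cx Λ) (hs : Λ ⊆ D) (h0 : ∅ ∈ Λ) {u v : ℕ} (huv : u ≠ v)
    (hav : Av {u, v} D) (h : BP D Λ) :
    ∃ h, PLeq h (R (Q1 D Λ u v)) (R (Q2 D u v)) ∧ ∀ w ∈ R (Q1 D Λ u v), w u = 0 → h w = w := by
  obtain ⟨Ω, hΩ, hdis, f, hf, hfe⟩ := h.off {u, v}
  have hu : u ∉ Ω := fun h => disjoint_left.1 hdis h (by simp)
  have hv : v ∉ Ω := fun h => disjoint_left.1 hdis h (by simp)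
  have avΩ : Av {u, v} (full Ω) := fun s hs => hdis.mono_left hs
  have eΩ : ∀ s, s ⊆ Ω → s \ {u, v} = s := fun s hs => sdiff_eq_self_of_disjoint (avΩ s hs)
  have eD : ∀ s ∈ D, s \ {u, v} = s := fun s hs => sdiff_eq_self_of_disjoint (hav s hs)
  have key : ∀ a ⊆ ({u, v} : Finset ℕ), ∀ s : Finset ℕ, (a ∪ s) \ {u, v} = s \ {u, v} := by
    intro a ha s; rw [union_sdiff_distrib, sdiff_eq_empty_iff_subset.2 ha, empty_union]
  have bdi : ∀ x ∈ R D, x.support ∈ Λ ↔ (f x).support ∈ bd Ω := by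
    intro x hx
    have e1 : x.support ∈ Λ ↔ x ∈ R Λ := ⟨fun h => ⟨hx.1, hx.2.1, h⟩, fun h => h.2.2⟩
    have hx' := hf.2.mapsTo hx
    have e2 : (f x).support ∈ bd Ω ↔ f x ∈ R (bd Ω) := ⟨fun h => ⟨hx'.1, hx'.2.1, h⟩, fun h => h.2.2⟩
    rw [e1, e2, ← hfe]
    constructor
    · exact fun h => ⟨x, h, rfl⟩
    · rintro ⟨y, hy, e⟩; rwa [← hf.2.injOn (R_mono hs hy) hx e]
  have vD : ∀ s ∈ D, v ∉ s := fun s hs h => disjoint_left.1 (hav s hs) h (by simp)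
  have uD : ∀ s ∈ D, u ∉ s := fun s hs h => disjoint_left.1 (hav s hs) h (by simp)
  -- the two join maps
  have F1 : PLeq (jmap {u, v} f) (R (Q1 D Λ u v)) (R (Q1 (full Ω) (bd Ω) u v)) := by
    refine jmap_eq hD hav (hs h0) avΩ (empty_subset _) hf (cx_Q1 hD hΛ u v) (fun _ h => h.1) (fun _ h => h.1) ?_ ?_
    · intro a ha
      simp only [Q1, Set.mem_ofPred_eq, sdiff_eq_empty_iff_subset.2 ha]
      simp only [hs h0, h0, true_and, implies_true, true_iff]
      exact ⟨empty_subset _, fun _ => hΩ.empty_ssubset⟩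
    · intro a ha x hx
      have hx' := hf.2.mapsTo hx
      simp only [Q1, Set.mem_ofPred_eq, key a ha, eD _ hx.2.2, eΩ _ hx'.2.2, bdi x hx, hx.2.2, hx'.2.2, true_and, mem_union]
      have h1 := vD _ hx.2.2
      have h2 : v ∉ (f x).support := fun h => hv (hx'.2.2 h)
      simp only [h1, h2, or_false]
  have F2 : PLeq (jmap {u, v} f) (R (Q2 D u v)) (R (Q2 (full Ω) u v)) := by
    refine jmap_eq hD hav (hs h0) avΩ (empty_subset _) hf (cx_Q2 hD u v) (fun _ h => h.2) (fun _ h => h.2) ?_ ?_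
    · intro a ha
      simp only [Q2, Set.mem_ofPred_eq, sdiff_eq_empty_iff_subset.2 ha]
      simp only [hs h0]
      exact and_congr_right fun _ => ⟨fun _ => empty_subset _, fun _ => trivial⟩
    · intro a ha x hx
      have hx' := hf.2.mapsTo hx
      simp only [Q2, Set.mem_ofPred_eq, key a ha, eD _ hx.2.2, eΩ _ hx'.2.2, hx.2.2, hx'.2.2, and_true, mem_union]
      have h1 := uD _ hx.2.2
      have h2 : u ∉ (f x).support := fun h => hu (hx'.2.2 h)
      simp only [h1, h2, or_false]
  have e1 : Q1 (full Ω) (bd Ω) u v = Star (full (insert v Ω)) (insert v Ω) u := by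
    ext s
    simp only [Q1, Star, full, bd, Set.mem_ofPred_eq]
    have hsub : s \ {u, v} ⊆ Ω ↔ s.erase u ⊆ insert v Ω := by
      constructor
      · intro h i hi; rw [mem_erase] at hi
        by_cases e : i = v
        · simp [e]
        · exact mem_insert_of_mem (h (by simp [hi.1, hi.2, e]))
      · intro h i hi
        simp only [mem_sdiff, mem_insert, mem_singleton, not_or] at hi
        have := h (mem_erase.2 ⟨hi.2.1, hi.1⟩)
        simpa [hi.2.2] using this
    have hcase : ((u ∉ s ∧ s ⊆ insert v Ω) ∨ (u ∈ s ∧ s.erase u ∪ insert v Ω ⊆ insert v Ω)) ↔ s.erase u ⊆ insert v Ω := by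
      by_cases hus : u ∈ s
      · simp only [hus, not_true, false_and, true_and, false_or, union_subset_iff, le_refl, and_true]
      · simp [hus, erase_eq_of_notMem]
    rw [hcase, ← hsub, and_comm (a := ¬ _)]
    refine and_congr_right fun h => ?_
    rw [insert_subset_iff, not_and]
    refine forall_congr' fun _ => ?_
    have : Ω ⊆ s ↔ Ω ⊆ s \ {u, v} := ⟨fun h i hi => by
      simp only [mem_sdiff, mem_insert, mem_singleton, not_or]
      exact ⟨h hi, fun e => hu (e ▸ hi), fun e => hv (e ▸ hi)⟩, fun h => h.trans sdiff_subset⟩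
    rw [this]; exact ⟨fun h => h.2, fun h' => ⟨h, h'⟩⟩
  have e2 : Q2 (full Ω) u v = full (insert v Ω) := by
    ext s
    simp only [Q2, full, Set.mem_ofPred_eq]
    constructor
    · rintro ⟨h1, h2⟩ i hi
      by_cases e : i = v
      · simp [e]
      · exact mem_insert_of_mem (h2 (by
          simp only [mem_sdiff, mem_insert, mem_singleton, not_or]
          exact ⟨hi, fun e => h1 (e ▸ hi), e⟩))
    · intro h
      refine ⟨fun h1 => ?_, fun i hi => ?_⟩
      · have := h h1; simp [huv, hu] at this
      · simp only [mem_sdiff, mem_insert, mem_singleton, not_or] at hi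
        have := h hi.1
        simpa [hi.2.2] using this
  obtain ⟨p, hp, hps⟩ := exists_pt (insert_nonempty v Ω)
  have hus : u ∉ insert v Ω := by simp [huv, hu]
  have F3 := star_image (cx_full (insert v Ω)) (m := u) (fun s hs h => hus (hs h)) hus hp hps
  rw [← e1, ← e2] at F3
  obtain ⟨g, hg, hgl, hgr⟩ := F2.symm
  refine ⟨_, (F1.trans F3).trans hg, ?_⟩
  intro w hw hwu
  have hz : jmap {u, v} f w u = 0 := by
    have := prI_jmap (fun _ => jmap_disj hf.2.mapsTo avΩ (R_mono (fun _ h => h.1) hw) (by assumption))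
    have h2 := DFunLike.congr_fun this u
    simpa [prI_apply, hwu] using h2
  rw [sub_of_zero hz]
  refine hgl ⟨hw.1, hw.2.1, ?_, hw.2.2.1⟩
  simpa using hwu

/-- contraction of the edge uv to v -/
def Contr (K : Set (Finset ℕ)) (u v : ℕ) : Set (Finset ℕ) :=
  {s | u ∉ s ∧ (s ∈ K ∨ (v ∈ s ∧ insert u (s.erase v) ∈ K))}

theorem cx_contr {K : Set (Finset ℕ)} (hK : Cx K) (u v : ℕ) : Cx (Contr K u v) := by
  constructor
  · refine (hK.1.union (hK.1.image fun s => insert v (s.erase u))).subset ?_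
    rintro s ⟨h1, (h | ⟨h2, h3⟩)⟩
    · exact Or.inl h
    · refine Or.inr ⟨_, h3, ?_⟩
      beta_reduce
      rw [erase_insert (fun h => h1 (mem_of_mem_erase h)), insert_erase h2]
  · rintro s ⟨h1, h2⟩ t ht
    refine ⟨fun h => h1 (ht h), ?_⟩
    rcases h2 with h | ⟨h2, h3⟩
    · exact Or.inl (hK.2 s h t ht)
    · by_cases hv : v ∈ t
      · exact Or.inr ⟨hv, hK.2 _ h3 _ (insert_subset_insert _ (erase_subset_erase _ ht))⟩
      · refine Or.inl (hK.2 _ h3 _ ((subset_erase.2 ⟨ht, hv⟩).trans (subset_insert _ _)))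

theorem contraction {K : Set (Finset ℕ)} (hK : Cx K) {u v : ℕ} (huv : u ≠ v) (he : {u, v} ∈ K)
    (hl : ∀ ρ : Finset ℕ, u ∉ ρ → v ∉ ρ → insert u ρ ∈ K → insert v ρ ∈ K → insert u (insert v ρ) ∈ K)
    (hb : BP (del (lk K u) v) (lk (lk K u) v)) :
    ∃ f, PLeq f (R K) (R (Contr K u v)) ∧ ∀ w, w u = 0 → f w = w := by
  have hL := cx_lk hK u
  have hD := cx_del hL v
  have hΛ := cx_lk hL v
  obtain ⟨h, hh, hid⟩ := cone_lemma hD hΛ (lk_sub_del hL v) (emp_lk ⟨by simpa using huv, he⟩) huv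
    (fun s hs => by
      rw [disjoint_right]; intro i hi; simp only [mem_insert, mem_singleton] at hi
      rcases hi with rfl | rfl
      exacts [hs.2.1, hs.1]) hb
  classical
  -- identification of Q1 with the closed star of u
  have q1 : Q1 (del (lk K u) v) (lk (lk K u) v) u v = {s | insert u s ∈ K} := by
    ext s
    simp only [Q1, del, lk, Set.mem_ofPred_eq]
    have hvs : v ∉ s \ {u, v} := by simp
    have hus : u ∉ s \ {u, v} := by simp
    simp only [hvs, hus, not_false_eq_true, true_and, mem_insert, huv, false_or]
    constructor
    · rintro ⟨h1, h2⟩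
      by_cases hv : v ∈ s
      · convert (h2 hv) using 1
        ext i; by_cases i = u <;> by_cases i = v <;> simp_all
      · convert h1 using 1
        ext i; by_cases i = u <;> by_cases i = v <;> simp_all
    · intro h
      refine ⟨hK.2 _ h _ (insert_subset_insert _ sdiff_subset), fun hv => hK.2 _ h _ ?_⟩
      refine insert_subset_insert _ (insert_subset hv sdiff_subset)
  have eK : R K = R (del K u) ∪ R {s | insert u s ∈ K} := by
    rw [← R_union]; congr 1; ext s
    constructor
    · intro h; by_cases hu : u ∈ s
      · right; show insert u s ∈ K; rwa [insert_eq_of_mem hu]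
      · exact Or.inl ⟨hu, h⟩
    · rintro (h | h)
      exacts [h.2, hK.2 _ h _ (subset_insert _ _)]
  have eC : R (Contr K u v) = R (del K u) ∪ R (Q2 (del (lk K u) v) u v) := by
    rw [← R_union]; congr 1; ext s
    have hvs : v ∉ s \ {u, v} := by simp
    have hus : u ∉ s \ {u, v} := by simp
    simp only [Contr, Q2, del, lk, Set.mem_ofPred_eq, Set.mem_union, hvs, hus, not_false_eq_true, true_and]
    constructor
    · rintro ⟨h1, (h | ⟨h2, h3⟩)⟩
      · exact Or.inl ⟨h1, h⟩
      · right; refine ⟨h1, ?_⟩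
        convert h3 using 1
        ext i; by_cases i = u <;> by_cases i = v <;> simp_all
    · rintro (h | ⟨h1, h2⟩)
      · exact ⟨h.1, Or.inl h.2⟩
      · refine ⟨h1, ?_⟩
        by_cases hv : v ∈ s
        · right; refine ⟨hv, ?_⟩
          convert h2 using 1
          ext i; by_cases i = u <;> by_cases i = v <;> simp_all
        · left; refine hK.2 _ h2 _ fun i hi => ?_
          by_cases i = u <;> by_cases i = v <;> simp_all
  let F : Vec → Vec := fun w => if w u = 0 then w else h w
  refine ⟨F, ?_, fun w hw => if_pos hw⟩
  rw [eK, eC]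
  rw [q1] at hh hid
  refine PLeq.glue ?_ ?_ ?_
  · refine (PLeq.refl (poly_R (cx_del hK u))).congr fun w hw => ?_
    have : w u = 0 := by simpa using hw.2.2.1
    simp only [F, this, if_true]
  · refine hh.congr fun w hw => ?_
    by_cases hu : w u = 0
    · simp only [F, hu, if_true]; exact hid w hw hu
    · simp only [F, hu, if_false]
  · rintro w ⟨h1, h2⟩
    have hu : w u = 0 := by simpa using h1.2.2.1
    have hus : u ∉ w.support := h1.2.2.1
    refine ⟨w, ⟨h1, h1.1, h1.2.1, ?_⟩, if_pos hu⟩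
    have h3 : insert u (w.support \ {u, v}) ∈ K := h2.2.2.2.2.2
    show insert u w.support ∈ K
    by_cases hv : v ∈ w.support
    · have := hl (w.support \ {u, v}) (by simp) (by simp) h3 (hK.2 _ h1.2.2.2 _ (insert_subset hv sdiff_subset))
      refine hK.2 _ this _ (insert_subset_insert _ fun i hi => ?_)
      by_cases e : i = v
      · simp [e]
      · refine mem_insert_of_mem (mem_sdiff.2 ⟨hi, ?_⟩)
        simp only [mem_insert, mem_singleton, not_or]
        exact ⟨fun e => hus (e ▸ hi), e⟩
    · refine hK.2 _ h3 _ (insert_subset_insert _ fun i hi => mem_sdiff.2 ⟨hi, ?_⟩)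
      simp only [mem_insert, mem_singleton, not_or]
      exact ⟨fun e => hus (e ▸ hi), fun e => hv (e ▸ hi)⟩
end PL
end HomologySpheres

end

open Finset
noncomputable section
namespace HomologySpheres
namespace PL

theorem star_del {K : Set (Finset ℕ)} {e : Finset ℕ} {p m : ℕ} (hp : p ∉ e) (hpm : p ≠ m) :
    del (Star K e m) p = Star (del K p) e m := by
  ext s
  simp only [del, Star, Set.mem_ofPred_eq, mem_union, mem_erase, not_or, not_and]
  tauto

theorem star_lk {K : Set (Finset ℕ)} {e : Finset ℕ} {p m : ℕ} (hp : p ∉ e) (hpm : p ≠ m) :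
    lk (Star K e m) p = Star (lk K p) e m := by
  ext s
  simp only [lk, Star, Set.mem_ofPred_eq, mem_union, mem_erase, not_or, not_and]
  have h1 : e ⊆ insert p s ↔ e ⊆ s := by rw [subset_insert_iff, erase_eq_of_notMem hp]
  have h2 : (insert p s).erase m ∪ e = insert p (s.erase m ∪ e) := by
    rw [erase_insert_of_ne hpm, insert_union]
  rw [h1, h2]
  simp only [mem_insert, hpm.symm, false_or]
  tauto

theorem swap_image_of_notMem {s : Finset ℕ} {w m : ℕ} (h1 : w ∉ s) (h2 : m ∉ s) : s.image (Equiv.swap w m) = s := by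
  conv_rhs => rw [← image_id (s := s)]
  refine image_congr fun i hi => ?_
  exact Equiv.swap_apply_of_ne_of_ne (fun e => h1 (e ▸ hi)) (fun e => h2 (e ▸ hi))
theorem swap_image_of_mem {s : Finset ℕ} {w m : ℕ} (h1 : w ∈ s) (h2 : m ∉ s) :
    s.image (Equiv.swap w m) = insert m (s.erase w) := by
  conv_lhs => rw [← insert_erase h1, image_insert, Equiv.swap_apply_left]
  rw [swap_image_of_notMem (by simp) (fun h => h2 (mem_of_mem_erase h))]

theorem mem_img_swap {K : Set (Finset ℕ)} {w m : ℕ} (hm : ∀ s ∈ K, m ∉ s) (hwm : w ≠ m) {s : Finset ℕ} :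
    s ∈ img (Equiv.swap w m) K ↔ w ∉ s ∧ ((m ∉ s ∧ s ∈ K) ∨ (m ∈ s ∧ insert w (s.erase m) ∈ K)) := by
  constructor
  · rintro ⟨t, ht, rfl⟩
    by_cases hw : w ∈ t
    · beta_reduce
      rw [swap_image_of_mem hw (hm t ht)]
      refine ⟨by simp [hwm], Or.inr ⟨by simp, ?_⟩⟩
      rw [erase_insert (fun h => hm t ht (mem_of_mem_erase h)), insert_erase hw]; exact ht
    · beta_reduce
      rw [swap_image_of_notMem hw (hm t ht)]
      exact ⟨hw, Or.inl ⟨hm t ht, ht⟩⟩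
  · rintro ⟨h1, (⟨h2, h3⟩ | ⟨h2, h3⟩)⟩
    · exact ⟨s, h3, swap_image_of_notMem h1 h2⟩
    · refine ⟨_, h3, ?_⟩
      beta_reduce
      rw [swap_image_of_mem (by simp) (hm _ h3), erase_insert (fun h => h1 (mem_of_mem_erase h)), insert_erase h2]

theorem star_lk_end {K : Set (Finset ℕ)} (hK : Cx K) {p w m : ℕ} (hpw : p ≠ w) (hm : ∀ s ∈ K, m ∉ s) (he : {p, w} ∈ K) :
    lk (Star K {p, w} m) p = img (Equiv.swap w m) (lk K p) := by
  have hpm : p ≠ m := fun e => hm _ he (by simp [e])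
  have hwm : w ≠ m := fun e => hm _ he (by simp [e])
  ext s
  rw [mem_img_swap (fun s hs => hm s (lk_sub hK p hs)) hwm]
  simp only [lk, Star, Set.mem_ofPred_eq, mem_insert, hpm.symm, hpw, false_or, mem_erase, insert_subset_iff, singleton_subset_iff, true_and, hpw.symm]
  have e1 : (insert p s).erase m ∪ {p, w} = insert p (insert w (s.erase m)) := by
    ext i; simp; tauto
  rw [e1]; tauto

/-- one edge-starring changes the link of a vertex by a PL homeomorphism -/
theorem es_lk {K K1 : Set (Finset ℕ)} (hK : Cx K) {r} (h : ES K K1 r) {p : ℕ} (hp : {p} ∈ K) : Heq (lk K1 p) (lk K p) := by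
  induction h with
  | refl => exact Heq.refl (cx_lk hK p)
  | @step K1 r x y m c h hxy he hm h0 h1 ih =>
    have hK1 := h.cx hK
    have hpm : p ≠ m := fun e => hm _ (h.vert hp).1 (by simp [e])
    refine Heq.trans ?_ ih
    by_cases hx : p = x
    · subst hx
      rw [star_lk_end hK1 hxy hm he]
      exact Heq.symm ⟨_, lm_eq (Equiv.injective _) (cx_lk hK1 p)⟩
    by_cases hy : p = y
    · subst hy
      rw [pair_comm] at he ⊢
      rw [star_lk_end hK1 hxy.symm hm he]
      exact Heq.symm ⟨_, lm_eq (Equiv.injective _) (cx_lk hK1 p)⟩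
    rw [star_lk (by simp [hx, hy]) hpm]
    exact (star_peq (Λ := lk K1 p) (cx_lk hK1 p) (cx_lk hK1 p) (le_refl _) ⟨x, by simp⟩ (fun s hs => hm s (lk_sub hK1 p hs))
      (fun h => hm _ he h)).heq

/-! ### cutting off a vertex -/
structure PC (K : Set (Finset ℕ)) (p : ℕ) (φ : Vec →ₗ[ℝ] ℝ) (ε : ℝ) : Prop where
  one : φ (dl p) = 1
  vert : {p} ∈ K
  le : ∀ w, {w} ∈ K → w ≠ p → φ (dl w) ≤ 1 - ε
  fl : ∀ s ∈ K, (∀ v ∈ s, φ (dl v) = 1 - ε) → insert p s ∈ K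

structure Cut (K : Set (Finset ℕ)) (p : ℕ) (φ : Vec →ₗ[ℝ] ℝ) (ε : ℝ) : Prop extends PC K p φ ε where
  nb : ∀ w, {p, w} ∈ K → w ≠ p → φ (dl w) = 1 - ε

theorem face_vert {K : Set (Finset ℕ)} (hK : Cx K) {s : Finset ℕ} (hs : s ∈ K) {v : ℕ} (hv : v ∈ s) : {v} ∈ K :=
  hK.2 s hs _ (by simpa using hv)

theorem exists_cut1 {ε : ℝ} (hε : 0 < ε) (p : ℕ) : ∀ (n : ℕ) (K : Set (Finset ℕ)) (φ : Vec →ₗ[ℝ] ℝ), Cx K → PC K p φ ε →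
    (∀ N : Finset ℕ, (∀ w ∈ N, {p, w} ∈ K ∧ w ≠ p ∧ φ (dl w) < 1 - ε) → N.card ≤ n) →
    ∃ K1 r, ES K K1 r ∧ Cut K1 p (φ ∘ₗ r) ε := by
  intro n
  induction n with
  | zero =>
    intro K φ hK h hN
    refine ⟨K, LinearMap.id, ES.refl, ⟨h, fun w hw hwp => ?_⟩⟩
    by_contra hne
    have h1 : φ (dl w) < 1 - ε := lt_of_le_of_ne (h.le w (face_vert hK hw (by simp)) hwp) hne
    have := hN {w} (by simpa using ⟨hw, hwp, h1⟩)
    simp at this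
  | succ n ih =>
    intro K φ hK h hN
    by_cases hex : ∃ w, {p, w} ∈ K ∧ w ≠ p ∧ φ (dl w) < 1 - ε
    · obtain ⟨w, hw, hwp, hlt⟩ := hex
      obtain ⟨m, hm, -⟩ := exists_fresh hK.1 ∅
      have hpm : p ≠ m := fun e => hm _ hw (by simp [e])
      have hwm : w ≠ m := fun e => hm _ hw (by simp [e])
      have hd : 0 < 1 - φ (dl w) := by linarith
      let c : ℝ := (1 - ε - φ (dl w)) / (1 - φ (dl w))
      have hc0 : 0 < c := div_pos (by linarith) hd
      have hc1 : c < 1 := (div_lt_one hd).2 (by linarith)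
      have hce : c * (1 - φ (dl w)) = 1 - ε - φ (dl w) := div_mul_cancel₀ _ hd.ne'
      have hES := ES.step p w m c (ES.refl (K := K)) (Ne.symm hwp) hw hm hc0 hc1
      rw [LinearMap.id_comp] at hES
      set q := c • dl p + (1 - c) • dl w with hq
      have hφm : φ (sub m q (dl m)) = 1 - ε := by
        rw [sub_dl_self, hq, map_add, map_smul, map_smul, h.one, smul_eq_mul, smul_eq_mul]; linarith
      have hφ : ∀ v, v ≠ m → φ (sub m q (dl v)) = φ (dl v) := fun v hv => by rw [sub_dl_ne _ hv]
      have hK1 := cx_star hK {p, w} m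
      have hPC : PC (Star K {p, w} m) p (φ ∘ₗ sub m q) ε := by
        refine ⟨by rw [LinearMap.comp_apply, hφ p hpm, h.one], (hES.vert h.vert).1, ?_, ?_⟩
        · intro v hv hvp
          rw [LinearMap.comp_apply]
          by_cases e : v = m
          · rw [e, hφm]
          · rw [hφ v e]
            rcases hv.2 with ⟨_, h2⟩ | ⟨h2, _⟩
            · exact h.le v h2 hvp
            · simp at h2; exact absurd h2.symm e
        · intro s hs hsv
          have hws : w ∉ s := fun hws => by
            have := hsv w hws; rw [LinearMap.comp_apply, hφ w hwm] at this; linarith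
          refine ⟨fun h' => ?_, ?_⟩
          · have := h' (show w ∈ ({p, w} : Finset ℕ) by simp)
            simp [hwp, hws] at this
          · rcases hs.2 with ⟨h1, h2⟩ | ⟨h1, h2⟩
            · left; refine ⟨by simp [hpm.symm, h1], h.fl s h2 fun v hv => ?_⟩
              have := hsv v hv
              rwa [LinearMap.comp_apply, hφ v (fun e => h1 (e ▸ hv))] at this
            · right; refine ⟨by simp [h1], ?_⟩
              convert h2 using 1
              rw [erase_insert_of_ne hpm]
              ext i; simp
      have key : ∀ N : Finset ℕ, (∀ u ∈ N, {p, u} ∈ Star K {p, w} m ∧ u ≠ p ∧ (φ ∘ₗ sub m q) (dl u) < 1 - ε) → N.card ≤ n := by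
        intro N hNN
        have hmN : ∀ v ∈ N, v ≠ m := fun v hv e => by
          have := (hNN v hv).2.2; rw [e, LinearMap.comp_apply, hφm] at this; exact lt_irrefl _ this
        have hwN : w ∉ N := fun hv => by
          have := (hNN w hv).1.1; simp at this
        have := hN (insert w N) (fun v hv => by
          rcases mem_insert.1 hv with rfl | hv
          · exact ⟨hw, hwp, hlt⟩
          · obtain ⟨h1, h2, h3⟩ := hNN v hv
            rw [LinearMap.comp_apply, hφ v (hmN v hv)] at h3
            refine ⟨?_, h2, h3⟩
            rcases h1.2 with ⟨_, h⟩ | ⟨h, _⟩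
            · exact h
            · simp [hpm.symm, (hmN v hv).symm] at h)
        rw [card_insert_of_notMem hwN] at this; omega
      obtain ⟨K1, r, hr, hc⟩ := ih _ _ hK1 hPC key
      exact ⟨K1, _, hES.trans hr, by rwa [LinearMap.comp_assoc] at hc⟩
    · refine ih K φ hK h (fun N hNN => ?_)
      rcases N.eq_empty_or_nonempty with rfl | ⟨w, hw⟩
      · simp
      · exact absurd ⟨w, hNN w hw⟩ hex

theorem verts_finite {K : Set (Finset ℕ)} (hK : Cx K) : ∃ V : Finset ℕ, ∀ s ∈ K, s ⊆ V := by
  refine ⟨hK.1.toFinset.sup id, fun s hs => ?_⟩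
  exact le_sup (f := id) (by simpa using hs : s ∈ hK.1.toFinset)

theorem exists_cut {ε : ℝ} (hε : 0 < ε) {p : ℕ} {K : Set (Finset ℕ)} {φ : Vec →ₗ[ℝ] ℝ} (hK : Cx K) (h : PC K p φ ε) :
    ∃ K1 r, ES K K1 r ∧ Cut K1 p (φ ∘ₗ r) ε := by
  obtain ⟨V, hV⟩ := verts_finite hK
  refine exists_cut1 hε p V.card K φ hK h fun N hN => card_le_card fun w hw => hV _ (hN w hw).1 (by simp)

theorem Cut.val {K : Set (Finset ℕ)} {p : ℕ} {φ : Vec →ₗ[ℝ] ℝ} {ε : ℝ} (hK : Cx K) (hε : 0 < ε) (h : Cut K p φ ε) {w : Vec} (hw : w ∈ R K) :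
    (w ∈ R (del K p) ↔ φ w ≤ 1 - ε) ∧ (w ∈ R (lk K p) ↔ φ w = 1 - ε) := by
  have hsum : ∑ i ∈ w.support, w i = 1 := by rw [← mass_eq (le_refl _)]; exact hw.2.1
  have e1 : w ∈ R (del K p) ↔ p ∉ w.support := ⟨fun h => h.2.2.1, fun h => ⟨hw.1, hw.2.1, h, hw.2.2⟩⟩
  have e2 : w ∈ R (lk K p) ↔ p ∉ w.support ∧ insert p w.support ∈ K := ⟨fun h => h.2.2, fun h => ⟨hw.1, hw.2.1, h⟩⟩
  have ev : φ w - (1 - ε) = ∑ i ∈ w.support, w i * (φ (dl i) - (1 - ε)) := by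
    simp only [mul_sub, sum_sub_distrib, ← sum_mul, hsum]
    rw [lin_sum φ (le_refl w.support)]; simp
  by_cases hp : p ∈ w.support
  · have : 0 < φ w - (1 - ε) := by
      rw [ev]
      refine sum_pos' (fun i hi => ?_) ⟨p, hp, ?_⟩
      · by_cases e : i = p
        · rw [e, h.one]; have := hw.1 p; nlinarith
        · rw [h.nb i (hK.2 _ hw.2.2 _ (by intro j hj; simp at hj; rcases hj with rfl | rfl <;> assumption)) e]; simp
      · rw [h.one]; have := lt_of_le_of_ne (hw.1 p) (Ne.symm (Finsupp.mem_support_iff.1 hp)); nlinarith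
    rw [e1, e2]
    exact ⟨⟨fun h => absurd hp h, fun h => by linarith⟩, ⟨fun h => absurd hp h.1, fun h => by linarith⟩⟩
  · have hle : ∀ i ∈ w.support, w i * (φ (dl i) - (1 - ε)) ≤ 0 := fun i hi => by
      have := h.le i (face_vert hK hw.2.2 hi) (fun e => hp (e ▸ hi))
      exact mul_nonpos_of_nonneg_of_nonpos (hw.1 i) (by linarith)
    rw [e1, e2]
    refine ⟨⟨fun _ => ?_, fun _ => hp⟩, ⟨fun hh => ?_, fun hh => ⟨hp, h.fl _ hw.2.2 fun v hv => ?_⟩⟩⟩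
    · have := sum_nonpos hle; linarith
    · have : ∑ i ∈ w.support, w i * (φ (dl i) - (1 - ε)) = 0 := sum_eq_zero fun i hi => by
        rw [h.nb i (hK.2 _ hh.2 _ (by intro j hj; simp at hj; rcases hj with rfl | rfl <;> simp_all)) (fun e => hp (e ▸ hi))]; simp
      linarith
    · have := (sum_eq_zero_iff_of_nonpos hle).1 (by linarith) v hv
      rcases mul_eq_zero.1 this with h | h
      · exact absurd h (Finsupp.mem_support_iff.1 hv)
      · linarith

theorem eq_dl {K : Set (Finset ℕ)} {w : Vec} (hw : w ∈ R K) {q : ℕ} (h : w q = 1) : w = dl q := by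
  have hq : q ∈ w.support := by simp [h]
  have := hw.2.1
  rw [mass_eq (le_refl _), ← add_sum_erase _ _ hq, h] at this
  have h2 : ∑ i ∈ w.support.erase q, w i = 0 := by linarith
  rw [sum_eq_zero_iff_of_nonneg (fun i _ => hw.1 i)] at h2
  ext i
  rw [dl_apply]
  split_ifs with e
  · rw [← e, h]
  · by_contra hne
    exact hne (h2 i (mem_erase.2 ⟨fun e' => e e'.symm, Finsupp.mem_support_iff.2 hne⟩))

/-- The local lemma. -/
theorem local_pair {K L : Set (Finset ℕ)} (hK : Cx K) (hL : Cx L) {f : Vec → Vec} (hf : PLeq f (R K) (R L)) {p q : ℕ}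
    (hp : {p} ∈ K) (hq : {q} ∈ L) (hpq : f (dl p) = dl q) :
    ∃ K1 r L1 r', ES K K1 r ∧ ES L L1 r' ∧ Peq (del K1 p) (lk K1 p) (del L1 q) (lk L1 q) := by
  obtain ⟨K1, r, g, hES, heq, hR⟩ := theoremR hK hL hf
  have hK1 := hES.cx hK
  have hp1 := hES.vert hp
  have hg : g (dl p) = dl q := by
    rw [← heq (dl_mem.2 hp1.1)]; show f (r (dl p)) = dl q; rw [hp1.2, hpq]
  obtain ⟨V, hV⟩ := verts_finite hK1
  classical
  have hlt : ∀ w, {w} ∈ K1 → w ≠ p → g (dl w) q < 1 := by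
    intro w hw hwp
    have h1 := hR.bij.mapsTo (dl_mem.2 hw)
    refine lt_of_le_of_ne (le_one_R h1 q) fun e => hwp ?_
    have := hR.bij.injOn (dl_mem.2 hw) (dl_mem.2 hp1.1) (by rw [eq_dl h1 e, hg])
    have h3 := congrArg Finsupp.support this
    rw [supp_dl, supp_dl] at h3
    exact singleton_injective h3
  obtain ⟨ε, hε, hε1, hεV⟩ : ∃ ε : ℝ, 0 < ε ∧ ε < 1 ∧ ∀ w, {w} ∈ K1 → w ≠ p → g (dl w) q < 1 - ε := by
    have : ∀ V : Finset ℕ, ∃ ε : ℝ, 0 < ε ∧ ε < 1 ∧ ∀ w ∈ V, {w} ∈ K1 → w ≠ p → g (dl w) q < 1 - ε := by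
      intro V
      induction V using Finset.induction with
      | empty => exact ⟨1/2, by norm_num, by norm_num, by simp⟩
      | insert x V hx ih =>
        obtain ⟨ε, h1, h2, h3⟩ := ih
        by_cases hh : {x} ∈ K1 ∧ x ≠ p
        · have := hlt x hh.1 hh.2
          refine ⟨min ε ((1 - g (dl x) q) / 2), lt_min h1 (by linarith), lt_of_le_of_lt (min_le_left _ _) h2, ?_⟩
          intro w hw hw1 hw2
          rcases mem_insert.1 hw with rfl | hw
          · have := min_le_right ε ((1 - g (dl w) q) / 2); linarith
          · have := min_le_left ε ((1 - g (dl x) q) / 2); have := h3 w hw hw1 hw2; linarith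
        · refine ⟨ε, h1, h2, ?_⟩
          intro w hw hw1 hw2
          rcases mem_insert.1 hw with rfl | hw
          · exact absurd ⟨hw1, hw2⟩ hh
          · exact h3 w hw hw1 hw2
    obtain ⟨ε, h1, h2, h3⟩ := this V
    exact ⟨ε, h1, h2, fun w hw => h3 w (hV _ hw (by simp)) hw⟩
  have pcK : PC K1 p (Finsupp.lapply q ∘ₗ g) ε := by
    refine ⟨by simp [hg, dl_apply], hp1.1, fun w hw hwp => (hεV w hw hwp).le, fun s hs hsv => ?_⟩
    rcases s.eq_empty_or_nonempty with rfl | ⟨v, hv⟩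
    · simpa using hp1.1
    · exfalso
      have h1 := hsv v hv
      by_cases e : v = p
      · rw [e] at h1; simp [hg, dl_apply] at h1; linarith
      · exact (hεV v (face_vert hK1 hs hv) e).ne h1
  have pcL : PC L q (Finsupp.lapply q) ε := by
    refine ⟨by simp [dl_apply], hq, fun w hw hwp => by simp [dl_apply, hwp]; linarith, fun s hs hsv => ?_⟩
    rcases s.eq_empty_or_nonempty with rfl | ⟨v, hv⟩
    · simpa using hq
    · exfalso
      have h1 := hsv v hv
      by_cases e : v = q
      · rw [e] at h1; simp [dl_apply] at h1; linarith
      · simp [dl_apply, e] at h1; linarith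
  obtain ⟨K2, r2, hE2, hc2⟩ := exists_cut hε hK1 pcK
  obtain ⟨L2, r', hE3, hc3⟩ := exists_cut hε hL pcL
  have hK2 := hE2.cx hK1
  have hL2 := hE3.cx hL
  have A1 : PLeq (g ∘ₗ r2) (R K2) (R L) := PLeq.of_linear (poly_R hK2) _ (by
    rw [LinearMap.coe_comp]; exact hR.bij.comp (hE2.bij hK1))
  have A2 : PLeq r' (R L2) (R L) := PLeq.of_linear (poly_R hL2) _ (hE3.bij hL)
  obtain ⟨i, hi, hil, hir⟩ := A2.symm
  have A := A1.trans hi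
  have hφ : ∀ w ∈ R K2, (Finsupp.lapply q ∘ₗ r') (i ((g ∘ₗ r2) w)) = ((Finsupp.lapply q ∘ₗ g) ∘ₗ r2) w := by
    intro w hw
    rw [LinearMap.comp_apply, hir (A1.2.mapsTo hw)]; rfl
  have k1 : ∀ w ∈ R K2, w ∈ R (del K2 p) ↔ i ((g ∘ₗ r2) w) ∈ R (del L2 q) := by
    intro w hw
    rw [(hc2.val hK2 hε hw).1, (hc3.val hL2 hε (A.2.mapsTo hw)).1, hφ w hw]
  have k2 : ∀ w ∈ R K2, w ∈ R (lk K2 p) ↔ i ((g ∘ₗ r2) w) ∈ R (lk L2 q) := by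
    intro w hw
    rw [(hc2.val hK2 hε hw).2, (hc3.val hL2 hε (A.2.mapsTo hw)).2, hφ w hw]
  have sK : R (del K2 p) ⊆ R K2 := R_mono fun _ h => h.2
  refine ⟨K2, _, L2, r', hES.trans hE2, hE3, _, ⟨A.1.mono (poly_R (cx_del hK2 p)) sK, ?_, A.2.injOn.mono sK, ?_⟩, ?_⟩
  · intro w hw; exact (k1 w (sK hw)).1 hw
  · intro y hy
    obtain ⟨w, hw, rfl⟩ := A.2.surjOn (R_mono (fun _ h => h.2) hy)
    exact ⟨w, (k1 w hw).2 hy, rfl⟩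
  · ext y; constructor
    · rintro ⟨w, hw, rfl⟩; exact (k2 w (R_mono (lk_sub hK2 p) hw)).1 hw
    · intro hy
      obtain ⟨w, hw, rfl⟩ := A.2.surjOn (R_mono (lk_sub hL2 q) hy)
      exact ⟨w, (k2 w hw).2 hy, rfl⟩
end PL
end HomologySpheres

end

open Finset
noncomputable section
namespace HomologySpheres
namespace PL

theorem slide_end {K : Set (Finset ℕ)} (hK : Cx K) {p w m : ℕ} (hpw : p ≠ w) (hm : ∀ s ∈ K, m ∉ s) (he : {p, w} ∈ K)
    (hb : BP (del (lk K w) p) (lk (lk K w) p)) :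
    Peq (del (Star K {p, w} m) p) (lk (Star K {p, w} m) p) (del K p) (lk K p) := by
  have hpm : p ≠ m := fun e => hm _ he (by simp [e])
  have hwm : w ≠ m := fun e => hm _ he (by simp [e])
  have hmem : ∀ s, s ∈ del (Star K {p, w} m) p ↔ p ∉ s ∧ ((m ∉ s ∧ s ∈ K) ∨ (m ∈ s ∧ s.erase m ∪ {p, w} ∈ K)) := by
    intro s
    simp only [del, Star, Set.mem_ofPred_eq, insert_subset_iff, singleton_subset_iff]
    tauto
  have hC := cx_del (cx_star hK {p, w} m) p
  obtain ⟨f, hf, hid⟩ := contraction hC (u := w) (v := m) hwm ((hmem _).2 ⟨by simp [hpw, hpm], Or.inr ⟨by simp, hK.2 _ he _ (by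
      intro i; simp; tauto)⟩⟩) (by
    intro ρ h1 h2 h3 h4
    rw [hmem] at *
    simp only [mem_insert, not_or] at h4 h3 ⊢
    refine ⟨⟨hpw, hpm, h4.1.2⟩, Or.inr ⟨by simp, ?_⟩⟩
    have := h4.2.resolve_left (by simp)
    refine hK.2 _ this.2 _ ?_
    intro i; simp; tauto) (by
    have e1 : del (lk (del (Star K {p, w} m) p) w) m = del (lk K w) p := by
      ext s
      simp only [del.eq_def (lk _ _), lk, Set.mem_ofPred_eq, hmem, mem_insert, not_or]
      constructor
      · rintro ⟨h1, h2, ⟨_, h3⟩, h4⟩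
        exact ⟨h3, h2, (h4.resolve_right (by simp [h1, hwm.symm])).2⟩
      · rintro ⟨h1, h2, h3⟩
        have h4 : m ∉ s := fun h => hm _ h3 (by simp [h])
        exact ⟨h4, h2, ⟨hpw, h1⟩, Or.inl ⟨⟨hwm.symm, h4⟩, h3⟩⟩
    have e2 : lk (lk (del (Star K {p, w} m) p) w) m = lk (lk K w) p := by
      ext s
      simp only [lk, Set.mem_ofPred_eq, hmem, mem_insert, not_or]
      constructor
      · rintro ⟨h1, ⟨_, h2⟩, ⟨_, _, h3⟩, h4⟩
        refine ⟨h3, ⟨hpw.symm, h2⟩, ?_⟩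
        refine hK.2 _ (h4.resolve_left (by simp)).2 _ ?_
        intro i; simp only [mem_insert, mem_union, mem_erase, mem_singleton]
        rintro (rfl | rfl | h)
        · tauto
        · tauto
        · exact Or.inl ⟨fun e => h1 (e ▸ h), by tauto⟩
      · rintro ⟨h1, ⟨_, h2⟩, h3⟩
        have h4 : m ∉ s := fun h => hm _ h3 (by simp [h])
        refine ⟨h4, ⟨hwm, h2⟩, ⟨hpw, hpm, h1⟩, Or.inr ⟨by simp, hK.2 _ h3 _ ?_⟩⟩
        intro i; simp; tauto
    rw [e1, e2]; exact hb)
  have e3 : Contr (del (Star K {p, w} m) p) w m = img (Equiv.swap w m) (del K p) := by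
    ext s
    rw [mem_img_swap (fun s hs => hm s hs.2) hwm]
    simp only [Contr, Set.mem_ofPred_eq, hmem]
    simp only [mem_insert, mem_erase, del, Set.mem_ofPred_eq, not_or, not_and]
    refine and_congr_right fun hw => ?_
    constructor
    · rintro (⟨h1, ⟨h2, h3⟩ | ⟨h2, h3⟩⟩ | ⟨h1, ⟨_, h2⟩, ⟨h3, h4⟩ | ⟨h3, h4⟩⟩)
      · tauto
      · refine Or.inr ⟨h2, ⟨hpw, fun _ => h1⟩, hK.2 _ h3 _ ?_⟩
        intro i; simp; tauto
      · exact Or.inr ⟨h1, ⟨hpw, h2⟩, h4⟩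
      · simp [hwm.symm] at h3
    · rintro (⟨h1, h2, h3⟩ | ⟨h1, ⟨_, h2⟩, h3⟩)
      · tauto
      · exact Or.inr ⟨h1, ⟨hpw, h2⟩, Or.inl ⟨⟨hwm.symm, by simp⟩, h3⟩⟩
  rw [e3] at hf
  have h1 : Peq (del (Star K {p, w} m) p) (lk (Star K {p, w} m) p) (img (Equiv.swap w m) (del K p)) (img (Equiv.swap w m) (lk K p)) := by
    refine ⟨f, hf, ?_⟩
    rw [star_lk_end hK hpw hm he]
    rw [Set.image_congr (g := id), Set.image_id]
    intro x hx
    refine hid x ?_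
    have := ((mem_img_swap (fun s hs => hm s (lk_sub hK p hs)) hwm).1 hx.2.2).1
    simpa using this
  refine h1.trans (Peq.symm (lk_sub_del hK p) (peq_img (Equiv.swap w m).injective (cx_del hK p) _))

theorem to_vertex {K L : Set (Finset ℕ)} (hL : Cx L) {f : Vec → Vec} (hf : PLeq f (R K) (R L)) {p q : ℕ}
    (hp : {p} ∈ K) (hq : ∀ s ∈ L, q ∉ s) :
    (f (dl p)).support ∈ L ∧ (f (dl p)).support.Nonempty ∧ {q} ∈ Star L (f (dl p)).support q ∧
    ∃ f', PLeq f' (R K) (R (Star L (f (dl p)).support q)) ∧ f' (dl p) = dl q := by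
  have h1 := hf.2.mapsTo (dl_mem.2 hp)
  have hq' := hq _ h1.2.2
  have hne : (f (dl p)).support.Nonempty := by
    rw [Finset.nonempty_iff_ne_empty, Ne, Finsupp.support_eq_empty]; exact ne_zero_R h1
  have hq1 : {q} ∈ Star L (f (dl p)).support q := by
    refine ⟨fun h => ?_, Or.inr ⟨by simp, by simpa using h1.2.2⟩⟩
    obtain ⟨x, hx⟩ := hne
    have := h hx; simp at this; exact hq' (this ▸ hx)
  refine ⟨h1.2.2, hne, hq1, ?_⟩
  have hs := star_image hL hq hq' (p := f (dl p)) ⟨h1.1, h1.2.1, fun _ h => h⟩ rfl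
  obtain ⟨g, hg, h2, h3⟩ := hs.symm
  refine ⟨_, hf.trans hg, ?_⟩
  have := h2 (dl_mem.2 hq1)
  rwa [sub_dl_self] at this

def lkj (L : Set (Finset ℕ)) (σ : Finset ℕ) : Set (Finset ℕ) := {τ | ¬ σ ⊆ τ ∧ τ ∪ σ ∈ L}

theorem lk_star_self {L : Set (Finset ℕ)} {σ : Finset ℕ} {q : ℕ} (hq : ∀ s ∈ L, q ∉ s) (hσ : q ∉ σ) :
    lk (Star L σ q) q = lkj L σ := by
  ext τ
  simp only [lk, Star, lkj, Set.mem_ofPred_eq]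
  constructor
  · rintro ⟨h1, h2, h3⟩
    have := (h3.resolve_left (by simp)).2
    rw [erase_insert h1] at this
    exact ⟨fun h => h2 (h.trans (subset_insert _ _)), this⟩
  · rintro ⟨h1, h2⟩
    have h3 : q ∉ τ := fun h => hq _ h2 (by simp [h])
    refine ⟨h3, fun h => h1 fun i hi => ?_, Or.inr ⟨by simp, by rwa [erase_insert h3]⟩⟩
    rcases mem_insert.1 (h hi) with rfl | h
    · exact absurd hi hσ
    · exact h

theorem link_carrier {K L : Set (Finset ℕ)} (hK : Cx K) (hL : Cx L) {f : Vec → Vec} (hf : PLeq f (R K) (R L)) {p : ℕ}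
    (hp : {p} ∈ K) : (f (dl p)).support ∈ L ∧ (f (dl p)).support.Nonempty ∧ Heq (lk K p) (lkj L (f (dl p)).support) := by
  obtain ⟨q, hq, -⟩ := exists_fresh hL.1 ∅
  obtain ⟨h1, h2, h3, f', hf', h4⟩ := to_vertex hL hf hp hq
  refine ⟨h1, h2, ?_⟩
  obtain ⟨K1, r, L1, r', e1, e2, e3⟩ := local_pair hK (cx_star hL _ _) hf' hp h3 h4
  rw [← lk_star_self hq (hq _ h1)]
  exact (es_lk hK e1 hp).symm.trans ((e3.heq' (cx_lk (e1.cx hK) _) (lk_sub_del (e1.cx hK) _)).trans (es_lk (cx_star hL _ _) e2 h3))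

theorem emp_bd {Ω : Finset ℕ} (h : 1 ≤ Ω.card) : ∅ ∈ bd Ω := by
  rw [Finset.one_le_card] at h
  exact Finset.ssubset_iff_subset_ne.2 ⟨by simp, h.ne_empty.symm⟩

theorem lkj_bd {Ω σ : Finset ℕ} (hσ : σ ⊆ Ω) : lkj (bd Ω) σ = {s | s ⊆ σ ∪ Ω \ σ ∧ ¬ σ ⊆ s ∧ ¬ Ω \ σ ⊆ s} := by
  ext s
  have : σ ∪ Ω \ σ = Ω := by ext i; have := @hσ i; simp; tauto
  rw [this]
  simp only [lkj, bd, Set.mem_ofPred_eq, Finset.ssubset_def]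
  constructor
  · rintro ⟨h1, h2, h3⟩
    refine ⟨(subset_union_left).trans h2, h1, fun h => h3 ?_⟩
    intro i hi
    by_cases h' : i ∈ σ
    · simp [h']
    · simp [h (mem_sdiff.2 ⟨hi, h'⟩)]
  · rintro ⟨h1, h2, h3⟩
    refine ⟨h2, union_subset h1 hσ, fun h => h3 fun i hi => ?_⟩
    rw [mem_sdiff] at hi
    have := h hi.1
    simpa [hi.2] using this

theorem cx_lkj {L : Set (Finset ℕ)} (hL : Cx L) (σ : Finset ℕ) : Cx (lkj L σ) :=
  ⟨hL.1.subset fun s hs => hL.2 _ hs.2 _ subset_union_left, fun s hs t ht =>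
    ⟨fun h => hs.1 (h.trans ht), hL.2 _ hs.2 _ (union_subset_union ht (le_refl _))⟩⟩

theorem Sph.lk {k : ℕ} {S : Set (Finset ℕ)} (h : Sph (k+1) S) {p : ℕ} (hp : {p} ∈ S) : Sph k (lk S p) := by
  obtain ⟨Ω, h1, f, hf⟩ := h.eqv
  obtain ⟨h2, h3, h4⟩ := link_carrier h.cx (cx_bd Ω) hf hp
  set σ := (f (dl p)).support
  have h2' := Finset.ssubset_iff_subset_ne.1 h2
  have hne : (Ω \ σ).Nonempty := by
    rw [sdiff_nonempty]; exact h2.2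
  rw [lkj_bd h2'.1] at h4
  obtain ⟨Ω', h5, h6⟩ := bp_join h3 hne disjoint_sdiff
  rw [← card_union_of_disjoint disjoint_sdiff] at h5
  have e : σ ∪ Ω \ σ = Ω := by ext i; have := @h2'.1 i; simp; tauto
  have h7 : Cx {s | s ⊆ σ ∪ Ω \ σ ∧ ¬ σ ⊆ s ∧ ¬ Ω \ σ ⊆ s} := by rw [← lkj_bd h2'.1]; exact cx_lkj (cx_bd Ω) _
  have h8 := h6.heq' h7 (fun s hs => And.intro hs.1 hs.2.1)
  rw [e] at h5
  refine ⟨cx_lk h.cx p, emp_lk hp, ?_, Ω', by omega, h4.trans h8⟩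
  have := h3.card_pos
  have := hne.card_pos
  have := card_sdiff_add_card_eq_card h2'.1
  omega

end PL
end HomologySpheres

end

open Finset
noncomputable section
namespace HomologySpheres
namespace PL

theorem ES.pleq {K K1 : Set (Finset ℕ)} {r} (hK : Cx K) (h : ES K K1 r) : PLeq r (R K1) (R K) :=
  PLeq.of_linear (poly_R (h.cx hK)) _ (h.bij hK)

theorem ES.sph {k : ℕ} {K K1 : Set (Finset ℕ)} {r} (h : ES K K1 r) (hK : Sph k K) (h0 : ∅ ∈ K1) : Sph k K1 :=
  hK.of_heq (h.cx hK.cx) h0 ⟨_, h.pleq hK.cx⟩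

theorem slide {k : ℕ} (hn : ∀ S, Sph k S → ∀ v, {v} ∈ S → BP (del S v) (lk S v)) {K K1 : Set (Finset ℕ)} {r} (hK : Sph (k+1) K)
    (h : ES K K1 r) {p : ℕ} (hp : {p} ∈ K) : Peq (del K1 p) (lk K1 p) (del K p) (lk K p) := by
  induction h with
  | refl => exact ⟨_, PLeq.refl (poly_R (cx_del hK.cx p)), Set.image_id' _⟩
  | @step K1 r x y m c h hxy he hm h0 h1 ih =>
    have hK1 := h.cx hK.cx
    have hS1 : Sph (k+1) K1 := h.sph hK (hK1.2 _ he _ (by simp))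
    have hpm : p ≠ m := fun e => hm _ (h.vert hp).1 (by simp [e])
    refine Peq.trans ?_ ih
    by_cases hx : p = x
    · subst hx
      exact slide_end hK1 hxy hm he (hn _ (hS1.lk (face_vert hK1 he (by simp))) p ⟨by simpa using hxy.symm, by rwa [pair_comm]⟩)
    by_cases hy : p = y
    · subst hy
      rw [pair_comm] at he ⊢
      exact slide_end hK1 hxy.symm hm he (hn _ (hS1.lk (face_vert hK1 he (by simp))) p ⟨by simpa using hxy, by rwa [pair_comm]⟩)
    rw [star_lk (by simp [hx, hy]) hpm, star_del (by simp [hx, hy]) hpm]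
    exact star_peq (cx_del hK1 p) (cx_lk hK1 p) (lk_sub_del hK1 p) ⟨x, by simp⟩ (fun s hs => hm s hs.2)
      (fun h => hm _ he h)

theorem nice : ∀ k S, Sph k S → ∀ v, {v} ∈ S → BP (del S v) (lk S v) := by
  intro k
  induction k with
  | zero => intro S hS; exact absurd hS.pos (by simp)
  | succ k ih =>
    intro S hS v hv
    obtain ⟨Ω, h1, f, hf⟩ := hS.eqv
    have hL := cx_bd Ω
    obtain ⟨q, hq, hqΩ⟩ := exists_fresh hL.1 Ω
    obtain ⟨h1, h2, h3, f', hf', h4⟩ := to_vertex hL hf hv hq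
    set σ := (f (dl v)).support
    have hLS : Sph (k+1) (Star (bd Ω) σ q) := by
      refine ⟨cx_star hL _ _, (cx_star hL _ _).2 _ h3 _ (by simp), hS.pos, Ω, by assumption, ?_⟩
      exact (star_peq hL hL (le_refl _) h2 hq (hq _ h1)).heq
    obtain ⟨K1, r, L1, r', e1, e2, e3⟩ := local_pair hS.cx hLS.cx hf' hv h3 h4
    have s1 := slide ih hS e1 hv
    have s2 := slide ih hLS e2 h3
    have hσ := (Finset.ssubset_iff_subset_ne.1 h1).1
    have hne : (Ω \ σ).Nonempty := sdiff_nonempty.2 h1.2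
    obtain ⟨Ω', h5, h6⟩ := bp_join h2 hne disjoint_sdiff
    have e : σ ∪ Ω \ σ = Ω := by ext i; have := @hσ i; simp; tauto
    have hBP : BP (del (Star (bd Ω) σ q) q) (lk (Star (bd Ω) σ q) q) := by
      refine ⟨Ω', ?_, ?_⟩
      · rw [← card_pos]
        have := h2.card_pos; have := hne.card_pos; omega
      · rw [lk_star_self hq (hq _ h1), lkj_bd hσ]
        convert h6 using 1
        ext s
        simp only [del, Star, Set.mem_ofPred_eq, bd, e]
        constructor
        · rintro ⟨h1, h2, h3⟩
          exact ⟨(h3.resolve_right (fun h => h1 h.1)).2.1, h2⟩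
        · rintro ⟨h1, h2⟩
          have : q ∉ s := fun h => hqΩ (h1 h)
          exact ⟨this, h2, Or.inl ⟨this, h1, fun h => h2 (hσ.trans h)⟩⟩
    refine hBP.of_peq ((Peq.symm (lk_sub_del (e1.cx hS.cx) _) s1).trans (e3.trans s2))

def lkS (L : Set (Finset ℕ)) (σ : Finset ℕ) : Set (Finset ℕ) := {τ | Disjoint τ σ ∧ τ ∪ σ ∈ L}

theorem lkS_insert {L : Set (Finset ℕ)} {σ : Finset ℕ} {v : ℕ} (hv : v ∉ σ) : lkS L (insert v σ) = lk (lkS L σ) v := by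
  ext s
  have : s ∪ insert v σ = insert v s ∪ σ := by ext i; simp
  simp only [lkS, lk, Set.mem_ofPred_eq, disjoint_insert_left, disjoint_insert_right, this]
  tauto

theorem lkS_empty {L : Set (Finset ℕ)} : lkS L ∅ = L := by ext s; simp [lkS]

theorem lkS_cons {L : Set (Finset ℕ)} {σ : Finset ℕ} {v : ℕ} (hv : v ∉ σ) : lkS L (insert v σ) = lkS (lk L v) σ := by
  ext s
  have : s ∪ insert v σ = insert v (s ∪ σ) := by ext i; simp
  simp only [lkS, lk, Set.mem_ofPred_eq, disjoint_insert_right, this, mem_union]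
  tauto

theorem Sph.lkS {k : ℕ} {S : Set (Finset ℕ)} (h : Sph k S) (σ : Finset ℕ) (hσ : σ ∈ S) :
    ∃ j, j + σ.card = k ∧ Sph j (lkS S σ) := by
  induction σ using Finset.induction with
  | empty => exact ⟨k, by simp, by rwa [lkS_empty]⟩
  | insert v σ hv ih =>
    obtain ⟨j, h1, h2⟩ := ih (h.cx.2 _ hσ _ (subset_insert _ _))
    obtain ⟨j, rfl⟩ : ∃ i, j = i + 1 := ⟨j - 1, by have := h2.pos; omega⟩
    rw [lkS_insert hv, card_insert_of_notMem hv]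
    exact ⟨j, by omega, h2.lk ⟨by simpa using hv, by simpa using hσ⟩⟩

theorem join_sph {j : ℕ} {X : Set (Finset ℕ)} (h : Sph j X) {σ : Finset ℕ} (hσ : σ.Nonempty) (hav : Av σ X) {k : ℕ} (hk : k + 1 = j + σ.card) :
    Sph k {s | s \ σ ∈ X ∧ ¬ σ ⊆ s} := by
  obtain ⟨Ω, h1, h2, f, hf⟩ := h.off σ
  have hΩ : Ω.Nonempty := by rw [← card_pos]; have := h.pos; omega
  have hΩ1 : ∅ ∈ bd Ω := emp_bd hΩ.card_pos
  have hQ : Cx {s | s \ σ ∈ X ∧ ¬ σ ⊆ s} := by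
    refine ⟨(cx_jn (A := σ) h.cx).1.subset fun s hs => hs.1, fun s hs t ht => ⟨h.cx.2 _ hs.1 _ (sdiff_subset_sdiff ht (le_refl _)), fun h => hs.2 (h.trans ht)⟩⟩
  have key : ∀ a ⊆ σ, ∀ b : Finset ℕ, Disjoint b σ → (a ∪ b) \ σ = b ∧ (σ ⊆ a ∪ b ↔ a = σ) := by
    intro a ha b hb
    rw [disjoint_left] at hb
    refine ⟨?_, ⟨fun h => ?_, fun h => by rw [h]; exact subset_union_left⟩⟩
    · ext i; have := @ha i; have := @hb i; simp; tauto
    · refine ha.antisymm fun i hi => ?_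
      rcases mem_union.1 (h hi) with h | h
      · exact h
      · exact absurd hi (hb h)
  have hYA : Av σ (bd Ω) := fun s hs => h2.mono_left hs.1
  have hj := jmap_eq h.cx hav h.emp hYA hΩ1 hf hQ (fun s hs => hs.1) (Q' := {s | s \ σ ∈ bd Ω ∧ ¬ σ ⊆ s})
    (fun s hs => hs.1) (by
      intro a ha
      have e := key a ha ∅ (by simp)
      rw [union_empty] at e
      simp only [Set.mem_ofPred_eq, e, h.emp, hΩ1]) (by
      intro a ha x hx
      have hfx := hf.2.mapsTo hx
      have e := key a ha _ (hav _ hx.2.2)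
      have e' := key a ha _ (hYA _ hfx.2.2)
      simp only [Set.mem_ofPred_eq, e, e', hx.2.2, hfx.2.2])
  obtain ⟨Ω', h5, h6⟩ := bp_join hσ hΩ h2.symm
  have e : {s | s ⊆ σ ∪ Ω ∧ ¬ σ ⊆ s ∧ ¬ Ω ⊆ s} = {s | s \ σ ∈ bd Ω ∧ ¬ σ ⊆ s} := by
    ext s
    have : s \ σ ∈ bd Ω ↔ s ⊆ σ ∪ Ω ∧ ¬ Ω ⊆ s := by
      rw [bd, Set.mem_ofPred_eq, Finset.ssubset_def]
      refine and_congr ?_ (not_congr ?_)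
      · rw [sdiff_le_iff]; rfl
      · rw [subset_sdiff]; exact and_iff_left h2
    simp only [Set.mem_ofPred_eq, this]; tauto
  have h7 : Cx {s | s ⊆ σ ∪ Ω ∧ ¬ σ ⊆ s ∧ ¬ Ω ⊆ s} :=
    ⟨(cx_full (σ ∪ Ω)).1.subset fun s hs => hs.1, fun s hs t ht => ⟨ht.trans hs.1, fun h => hs.2.1 (h.trans ht), fun h => hs.2.2 (h.trans ht)⟩⟩
  have h8 := h6.heq' h7 (fun s hs => And.intro hs.1 hs.2.1)
  rw [e] at h8
  refine ⟨hQ, ⟨by simpa using h.emp, fun h => by have := hσ.mono h; simp at this⟩, ?_, Ω', by omega, Heq.trans ⟨_, hj⟩ h8⟩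
  have := h.pos; have := hσ.card_pos; omega

structure Man (k : ℕ) (K : Set (Finset ℕ)) : Prop where
  cx : Cx K
  sph : ∀ v, {v} ∈ K → Sph k (lk K v)

theorem lkj_eq {L : Set (Finset ℕ)} (σ : Finset ℕ) : lkj L σ = {s | s \ σ ∈ lkS L σ ∧ ¬ σ ⊆ s} := by
  ext s
  simp only [lkj, lkS, Set.mem_ofPred_eq, sdiff_union_self_eq_union]
  have : Disjoint (s \ σ) σ := sdiff_disjoint
  tauto

theorem Man.of_heq {k : ℕ} {K L : Set (Finset ℕ)} (hL : Man k L) (hK : Cx K) (h : Heq K L) : Man k K := by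
  refine ⟨hK, fun p hp => ?_⟩
  obtain ⟨f, hf⟩ := h
  obtain ⟨h1, h2, h3⟩ := link_carrier hK hL.cx hf hp
  set σ := (f (dl p)).support
  obtain ⟨v, hv⟩ := h2
  have e : σ = insert v (σ.erase v) := (insert_erase hv).symm
  obtain ⟨j, h4, h5⟩ := (hL.sph v (face_vert hL.cx h1 hv)).lkS (σ.erase v) ⟨by simp, by rwa [← e]⟩
  rw [← lkS_cons (by simp), ← e] at h5
  have hc := card_erase_add_one hv
  have := join_sph h5 ⟨v, hv⟩ (fun s hs => hs.1) (k := k) (by omega)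
  rw [← lkj_eq] at this
  exact this.of_heq (cx_lk hK p) (emp_lk hp) h3

end PL
end HomologySpheres

end

open Finset
noncomputable section
namespace HomologySpheres
namespace PL

abbrev Chn := Finset ℕ →₀ ZMod 2
def ee (s : Finset ℕ) : Chn := Finsupp.single s 1
def lin (f : Finset ℕ → Chn) : Chn →ₗ[ZMod 2] Chn := Finsupp.linearCombination (ZMod 2) f

theorem lin_ee (f : Finset ℕ → Chn) (s : Finset ℕ) : lin f (ee s) = f s := by
  simp [lin, ee]

theorem ch_ext {S T : Chn →ₗ[ZMod 2] Chn} (h : ∀ s, S (ee s) = T (ee s)) : S = T := by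
  refine Finsupp.lhom_ext' fun s => ?_
  refine LinearMap.ext_ring ?_
  exact h s

theorem chn_add_self (c : Chn) : c + c = 0 := by
  ext s; exact CharTwo.add_self_eq_zero (c s)

theorem chn_cancel (a b c : Chn) : (a + b) + (b + c) = a + c := by
  have := chn_add_self b
  calc (a + b) + (b + c) = a + (b + b) + c := by abel
    _ = a + c := by rw [this, add_zero]

def Ch (K : Set (Finset ℕ)) (n : ℕ) : Submodule (ZMod 2) Chn := Finsupp.supported (ZMod 2) (ZMod 2) {s | s ∈ K ∧ s.card = n}

theorem mem_Ch {K : Set (Finset ℕ)} {n : ℕ} {c : Chn} : c ∈ Ch K n ↔ ∀ s, c s ≠ 0 → s ∈ K ∧ s.card = n := by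
  rw [Ch, Finsupp.mem_supported]
  simp only [Set.subset_def, mem_coe, Finsupp.mem_support_iff]
  rfl

theorem ee_mem {K : Set (Finset ℕ)} {n : ℕ} {s : Finset ℕ} (h : s ∈ K) (h' : s.card = n) : ee s ∈ Ch K n :=
  Finsupp.single_mem_supported _ _ ⟨h, h'⟩

theorem Ch_mono {K L : Set (Finset ℕ)} (h : K ⊆ L) {n : ℕ} {c : Chn} (hc : c ∈ Ch K n) : c ∈ Ch L n :=
  mem_Ch.2 fun s hs => ⟨h (mem_Ch.1 hc s hs).1, (mem_Ch.1 hc s hs).2⟩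

theorem map_mem {K : Set (Finset ℕ)} {n : ℕ} {c : Chn} (hc : c ∈ Ch K n) {T : Chn →ₗ[ZMod 2] Chn} {N : Submodule (ZMod 2) Chn}
    (h : ∀ s ∈ K, s.card = n → T (ee s) ∈ N) : T c ∈ N := by
  rw [← Finsupp.sum_single c, Finsupp.sum, map_sum]
  refine Submodule.sum_mem _ fun s hs => ?_
  have := mem_Ch.1 hc s (Finsupp.mem_support_iff.1 hs)
  have e : Finsupp.single s (c s) = c s • ee s := by simp [ee]
  rw [e, map_smul]
  exact N.smul_mem _ (h s this.1 this.2)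

theorem map_congr {K : Set (Finset ℕ)} {n : ℕ} {c : Chn} (hc : c ∈ Ch K n) {S T : Chn →ₗ[ZMod 2] Chn}
    (h : ∀ s ∈ K, s.card = n → S (ee s) = T (ee s)) : S c = T c := by
  have := map_mem hc (T := S - T) (N := ⊥) (fun s hs hn => by simp [h s hs hn])
  rw [Submodule.mem_bot, LinearMap.sub_apply, sub_eq_zero] at this
  exact this

def bdy : Chn →ₗ[ZMod 2] Chn := lin fun s => ∑ v ∈ s, ee (s.erase v)
def cone (p : ℕ) : Chn →ₗ[ZMod 2] Chn := lin fun s => if p ∈ s then 0 else ee (insert p s)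
def iota (v : ℕ) : Chn →ₗ[ZMod 2] Chn := lin fun s => if v ∈ s then ee (s.erase v) else 0
def push (φ : ℕ → ℕ) : Chn →ₗ[ZMod 2] Chn := lin fun s => if (s.image φ).card = s.card then ee (s.image φ) else 0

theorem bdy_ee (s : Finset ℕ) : bdy (ee s) = ∑ v ∈ s, ee (s.erase v) := lin_ee _ _
theorem cone_ee (p : ℕ) (s : Finset ℕ) : cone p (ee s) = if p ∈ s then 0 else ee (insert p s) := lin_ee _ _
theorem iota_ee (p : ℕ) (s : Finset ℕ) : iota p (ee s) = if p ∈ s then ee (s.erase p) else 0 := lin_ee _ _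
theorem push_ee (φ : ℕ → ℕ) (s : Finset ℕ) : push φ (ee s) = if (s.image φ).card = s.card then ee (s.image φ) else 0 := lin_ee _ _

theorem bdy_cone (p : ℕ) (c : Chn) : bdy (cone p c) = c + cone p (bdy c) := by
  suffices h : bdy ∘ₗ cone p = LinearMap.id + cone p ∘ₗ bdy from LinearMap.congr_fun h c
  refine ch_ext fun s => ?_
  simp only [LinearMap.comp_apply, LinearMap.add_apply, LinearMap.id_apply, cone_ee, bdy_ee, map_sum]
  by_cases hp : p ∈ s
  · rw [if_pos hp, map_zero, ← add_sum_erase _ _ hp]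
    rw [sum_eq_zero (fun v hv => by rw [if_pos]; rw [mem_erase] at hv ⊢; exact ⟨hv.1.symm, hp⟩)]
    rw [if_neg (by simp), insert_erase hp, add_zero, chn_add_self]
  · rw [if_neg hp, bdy_ee, sum_insert hp, erase_insert hp]
    congr 1
    refine sum_congr rfl fun v hv => ?_
    rw [if_neg (by simp [hp]), erase_insert_of_ne (show p ≠ v from fun e => hp (by rw [e]; exact hv))]

theorem bdy_bdy (c : Chn) : bdy (bdy c) = 0 := by
  suffices h : bdy ∘ₗ bdy = 0 from LinearMap.congr_fun h c
  refine ch_ext fun s => ?_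
  rw [LinearMap.comp_apply, LinearMap.zero_apply]
  induction s using Finset.induction with
  | empty => simp [bdy_ee]
  | insert p s hp ih =>
    have e : ee (insert p s) = cone p (ee s) := by rw [cone_ee, if_neg hp]
    rw [e, bdy_cone, map_add, bdy_cone, ih, map_zero, add_zero, chn_add_self]

theorem push_cone (φ : ℕ → ℕ) (p : ℕ) (c : Chn) : push φ (cone p c) = cone (φ p) (push φ c) := by
  suffices h : push φ ∘ₗ cone p = cone (φ p) ∘ₗ push φ from LinearMap.congr_fun h c
  refine ch_ext fun s => ?_
  simp only [LinearMap.comp_apply, cone_ee, push_ee]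
  by_cases hp : p ∈ s
  · rw [if_pos hp, map_zero]
    split_ifs
    · rw [cone_ee, if_pos (mem_image_of_mem _ hp)]
    · rw [map_zero]
  · rw [if_neg hp, push_ee, image_insert, card_insert_of_notMem hp]
    have hle := card_image_le (s := s) (f := φ)
    split_ifs with h1 h2 h2
    · rw [cone_ee, if_neg]
      intro h; rw [insert_eq_of_mem h] at h1; omega
    · have := card_insert_le (φ p) (s.image φ); omega
    · rw [cone_ee, if_pos]
      by_contra h; rw [card_insert_of_notMem h] at h1; omega
    · rw [map_zero]

theorem bdy_push (φ : ℕ → ℕ) (c : Chn) : bdy (push φ c) = push φ (bdy c) := by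
  suffices h : bdy ∘ₗ push φ = push φ ∘ₗ bdy from LinearMap.congr_fun h c
  refine ch_ext fun s => ?_
  rw [LinearMap.comp_apply, LinearMap.comp_apply]
  induction s using Finset.induction with
  | empty => simp [bdy_ee, push_ee]
  | insert p s hp ih =>
    have e : ee (insert p s) = cone p (ee s) := by rw [cone_ee, if_neg hp]
    rw [e, push_cone, bdy_cone, bdy_cone, ih, map_add, push_cone]

theorem bdy_iota (v : ℕ) (c : Chn) : bdy (iota v c) = iota v (bdy c) := by
  suffices h : bdy ∘ₗ iota v = iota v ∘ₗ bdy from LinearMap.congr_fun h c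
  refine ch_ext fun s => ?_
  simp only [LinearMap.comp_apply, iota_ee, bdy_ee, map_sum]
  by_cases hv : v ∈ s
  · rw [if_pos hv, bdy_ee, ← add_sum_erase s (fun x => if v ∈ s.erase x then ee ((s.erase x).erase v) else 0) hv, if_neg (by simp), zero_add]
    refine sum_congr rfl fun x hx => ?_
    rw [mem_erase] at hx
    rw [if_pos (by simp [hv, hx.1.symm]), erase_right_comm]
  · rw [if_neg hv, map_zero, sum_eq_zero]
    intro x hx
    rw [if_neg (fun h => hv (mem_of_mem_erase h))]

theorem bdy_mem {K : Set (Finset ℕ)} (hK : Cx K) {n : ℕ} {c : Chn} (hc : c ∈ Ch K (n+1)) : bdy c ∈ Ch K n := by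
  refine map_mem hc fun s hs hn => ?_
  rw [bdy_ee]
  refine Submodule.sum_mem _ fun v hv => ee_mem (hK.2 _ hs _ (erase_subset _ _)) (by rw [card_erase_of_mem hv]; omega)

theorem push_mem {K L : Set (Finset ℕ)} {φ : ℕ → ℕ} (h : ∀ s ∈ K, s.image φ ∈ L) {n : ℕ} {c : Chn} (hc : c ∈ Ch K n) :
    push φ c ∈ Ch L n := by
  refine map_mem hc fun s hs hn => ?_
  rw [push_ee]
  split_ifs with h1
  · exact ee_mem (h s hs) (by omega)
  · exact Submodule.zero_mem _

theorem iota_mem {K L : Set (Finset ℕ)} {v : ℕ} (h : ∀ s ∈ K, v ∈ s → s.erase v ∈ L) {n : ℕ} {c : Chn} (hc : c ∈ Ch K (n+1)) :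
    iota v c ∈ Ch L n := by
  refine map_mem hc fun s hs hn => ?_
  rw [iota_ee]
  split_ifs with h1
  · exact ee_mem (h s hs h1) (by rw [card_erase_of_mem h1]; omega)
  · exact Submodule.zero_mem _

theorem cone_mem {K L : Set (Finset ℕ)} {v : ℕ} (h : ∀ s ∈ K, insert v s ∈ L) {n : ℕ} {c : Chn} (hc : c ∈ Ch K n) :
    cone v c ∈ Ch L (n+1) := by
  refine map_mem hc fun s hs hn => ?_
  rw [cone_ee]
  split_ifs with h1
  · exact Submodule.zero_mem _
  · exact ee_mem (h s hs) (by rw [card_insert_of_notMem h1]; omega)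

theorem bdy_zero_level {K : Set (Finset ℕ)} {c : Chn} (hc : c ∈ Ch K 0) : bdy c = 0 := by
  have := map_mem hc (T := bdy) (N := ⊥) (fun s _ hn => by rw [card_eq_zero.1 hn, bdy_ee]; simp)
  simpa using this

theorem iota_zero_level {K : Set (Finset ℕ)} {c : Chn} (v : ℕ) (hc : c ∈ Ch K 0) : iota v c = 0 := by
  have := map_mem hc (T := iota v) (N := ⊥) (fun s _ hn => by rw [card_eq_zero.1 hn, iota_ee]; simp)
  simpa using this

/-- Vanishing of reduced mod two homology at level `n`. -/
def Van (n : ℕ) (K : Set (Finset ℕ)) : Prop := ∀ c ∈ Ch K n, bdy c = 0 → ∃ c' ∈ Ch K (n+1), bdy c' = c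

/-- one vertex change -/
theorem contig1 {K L : Set (Finset ℕ)} {φ ψ : ℕ → ℕ} {v : ℕ} (h : ∀ i, i ≠ v → φ i = ψ i)
    (hc : ∀ s ∈ K, s.Nonempty → s.image φ ∪ s.image ψ ∈ L) (hL : Cx L) {n : ℕ} {z : Chn} (hz : z ∈ Ch K n) (hz0 : bdy z = 0) :
    ∃ y ∈ Ch L (n+1), bdy y = push φ z + push ψ z := by
  refine ⟨cone (φ v) (cone (ψ v) (push φ (iota v z))), ?_, ?_⟩
  · refine map_mem hz (T := cone (φ v) ∘ₗ cone (ψ v) ∘ₗ push φ ∘ₗ iota v) fun s hs hn => ?_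
    simp only [LinearMap.comp_apply, iota_ee]
    split_ifs with h1
    · rw [push_ee]
      split_ifs with h2
      · rw [cone_ee]
        split_ifs with h3
        · rw [map_zero]; exact Submodule.zero_mem _
        · rw [cone_ee]
          split_ifs with h4
          · exact Submodule.zero_mem _
          · refine ee_mem (hL.2 _ (hc s hs ⟨v, h1⟩) _ ?_) ?_
            · intro i hi
              simp only [mem_insert, mem_image, mem_erase, mem_union] at hi ⊢
              rcases hi with rfl | rfl | ⟨a, ha, rfl⟩
              · exact Or.inl ⟨v, h1, rfl⟩
              · exact Or.inr ⟨v, h1, rfl⟩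
              · exact Or.inl ⟨a, ha.2, rfl⟩
            · rw [card_insert_of_notMem h4, card_insert_of_notMem h3, h2, card_erase_of_mem h1]
              have : 0 < s.card := card_pos.2 ⟨v, h1⟩
              omega
      · simp
    · simp
  · rw [bdy_cone, bdy_cone, bdy_push, bdy_iota, hz0]
    simp only [map_zero, add_zero]
    rw [← push_cone]
    refine map_congr hz (S := cone (ψ v) ∘ₗ push φ ∘ₗ iota v + push φ ∘ₗ cone v ∘ₗ iota v) (T := push φ + push ψ) fun s hs hn => ?_
    simp only [LinearMap.comp_apply, LinearMap.add_apply, iota_ee]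
    by_cases h1 : v ∈ s
    · rw [if_pos h1]
      have e1 : push φ (ee (s.erase v)) = push ψ (ee (s.erase v)) := by
        have : (s.erase v).image φ = (s.erase v).image ψ := image_congr fun i hi => h i (mem_erase.1 hi).1
        rw [push_ee, push_ee, this]
      rw [e1, ← push_cone, cone_ee, if_neg (by simp), insert_erase h1, add_comm]
    · rw [if_neg h1]
      have : s.image φ = s.image ψ := image_congr fun i hi => h i (fun e => h1 (e ▸ hi))
      rw [push_ee, push_ee, this, chn_add_self]; simp

theorem contig {K L : Set (Finset ℕ)} (hK : Cx K) {φ ψ : ℕ → ℕ}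
    (hc : ∀ s ∈ K, s.Nonempty → s.image φ ∪ s.image ψ ∈ L) (hL : Cx L) {n : ℕ} {z : Chn} (hz : z ∈ Ch K n) (hz0 : bdy z = 0) :
    ∃ y ∈ Ch L (n+1), bdy y = push φ z + push ψ z := by
  have key : ∀ N : Finset ℕ, ∃ y ∈ Ch L (n+1), bdy y = push φ z + push (fun i => if i ∈ N then ψ i else φ i) z := by
    intro N
    induction N using Finset.induction with
    | empty => exact ⟨0, Submodule.zero_mem _, by simp [chn_add_self]⟩
    | insert a N ha ih =>
      obtain ⟨y, hy, e⟩ := ih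
      obtain ⟨y', hy', e'⟩ := contig1 (K := K) (L := L) (φ := fun i => if i ∈ N then ψ i else φ i) (ψ := fun i => if i ∈ insert a N then ψ i else φ i)
        (v := a) (fun i hi => by simp [hi]) (fun s hs h => hL.2 _ (hc s hs h) _ (by
          intro i; simp only [mem_union, mem_image]
          rintro (⟨j, hj, rfl⟩ | ⟨j, hj, rfl⟩) <;> split_ifs <;> [right; left; right; left] <;> exact ⟨j, hj, rfl⟩)) hL hz hz0
      refine ⟨y + y', Submodule.add_mem _ hy hy', ?_⟩
      rw [map_add, e, e', chn_cancel]
  obtain ⟨V, hV⟩ := verts_finite hK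
  obtain ⟨y, hy, e⟩ := key V
  refine ⟨y, hy, ?_⟩
  rw [e]; congr 1
  refine map_congr hz fun s hs hn => ?_
  have : s.image (fun i => if i ∈ V then ψ i else φ i) = s.image ψ := image_congr fun i hi => by simp [hV s hs hi]
  rw [push_ee, push_ee, this]

end PL
end HomologySpheres

end

open Finset
noncomputable section
namespace HomologySpheres
namespace PL

theorem push_comp (φ ψ : ℕ → ℕ) (c : Chn) : push (φ ∘ ψ) c = push φ (push ψ c) := by
  suffices h : push (φ ∘ ψ) = push φ ∘ₗ push ψ from LinearMap.congr_fun h c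
  refine ch_ext fun s => ?_
  rw [LinearMap.comp_apply]
  induction s using Finset.induction with
  | empty => simp [push_ee]
  | insert p s hp ih =>
    have e : ee (insert p s) = cone p (ee s) := by rw [cone_ee, if_neg hp]
    rw [e, push_cone, push_cone, push_cone, ih]; rfl

theorem push_id {φ : ℕ → ℕ} {K : Set (Finset ℕ)} {n : ℕ} {c : Chn} (hc : c ∈ Ch K n) (h : ∀ s ∈ K, ∀ i ∈ s, φ i = i) : push φ c = c := by
  refine map_congr hc (T := LinearMap.id) fun s hs hn => ?_
  have : s.image φ = s := by
    conv_rhs => rw [← image_id (s := s)]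
    exact image_congr fun i hi => h s hs i hi
  rw [push_ee, this, if_pos rfl]; rfl

def hsd (x y m : ℕ) : Chn →ₗ[ZMod 2] Chn := lin fun s => if {x, y} ⊆ s then ee (insert m s) else 0
theorem hsd_ee (x y m : ℕ) (s : Finset ℕ) : hsd x y m (ee s) = if {x, y} ⊆ s then ee (insert m s) else 0 := lin_ee _ _

def sd (x y m : ℕ) : Chn →ₗ[ZMod 2] Chn := LinearMap.id + bdy ∘ₗ hsd x y m + hsd x y m ∘ₗ bdy

theorem sd_apply (x y m : ℕ) (c : Chn) : sd x y m c = c + bdy (hsd x y m c) + hsd x y m (bdy c) := rfl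

theorem bdy_sd (x y m : ℕ) (c : Chn) : bdy (sd x y m c) = sd x y m (bdy c) := by
  simp [sd_apply, bdy_bdy]

theorem sd_ee {x y m : ℕ} (hxy : x ≠ y) {s : Finset ℕ} (hm : m ∉ s) :
    sd x y m (ee s) = if {x, y} ⊆ s then ee (insert m (s.erase x)) + ee (insert m (s.erase y)) else ee s := by
  rw [sd_apply, hsd_ee]
  by_cases h : {x, y} ⊆ s
  · rw [if_pos h, if_pos h]
    have e : ee (insert m s) = cone m (ee s) := by rw [cone_ee, if_neg hm]
    rw [e, bdy_cone, ← add_assoc, chn_add_self, zero_add, bdy_ee, map_sum, map_sum, ← sum_add_distrib]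
    rw [← sum_subset h, sum_pair hxy]
    · simp only [cone_ee, hsd_ee, mem_erase, hm, and_false, if_false]
      rw [if_neg, if_neg, add_zero, add_zero]
      · intro h; have := h (show y ∈ ({x, y} : Finset ℕ) by simp); simp at this
      · intro h; have := h (show x ∈ ({x, y} : Finset ℕ) by simp); simp at this
    · intro v hv hv2
      simp only [mem_insert, mem_singleton, not_or] at hv2
      rw [cone_ee, if_neg (by simp [hm]), hsd_ee, if_pos, chn_add_self]
      intro i hi
      refine mem_erase.2 ⟨?_, h hi⟩
      rintro rfl
      simp only [mem_insert, mem_singleton] at hi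
      tauto
  · rw [if_neg h, if_neg h, bdy_ee, map_zero, add_zero, map_sum, sum_eq_zero, add_zero]
    intro v hv
    rw [hsd_ee, if_neg (fun h' => h (h'.trans (erase_subset _ _)))]

section
variable {L : Set (Finset ℕ)} {x y m : ℕ}

theorem sd_mem (hL : Cx L) (hxy : x ≠ y) (hm : ∀ s ∈ L, m ∉ s) {n : ℕ} {c : Chn} (hc : c ∈ Ch L n) :
    sd x y m c ∈ Ch (Star L {x, y} m) n := by
  refine map_mem hc fun s hs hn => ?_
  have hms := hm s hs
  rw [sd_ee hxy hms]
  split_ifs with h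
  · have hx : x ∈ s := h (by simp)
    have hy : y ∈ s := h (by simp)
    have hxm : x ≠ m := fun e => hms (e ▸ hx)
    have hym : y ≠ m := fun e => hms (e ▸ hy)
    have hpos : 0 < s.card := card_pos.2 ⟨x, hx⟩
    refine Submodule.add_mem _ (ee_mem ⟨?_, Or.inr ⟨by simp, ?_⟩⟩ ?_) (ee_mem ⟨?_, Or.inr ⟨by simp, ?_⟩⟩ ?_)
    · intro h'; have := h' (show x ∈ ({x, y} : Finset ℕ) by simp); simp [hxm] at this
    · refine hL.2 _ hs _ (union_subset (fun i hi => ?_) h)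
      simp at hi; tauto
    · rw [card_insert_of_notMem (by simp [hms]), card_erase_of_mem hx]; omega
    · intro h'; have := h' (show y ∈ ({x, y} : Finset ℕ) by simp); simp [hym] at this
    · refine hL.2 _ hs _ (union_subset (fun i hi => ?_) h)
      simp at hi; tauto
    · rw [card_insert_of_notMem (by simp [hms]), card_erase_of_mem hy]; omega
  · exact ee_mem ⟨h, Or.inl ⟨hms, hs⟩⟩ hn

def pm (x m : ℕ) (i : ℕ) : ℕ := if i = m then x else i

theorem image_pm_of_notMem {s : Finset ℕ} (hm : m ∉ s) : s.image (pm x m) = s := by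
  conv_rhs => rw [← image_id (s := s)]
  refine image_congr fun i hi => ?_
  simp only [pm, id]; rw [if_neg]; exact fun e => hm (e ▸ hi)

theorem image_pm {s : Finset ℕ} (hm : m ∉ s) : (insert m s).image (pm x m) = insert x s := by
  rw [image_insert, image_pm_of_notMem hm]; simp [pm]

theorem push_sd (hxy : x ≠ y) (hm : ∀ s ∈ L, m ∉ s) {n : ℕ} {c : Chn} (hc : c ∈ Ch L n) :
    push (pm x m) (sd x y m c) = c := by
  refine map_congr hc (S := push (pm x m) ∘ₗ sd x y m) (T := LinearMap.id) fun s hs hn => ?_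
  have hms := hm s hs
  rw [LinearMap.comp_apply, sd_ee hxy hms]
  split_ifs with h
  · have hx : x ∈ s := h (by simp)
    have hy : y ∈ s := h (by simp)
    have hpos : 0 < s.card := card_pos.2 ⟨x, hx⟩
    have h1 : m ∉ s.erase x := by simp [hms]
    have h2 : m ∉ s.erase y := by simp [hms]
    rw [map_add, push_ee, push_ee, image_pm h1, image_pm h2, insert_erase hx, card_insert_of_notMem h1, card_erase_of_mem hx,
      if_pos (by omega), if_neg, add_zero]; rfl
    rw [insert_eq_of_mem (by simp [hx, hxy]), card_insert_of_notMem h2]; omega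
  · rw [push_ee, image_pm_of_notMem hms, if_pos rfl]; rfl

def dst (x y m : ℕ) : Chn →ₗ[ZMod 2] Chn := lin fun s => if m ∈ s ∧ x ∉ s ∧ y ∉ s then ee (insert x s) else 0
theorem dst_ee (x y m : ℕ) (s : Finset ℕ) : dst x y m (ee s) = if m ∈ s ∧ x ∉ s ∧ y ∉ s then ee (insert x s) else 0 := lin_ee _ _

theorem star_homotopy (hxy : x ≠ y) (hxm : x ≠ m) (hym : y ≠ m) {n : ℕ} {c : Chn} (hc : c ∈ Ch (Star L {x, y} m) n) :
    bdy (dst x y m c) + dst x y m (bdy c) = c + sd x y m (push (pm x m) c) := by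
  refine map_congr hc (S := bdy ∘ₗ dst x y m + dst x y m ∘ₗ bdy) (T := LinearMap.id + sd x y m ∘ₗ push (pm x m)) fun s hs hn => ?_
  simp only [LinearMap.add_apply, LinearMap.comp_apply, LinearMap.id_apply]
  have hns := hs.1
  simp only [insert_subset_iff, singleton_subset_iff, not_and] at hns
  by_cases hm : m ∈ s
  swap
  · rw [push_ee, image_pm_of_notMem hm, if_pos rfl, sd_ee hxy hm, if_neg hs.1, dst_ee, if_neg (by tauto), bdy_ee, map_zero, map_sum,
      sum_eq_zero, add_zero, chn_add_self]
    intro v hv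
    rw [dst_ee, if_neg]; simp [hm]
  obtain ⟨τ, hτ, rfl⟩ : ∃ τ, m ∉ τ ∧ s = insert m τ := ⟨s.erase m, by simp, (insert_erase hm).symm⟩
  simp only [mem_insert, hxm, hym, false_or] at hns
  by_cases hx : x ∈ τ
  · have hy := hns hx
    rw [dst_ee, if_neg (by simp [hx]), map_zero, zero_add, push_ee, image_pm hτ, insert_eq_of_mem hx, card_insert_of_notMem hτ, if_neg (by omega),
      map_zero, add_zero, bdy_ee, map_sum, sum_eq_single x]
    · rw [dst_ee, if_pos (by simp [hxm.symm, hy, hym]), insert_erase (by simp [hx])]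
    · intro v hv hvx
      rw [dst_ee, if_neg]
      simp [hx, hvx.symm]
    · intro h; simp [hx] at h
  by_cases hy : y ∈ τ
  · rw [dst_ee, if_neg (by simp [hy]), map_zero, zero_add, push_ee, image_pm hτ, card_insert_of_notMem hτ, card_insert_of_notMem hx, if_pos rfl,
      sd_ee hxy (by simp [hxm.symm, hτ]), if_pos (by simp [insert_subset_iff, hy]), erase_insert hx, ← add_assoc, chn_add_self, zero_add,
      bdy_ee, map_sum, sum_eq_single y]
    · rw [dst_ee, if_pos (by simp [hym.symm, hx, hxm]), erase_insert_of_ne hym.symm, erase_insert_of_ne hxy, Finset.insert_comm]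
    · intro v hv hvy
      rw [dst_ee, if_neg]
      simp [hy, hvy.symm]
    · intro h; simp [hy] at h
  · rw [dst_ee, if_pos (by simp [hx, hy, hxm, hym]), push_ee, image_pm hτ, card_insert_of_notMem hτ, card_insert_of_notMem hx, if_pos rfl,
      sd_ee hxy (by simp [hxm.symm, hτ]), if_neg (by simp [insert_subset_iff, hy, hxy.symm])]
    have e : ee (insert x (insert m τ)) = cone x (ee (insert m τ)) := by rw [cone_ee, if_neg (by simp [hx, hxm])]
    rw [e, bdy_cone, add_assoc, bdy_ee, map_sum, map_sum, ← sum_add_distrib, sum_eq_single m]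
    · rw [erase_insert hτ, cone_ee, if_neg hx, dst_ee, if_neg (by simp [hτ]), add_zero]
    · intro v hv hvm
      rw [cone_ee, if_neg (by simp [hx, hxm]), dst_ee, if_pos (by simp [hx, hy, hxm, hym, hvm.symm]), chn_add_self]
    · intro h; simp at h

theorem van_star (hL : Cx L) (hxy : x ≠ y) (he : {x, y} ∈ L) (hm : ∀ s ∈ L, m ∉ s) {n : ℕ} (h : Van n L) : Van n (Star L {x, y} m) := by
  have hxm : x ≠ m := fun e => hm _ he (by simp [e])
  have hym : y ≠ m := fun e => hm _ he (by simp [e])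
  intro c hc hc0
  have h1 := star_homotopy hxy hxm hym hc
  have hp : push (pm x m) c ∈ Ch L n := push_mem (fun s hs => by
    rcases hs.2 with ⟨h1, h2⟩ | ⟨h1, h2⟩
    · rwa [image_pm_of_notMem h1]
    · rw [← insert_erase h1, image_pm (by simp)]
      exact hL.2 _ h2 _ (by intro i; simp; tauto)) hc
  obtain ⟨u, hu, e⟩ := h _ hp (by rw [bdy_push, hc0, map_zero])
  rw [hc0, map_zero, add_zero, ← e, ← bdy_sd] at h1
  refine ⟨dst x y m c + sd x y m u, Submodule.add_mem _ ?_ (sd_mem hL hxy hm hu), ?_⟩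
  · refine map_mem hc fun s hs hn => ?_
    rw [dst_ee]
    split_ifs with h
    · refine ee_mem ⟨?_, Or.inr ⟨by simp [h], ?_⟩⟩ (by rw [card_insert_of_notMem h.2.1]; omega)
      · simp [insert_subset_iff, hxy.symm, h]
      · refine hL.2 _ (hs.2.resolve_left (by simp [h])).2 _ ?_
        intro i; simp; tauto
    · exact Submodule.zero_mem _
  · rw [map_add, h1, add_assoc, chn_add_self, add_zero]

end

theorem van_es {K K1 : Set (Finset ℕ)} {r} (hK : Cx K) (h : ES K K1 r) {n : ℕ} (hv : Van n K) : Van n K1 := by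
  induction h with
  | refl => exact hv
  | step x y m c h hxy he hm h0 h1 ih => exact van_star (h.cx hK) hxy he hm ih

theorem es_emp {K K1 : Set (Finset ℕ)} {r} (h : ES K K1 r) (h0 : ∅ ∈ K) : ∅ ∈ K1 := by
  induction h with
  | refl => exact h0
  | step x y m c h hxy he hm _ h1 ih => exact ⟨by simp, Or.inl ⟨by simp, ih⟩⟩

theorem es_chain {K K1 : Set (Finset ℕ)} {r} (hK : Cx K) (h : ES K K1 r) :
    ∃ (S : Chn →ₗ[ZMod 2] Chn) (π : ℕ → ℕ), (∀ n, ∀ c ∈ Ch K n, S c ∈ Ch K1 n) ∧ (∀ c, bdy (S c) = S (bdy c)) ∧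
      (∀ n, ∀ c ∈ Ch K n, push π (S c) = c) ∧ ∀ v, {v} ∈ K1 → π v ∈ (r (dl v)).support := by
  induction h with
  | refl => exact ⟨LinearMap.id, id, fun n c hc => hc, fun c => rfl, fun n c hc => push_id hc fun _ _ _ _ => rfl, fun v _ => by simp [supp_dl]⟩
  | @step K1 r x y m t h hxy he hm h0 h1 ih =>
    obtain ⟨S, π, e1, e2, e3, e4⟩ := ih
    have hK1 := h.cx hK
    refine ⟨sd x y m ∘ₗ S, π ∘ pm x m, fun n c hc => sd_mem hK1 hxy hm (e1 n c hc), fun c => ?_, fun n c hc => ?_, fun v hv => ?_⟩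
    · rw [LinearMap.comp_apply, bdy_sd, e2]; rfl
    · rw [push_comp, LinearMap.comp_apply, push_sd hxy hm (e1 n c hc), e3 n c hc]
    · rw [LinearMap.comp_apply]
      by_cases hvm : v = m
      · subst hvm
        have hx := face_vert hK1 he (v := x) (by simp)
        have hy := face_vert hK1 he (v := y) (by simp)
        rw [sub_dl_self, map_add, map_smul, map_smul]
        have hb := h.bij hK
        have h4 := e4 x hx
        have a1 := (hb.mapsTo (dl_mem.2 hx)).1 (π x)
        have a2 := (hb.mapsTo (dl_mem.2 hy)).1 (π x)
        rw [Finsupp.mem_support_iff] at h4 ⊢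
        have a3 : 0 < r (dl x) (π x) := lt_of_le_of_ne a1 (Ne.symm h4)
        simp only [Function.comp, pm, if_pos, Finsupp.add_apply, Finsupp.smul_apply, smul_eq_mul]
        have : 0 < t * r (dl x) (π x) := mul_pos h0 a3
        have : 0 ≤ (1 - t) * r (dl y) (π x) := mul_nonneg (by linarith) a2
        exact ne_of_gt (by linarith)
      · rw [sub_dl_ne _ hvm]
        simp only [Function.comp, pm, if_neg hvm]
        refine e4 v ?_
        rcases hv.2 with h | h
        · exact h.2
        · have := h.1; simp at this; exact absurd this.symm hvm

theorem Van.of_heq {K L : Set (Finset ℕ)} (hK : Cx K) (hL : Cx L) (hL0 : ∅ ∈ L) (h : Heq K L) {n : ℕ} (hv : Van n L) : Van n K := by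
  obtain ⟨f, hf⟩ := h.symm
  obtain ⟨L1, r', g', hES', heq', hR'⟩ := theoremR hL hK hf
  have hL1 := hES'.cx hL
  have hL10 := es_emp hES' hL0
  have hhP : PLeq g' (R L1) (R K) := PLeq.of_linear (poly_R hL1) _ hR'.bij
  obtain ⟨k, hk, i1, i2⟩ := hhP.symm
  obtain ⟨K1, r, g, hES, heq, hR⟩ := theoremR hK hL1 hk
  have hK1 := hES.cx hK
  have hgr : ∀ v, {v} ∈ K1 → g' (g (dl v)) = r (dl v) := by
    intro v hv
    have := heq (dl_mem.2 hv)
    rw [← this]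
    exact i2 ((hES.bij hK).mapsTo (dl_mem.2 hv))
  obtain ⟨S, π, e1, e2, e3, e4⟩ := es_chain hK hES
  -- simplicial approximations
  have hγ : ∀ v, ∃ w, {v} ∈ K1 → w ∈ (g (dl v)).support := by
    intro v
    by_cases hv : {v} ∈ K1
    · have := ne_zero_R (hR.bij.mapsTo (dl_mem.2 hv))
      rw [← Finsupp.support_nonempty_iff] at this
      exact ⟨this.choose, fun _ => this.choose_spec⟩
    · exact ⟨0, fun h => absurd h hv⟩
  have hδ : ∀ v, ∃ w, {v} ∈ L1 → w ∈ (g' (dl v)).support := by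
    intro v
    by_cases hv : {v} ∈ L1
    · have := ne_zero_R (hR'.bij.mapsTo (dl_mem.2 hv))
      rw [← Finsupp.support_nonempty_iff] at this
      exact ⟨this.choose, fun _ => this.choose_spec⟩
    · exact ⟨0, fun h => absurd h hv⟩
  choose γ hγ using hγ
  choose δ hδ using hδ
  have hγs : ∀ s ∈ K1, s.image γ ∈ L1 := by
    intro s hs
    rcases s.eq_empty_or_nonempty with rfl | hne
    · simpa using hL10
    · obtain ⟨t, ht, h⟩ := hR.simp s hs hne
      refine hL1.2 _ ht _ (image_subset_iff.2 fun v hv => h v hv (hγ v (face_vert hK1 hs hv)))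
  intro z hz hz0
  -- cycle in L1
  have hy1 : push γ (S z) ∈ Ch L1 n := push_mem hγs (e1 n z hz)
  have hSz0 : bdy (S z) = 0 := by rw [e2, hz0, map_zero]
  obtain ⟨u, hu, hue⟩ := van_es hL hES' hv _ hy1 (by rw [bdy_push, hSz0, map_zero])
  have hK0 : n = 0 → z ≠ 0 → ∅ ∈ K := by
    intro h hne
    obtain ⟨s, hs⟩ := Finsupp.support_nonempty_iff.2 hne
    have := mem_Ch.1 hz s (Finsupp.mem_support_iff.1 hs)
    have hs0 : s = ∅ := card_eq_zero.1 (this.2.trans h)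
    rw [← hs0]; exact this.1
  obtain ⟨y, hy, hye⟩ := contig (K := K1) (L := K) hK1 (φ := δ ∘ γ) (ψ := π) (by
    intro s hs hne
    obtain ⟨t, ht, h⟩ := hR.simp s hs hne
    obtain ⟨v0, hv0⟩ := hne
    have htne : t.Nonempty := ⟨_, h v0 hv0 (hγ v0 (face_vert hK1 hs hv0))⟩
    obtain ⟨t', ht', h'⟩ := hR'.simp t ht htne
    refine hK.2 _ ht' _ (union_subset (image_subset_iff.2 fun v hv => ?_) (image_subset_iff.2 fun v hv => ?_))
    · have hg := h v hv (hγ v (face_vert hK1 hs hv))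
      exact h' _ hg (hδ _ (face_vert hL1 ht hg))
    · have hv1 := face_vert hK1 hs hv
      have h5 := e4 v hv1
      rw [← hgr v hv1, lin_sum g' (h v hv)] at h5
      obtain ⟨w, hw, hw'⟩ := mem_biUnion.1 (Finsupp.support_finsetSum h5)
      exact h' w hw (Finsupp.support_smul hw')) hK (e1 n z hz) hSz0
  rw [e3 n z hz, push_comp, ← hue] at hye
  refine ⟨y + push δ u, ?_, ?_⟩
  · refine Submodule.add_mem _ hy (map_mem hu fun s hs hn => ?_)
    rw [push_ee]
    split_ifs with hc
    · have hne : s.Nonempty := card_pos.1 (by omega)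
      obtain ⟨t, ht, h⟩ := hR'.simp s hs hne
      exact ee_mem (hK.2 _ ht _ (image_subset_iff.2 fun v hv => h v hv (hδ v (face_vert hL1 hs hv)))) (by omega)
    · exact Submodule.zero_mem _
  · rw [map_add, hye, bdy_push, add_comm, ← add_assoc, chn_add_self, zero_add]

end PL
end HomologySpheres

end

open Finset
noncomputable section
namespace HomologySpheres
namespace PL

theorem iota_apply (v : ℕ) (c : Chn) (s : Finset ℕ) : iota v c s = if v ∈ s then 0 else c (insert v s) := by
  induction c using Finsupp.induction_linear with
  | zero => simp
  | add f g hf hg => rw [map_add, Finsupp.add_apply, hf, hg, Finsupp.add_apply]; split_ifs <;> simp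
  | single t b =>
    have e : Finsupp.single t b = b • ee t := by simp [ee]
    rw [e, map_smul, Finsupp.smul_apply, Finsupp.smul_apply, iota_ee]
    by_cases h : v ∈ s
    · rw [if_pos h]
      split_ifs with h1
      · rw [ee, Finsupp.single_apply, if_neg]; · simp
        rintro rfl; simp at h
      · simp
    · rw [if_neg h]
      split_ifs with h1
      · congr 1
        simp only [ee, Finsupp.single_apply]
        congr 1
        apply propext; constructor
        · rintro rfl; exact (insert_erase h1).symm
        · rintro rfl; exact erase_insert h
      · rw [ee, Finsupp.single_apply, if_neg]; · simp
        rintro rfl; simp at h1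

theorem iota_lk {K : Set (Finset ℕ)} {n : ℕ} {c : Chn} (v : ℕ) (hc : c ∈ Ch K (n+1)) : iota v c ∈ Ch (lk K v) n :=
  iota_mem (L := lk K v) (fun s hs hv => ⟨by simp, by rwa [insert_erase hv]⟩) hc

theorem decomp {K : Set (Finset ℕ)} {n : ℕ} {c : Chn} (v : ℕ) (hc : c ∈ Ch K n) : c + cone v (iota v c) ∈ Ch (del K v) n := by
  refine map_mem hc (T := LinearMap.id + cone v ∘ₗ iota v) fun s hs hn => ?_
  simp only [LinearMap.add_apply, LinearMap.comp_apply, LinearMap.id_apply, iota_ee]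
  split_ifs with h
  · rw [cone_ee, if_neg (by simp), insert_erase h, chn_add_self]; exact Submodule.zero_mem _
  · rw [map_zero, add_zero]; exact ee_mem ⟨h, hs⟩ hn

theorem del_of_iota {K : Set (Finset ℕ)} {n : ℕ} {c : Chn} {v : ℕ} (hc : c ∈ Ch K n) (h : iota v c = 0) : c ∈ Ch (del K v) n := by
  have := decomp v hc; rwa [h, map_zero, add_zero] at this

theorem van_full {Ω : Finset ℕ} (h : Ω.Nonempty) (n : ℕ) : Van n (full Ω) := by
  intro c hc h0
  obtain ⟨p, hp⟩ := h
  refine ⟨cone p c, cone_mem (fun s hs => insert_subset hp hs) hc, ?_⟩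
  rw [bdy_cone, h0, map_zero, add_zero]

theorem van_bd {Ω : Finset ℕ} (h : Ω.Nonempty) {n : ℕ} (hn : n + 1 ≠ Ω.card) : Van n (bd Ω) := by
  intro c hc h0
  obtain ⟨p, hp⟩ := h
  have h1 : cone p c ∈ Ch (full Ω) (n+1) := cone_mem (fun s hs => insert_subset hp (show s ⊆ Ω from hs.1)) hc
  refine ⟨cone p c, ?_, ?_⟩
  · rw [mem_Ch] at h1 ⊢
    intro s hs
    refine ⟨Finset.ssubset_iff_subset_ne.2 ⟨(h1 s hs).1, ?_⟩, (h1 s hs).2⟩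
    rintro rfl; exact hn (h1 _ hs).2.symm
  · rw [bdy_cone, h0, map_zero, add_zero]

theorem Sph.van {k : ℕ} {S : Set (Finset ℕ)} (h : Sph k S) {n : ℕ} (hn : n + 1 ≠ k) : Van n S := by
  obtain ⟨Ω, hΩ, e⟩ := h.eqv
  have := h.pos
  exact Van.of_heq h.cx (cx_bd _) (emp_bd (by omega)) e (van_bd (card_pos.1 (by omega)) (by omega))

theorem Sph.card_lt {k : ℕ} {S : Set (Finset ℕ)} (h : Sph k S) {σ : Finset ℕ} (hσ : σ ∈ S) : σ.card < k := by
  obtain ⟨j, hj, hs⟩ := h.lkS σ hσ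
  have := hs.pos; omega

theorem ch_eq_zero {K : Set (Finset ℕ)} {n : ℕ} {c : Chn} (hc : c ∈ Ch K n) (h : ∀ s ∈ K, s.card ≠ n) : c = 0 := by
  ext s
  by_contra h'
  exact h s (mem_Ch.1 hc s h').1 (mem_Ch.1 hc s h').2

theorem BP.van {D Λ : Set (Finset ℕ)} (h : BP D Λ) (hD : Cx D) (n : ℕ) : Van n D := by
  obtain ⟨Ω, hΩ, e⟩ := h
  exact Van.of_heq hD (cx_full _) (by simp [full]) e.heq (van_full hΩ n)

theorem Sph.touch {n : ℕ} {S : Set (Finset ℕ)} (h : Sph (n+1) S) {c : Chn} (hc : c ∈ Ch S n) (h0 : bdy c = 0) (hne : c ≠ 0) {v : ℕ} (hv : {v} ∈ S) :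
    iota v c ≠ 0 := by
  intro hi
  obtain ⟨c', hc', e⟩ := (nice _ _ h v hv).van (cx_del h.cx v) n c (del_of_iota hc hi) h0
  rw [ch_eq_zero hc' (fun s hs => by have := h.card_lt hs.2; omega), map_zero] at e
  exact hne e.symm

theorem exists_vert {K : Set (Finset ℕ)} (hK : Cx K) {n : ℕ} {c : Chn} (hc : c ∈ Ch K (n+1)) (hne : c ≠ 0) : ∃ v, {v} ∈ K ∧ iota v c ≠ 0 := by
  obtain ⟨s, hs⟩ := Finsupp.ne_iff.1 hne
  have h1 := mem_Ch.1 hc s hs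
  obtain ⟨v, hv⟩ : s.Nonempty := card_pos.1 (by omega)
  refine ⟨v, face_vert hK h1.1 hv, fun h => hs ?_⟩
  have := iota_apply v c (s.erase v)
  rw [h, if_neg (by simp), insert_erase hv] at this
  exact this.symm

theorem zmod2 {x : ZMod 2} (h : x ≠ 0) : x = 1 := by revert x; decide

theorem Sph.uniq : ∀ {n : ℕ} {S : Set (Finset ℕ)} (h : Sph (n+1) S) {c c' : Chn}, c ∈ Ch S n → c' ∈ Ch S n → bdy c = 0 → bdy c' = 0 →
    c ≠ 0 → c' ≠ 0 → c = c' := by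
  intro n
  induction n with
  | zero =>
    intro S h c c' hc hc' _ _ h0 h0'
    have key : ∀ c ∈ Ch S 0, c ≠ 0 → c = ee ∅ := by
      intro c hc h0
      obtain ⟨s, hs⟩ := Finsupp.ne_iff.1 h0
      ext t
      by_cases ht : t = ∅
      · rw [ht, ee, Finsupp.single_eq_same]
        rw [card_eq_zero.1 (mem_Ch.1 hc s hs).2] at hs
        exact zmod2 hs
      · rw [ee, Finsupp.single_eq_of_ne ht]
        by_contra h; exact ht (card_eq_zero.1 (mem_Ch.1 hc t h).2)
    rw [key c hc h0, key c' hc' h0']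
  | succ n ih =>
    intro S h c c' hc hc' hz hz' h0 h0'
    obtain ⟨v, hv, hvc⟩ := exists_vert h.cx hc h0
    have e := ih (h.lk hv) (iota_lk v hc) (iota_lk v hc') (by rw [bdy_iota, hz, map_zero]) (by rw [bdy_iota, hz', map_zero]) hvc
      (h.touch hc' hz' h0' hv)
    have e2 : c + c' = 0 := by
      by_contra hne
      refine h.touch (Submodule.add_mem _ hc hc') (by rw [map_add, hz, hz', add_zero]) hne hv ?_
      rw [map_add, e, chn_add_self]
    calc c = c + (c' + c') := by rw [chn_add_self, add_zero]
      _ = c' := by rw [← add_assoc, e2, zero_add]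

theorem Man.touch {d : ℕ} (hd : 1 ≤ d) {M : Set (Finset ℕ)} (hM : Man (d+1) M) (h1 : Van 1 M) {Z : Chn} (hZ : Z ∈ Ch M (d+1)) (hz : bdy Z = 0)
    (hne : Z ≠ 0) {v : ℕ} (hv : {v} ∈ M) : iota v Z ≠ 0 := by
  classical
  have step : ∀ x y, x ≠ y → ({x, y} : Finset ℕ) ∈ M → iota x Z ≠ 0 → iota y Z ≠ 0 := by
    intro x y hxy he hx hy
    obtain ⟨d', rfl⟩ : ∃ d', d = d' + 1 := ⟨d-1, by omega⟩
    have hxM : {x} ∈ M := hM.cx.2 _ he _ (by simp)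
    refine (hM.sph x hxM).touch (iota_lk x hZ) (by rw [bdy_iota, hz, map_zero]) hx (v := y) ⟨by simpa using hxy, he⟩ ?_
    ext s
    rw [iota_apply]
    split_ifs with h
    · rfl
    · rw [iota_apply]
      split_ifs with h'
      · rfl
      · rw [Finset.insert_comm]
        have := iota_apply y Z (insert x s)
        rw [hy, if_neg (by simp [h, hxy.symm])] at this
        exact this.symm
  obtain ⟨w, hw, hwZ⟩ := exists_vert hM.cx hZ hne
  intro hvZ
  have hb : ∀ x : ℕ, bdy (ee {x}) = ee ∅ := fun x => by simp [bdy_ee]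
  obtain ⟨y, hy, e⟩ := h1 (ee {v} + ee {w}) (Submodule.add_mem _ (ee_mem hv (by simp)) (ee_mem hw (by simp))) (by rw [map_add, hb, hb, chn_add_self])
  let T : Chn →ₗ[ZMod 2] Chn := lin fun s => if ∃ u, s = {u} ∧ iota u Z ≠ 0 then ee ∅ else 0
  have hT : ∀ u, T (ee {u}) = if iota u Z ≠ 0 then ee ∅ else 0 := by
    intro u; simp only [T]; rw [lin_ee]; simp
  have h2 : T (bdy y) = 0 := by
    refine map_congr hy (S := T ∘ₗ bdy) (T := 0) fun s hs hn => ?_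
    obtain ⟨x, z, hxz, rfl⟩ := card_eq_two.1 hn
    rw [LinearMap.comp_apply, bdy_ee, sum_pair hxz, LinearMap.zero_apply]
    have e1 : ({x, z} : Finset ℕ).erase x = {z} := by ext i; simp; grind
    have e2 : ({x, z} : Finset ℕ).erase z = {x} := by ext i; simp; grind
    rw [e1, e2, map_add, hT, hT]
    have h3 := step x z hxz hs
    have h4 := step z x hxz.symm (by rwa [pair_comm])
    by_cases h : iota x Z = 0
    · rw [if_neg (fun h' => h4 h' h), if_neg (by simp [h]), add_zero]
    · rw [if_pos (h3 h), if_pos h, chn_add_self]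
  rw [e, map_add, hT, hT, if_neg (by simp [hvZ]), if_pos hwZ, zero_add] at h2
  have := congrArg (fun c : Chn => c ∅) h2
  simp [ee] at this

theorem top_cycle {n : ℕ} {M : Set (Finset ℕ)} (h : ¬ Van n M) : ∃ Z ∈ Ch M n, bdy Z = 0 ∧ Z ≠ 0 := by
  by_contra hc
  push Not at hc
  refine h fun c hc' h0 => ⟨0, Submodule.zero_mem _, by rw [map_zero, hc c hc' h0]⟩

theorem no_cycle {d : ℕ} (hd : 1 ≤ d) {M : Set (Finset ℕ)} (hM : Man (d+1) M) (hv : ∀ n, n ≠ d+1 → Van n M) (hnv : ¬ Van (d+1) M)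
    {a : ℕ} (ha : {a} ∈ M) {B : Finset ℕ} (haB : a ∉ B) {r : ℕ → ℕ} (hrB : ∀ b ∈ B, r b = b)
    (hr : ∀ f ∈ M, a ∉ f → f.image r ∈ M ∧ f.image r ⊆ B) {n : ℕ} (hn : ∀ f ∈ M, f ⊆ B → f.card ≠ n + 1)
    {W : Chn} (hW : W ∈ Ch {f | f ∈ M ∧ f ⊆ B} n) (hW0 : bdy W = 0) : W = 0 := by
  have hWM : W ∈ Ch M n := Ch_mono (fun f hf => hf.1) hW
  have hia : iota a W = 0 := by
    ext s
    rw [iota_apply]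
    split_ifs with h
    · rfl
    · by_contra h'
      exact haB ((mem_Ch.1 hW _ h').1.2 (mem_insert_self _ _))
  by_cases hnd : n = d + 1
  · subst hnd
    by_contra hne
    exact hM.touch hd (hv 1 (by omega)) hWM hW0 hne ha hia
  obtain ⟨y, hy, e⟩ := hv n hnd W hWM hW0
  have hS := hM.sph a ha
  have hp := iota_lk a hy
  have hp0 : bdy (iota a y) = 0 := by rw [bdy_iota, e, hia]
  have hq := decomp a hy
  obtain ⟨u, hu, hue⟩ : ∃ u ∈ Ch (del M a) (n+1), bdy u = iota a y := by
    by_cases hn' : n = d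
    · subst hn'
      by_cases hp1 : iota a y = 0
      · exact ⟨0, Submodule.zero_mem _, by rw [map_zero, hp1]⟩
      obtain ⟨Z, hZ, hZ0, hZ1⟩ := top_cycle hnv
      have e1 := hS.uniq hp (iota_lk a hZ) hp0 (by rw [bdy_iota, hZ0, map_zero]) hp1 (hM.touch hd (hv 1 (by omega)) hZ hZ0 hZ1 ha)
      refine ⟨_, decomp a hZ, ?_⟩
      rw [map_add, hZ0, zero_add, bdy_cone, ← e1, hp0, map_zero, add_zero]
    · obtain ⟨u, hu, e⟩ := hS.van (n := n) (by omega) _ hp hp0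
      exact ⟨u, Ch_mono (lk_sub_del hM.cx a) hu, e⟩
  have e2 : bdy (u + (y + cone a (iota a y))) = W := by
    rw [map_add, map_add, hue, bdy_cone, hp0, map_zero, add_zero, e, add_comm W, ← add_assoc, chn_add_self, zero_add]
  have hm := Submodule.add_mem _ hu hq
  have h3 : push r (u + (y + cone a (iota a y))) = 0 :=
    ch_eq_zero (push_mem (L := {f | f ∈ M ∧ f ⊆ B}) (fun f hf => hr f hf.2 hf.1) hm) (fun f hf => hn f hf.1 hf.2)
  have h4 : push r W = W := by
    refine map_congr hW (T := LinearMap.id) fun s hs _ => ?_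
    have : s.image r = s := by
      rw [image_congr (g := id) (fun i hi => hrB i (hs.2 hi)), image_id]
    rw [push_ee, this, if_pos rfl, LinearMap.id_apply]
  rw [← h4, ← e2, ← bdy_push, h3, map_zero]

end PL
end HomologySpheres

end

open Finset
noncomputable section
namespace HomologySpheres
namespace PL

theorem exists_lab (V : Finset ℕ) : ∃ lab : Finset ℕ → ℕ, Function.Injective lab ∧ ∀ s, lab s ∉ V := by
  refine ⟨fun s => V.sup id + 1 + Encodable.encode s, fun s t h => Encodable.encode_injective (by simpa using h), fun s hs => ?_⟩
  have := Finset.le_sup (f := id) hs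
  simp only [id] at this
  omega

/-- partial subdivision: the faces in `U` have been starred -/
def KU (M : Set (Finset ℕ)) (V : Finset ℕ) (lab : Finset ℕ → ℕ) (U : Finset (Finset ℕ)) : Set (Finset ℕ) :=
  {f | (∀ i ∈ f, i ∈ V ∨ ∃ s ∈ U, i = lab s) ∧ (∀ s ∈ U, ∀ t ∈ U, lab s ∈ f → lab t ∈ f → s ⊆ t ∨ t ⊆ s) ∧
    (∀ s ∈ U, lab s ∈ f → f ∩ V ⊆ s) ∧ f ∩ V ∈ M ∧ ∀ u ∈ U, ¬ u ⊆ f}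

theorem star_KU {M : Set (Finset ℕ)} (hM : Cx M) {V : Finset ℕ} (hV : ∀ s ∈ M, s ⊆ V) {lab : Finset ℕ → ℕ} (hl : Function.Injective lab)
    (hlV : ∀ s, lab s ∉ V) {U Mx : Finset (Finset ℕ)} (hMx : ∀ s ∈ Mx, s ∈ M) (hup : ∀ s ∈ Mx, ∀ t ∈ M, s ⊆ t → t ∈ Mx) {s : Finset ℕ} (hs : s ∈ Mx) (hsU : s ∉ U)
    (hU : U ⊆ Mx) (h1 : ∀ t ∈ Mx, s ⊆ t → t ≠ s → t ∈ U) (h2 : ∀ t ∈ U, ¬ t ⊆ s) :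
    Star (KU M V lab U) s (lab s) = KU M V lab (insert s U) := by
  have hsM := hMx s hs
  have hsV := hV s hsM
  ext f
  constructor
  · rintro ⟨hn, (⟨hm, hf⟩ | ⟨hm, hf⟩)⟩
    · obtain ⟨a1, a2, a3, a4, a5⟩ := hf
      refine ⟨?_, ?_, ?_, a4, ?_⟩ <;> grind
    · obtain ⟨a1, a2, a3, a4, a5⟩ := hf
      have e : (f.erase (lab s) ∪ s) ∩ V = (f ∩ V) ∪ s := by
        ext i; have := hlV s; simp only [mem_inter, mem_union, mem_erase]; grind
      rw [e] at a4
      have a6 : f ∩ V ⊆ s := by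
        by_contra h
        have h3 := h1 _ (hup s hs _ a4 subset_union_right) subset_union_right (fun h' => h (by rw [← h']; exact subset_union_left))
        exact a5 _ h3 (by rw [← e]; exact inter_subset_left)
      have a7 : ∀ t ∈ U, lab t ∈ f → s ⊆ t := by
        intro t ht htf
        have : t ≠ s := fun h => hsU (h ▸ ht)
        have := a3 t ht (by simp [htf, hl.eq_iff, this])
        rw [e] at this
        exact subset_union_right.trans this
      refine ⟨?_, ?_, ?_, ?_, ?_⟩
      · grind
      · intro t ht t' ht' htf htf'
        rw [mem_insert] at ht ht'
        rcases ht with rfl | ht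
        · rcases ht' with rfl | ht'
          · left; rfl
          · left; exact a7 t' ht' htf'
        · rcases ht' with rfl | ht'
          · right; exact a7 t ht htf
          · have : t ≠ s := fun h => hsU (h ▸ ht)
            have : t' ≠ s := fun h => hsU (h ▸ ht')
            refine a2 t ht t' ht' ?_ ?_ <;> simp [hl.eq_iff, *]
      · intro t ht htf
        rw [mem_insert] at ht
        rcases ht with rfl | ht
        · exact a6
        · exact a6.trans (a7 t ht htf)
      · exact hM.2 _ hsM _ a6
      · intro u hu huf
        rw [mem_insert] at hu
        rcases hu with rfl | hu
        · exact hn huf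
        · have h3 : u ⊆ f ∩ V := subset_inter huf (hV _ (hMx _ (hU hu)))
          exact h2 u hu (h3.trans a6)
  · rintro ⟨a1, a2, a3, a4, a5⟩
    refine ⟨a5 s (mem_insert_self _ _), ?_⟩
    by_cases hm : lab s ∈ f
    · right
      refine ⟨hm, ?_⟩
      have e : (f.erase (lab s) ∪ s) ∩ V = s := by
        have := a3 s (mem_insert_self _ _) hm
        ext i; have := hlV s; simp only [mem_inter, mem_union, mem_erase]; grind
      have a7 : ∀ t ∈ U, lab t ∈ f → s ⊆ t := by
        intro t ht htf
        rcases a2 s (mem_insert_self _ _) t (mem_insert_of_mem ht) hm htf with h | h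
        · exact h
        · exact absurd h (h2 t ht)
      have a8 : ∀ t ∈ U, lab t ∈ f.erase (lab s) ∪ s → lab t ∈ f := by
        intro t ht h
        rw [mem_union, mem_erase] at h
        rcases h with h | h
        · exact h.2
        · exact absurd (hsV h) (hlV t)
      refine ⟨?_, ?_, ?_, ?_, ?_⟩
      · intro i hi
        rw [mem_union, mem_erase] at hi
        rcases hi with hi | hi
        · rcases a1 i hi.2 with h | ⟨t, ht, rfl⟩
          · exact Or.inl h
          · rw [mem_insert] at ht
            rcases ht with rfl | ht
            · exact absurd rfl hi.1
            · exact Or.inr ⟨t, ht, rfl⟩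
        · exact Or.inl (hsV hi)
      · intro t ht t' ht' h h'
        exact a2 t (mem_insert_of_mem ht) t' (mem_insert_of_mem ht') (a8 t ht h) (a8 t' ht' h')
      · intro t ht h
        rw [e]; exact a7 t ht (a8 t ht h)
      · rw [e]; exact hsM
      · intro u hu huf
        have h3 := subset_inter huf (hV _ (hMx _ (hU hu)))
        rw [e] at h3
        exact h2 u hu h3
    · left
      refine ⟨hm, ?_, ?_, ?_, a4, ?_⟩
      · intro i hi
        rcases a1 i hi with h | ⟨t, ht, rfl⟩
        · exact Or.inl h
        · rw [mem_insert] at ht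
          rcases ht with rfl | ht
          · exact absurd hi hm
          · exact Or.inr ⟨t, ht, rfl⟩
      · intro t ht t' ht'
        exact a2 t (mem_insert_of_mem ht) t' (mem_insert_of_mem ht')
      · intro t ht; exact a3 t (mem_insert_of_mem ht)
      · intro u hu; exact a5 u (mem_insert_of_mem hu)

theorem KU_empty {M : Set (Finset ℕ)} {V : Finset ℕ} (hV : ∀ s ∈ M, s ⊆ V) (lab : Finset ℕ → ℕ) : KU M V lab ∅ = M := by
  ext f
  constructor
  · rintro ⟨a1, a2, a3, a4, a5⟩
    have : f ∩ V = f := inter_eq_left.2 fun i hi => by simpa using a1 i hi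
    rwa [this] at a4
  · intro h
    refine ⟨fun i hi => Or.inl (hV f h hi), by simp, by simp, ?_, by simp⟩
    rwa [inter_eq_left.2 (hV f h)]

theorem heq_star {K : Set (Finset ℕ)} (hK : Cx K) {τ : Finset ℕ} (hτ0 : τ.Nonempty) {m : ℕ}
    (hm : ∀ s ∈ K, m ∉ s) (hτ : m ∉ τ) : Heq (Star K τ m) K := (star_peq hK hK le_rfl hτ0 hm hτ).heq

theorem KU_heq {M : Set (Finset ℕ)} (hM : Cx M) {V : Finset ℕ} (hV : ∀ s ∈ M, s ⊆ V) {lab : Finset ℕ → ℕ} (hl : Function.Injective lab)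
    (hlV : ∀ s, lab s ∉ V) {Mx : Finset (Finset ℕ)} (hMx : ∀ s ∈ Mx, s ∈ M) (hne : ∀ s ∈ Mx, s.Nonempty)
    (hup : ∀ s ∈ Mx, ∀ t ∈ M, s ⊆ t → t ∈ Mx) :
    ∀ n, ∀ U : Finset (Finset ℕ), U.card = n → U ⊆ Mx → (∀ s ∈ U, ∀ t ∈ Mx, s ⊆ t → t ∈ U) → Cx (KU M V lab U) ∧ Heq (KU M V lab U) M := by
  intro n
  induction n with
  | zero =>
    intro U hU _ _
    rw [card_eq_zero.1 hU, KU_empty hV]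
    exact ⟨hM, Heq.refl hM⟩
  | succ n ih =>
    intro U hU hUM hu
    obtain ⟨s, hs, hmin⟩ := exists_min_image U card (card_pos.1 (by omega))
    have hlt : ∀ t ∈ U, t ⊆ s → t = s := fun t ht h => eq_of_subset_of_card_le h (hmin t ht)
    obtain ⟨h1, h2⟩ := ih (U.erase s) (by rw [card_erase_of_mem hs]; omega) ((erase_subset _ _).trans hUM) (by
      intro t ht t' ht' h
      rw [mem_erase] at ht ⊢
      exact ⟨fun e => ht.1 (hlt t ht.2 (e ▸ h)), hu t ht.2 t' ht' h⟩)
    have e := star_KU hM hV hl hlV hMx hup (hUM hs) (notMem_erase s U) ((erase_subset _ _).trans hUM)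
      (fun t ht h h' => mem_erase.2 ⟨h', hu s hs t ht h⟩) (fun t ht h => (mem_erase.1 ht).1 (hlt t (mem_erase.1 ht).2 h))
    rw [insert_erase hs] at e
    rw [← e]
    refine ⟨cx_star h1 _ _, (heq_star h1 (hne s (hUM hs)) ?_ ?_).trans h2⟩
    · intro f hf h
      rcases hf.1 _ h with h' | ⟨t, ht, h'⟩
      · exact hlV _ h'
      · exact (mem_erase.1 ht).1 (hl h').symm
    · exact fun h => hlV s (hV s (hMx s (hUM hs)) h)

end PL
end HomologySpheres

end

open Finset
noncomputable section
namespace HomologySpheres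
namespace PL

theorem Man.contr {k : ℕ} {K : Set (Finset ℕ)} (hM : Man k K) {u v : ℕ} (huv : u ≠ v) (he : {u, v} ∈ K)
    (hl : ∀ ρ : Finset ℕ, u ∉ ρ → v ∉ ρ → insert u ρ ∈ K → insert v ρ ∈ K → insert u (insert v ρ) ∈ K) :
    Heq K (Contr K u v) := by
  have hu : {u} ∈ K := hM.cx.2 _ he _ (by simp)
  obtain ⟨f, hf, _⟩ := contraction hM.cx huv he hl (nice _ _ (hM.sph u hu) v ⟨by simpa using huv, he⟩)
  exact ⟨f, hf⟩

theorem Heq.symm' {K L : Set (Finset ℕ)} (h : Heq K L) : Heq L K := h.symm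

def KN (M : Set (Finset ℕ)) (A B : Finset ℕ) (a : ℕ) (lab : Finset ℕ → ℕ) (Mx : Finset (Finset ℕ)) (N : Finset ℕ) : Set (Finset ℕ) :=
  {f | (∀ i ∈ f, i ∈ A ∪ B ∨ ∃ s ∈ Mx, i = lab s) ∧ (∀ i ∈ f, i ∉ N) ∧ (∀ s ∈ Mx, ∀ t ∈ Mx, lab s ∈ f → lab t ∈ f → s ⊆ t ∨ t ⊆ s) ∧
    f ∩ (A ∪ B) ∈ M ∧ ((∀ i ∈ f, i ∉ A) ∨ (∀ i ∈ f, i ∉ B)) ∧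
    ∀ s ∈ Mx, lab s ∈ f → (∀ i ∈ f, i ∈ A ∪ B → i ≠ a → i ∈ s) ∧ (a ∈ f → ∃ x ∈ s, x ∈ N ∨ x = a)}

theorem KN_zero {M : Set (Finset ℕ)} {A B : Finset ℕ} {a : ℕ} (ha : a ∈ A) (lab : Finset ℕ → ℕ) {Mx : Finset (Finset ℕ)}
    (hMx : ∀ s, s ∈ Mx ↔ s ∈ M ∧ (∃ x ∈ s, x ∈ A) ∧ ∃ x ∈ s, x ∈ B) (hV : ∀ s ∈ M, s ⊆ A ∪ B) :
    KN M A B a lab Mx ∅ = KU M (A ∪ B) lab Mx := by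
  ext f
  constructor
  · rintro ⟨a1, a2, a3, a4, a5, a6⟩
    refine ⟨a1, a3, ?_, a4, ?_⟩
    · intro s hs h i hi
      rw [mem_inter] at hi
      by_cases hia : i = a
      · obtain ⟨x, hx, hx'⟩ := (a6 s hs h).2 (hia ▸ hi.1)
        simp only [notMem_empty, false_or] at hx'
        rw [hia, ← hx']; exact hx
      · exact (a6 s hs h).1 i hi.1 hi.2 hia
    · intro u hu huf
      obtain ⟨_, ⟨x, hx, hxA⟩, y, hy, hyB⟩ := (hMx u).1 hu
      rcases a5 with h | h
      · exact h x (huf hx) hxA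
      · exact h y (huf hy) hyB
  · rintro ⟨a1, a2, a3, a4, a5⟩
    refine ⟨a1, by simp, a2, a4, ?_, ?_⟩
    · by_contra h
      push Not at h
      obtain ⟨⟨x, hx, hxA⟩, y, hy, hyB⟩ := h
      refine a5 (f ∩ (A ∪ B)) ((hMx _).2 ⟨a4, ⟨x, by simp [*], hxA⟩, y, by simp [*], hyB⟩) inter_subset_left
    · intro s hs h
      refine ⟨fun i hi hi' _ => a3 s hs h (mem_inter.2 ⟨hi, hi'⟩), fun h' => ⟨a, a3 s hs h (mem_inter.2 ⟨h', by simp [ha]⟩), Or.inr rfl⟩⟩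

theorem KN_link {M : Set (Finset ℕ)} (hM : Cx M) {A B : Finset ℕ} {a : ℕ} (hAB : ∀ i ∈ A, i ∉ B) (ha : a ∈ A) {lab : Finset ℕ → ℕ} {Mx : Finset (Finset ℕ)}
    (h3 : ∀ s ∈ M, (∀ i ∈ s, i ∉ B) → insert a s ∈ M) {N : Finset ℕ} {u : ℕ} (hu : u ∈ A) (hua : u ≠ a)
    (hlV : ∀ s, lab s ∉ A ∪ B) {ρ : Finset ℕ} (h : insert u ρ ∈ KN M A B a lab Mx N) (h' : insert a ρ ∈ KN M A B a lab Mx N) :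
    insert u (insert a ρ) ∈ KN M A B a lab Mx N := by
  obtain ⟨a1, a2, a3, a4, a5, a6⟩ := h
  obtain ⟨b1, b2, b3, b4, b5, b6⟩ := h'
  have hl1 : ∀ s, lab s ≠ u := fun s e => hlV s (by rw [e]; simp [hu])
  have hl2 : ∀ s, lab s ≠ a := fun s e => hlV s (by rw [e]; simp [ha])
  simp only [mem_insert, hl1, hl2, false_or] at a1 a2 a3 a5 a6 b1 b2 b3 b5 b6
  have a5' : ∀ i, i = u ∨ i ∈ ρ → i ∉ B := by
    rcases a5 with h | h
    · exact absurd hu (h u (Or.inl rfl))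
    · exact h
  refine ⟨?_, ?_, ?_, ?_, ?_, ?_⟩
  · simp only [mem_insert]; grind
  · simp only [mem_insert]; grind
  · simp only [mem_insert, hl1, hl2, false_or]; exact a3
  · have := h3 _ a4 (by simp only [mem_inter, mem_insert]; grind)
    convert this using 1
    ext i; simp only [mem_inter, mem_insert, mem_union]; grind
  · right; simp only [mem_insert]; grind
  · simp only [mem_insert, hl1, hl2, false_or]
    intro s hs hsf
    refine ⟨?_, ?_⟩
    · have := (a6 s hs hsf).1; grind
    · have := (b6 s hs hsf).2; grind

theorem KN_contr {M : Set (Finset ℕ)} (hM : Cx M) {A B : Finset ℕ} {a : ℕ} (hAB : ∀ i ∈ A, i ∉ B) (ha : a ∈ A) {lab : Finset ℕ → ℕ} {Mx : Finset (Finset ℕ)}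
    (hMx : ∀ s, s ∈ Mx → s ∈ M) (hV : ∀ s ∈ M, s ⊆ A ∪ B)
    (h3 : ∀ s ∈ M, (∀ i ∈ s, i ∉ B) → insert a s ∈ M) {N : Finset ℕ} {u : ℕ} (hu : u ∈ A) (hua : u ≠ a) (huN : u ∉ N) (haN : a ∉ N)
    (hlV : ∀ s, lab s ∉ A ∪ B) : Contr (KN M A B a lab Mx N) u a = KN M A B a lab Mx (insert u N) := by
  have hl1 : ∀ s, lab s ≠ u := fun s e => hlV s (by rw [e]; simp [hu])
  have hl2 : ∀ s, lab s ≠ a := fun s e => hlV s (by rw [e]; simp [ha])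
  ext f
  constructor
  · rintro ⟨huf, (h | ⟨haf, h⟩)⟩
    · obtain ⟨a1, a2, a3, a4, a5, a6⟩ := h
      refine ⟨a1, ?_, a3, a4, a5, ?_⟩
      · simp only [mem_insert]; grind
      · intro s hs hsf
        refine ⟨(a6 s hs hsf).1, fun h => ?_⟩
        obtain ⟨x, hx, hx'⟩ := (a6 s hs hsf).2 h
        exact ⟨x, hx, by simp only [mem_insert]; tauto⟩
    · obtain ⟨a1, a2, a3, a4, a5, a6⟩ := h
      have hfl : ∀ s, lab s ∈ insert u (f.erase a) ↔ lab s ∈ f := by intro s; simp [hl1, hl2]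
      simp only [hfl] at a3 a6
      simp only [mem_insert, mem_erase] at a1 a2 a5 a6
      have a5' : ∀ i, i = u ∨ i ≠ a ∧ i ∈ f → i ∉ B := by
        rcases a5 with h | h
        · exact absurd hu (h u (Or.inl rfl))
        · exact h
      refine ⟨?_, ?_, a3, ?_, ?_, ?_⟩
      · intro i hi
        by_cases hia : i = a
        · left; simp [hia, ha]
        · exact a1 i (Or.inr ⟨hia, hi⟩)
      · intro i hi
        rw [mem_insert]
        rintro (rfl | h)
        · exact huf hi
        · by_cases hia : i = a
          · subst hia
            exact haN h
          · exact a2 i (Or.inr ⟨hia, hi⟩) h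
      · have := h3 _ a4 (by simp only [mem_inter, mem_insert, mem_erase]; grind)
        refine hM.2 _ this _ ?_
        intro i; simp only [mem_inter, mem_insert, mem_erase, mem_union]; grind
      · right
        intro i hi
        by_cases hia : i = a
        · rw [hia]; exact hAB a ha
        · exact a5' i (Or.inr ⟨hia, hi⟩)
      · intro s hs hsf
        refine ⟨fun i hi hi' hia => (a6 s hs hsf).1 i (Or.inr ⟨hia, hi⟩) hi' hia, fun _ => ⟨u, (a6 s hs hsf).1 u (Or.inl rfl) (by simp [hu]) hua, by simp⟩⟩
  · rintro ⟨a1, a2, a3, a4, a5, a6⟩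
    have huf : u ∉ f := fun h => a2 u h (mem_insert_self _ _)
    refine ⟨huf, ?_⟩
    by_cases hall : a ∈ f → ∀ s ∈ Mx, lab s ∈ f → ∃ x ∈ s, x ∈ N ∨ x = a
    · left
      refine ⟨a1, fun i hi h => a2 i hi (mem_insert_of_mem h), a3, a4, a5, fun s hs hsf => ⟨(a6 s hs hsf).1, fun h => hall h s hs hsf⟩⟩
    · push Not at hall
      obtain ⟨haf, s0, hs0, hs0f, hno⟩ := hall
      right
      refine ⟨haf, ?_⟩
      have hut : ∀ t ∈ Mx, lab t ∈ f → u ∈ t := by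
        have hus : u ∈ s0 := by
          obtain ⟨x, hx, hx'⟩ := (a6 s0 hs0 hs0f).2 haf
          have := hno x hx
          rw [mem_insert] at hx'
          have : x = u := by tauto
          exact this ▸ hx
        intro t ht htf
        rcases a3 s0 hs0 t ht hs0f htf with h | h
        · exact h hus
        · obtain ⟨x, hx, hx'⟩ := (a6 t ht htf).2 haf
          have := hno x (h hx)
          rw [mem_insert] at hx'
          have : x = u := by tauto
          exact this ▸ hx
      have hfl : ∀ s, lab s ∈ insert u (f.erase a) ↔ lab s ∈ f := by intro s; simp [hl1, hl2]
      refine ⟨?_, ?_, ?_, ?_, ?_, ?_⟩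
      · intro i hi
        rw [mem_insert, mem_erase] at hi
        rcases hi with rfl | hi
        · left; simp [hu]
        · exact a1 i hi.2
      · intro i hi
        rw [mem_insert, mem_erase] at hi
        rcases hi with rfl | hi
        · exact huN
        · exact fun h => a2 i hi.2 (mem_insert_of_mem h)
      · simp only [hfl]; exact a3
      · refine hM.2 _ (hMx s0 hs0) _ ?_
        intro i hi
        rw [mem_inter, mem_insert, mem_erase] at hi
        rcases hi with ⟨rfl | hi, hi'⟩
        · exact hut s0 hs0 hs0f
        · exact (a6 s0 hs0 hs0f).1 i hi.2 hi' hi.1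
      · right
        have a5' : ∀ i ∈ f, i ∉ B := by
          rcases a5 with h | h
          · exact absurd ha (h a haf)
          · exact h
        intro i hi
        rw [mem_insert, mem_erase] at hi
        rcases hi with rfl | hi
        · exact hAB _ hu
        · exact a5' i hi.2
      · simp only [hfl]
        intro s hs hsf
        refine ⟨?_, ?_⟩
        · intro i hi hi' hia
          rw [mem_insert, mem_erase] at hi
          rcases hi with rfl | hi
          · exact hut s hs hsf
          · exact (a6 s hs hsf).1 i hi.2 hi' hi.1
        · intro h; simp [hua.symm] at h

/-- the state reached after preparation -/
structure St (M : Set (Finset ℕ)) (B : Finset ℕ) (a : ℕ) : Prop where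
  s0 : {a} ∈ M
  sa : a ∉ B
  s1 : ∀ f ∈ M, a ∈ f → Disjoint f B
  s2 : ∀ ρ τ τ' : Finset ℕ, ρ.Nonempty → Disjoint ρ B → τ ⊆ B → τ' ⊆ B → ρ ∪ τ ∈ M → ρ ∪ τ' ∈ M → ρ ∪ (τ ∪ τ') ∈ M
  s3 : ∀ f ∈ M, Disjoint f B → insert a f ∈ M
  s4 : ∀ f ∈ M, f.Nonempty → Disjoint f B → a ∉ f → ∃ b ∈ B, insert b f ∈ M
  s5 : ∃ r : ℕ → ℕ, (∀ b ∈ B, r b = b) ∧ ∀ f ∈ M, a ∉ f → f.image r ∈ M ∧ f.image r ⊆ B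

end PL
end HomologySpheres

end

open Finset
noncomputable section
namespace HomologySpheres
namespace PL

theorem KN_all {k : ℕ} {M : Set (Finset ℕ)} (hM : Man k M) {A B : Finset ℕ} {a : ℕ} (hAB : ∀ i ∈ A, i ∉ B) (ha : a ∈ A) (hAM : ∀ i ∈ A, {i} ∈ M)
    {lab : Finset ℕ → ℕ} (hl : Function.Injective lab) {Mx : Finset (Finset ℕ)}
    (hMx : ∀ s, s ∈ Mx ↔ s ∈ M ∧ (∃ x ∈ s, x ∈ A) ∧ ∃ x ∈ s, x ∈ B) (hV : ∀ s ∈ M, s ⊆ A ∪ B)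
    (h3 : ∀ s ∈ M, (∀ i ∈ s, i ∉ B) → insert a s ∈ M) (hlV : ∀ s, lab s ∉ A ∪ B) (N : Finset ℕ) (hN : N ⊆ A.erase a) :
    Man k (KN M A B a lab Mx N) ∧ Heq (KN M A B a lab Mx N) M := by
  induction N using Finset.induction with
  | empty =>
    rw [KN_zero ha lab hMx hV]
    have := KU_heq hM.cx hV hl hlV (Mx := Mx) (fun s hs => ((hMx s).1 hs).1) (fun s hs => by
      obtain ⟨_, ⟨x, hx, _⟩, _⟩ := (hMx s).1 hs; exact ⟨x, hx⟩) (fun s hs t ht hst => by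
      obtain ⟨_, ⟨x, hx, hx'⟩, y, hy, hy'⟩ := (hMx s).1 hs
      exact (hMx t).2 ⟨ht, ⟨x, hst hx, hx'⟩, y, hst hy, hy'⟩) _ Mx rfl le_rfl (fun s _ t ht _ => ht)
    exact ⟨hM.of_heq this.1 this.2, this.2⟩
  | insert u N huN ih =>
    obtain ⟨hu, hN⟩ := insert_subset_iff.1 hN
    rw [mem_erase] at hu
    have haN : a ∉ N := fun h => (mem_erase.1 (hN h)).1 rfl
    obtain ⟨h1, h2⟩ := ih hN
    rw [← KN_contr hM.cx hAB ha (fun s hs => ((hMx s).1 hs).1) hV h3 hu.2 hu.1 huN haN hlV]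
    have hl1 : ∀ s, lab s ≠ u := fun s e => hlV s (by rw [e]; simp [hu])
    have hl2 : ∀ s, lab s ≠ a := fun s e => hlV s (by rw [e]; simp [ha])
    have e : Heq (KN M A B a lab Mx N) (Contr (KN M A B a lab Mx N) u a) := by
      refine h1.contr hu.1 ?_ (fun ρ _ _ h h' => KN_link hM.cx hAB ha h3 hu.2 hu.1 hlV h h')
      refine ⟨?_, ?_, ?_, ?_, ?_, ?_⟩
      · simp only [mem_insert, mem_singleton, mem_union]; rintro i (rfl | rfl) <;> simp [*]
      · simp only [mem_insert, mem_singleton]; rintro i (rfl | rfl) <;> assumption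
      · simp [hl1, hl2]
      · have := h3 {u} (hAM u hu.2) (by simp; exact hAB u hu.2)
        convert this using 1
        ext i; simp only [mem_inter, mem_insert, mem_singleton, mem_union]; grind
      · right; simp only [mem_insert, mem_singleton]; rintro i (rfl | rfl) <;> exact hAB _ (by simp [*])
      · simp [hl1, hl2]
    have e' := e.symm.trans h2
    exact ⟨hM.of_heq (cx_contr h1.cx u a) e', e'⟩

theorem prep {k : ℕ} {M : Set (Finset ℕ)} (hM : Man k M) (h0 : ∅ ∈ M) {B : Finset ℕ} {a : ℕ} (haB : a ∉ B)
    (h3 : ∀ s ∈ M, Disjoint s B → insert a s ∈ M) :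
    ∃ M', Man k M' ∧ Heq M' M ∧ St M' B a ∧ ∀ s ⊆ B, s ∈ M' ↔ s ∈ M := by
  classical
  obtain ⟨V, hVM⟩ := verts_finite hM.cx
  set A := V.filter (fun i => i ∉ B ∧ {i} ∈ M) with hA
  have hV : ∀ s ∈ M, s ⊆ A ∪ B := by
    intro s hs i hi
    rw [mem_union, hA, mem_filter]
    by_cases h : i ∈ B
    · exact Or.inr h
    · exact Or.inl ⟨hVM s hs hi, h, face_vert hM.cx hs hi⟩
  have haM : {a} ∈ M := by simpa using h3 ∅ h0 (by simp)
  have haA : a ∈ A := by rw [hA, mem_filter]; exact ⟨hVM _ haM (by simp), haB, haM⟩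
  have hAB : ∀ i ∈ A, i ∉ B := fun i hi => by rw [hA, mem_filter] at hi; exact hi.2.1
  have hAM : ∀ i ∈ A, {i} ∈ M := fun i hi => by rw [hA, mem_filter] at hi; exact hi.2.2
  obtain ⟨lab, hl, hlV⟩ := exists_lab (A ∪ B)
  set Mx := hM.cx.1.toFinset.filter (fun s => (∃ x ∈ s, x ∈ A) ∧ ∃ x ∈ s, x ∈ B) with hMx0
  have hMx : ∀ s, s ∈ Mx ↔ s ∈ M ∧ (∃ x ∈ s, x ∈ A) ∧ ∃ x ∈ s, x ∈ B := by
    intro s; rw [hMx0, mem_filter, Set.Finite.mem_toFinset]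
  have h3' : ∀ s ∈ M, (∀ i ∈ s, i ∉ B) → insert a s ∈ M := fun s hs h => h3 s hs (disjoint_left.2 h)
  obtain ⟨h1, h2⟩ := KN_all hM hAB haA hAM hl hMx hV h3' hlV (A.erase a) le_rfl
  set M' := KN M A B a lab Mx (A.erase a) with hM'
  have hlB : ∀ s, lab s ∉ B := fun s h => hlV s (by simp [h])
  have hla : ∀ s, lab s ≠ a := fun s h => hlV s (by simp [h, haA])
  have key : ∀ f, f ∈ M' ↔ (∀ i ∈ f, i = a ∨ i ∈ B ∨ ∃ s ∈ Mx, i = lab s) ∧ (∀ s ∈ Mx, ∀ t ∈ Mx, lab s ∈ f → lab t ∈ f → s ⊆ t ∨ t ⊆ s) ∧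
      (a ∈ f → Disjoint f B) ∧ f ∩ B ∈ M ∧ ∀ s ∈ Mx, lab s ∈ f → f ∩ B ⊆ s := by
    intro f
    constructor
    · rintro ⟨a1, a2, a3, a4, a5, a6⟩
      refine ⟨?_, a3, ?_, hM.cx.2 _ a4 _ (inter_subset_inter_left subset_union_right), ?_⟩
      · intro i hi
        have := a1 i hi; have := a2 i hi
        simp only [mem_erase, mem_union] at *; tauto
      · intro haf
        rcases a5 with h | h
        · exact absurd haA (h a haf)
        · exact disjoint_left.2 h
      · intro s hs hsf i hi
        rw [mem_inter] at hi
        exact (a6 s hs hsf).1 i hi.1 (by simp [hi]) (fun e => haB (e ▸ hi.2))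
    · rintro ⟨a1, a2, a3, a4, a5⟩
      have haf : a ∈ f ∨ a ∉ f := em _
      refine ⟨?_, ?_, a2, ?_, ?_, ?_⟩
      · intro i hi
        rcases a1 i hi with rfl | h | h
        · left; simp [haA]
        · left; simp [h]
        · right; exact h
      · intro i hi
        rw [mem_erase]
        rintro ⟨h1, h2⟩
        rcases a1 i hi with h | h | ⟨s, _, rfl⟩
        · exact h1 h
        · exact hAB i h2 h
        · exact hlV s (by simp [h2])
      · by_cases haf : a ∈ f
        · refine hM.cx.2 _ haM _ ?_
          intro i hi
          rw [mem_inter] at hi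
          rcases a1 i hi.1 with h | h | ⟨s, _, rfl⟩
          · simp [h]
          · exact absurd h (disjoint_left.1 (a3 haf) hi.1)
          · exact absurd hi.2 (hlV s)
        · refine hM.cx.2 _ a4 _ ?_
          intro i hi
          rw [mem_inter] at hi
          rcases a1 i hi.1 with rfl | h | ⟨s, _, rfl⟩
          · exact absurd hi.1 haf
          · exact mem_inter.2 ⟨hi.1, h⟩
          · exact absurd hi.2 (hlV s)
      · by_cases haf : a ∈ f
        · right; exact disjoint_left.1 (a3 haf)
        · left
          intro i hi
          rcases a1 i hi with rfl | h | ⟨s, _, rfl⟩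
          · exact absurd hi haf
          · exact fun h' => hAB i h' h
          · exact fun h' => hlV s (by simp [h'])
      · intro s hs hsf
        refine ⟨?_, ?_⟩
        · intro i hi hi' hia
          rcases a1 i hi with rfl | h | ⟨s, _, rfl⟩
          · exact absurd rfl hia
          · exact a5 s hs hsf (mem_inter.2 ⟨hi, h⟩)
          · exact absurd hi' (hlV s)
        · intro _
          obtain ⟨_, ⟨x, hx, hxA⟩, _⟩ := (hMx s).1 hs
          refine ⟨x, hx, ?_⟩
          rw [mem_erase]; tauto
  refine ⟨M', h1, h2, ?_, ?_⟩
  · choose! r hr hrB using fun s (hs : s ∈ Mx) => ((hMx s).1 hs).2.2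
    refine ⟨?_, haB, ?_, ?_, ?_, ?_, ?_⟩
    · rw [key]
      refine ⟨by simp, by simp [hla], by simp [haB], ?_, by simp [hla]⟩
      rwa [show ({a} : Finset ℕ) ∩ B = ∅ by simp [haB]]
    · intro f hf; exact ((key f).1 hf).2.2.1
    · intro ρ τ τ' hρ hρB hτ hτ' h h'
      obtain ⟨a1, a2, a3, a4, a5⟩ := (key _).1 h
      obtain ⟨b1, b2, b3, b4, b5⟩ := (key _).1 h'
      have e1 : (ρ ∪ τ) ∩ B = τ := by
        rw [union_inter_distrib_right, disjoint_iff_inter_eq_empty.1 hρB, empty_union, inter_eq_left.2 hτ]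
      have e2 : (ρ ∪ τ') ∩ B = τ' := by
        rw [union_inter_distrib_right, disjoint_iff_inter_eq_empty.1 hρB, empty_union, inter_eq_left.2 hτ']
      have e3 : (ρ ∪ (τ ∪ τ')) ∩ B = τ ∪ τ' := by
        rw [union_inter_distrib_right, disjoint_iff_inter_eq_empty.1 hρB, empty_union, inter_eq_left.2 (union_subset hτ hτ')]
      have hlρ : ∀ s, lab s ∈ ρ ∪ (τ ∪ τ') → lab s ∈ ρ := by
        intro s hs
        simp only [mem_union] at hs
        rcases hs with h | h | h
        · exact h
        · exact absurd (hτ h) (hlB s)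
        · exact absurd (hτ' h) (hlB s)
      by_cases haρ : a ∈ ρ
      · have t1 : τ = ∅ := by
          rw [← e1]; exact disjoint_iff_inter_eq_empty.1 (a3 (by simp [haρ]))
        have t2 : τ' = ∅ := by
          rw [← e2]; exact disjoint_iff_inter_eq_empty.1 (b3 (by simp [haρ]))
        rw [t1] at h; rw [t1, t2]; simpa using h
      rw [e1] at a4 a5; rw [e2] at b4 b5
      obtain ⟨x, hx⟩ := hρ
      obtain ⟨s, hs, rfl⟩ : ∃ s ∈ Mx, x = lab s := by
        rcases a1 x (by simp [hx]) with rfl | h | h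
        · exact absurd hx haρ
        · exact absurd h (disjoint_left.1 hρB hx)
        · exact h
      rw [key, e3]
      refine ⟨?_, ?_, ?_, ?_, ?_⟩
      · intro i hi
        simp only [mem_union] at hi
        rcases hi with h | h | h
        · exact a1 i (by simp [h])
        · exact a1 i (by simp [h])
        · exact b1 i (by simp [h])
      · intro s hs t ht h h'
        exact a2 s hs t ht (by simp [hlρ s h]) (by simp [hlρ t h'])
      · intro h
        simp only [mem_union] at h
        rcases h with h | h | h
        · exact absurd h haρ
        · exact absurd (hτ h) haB
        · exact absurd (hτ' h) haB
      · exact hM.cx.2 _ ((hMx s).1 hs).1 _ (union_subset (a5 s hs (by simp [hx])) (b5 s hs (by simp [hx])))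
      · intro t ht h
        exact union_subset (a5 t ht (by simp [hlρ t h])) (b5 t ht (by simp [hlρ t h]))
    · intro f hf hfB
      obtain ⟨a1, a2, a3, a4, a5⟩ := (key _).1 hf
      have e : insert a f ∩ B = ∅ := by rw [insert_inter_of_notMem haB, disjoint_iff_inter_eq_empty.1 hfB]
      rw [key, e]
      refine ⟨?_, ?_, ?_, h0, by simp⟩
      · intro i hi
        rw [mem_insert] at hi
        rcases hi with h | h
        · exact Or.inl h
        · exact a1 i h
      · simpa [hla] using a2
      · intro _; rwa [disjoint_insert_left, and_iff_right haB]
    · intro f hf hne hfB haf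
      obtain ⟨a1, a2, a3, a4, a5⟩ := (key _).1 hf
      have hlab : ∀ i ∈ f, ∃ s ∈ Mx, i = lab s := by
        intro i hi
        rcases a1 i hi with rfl | h | h
        · exact absurd hi haf
        · exact absurd h (disjoint_left.1 hfB hi)
        · exact h
      obtain ⟨s, hs, hmin⟩ := exists_min_image (Mx.filter (fun s => lab s ∈ f)) card (by
        obtain ⟨x, hx⟩ := hne
        obtain ⟨s, hs, rfl⟩ := hlab x hx
        exact ⟨s, mem_filter.2 ⟨hs, hx⟩⟩)
      rw [mem_filter] at hs
      have hsub : ∀ t ∈ Mx, lab t ∈ f → s ⊆ t := by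
        intro t ht htf
        rcases a2 s hs.1 t ht hs.2 htf with h | h
        · exact h
        · rw [eq_of_subset_of_card_le h (hmin t (mem_filter.2 ⟨ht, htf⟩))]
      have hrl : ∀ t, lab t ≠ r s := fun t e => hlB t (e ▸ hrB s hs.1)
      have e : insert (r s) f ∩ B = {r s} := by
        rw [insert_inter_of_mem (hrB s hs.1), disjoint_iff_inter_eq_empty.1 hfB]; rfl
      refine ⟨r s, hrB s hs.1, (key _).2 ?_⟩
      rw [e]
      refine ⟨?_, ?_, ?_, ?_, ?_⟩
      · intro i hi
        rw [mem_insert] at hi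
        rcases hi with rfl | h
        · exact Or.inr (Or.inl (hrB s hs.1))
        · exact a1 i h
      · simpa [hrl] using a2
      · intro h
        rw [mem_insert] at h
        rcases h with h | h
        · exact absurd (hrB s hs.1) (h ▸ haB)
        · exact absurd h haf
      · exact hM.cx.2 _ ((hMx s).1 hs.1).1 _ (by simpa using hr s hs.1)
      · intro t ht h
        simp only [mem_insert, hrl, false_or] at h
        simpa using hsub t ht h (hr s hs.1)
    · refine ⟨fun i => if h : ∃ s ∈ Mx, i = lab s then r h.choose else i, ?_, ?_⟩
      · intro b hb
        beta_reduce
        rw [dif_neg]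
        rintro ⟨s, _, rfl⟩
        exact hlB s hb
      · have hR : ∀ s ∈ Mx, (if h : ∃ t ∈ Mx, lab s = lab t then r h.choose else lab s) = r s := by
          intro s hs
          have h : ∃ t ∈ Mx, lab s = lab t := ⟨s, hs, rfl⟩
          rw [dif_pos h, ← hl h.choose_spec.2]
        intro f hf haf
        obtain ⟨a1, a2, a3, a4, a5⟩ := (key _).1 hf
        set ri : ℕ → ℕ := fun i => if h : ∃ s ∈ Mx, i = lab s then r h.choose else i with hri
        have hriB : ∀ b ∈ B, ri b = b := by
          intro b hb
          rw [hri]; beta_reduce; rw [dif_neg]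
          rintro ⟨s, _, rfl⟩
          exact hlB s hb
        have hsub : f.image ri ⊆ B := by
          intro j hj
          obtain ⟨i, hi, rfl⟩ := mem_image.1 hj
          rcases a1 i hi with rfl | h | ⟨s, hs, rfl⟩
          · exact absurd hi haf
          · rw [hriB i h]; exact h
          · rw [show ri (lab s) = r s from hR s hs]; exact hrB s hs
        refine ⟨?_, hsub⟩
        have hmem : f.image ri ∈ M := by
          by_cases hex : ∃ s ∈ Mx, lab s ∈ f
          · obtain ⟨s, hs, hmax⟩ := exists_max_image (Mx.filter (fun s => lab s ∈ f)) card (by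
              obtain ⟨s, hs, h⟩ := hex; exact ⟨s, mem_filter.2 ⟨hs, h⟩⟩)
            rw [mem_filter] at hs
            refine hM.cx.2 _ ((hMx s).1 hs.1).1 _ ?_
            intro j hj
            obtain ⟨i, hi, rfl⟩ := mem_image.1 hj
            rcases a1 i hi with rfl | h | ⟨t, ht, rfl⟩
            · exact absurd hi haf
            · rw [hriB i h]; exact a5 s hs.1 hs.2 (mem_inter.2 ⟨hi, h⟩)
            · rw [show ri (lab t) = r t from hR t ht]
              rcases a2 t ht s hs.1 hi hs.2 with h | h
              · exact h (hr t ht)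
              · rw [eq_of_subset_of_card_le h (hmax t (mem_filter.2 ⟨ht, hi⟩))]; exact hr t ht
          · refine hM.cx.2 _ a4 _ ?_
            intro j hj
            obtain ⟨i, hi, rfl⟩ := mem_image.1 hj
            rcases a1 i hi with rfl | h | ⟨t, ht, rfl⟩
            · exact absurd hi haf
            · rw [hriB i h]; exact mem_inter.2 ⟨hi, h⟩
            · exact absurd ⟨t, ht, hi⟩ hex
        rw [key, inter_eq_left.2 hsub]
        refine ⟨fun i hi => Or.inr (Or.inl (hsub hi)), ?_, ?_, hmem, ?_⟩
        · intro s _ t _ h; exact absurd (hsub h) (hlB s)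
        · intro h; exact absurd (hsub h) haB
        · intro s _ h; exact absurd (hsub h) (hlB s)
  · intro s hs
    rw [key, inter_eq_left.2 hs]
    constructor
    · exact fun h => h.2.2.2.1
    · intro h
      refine ⟨fun i hi => Or.inr (Or.inl (hs hi)), ?_, ?_, h, ?_⟩
      · intro t _ t' _ h; exact absurd (hs h) (hlB t)
      · intro h; exact absurd (hs h) haB
      · intro t _ h; exact absurd (hs h) (hlB t)

end PL
end HomologySpheres

end

open Finset
noncomputable section
namespace HomologySpheres
namespace PL

theorem even_cycle {k : ℕ} {W : Finset (Finset ℕ)} (hW : ∀ t ∈ W, t.card = k + 1) (h : ∀ r : Finset ℕ, r.card = k → Even #{t ∈ W | r ⊆ t}) :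
    bdy (∑ t ∈ W, ee t) = 0 := by
  have hb : ∀ t ∈ W, ∀ r, bdy (ee t) r = if r.card = k ∧ r ⊆ t then 1 else 0 := by
    intro t ht r
    rw [bdy_ee, Finsupp.finsetSum_apply]
    split_ifs with h1
    · have hc : (t \ r).card = 1 := by rw [card_sdiff_of_subset h1.2, hW t ht]; omega
      obtain ⟨v, hv⟩ := card_eq_one.1 hc
      have hvm : v ∈ t \ r := by rw [hv]; simp
      rw [mem_sdiff] at hvm
      have hr : t.erase v = r := by
        refine (eq_of_subset_of_card_le (subset_erase.2 ⟨h1.2, hvm.2⟩) ?_).symm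
        rw [card_erase_of_mem hvm.1, hW t ht]; omega
      rw [sum_eq_single v]
      · rw [ee, Finsupp.single_apply, if_pos hr]
      · intro w hw hwv
        rw [ee, Finsupp.single_apply, if_neg]
        intro e
        have : v ∈ t.erase w := mem_erase.2 ⟨hwv.symm, hvm.1⟩
        rw [e] at this; exact hvm.2 this
      · intro h; exact absurd hvm.1 h
    · refine sum_eq_zero fun v hv => ?_
      rw [ee, Finsupp.single_apply, if_neg]
      rintro rfl
      exact h1 ⟨by rw [card_erase_of_mem hv, hW t ht]; omega, erase_subset _ _⟩
  ext r
  rw [map_sum, Finsupp.finsetSum_apply, sum_congr rfl (fun t ht => hb t ht r)]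
  by_cases hr : r.card = k
  · simp only [hr, true_and]
    rw [sum_boole]
    have := h r hr
    rw [Finsupp.zero_apply]
    exact (ZMod.natCast_eq_zero_iff_even).2 this
  · simp [hr]

theorem collapse {k : ℕ} {M : Set (Finset ℕ)} (hM : Man k M) {B : Finset ℕ} {a : ℕ} (hS : St M B a) {τ : Finset ℕ} {p : ℕ}
    (hτ0 : τ.Nonempty) (hpτ : p ∉ τ) (hσ : insert p τ ∈ M) (hσB : insert p τ ⊆ B)
    (hfree : ∀ f ∈ M, f ⊆ B → τ ⊆ f → f = τ ∨ f = insert p τ) :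
    ∃ M', Man k M' ∧ Heq M' M ∧ ∅ ∈ M' ∧ (∀ s ∈ M', Disjoint s B → insert a s ∈ M') ∧ ∀ s ⊆ B, s ∈ M' ↔ s ∈ M ∧ ¬ τ ⊆ s := by
  have h0 : ∅ ∈ M := hM.cx.2 _ hσ _ (by simp)
  have hτB : τ ⊆ B := (subset_insert _ _).trans hσB
  have hpB : p ∈ B := hσB (by simp)
  obtain ⟨t, htM, htB⟩ := exists_fresh hM.cx.1 (insert a B)
  rw [mem_insert, not_or] at htB
  have htτ : t ∉ τ := fun h => htB.2 (hτB h)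
  have htp : t ≠ p := fun h => htB.2 (h ▸ hpB)
  set K1 := Star M τ t with hK1
  have e1 : Heq K1 M := heq_star hM.cx hτ0 htM htτ
  have hM1 : Man k K1 := hM.of_heq (cx_star hM.cx _ _) e1
  have hmem : ∀ s, s ∈ K1 ↔ ¬ τ ⊆ s ∧ ((t ∉ s ∧ s ∈ M) ∨ (t ∈ s ∧ s.erase t ∪ τ ∈ M)) := fun s => Iff.rfl
  have hpe : ∀ ρ : Finset ℕ, t ∉ ρ → p ∉ ρ → ρ ∪ τ ∈ M → ρ ∩ B ⊆ τ := by
    intro ρ ht hp h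
    rcases hfree (ρ ∩ B ∪ τ) (hM.cx.2 _ h _ (union_subset_union_left inter_subset_left)) (union_subset inter_subset_right hτB) subset_union_right with h | h
    · rw [← h]; exact subset_union_left
    · have : p ∈ ρ ∩ B ∪ τ := by rw [h]; simp
      rw [mem_union, mem_inter] at this
      tauto
  have e2 : Heq K1 (Contr K1 t p) := by
    refine hM1.contr htp ?_ ?_
    · rw [hmem]
      refine ⟨?_, Or.inr ⟨by simp, ?_⟩⟩
      · intro h
        obtain ⟨x, hx⟩ := hτ0
        have := h hx
        simp only [mem_insert, mem_singleton] at this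
        rcases this with rfl | rfl
        · exact htτ hx
        · exact hpτ hx
      · convert hσ using 1
        ext i; simp only [mem_union, mem_erase, mem_insert, mem_singleton]; grind
    · intro ρ ht hp h h'
      rw [hmem] at h h' ⊢
      obtain ⟨b1, b2⟩ := h
      obtain ⟨c1, c2⟩ := h'
      have b2' : ρ ∪ τ ∈ M := by
        rcases b2 with b | b
        · exact absurd (mem_insert_self _ _) b.1
        · have := b.2; rwa [erase_insert ht] at this
      have c2' : insert p ρ ∈ M := by
        rcases c2 with c | c
        · exact c.2
        · have := c.1; rw [mem_insert] at this; tauto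
      refine ⟨?_, Or.inr ⟨by simp, ?_⟩⟩
      · intro h; apply c1
        intro x hx
        have := h hx; rw [mem_insert] at this
        rcases this with rfl | h
        · exact absurd hx htτ
        · exact h
      · rw [erase_insert (by simp [ht, htp])]
        have hB := hpe ρ ht hp b2'
        have eq : insert p ρ ∪ τ = (ρ \ B) ∪ ((ρ ∩ B ∪ τ) ∪ (insert p (ρ ∩ B))) := by
          ext i; simp only [mem_union, mem_insert, mem_sdiff, mem_inter]; grind
        by_cases hne : (ρ \ B).Nonempty
        · rw [eq]
          refine hS.s2 _ _ _ hne sdiff_disjoint (union_subset inter_subset_right hτB) (insert_subset hpB inter_subset_right) ?_ ?_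
          · convert b2' using 1
            ext i; simp only [mem_union, mem_sdiff, mem_inter]; grind
          · convert c2' using 1
            ext i; simp only [mem_union, mem_insert, mem_sdiff, mem_inter]; grind
        · rw [not_nonempty_iff_eq_empty] at hne
          rw [eq, hne]
          refine hM.cx.2 _ hσ _ ?_
          intro i; have := @hB i
          simp only [mem_union, mem_insert, mem_inter, notMem_empty] at this ⊢; grind
  have hcm : ∀ s, s ∈ Contr K1 t p ↔ t ∉ s ∧ (s ∈ K1 ∨ (p ∈ s ∧ insert t (s.erase p) ∈ K1)) := fun s => Iff.rfl
  have e3 := e2.symm.trans e1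
  have hcx := cx_contr hM1.cx t p
  have key : ∀ s ⊆ B, s ∈ Contr K1 t p ↔ s ∈ M ∧ ¬ τ ⊆ s := by
    intro s hs
    have hts : t ∉ s := fun h => htB.2 (hs h)
    rw [hcm]
    constructor
    · rintro ⟨_, (h | ⟨hp, h⟩)⟩
      · rw [hmem] at h
        exact ⟨by grind, h.1⟩
      · rw [hmem, erase_insert (by simp [hts])] at h
        have h1 : s.erase p ∪ τ ∈ M := by
          rcases h.2 with h | h
          · exact absurd (mem_insert_self _ _) h.1
          · exact h.2
        have h2 := hpe (s.erase p) (by simp [hts]) (by simp) h1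
        refine ⟨hM.cx.2 _ hσ _ ?_, ?_⟩
        · intro i hi
          rw [mem_insert]
          by_cases hip : i = p
          · exact Or.inl hip
          · exact Or.inr (h2 (mem_inter.2 ⟨mem_erase.2 ⟨hip, hi⟩, hs hi⟩))
        · intro hτs
          refine h.1 fun i hi => mem_insert_of_mem (mem_erase.2 ⟨fun e => hpτ (e ▸ hi), hτs hi⟩)
    · rintro ⟨h1, h2⟩
      exact ⟨hts, Or.inl ((hmem s).2 ⟨h2, Or.inl ⟨hts, h1⟩⟩)⟩
  refine ⟨_, hM.of_heq hcx e3, e3, ?_, ?_, key⟩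
  · rw [key ∅ (by simp)]
    exact ⟨h0, fun h => hτ0.ne_empty (subset_empty.1 h)⟩
  · intro s hs hsB
    rw [hcm] at hs ⊢
    have hps : p ∉ s := fun h => disjoint_left.1 hsB h hpB
    obtain ⟨hts, (h | h)⟩ := hs
    · rw [hmem] at h
      have hsM : s ∈ M := by tauto
      have hta : t ∉ insert a s := by simp [htB.1, hts]
      refine ⟨hta, Or.inl ((hmem _).2 ⟨?_, Or.inl ⟨hta, hS.s3 s hsM hsB⟩⟩)⟩
      intro h'
      obtain ⟨x, hx⟩ := hτ0
      have := h' hx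
      rw [mem_insert] at this
      rcases this with rfl | h'
      · exact hS.sa (hτB hx)
      · exact disjoint_left.1 hsB h' (hτB hx)
    · exact absurd h.1 hps

theorem finish {d : ℕ} {M : Set (Finset ℕ)} (hM : Man (d+1) M) {B : Finset ℕ} {a : ℕ} (hS : St M B a) {b : ℕ} (hbB : b ∈ B) (hb : {b} ∈ M)
    (hC : ∀ f ∈ M, f ⊆ B → f ⊆ {b}) : Sph (d+2) M := by
  have hab : a ≠ b := fun e => hS.sa (e ▸ hbB)
  have hfB : ∀ f ∈ M, ∀ i ∈ f, i ∈ B → i = b := by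
    intro f hf i hi hiB
    have := hC {i} (face_vert hM.cx hf hi) (by simpa using hiB)
    simpa using this
  have h := join_sph (hM.sph a hS.s0) (σ := {a, b}) (by simp) (by
    intro s hs
    rw [disjoint_right]
    intro i hi
    simp only [mem_insert, mem_singleton] at hi
    rcases hi with rfl | rfl
    · exact hs.1
    · exact fun h => disjoint_left.1 (hS.s1 _ hs.2 (mem_insert_self _ _)) (mem_insert_of_mem h) hbB) (k := d + 2) (by rw [card_pair hab])
  convert h using 1
  ext f
  constructor
  · intro hf
    refine And.intro ⟨by simp, ?_⟩ ?_
    · refine hS.s3 _ (hM.cx.2 _ hf _ sdiff_subset) (disjoint_left.2 fun i hi hiB => ?_)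
      rw [mem_sdiff] at hi
      have := hfB f hf i hi.1 hiB
      exact hi.2 (by simp [this])
    · intro hab
      exact disjoint_left.1 (hS.s1 f hf (hab (by simp))) (hab (by simp : b ∈ ({a, b} : Finset ℕ))) hbB
  · rintro ⟨⟨_, h1⟩, h2⟩
    set g := f \ {a, b} with hg
    have hgM : g ∈ M := hM.cx.2 _ h1 _ (subset_insert _ _)
    have hgB : Disjoint g B := (hS.s1 _ h1 (mem_insert_self _ _)).mono_left (subset_insert _ _)
    have hag : a ∉ g := by simp [hg]
    by_cases hbf : b ∈ f
    · have haf : a ∉ f := fun h => h2 (by simp [insert_subset_iff, h, hbf])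
      have hbg : insert b g ∈ M := by
        by_cases hne : g.Nonempty
        · obtain ⟨b', hb', h⟩ := hS.s4 g hgM hne hgB hag
          have := hfB _ h b' (mem_insert_self _ _) hb'
          rwa [← this]
        · rw [not_nonempty_iff_eq_empty.1 hne]; simpa using hb
      refine hM.cx.2 _ hbg _ ?_
      intro i hi
      simp only [hg, mem_insert, mem_sdiff, mem_singleton]
      by_cases i = b
      · left; assumption
      · right; refine ⟨hi, ?_⟩
        rintro (rfl | h)
        · exact haf hi
        · contradiction
    · refine hM.cx.2 _ h1 _ ?_
      intro i hi
      simp only [hg, mem_insert, mem_sdiff, mem_singleton]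
      by_cases i = a
      · left; assumption
      · right; refine ⟨hi, ?_⟩
        rintro (h | rfl)
        · contradiction
        · exact hbf hi

theorem reduce {d : ℕ} (hd : 1 ≤ d) {B : Finset ℕ} (hB : B.card ≤ 7) : ∀ m : ℕ, ∀ (M : Set (Finset ℕ)) (a : ℕ), Man (d+1) M → ∅ ∈ M → a ∉ B →
    (∀ s ∈ M, Disjoint s B → insert a s ∈ M) → (∀ n, n ≠ d+1 → Van n M) → ¬ Van (d+1) M → {f | f ∈ M ∧ f ⊆ B}.ncard = m → Sph (d+2) M := by
  classical
  intro m
  induction m using Nat.strong_induction_on with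
  | _ m ih =>
  intro M a hM h0 haB h3 hv hnv hm
  obtain ⟨M', hM', e, hS, hC⟩ := prep hM h0 haB h3
  have h0' : ∅ ∈ M' := (hC ∅ (by simp)).2 h0
  have hv' : ∀ n, n ≠ d+1 → Van n M' := fun n hn => (hv n hn).of_heq hM'.cx hM.cx h0 e
  have hnv' : ¬ Van (d+1) M' := fun h => hnv (h.of_heq hM.cx hM'.cx h0' e.symm)
  suffices h : Sph (d+2) M' from h.of_heq hM.cx h0 e.symm
  obtain ⟨r, hrB, hr⟩ := hS.s5
  set C := B.powerset.filter (fun f => f ∈ M') with hCdef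
  have hCm : ∀ f, f ∈ C ↔ f ⊆ B ∧ f ∈ M' := by intro f; rw [hCdef, mem_filter, mem_powerset]
  obtain ⟨σ, hσ, hmax⟩ := exists_max_image C card ⟨∅, (hCm ∅).2 ⟨by simp, h0'⟩⟩
  obtain ⟨n, hn⟩ : ∃ n, σ.card = n := ⟨_, rfl⟩
  have hno : ∀ f ∈ M', f ⊆ B → f.card ≠ n + 1 := by
    intro f hf hfB h
    have := hmax f ((hCm f).2 ⟨hfB, hf⟩); omega
  have hnc := fun (W : Chn) => no_cycle hd hM' hv' hnv' hS.s0 hS.sa hrB hr hno (W := W)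
  rcases n with _ | k
  · have := hnc (ee ∅) (ee_mem ⟨h0', by simp⟩ (by simp)) (by simp [bdy_ee])
    have := congrArg (fun c : Chn => c ∅) this
    simp [ee] at this
  set T := C.filter (fun f => f.card = k + 1) with hT
  have hTm : ∀ f, f ∈ T ↔ (f ⊆ B ∧ f ∈ M') ∧ f.card = k + 1 := by intro f; rw [hT, mem_filter, hCm]
  by_cases hdeg : ∀ r : Finset ℕ, r.card = k → #{t ∈ T | r ⊆ t} ≠ 1
  · obtain ⟨W, hWT, hWne, hWe⟩ := C7 hB (k := k) (T := T) ⟨σ, mem_filter.2 ⟨hσ, hn⟩⟩ (fun t ht => ⟨((hTm t).1 ht).1.1, ((hTm t).1 ht).2⟩) (by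
      intro r hr; convert hdeg r hr)
    have h1 := hnc (∑ t ∈ W, ee t) (Submodule.sum_mem _ fun t ht => by
      have := (hTm t).1 (hWT ht)
      exact ee_mem ⟨this.1.2, this.1.1⟩ this.2) (even_cycle (fun t ht => ((hTm t).1 (hWT ht)).2) (fun r hr => by convert hWe r hr))
    obtain ⟨t, ht⟩ := hWne
    have h2 := congrArg (fun c : Chn => c t) h1
    simp only [Finsupp.finsetSum_apply, Finsupp.zero_apply] at h2
    rw [sum_eq_single t] at h2
    · simp [ee] at h2
    · intro t' _ hne; rw [ee, Finsupp.single_apply, if_neg hne]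
    · intro h; exact absurd ht h
  push Not at hdeg
  obtain ⟨τ, hτk, hτ1⟩ := hdeg
  obtain ⟨σ', hσ'⟩ := card_eq_one.1 hτ1
  have hσ1 : σ' ∈ T ∧ τ ⊆ σ' := by rw [← mem_filter, hσ']; simp
  have huniq : ∀ f ∈ T, τ ⊆ f → f = σ' := by
    intro f hf h
    have : f ∈ ({t ∈ T | τ ⊆ t} : Finset _) := mem_filter.2 ⟨hf, h⟩
    rw [hσ'] at this; simpa using this
  have hσ2 := (hTm σ').1 hσ1.1
  have hfree : ∀ f ∈ M', f ⊆ B → τ ⊆ f → f = τ ∨ f = σ' := by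
    intro f hf hfB hτf
    have h1 := hmax f ((hCm f).2 ⟨hfB, hf⟩)
    have h2 := card_le_card hτf
    by_cases hfc : f.card = k + 1
    · right; exact huniq f ((hTm f).2 ⟨⟨hfB, hf⟩, hfc⟩) hτf
    · left; exact (eq_of_subset_of_card_le hτf (by omega)).symm
  obtain ⟨p, hp⟩ := card_eq_one.1 (show (σ' \ τ).card = 1 by rw [card_sdiff_of_subset hσ1.2]; omega)
  have hpm : p ∈ σ' \ τ := by rw [hp]; simp
  rw [mem_sdiff] at hpm
  have hσe : σ' = insert p τ := by
    rw [← sdiff_union_of_subset hσ1.2, hp]; rfl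
  rw [hσe] at hσ2 hfree
  rcases k with _ | k
  · obtain rfl := card_eq_zero.1 hτk
    refine finish hM' hS (b := p) (hσ2.1.1 (by simp)) (by simpa using hσ2.1.2) ?_
    intro f hf hfB
    rcases hfree f hf hfB (by simp) with rfl | rfl <;> simp
  · obtain ⟨M2, hM2, e2, h02, h32, hC2⟩ := collapse hM' hS (τ := τ) (p := p) (card_pos.1 (by omega)) hpm.2 hσ2.1.2 hσ2.1.1 hfree
    have h := ih _ ?_ M2 a hM2 h02 haB h32 (fun n hn => (hv' n hn).of_heq hM2.cx hM'.cx h0' e2)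
      (fun h => hnv' (h.of_heq hM'.cx hM2.cx h02 e2.symm)) rfl
    · exact h.of_heq hM'.cx h0' e2.symm
    · rw [← hm]
      refine Set.ncard_lt_ncard ?_ (hM.cx.1.subset fun f hf => hf.1)
      rw [Set.ssubset_iff_of_subset]
      · have hτB : τ ⊆ B := (subset_insert p τ).trans hσ2.1.1
        refine ⟨τ, ⟨(hC τ hτB).1 (hM'.cx.2 _ hσ2.1.2 _ (subset_insert _ _)), hτB⟩, ?_⟩
        intro h
        exact ((hC2 τ hτB).1 h.1).2 subset_rfl
      · intro f hf
        exact ⟨(hC f hf.2).1 ((hC2 f hf.2).1 hf.1).1, hf.2⟩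

end PL
end HomologySpheres

end

open Finset
noncomputable section
namespace HomologySpheres
namespace PL
open scoped Classical

theorem mem_verts {α : Type*} [DecidableEq α] {K : Finset (Finset α)} {v : α} : v ∈ verts K ↔ ∃ s ∈ K, v ∈ s := by
  simp [verts, mem_sup]

def Lab {α : Type*} (K : Finset (Finset α)) (f : α → ℕ) : Set (Finset ℕ) :=
  {s | ∃ t, (t ∈ K ∨ t = ∅) ∧ s = t.image f}

theorem Lab_congr {α : Type*} [DecidableEq α] {K : Finset (Finset α)} {f g : α → ℕ} (h : ∀ v ∈ verts K, f v = g v) : Lab K f = Lab K g := by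
  have : ∀ t, (t ∈ K ∨ t = ∅) → t.image f = t.image g := by
    rintro t (ht | rfl)
    · exact image_congr fun x hx => h x (mem_verts.2 ⟨t, ht, hx⟩)
    · simp
  ext s
  constructor
  · rintro ⟨t, ht, rfl⟩; exact ⟨t, ht, this t ht⟩
  · rintro ⟨t, ht, rfl⟩; exact ⟨t, ht, (this t ht).symm⟩

theorem Lab_image {α β : Type*} [DecidableEq α] [DecidableEq β] {K : Finset (Finset α)} (f : α → β) (h : β → ℕ) :
    Lab (K.image (Finset.image f)) h = Lab K (fun x => h (f x)) := by
  ext s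
  constructor
  · rintro ⟨t, ht, rfl⟩
    rcases ht with ht | rfl
    · obtain ⟨u, hu, rfl⟩ := mem_image.1 ht
      exact ⟨u, Or.inl hu, by rw [image_image]; rfl⟩
    · exact ⟨∅, Or.inr rfl, by simp⟩
  · rintro ⟨t, ht, rfl⟩
    rcases ht with ht | rfl
    · exact ⟨t.image f, Or.inl (mem_image_of_mem _ ht), by rw [image_image]; rfl⟩
    · exact ⟨∅, Or.inr rfl, by simp⟩

theorem Lab_cx {α : Type*} {K : Finset (Finset α)} (h : ∀ s ∈ K, ∀ t : Finset α, t ⊆ s → t.Nonempty → t ∈ K) (f : α → ℕ) : Cx (Lab K f) := by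
  constructor
  · refine ((insert ∅ K).image (Finset.image f)).finite_toSet.subset ?_
    rintro s ⟨t, ht, rfl⟩
    rw [mem_coe]
    exact mem_image_of_mem _ (by rcases ht with ht | rfl <;> simp [*])
  · rintro s ⟨t, ht, rfl⟩ u hu
    obtain ⟨t', h1, rfl⟩ := subset_image_iff.1 hu
    refine ⟨t', ?_, rfl⟩
    rcases t'.eq_empty_or_nonempty with h0 | h0
    · exact Or.inr h0
    · rcases ht with ht | rfl
      · exact Or.inl (h t ht t' (by simpa using h1) h0)
      · simp at h1; exact Or.inr h1

theorem Lab_emp {α : Type*} {K : Finset (Finset α)} (f : α → ℕ) : ∅ ∈ Lab K f := ⟨∅, Or.inr rfl, by simp⟩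

theorem R_full_emp : R (full ∅) = ∅ := by rw [R_full]; simp

theorem hull_img {T : Vec →ₗ[ℝ] (ℕ → ℝ)} (s : Finset ℕ) :
    convexHull ℝ ((s.image fun i => T (dl i) : Finset (ℕ → ℝ)) : Set (ℕ → ℝ)) = T '' R (full s) := by
  rw [R_full, LinearMap.image_convexHull, Set.image_image, coe_image]

theorem g_bij (G : GComplex) {h : (ℕ → ℝ) → ℕ} (hh : Set.InjOn h ↑(verts G.faces)) :
    ∃ F : Vec →ₗ[ℝ] (ℕ → ℝ), Set.BijOn F (R (Lab G.faces h)) G.carrier := by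
  set iv : ℕ → (ℕ → ℝ) := Function.invFunOn h ↑(verts G.faces) with hiv
  have hivh : ∀ x ∈ verts G.faces, iv (h x) = x := fun x hx => hh.leftInvOn_invFunOn hx
  set F : Vec →ₗ[ℝ] (ℕ → ℝ) := Finsupp.linearCombination ℝ iv with hF
  have hFd : ∀ x ∈ verts G.faces, F (dl (h x)) = x := fun x hx => by
    rw [hF, dl, Finsupp.linearCombination_single, one_smul, hivh x hx]
  have himg : ∀ t : Finset (ℕ → ℝ), (∀ x ∈ t, x ∈ verts G.faces) → F '' R (full (t.image h)) = convexHull ℝ (t : Set (ℕ → ℝ)) := by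
    intro t ht
    rw [← hull_img]
    congr 2
    rw [image_image]
    conv_rhs => rw [← image_id (s := t)]
    exact image_congr fun x hx => hFd x (ht x hx)
  have hv : ∀ t ∈ G.faces, ∀ x ∈ t, x ∈ verts G.faces := fun t ht x hx => mem_verts.2 ⟨t, ht, hx⟩
  have hcx := Lab_cx G.down_closed h
  have hinj : ∀ t ∈ G.faces, Set.InjOn F (R (full (t.image h))) := by
    intro t ht w hw w' hw' e
    have hs : ∀ w ∈ R (full (t.image h)), F w = ∑ x : {y // y ∈ t}, w (h x) • (x : ℕ → ℝ) ∧ ∑ x : {y // y ∈ t}, w (h x) = 1 := by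
      intro w hw
      have hio : Set.InjOn h t := hh.mono fun x hx => hv t ht x hx
      constructor
      · rw [lin_sum F hw.2.2, sum_image hio, ← sum_coe_sort]
        exact sum_congr rfl fun x _ => by rw [hFd x (hv t ht x x.2)]
      · rw [← hw.2.1, mass_eq hw.2.2, sum_image hio]
        exact sum_coe_sort t fun x => w (h x)
    have := affineIndependent_iff.1 (G.indep t ht) univ (fun x => w (h x) - w' (h x))
      (by rw [sum_sub_distrib, (hs w hw).2, (hs w' hw').2, sub_self])
      (by simp only [sub_smul]; rw [sum_sub_distrib, ← (hs w hw).1, ← (hs w' hw').1, e, sub_self])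
    ext i
    by_cases hi : i ∈ t.image h
    · obtain ⟨x, hx, rfl⟩ := mem_image.1 hi
      exact sub_eq_zero.1 (this ⟨x, hx⟩ (mem_univ _))
    · rw [Finsupp.notMem_support_iff.1 fun h' => hi (hw.2.2 h'), Finsupp.notMem_support_iff.1 fun h' => hi (hw'.2.2 h')]
  have hface : ∀ w ∈ R (Lab G.faces h), ∃ t ∈ G.faces, w ∈ R (full (t.image h)) := by
    intro w hw
    obtain ⟨t, ht, e⟩ := hw.2.2
    rcases ht with ht | rfl
    · exact ⟨t, ht, hw.1, hw.2.1, e.le⟩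
    · exact absurd (Finsupp.support_eq_empty.1 (by simpa using e)) (ne_zero_R hw)
  have hup : ∀ t ∈ G.faces, R (full (t.image h)) ⊆ R (Lab G.faces h) := by
    intro t ht
    exact R_mono fun s hs => hcx.2 _ ⟨t, Or.inl ht, rfl⟩ _ hs
  refine ⟨F, ?_, ?_, ?_⟩
  · intro w hw
    obtain ⟨t, ht, hwt⟩ := hface w hw
    refine Set.mem_iUnion₂.2 ⟨t, ht, ?_⟩
    rw [← himg t (hv t ht)]
    exact ⟨w, hwt, rfl⟩
  · intro w hw w' hw' e
    obtain ⟨t, ht, hwt⟩ := hface w hw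
    obtain ⟨t', ht', hwt'⟩ := hface w' hw'
    have h1 : F w ∈ convexHull ℝ ((t ∩ t' : Finset (ℕ → ℝ)) : Set (ℕ → ℝ)) := by
      rw [← G.glue t ht t' ht', ← himg t (hv t ht), ← himg t' (hv t' ht')]
      exact ⟨⟨w, hwt, rfl⟩, ⟨w', hwt', e.symm⟩⟩
    rw [← himg _ fun x hx => hv t ht x (mem_inter.1 hx).1] at h1
    obtain ⟨w2, hw2, e2⟩ := h1
    have a1 : w2 = w := hinj t ht (R_mono (fun s hs => hs.trans (image_subset_image inter_subset_left)) hw2) hwt e2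
    have a2 : w2 = w' := hinj t' ht' (R_mono (fun s hs => hs.trans (image_subset_image inter_subset_right)) hw2) hwt' (e2.trans e)
    rw [← a1, a2]
  · intro p hp
    obtain ⟨t, ht, hpt⟩ := Set.mem_iUnion₂.1 hp
    rw [← himg t (hv t ht)] at hpt
    obtain ⟨w, hw, rfl⟩ := hpt
    exact ⟨w, hup t ht hw, rfl⟩

theorem g_pl (G : GComplex) {h : (ℕ → ℝ) → ℕ} (hh : Set.InjOn h ↑(verts G.faces)) :
    ∃ F : Vec → (ℕ → ℝ), PLeq F (R (Lab G.faces h)) G.carrier := by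
  obtain ⟨F, hF⟩ := g_bij G hh
  exact ⟨F, PLeq.of_linear (poly_R (Lab_cx G.down_closed h)) F hF⟩

theorem heq_of_carrier {G G' : GComplex} (e : G.carrier = G'.carrier) {h h' : (ℕ → ℝ) → ℕ} (hh : Set.InjOn h ↑(verts G.faces))
    (hh' : Set.InjOn h' ↑(verts G'.faces)) : Heq (Lab G.faces h) (Lab G'.faces h') := by
  obtain ⟨F, hF⟩ := g_pl G hh
  obtain ⟨F', hF'⟩ := g_pl G' hh'
  obtain ⟨g, hg, -⟩ := hF'.symm
  rw [e] at hF
  exact ⟨_, hF.trans hg⟩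

theorem real_lab {α : Type*} [DecidableEq α] {K : Finset (Finset α)} {G : GComplex} (h : Realizes G K) {e : α → ℕ}
    (he : Set.InjOn e ↑(verts K)) : ∃ h : (ℕ → ℝ) → ℕ, Set.InjOn h ↑(verts G.faces) ∧ Lab G.faces h = Lab K e := by
  obtain ⟨f, hf, hG⟩ := h
  set iv := fun x => if hx : ∃ v ∈ verts K, f v = x then e hx.choose else 0 with hiv
  have hivf : ∀ v ∈ verts K, iv (f v) = e v := by
    intro v hv
    have hx : ∃ u ∈ verts K, f u = f v := ⟨v, hv, rfl⟩
    simp only [hiv, dif_pos hx]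
    rw [hf hx.choose_spec.1 hv hx.choose_spec.2]
  refine ⟨iv, ?_, ?_⟩
  · have : ∀ x ∈ verts G.faces, ∃ v ∈ verts K, f v = x := by
      intro x hx
      obtain ⟨s, hs, hxs⟩ := mem_verts.1 hx
      rw [hG] at hs
      obtain ⟨t, ht, rfl⟩ := mem_image.1 hs
      obtain ⟨v, hv, rfl⟩ := mem_image.1 hxs
      exact ⟨v, mem_verts.2 ⟨t, ht, hv⟩, rfl⟩
    intro x hx y hy e1
    obtain ⟨v, hv, rfl⟩ := this x hx
    obtain ⟨u, hu, rfl⟩ := this y hy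
    rw [hivf v hv, hivf u hu] at e1
    rw [he hv hu e1]
  · rw [hG, Lab_image]
    exact Lab_congr hivf

theorem exists_labelling {α : Type*} [DecidableEq α] (s : Finset α) : ∃ e : α → ℕ, Set.InjOn e ↑s :=
  Set.countable_iff_exists_injOn.1 s.finite_toSet.countable

theorem comb_heq {α β : Type*} [DecidableEq α] [DecidableEq β] {K : Finset (Finset α)} {L : Finset (Finset β)} (h : CombEquiv K L)
    {e : α → ℕ} (he : Set.InjOn e ↑(verts K)) {e' : β → ℕ} (he' : Set.InjOn e' ↑(verts L)) : Heq (Lab K e) (Lab L e') := by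
  obtain ⟨G1, G1', G2, G2', r1, r2, s1, s2, φ, hφ, hI⟩ := h
  obtain ⟨h1, hi1, e1⟩ := real_lab r1 he
  obtain ⟨h2, hi2, e2⟩ := real_lab r2 he'
  obtain ⟨k, hk⟩ := exists_labelling (verts G2'.faces)
  have hk1 : Set.InjOn (fun x => k (φ x)) ↑(verts G1'.faces) := by
    refine hk.comp hφ ?_
    intro x hx
    obtain ⟨s, hs, hxs⟩ := mem_verts.1 (mem_coe.1 hx)
    rw [mem_coe, mem_verts, hI]
    exact ⟨s.image φ, mem_image_of_mem _ hs, mem_image_of_mem _ hxs⟩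
  rw [← e1, ← e2]
  have a := heq_of_carrier s1.1.symm hi1 hk1
  have b := heq_of_carrier s2.1 hk hi2
  rw [hI, Lab_image] at b
  exact a.trans b

theorem Lab_std (A : Finset ℕ) (hA : A.Nonempty) : ∀ inst : DecidableEq ℕ, Lab (@stdSphere ℕ inst A) id = bd A := by
  intro inst
  obtain rfl : inst = instDecidableEqNat := Subsingleton.elim _ _
  ext s
  have : ∀ t : Finset ℕ, t ∈ stdSphere A ↔ t ≠ A ∧ t ≠ ∅ ∧ t ⊆ A := by
    intro t; simp [stdSphere]
  constructor
  · rintro ⟨t, ht, rfl⟩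
    rw [image_id]
    rcases ht with ht | rfl
    · rw [this] at ht
      exact Finset.ssubset_iff_subset_ne.2 ⟨ht.2.2, ht.1⟩
    · exact empty_ssubset.2 hA
  · intro hs
    have hs := Finset.ssubset_iff_subset_ne.1 hs
    refine ⟨s, ?_, by simp⟩
    rw [this]
    by_cases h : s = ∅
    · exact Or.inr h
    · exact Or.inl ⟨hs.2, h, hs.1⟩

theorem Lab_inj {α : Type*} [DecidableEq α] {K : Finset (Finset α)} {e : α → ℕ} (he : Set.InjOn e ↑(verts K)) {t : Finset α}
    (ht : ∀ x ∈ t, x ∈ verts K) : t.image e ∈ Lab K e ↔ t ∈ K ∨ t = ∅ := by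
  constructor
  · rintro ⟨u, hu, h⟩
    have hu' : ∀ x ∈ u, x ∈ verts K := by
      rcases hu with hu | rfl
      · exact fun x hx => mem_verts.2 ⟨u, hu, hx⟩
      · simp
    have : t = u := by
      ext x
      constructor
      · intro hx
        have : e x ∈ u.image e := h ▸ mem_image_of_mem e hx
        obtain ⟨y, hy, hxy⟩ := mem_image.1 this
        rwa [← he (hu' y hy) (ht x hx) hxy]
      · intro hx
        have : e x ∈ t.image e := h ▸ mem_image_of_mem e hx
        obtain ⟨y, hy, hxy⟩ := mem_image.1 this
        rwa [← he (ht y hy) (hu' x hx) hxy]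
    rwa [this]
  · intro h; exact ⟨t, h, rfl⟩

theorem Lab_link {α : Type*} [DecidableEq α] {K : Finset (Finset α)} (hK : IsComplex K) {e : α → ℕ} (he : Set.InjOn e ↑(verts K)) {v : α}
    (hv : v ∈ verts K) : Lab (link K {v}) e = lk (Lab K e) (e v) := by
  obtain ⟨s0, hs0, hvs0⟩ := mem_verts.1 hv
  have hv1 : {v} ∈ K := hK.2.2 s0 hs0 _ (by simpa using hvs0) (by simp)
  ext s
  constructor
  · rintro ⟨t, ht, rfl⟩
    have ht' : v ∉ t ∧ insert v t ∈ K := by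
      rcases ht with ht | rfl
      · simp only [link, mem_filter, disjoint_singleton_right] at ht
        refine ⟨ht.2.1, ?_⟩
        rw [insert_eq, union_comm]; exact ht.2.2
      · simpa using hv1
    refine ⟨fun h => ?_, ?_⟩
    · obtain ⟨x, hx, hxv⟩ := mem_image.1 h
      exact ht'.1 (by rw [← he (mem_verts.2 ⟨_, ht'.2, mem_insert_of_mem hx⟩) hv hxv]; exact hx)
    · exact ⟨insert v t, Or.inl ht'.2, by rw [image_insert]⟩
  · rintro ⟨h1, t, ht, h2⟩
    rcases ht with ht | rfl
    · have hvt : v ∈ t := by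
        have : e v ∈ t.image e := h2 ▸ mem_insert_self _ _
        obtain ⟨x, hx, hxv⟩ := mem_image.1 this
        rw [← he (mem_verts.2 ⟨_, ht, hx⟩) hv hxv]; exact hx
      have hs : s = (t.erase v).image e := by
        have : s = (insert (e v) s).erase (e v) := (erase_insert h1).symm
        rw [this, h2]
        ext i
        simp only [mem_erase, mem_image]
        constructor
        · rintro ⟨hi, x, hx, rfl⟩
          exact ⟨x, ⟨fun h => hi (by rw [h]), hx⟩, rfl⟩
        · rintro ⟨x, ⟨hx, hxt⟩, rfl⟩
          exact ⟨fun h => hx (he (mem_verts.2 ⟨_, ht, hxt⟩) hv h), x, hxt, rfl⟩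
      refine ⟨t.erase v, ?_, hs⟩
      rcases (t.erase v).eq_empty_or_nonempty with h0 | h0
      · exact Or.inr h0
      · left
        simp only [link, mem_filter, disjoint_singleton_right]
        refine ⟨hK.2.2 t ht _ (erase_subset _ _) h0, by simp, ?_⟩
        rw [union_comm, ← insert_eq, insert_erase hvt]; exact ht
    · simp at h2

theorem sph_of_comb {α : Type*} [DecidableEq α] {K : Finset (Finset α)} {k : ℕ} (h : IsCombSphere k K)
    (hK : ∀ s ∈ K, ∀ t : Finset α, t ⊆ s → t.Nonempty → t ∈ K) {e : α → ℕ} (he : Set.InjOn e ↑(verts K)) : Sph (k+2) (Lab K e) := by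
  obtain ⟨A, hA, h⟩ := h
  have hA0 : A.Nonempty := card_pos.1 (by omega)
  have := comb_heq h he (e' := id) Function.injective_id.injOn
  rw [Lab_std A hA0] at this
  exact ⟨Lab_cx hK e, Lab_emp e, by omega, A, hA, this⟩

theorem man_of_comb {α : Type*} [DecidableEq α] {M : Finset (Finset α)} {d : ℕ} (hd : 1 ≤ d) (h : IsCombManifold d M)
    {e : α → ℕ} (he : Set.InjOn e ↑(verts M)) : Man (d+1) (Lab M e) := by
  refine ⟨Lab_cx h.1.2.2 e, ?_⟩
  rintro i ⟨t, ht, hi⟩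
  have : i ∈ t.image e := by rw [← hi]; simp
  obtain ⟨v, hv, rfl⟩ := mem_image.1 this
  rcases ht with ht | rfl
  · have hvv := mem_verts.2 ⟨t, ht, hv⟩
    rw [← Lab_link h.1 he hvv]
    have := h.2 v hvv
    obtain ⟨k, rfl⟩ : ∃ k, d = k + 1 := ⟨d-1, by omega⟩
    refine sph_of_comb (by simpa using this) ?_ (he.mono ?_)
    · intro s hs u hu h0
      simp only [link, mem_filter] at hs ⊢
      exact ⟨h.1.2.2 s hs.1 u hu h0, hs.2.1.mono_left hu, h.1.2.2 _ hs.2.2 _ (union_subset_union hu le_rfl) (h0.mono subset_union_left)⟩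
    · intro x hx
      obtain ⟨s, hs, hxs⟩ := mem_verts.1 (mem_coe.1 hx)
      exact mem_verts.2 ⟨s, (mem_filter.1 hs).1, hxs⟩
  · simp at hv

end PL
end HomologySpheres

end

open Finset
noncomputable section
namespace HomologySpheres
namespace PL
open scoped Classical

theorem ker_zero {K : Set (Finset ℕ)} (hK : Cx K) {T : Vec →ₗ[ℝ] (ℕ → ℝ)} (hT : Set.InjOn T (R K)) {s : Finset ℕ} (hs : s ∈ K)
    {z : Vec} (hz : z.support ⊆ s) (hm : mass z = 0) (h0 : T z = 0) : z = 0 := by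
  set a : Vec := Finsupp.mapRange abs abs_zero z with ha
  have haa : ∀ i, a i = |z i| := fun i => Finsupp.mapRange_apply (hf := abs_zero) ..
  have has : a.support ⊆ s := by
    intro i hi
    rw [Finsupp.mem_support_iff, haa] at hi
    exact hz (Finsupp.mem_support_iff.2 (abs_ne_zero.1 hi))
  set C := mass a with hC
  have hCs : C = ∑ i ∈ s, |z i| := by rw [hC, mass_eq has]; exact sum_congr rfl fun i _ => haa i
  have hC0 : 0 ≤ C := by rw [hCs]; exact sum_nonneg fun i _ => abs_nonneg _
  rcases hC0.eq_or_lt with h | h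
  · ext i
    by_cases hi : i ∈ s
    · rw [hCs] at h
      exact abs_eq_zero.1 ((sum_eq_zero_iff_of_nonneg fun i _ => abs_nonneg (z i)).1 h.symm i hi)
    · exact Finsupp.notMem_support_iff.1 fun h' => hi (hz h')
  · have m1 : C⁻¹ • a ∈ R K := by
      refine ⟨fun i => ?_, ?_, hK.2 s hs _ (Finsupp.support_smul.trans has)⟩
      · rw [Finsupp.smul_apply, haa]; exact mul_nonneg (inv_nonneg.2 hC0) (abs_nonneg _)
      · rw [map_smul, ← hC, smul_eq_mul, inv_mul_cancel₀ h.ne']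
    have m2 : C⁻¹ • (a + z) ∈ R K := by
      refine ⟨fun i => ?_, ?_, hK.2 s hs _ (Finsupp.support_smul.trans (Finsupp.support_add.trans (union_subset has hz)))⟩
      · rw [Finsupp.smul_apply, Finsupp.add_apply, haa]
        exact mul_nonneg (inv_nonneg.2 hC0) (by linarith [neg_abs_le (z i)])
      · rw [map_smul, map_add, ← hC, hm, add_zero, smul_eq_mul, inv_mul_cancel₀ h.ne']
    have := hT m1 m2 (by rw [map_smul, map_smul, map_add, h0, add_zero])
    have := smul_right_injective Vec (inv_ne_zero h.ne') this
    simpa using this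

theorem full_sub {K : Set (Finset ℕ)} (hK : Cx K) {s : Finset ℕ} (hs : s ∈ K) : R (full s) ⊆ R K :=
  R_mono fun t ht => hK.2 s hs t ht

theorem mkG {K : Set (Finset ℕ)} (hK : Cx K) (hne : ∃ s ∈ K, s.Nonempty) {T : Vec →ₗ[ℝ] (ℕ → ℝ)} (hT : Set.InjOn T (R K)) :
    ∃ G : GComplex, ∀ f, f ∈ G.faces ↔ ∃ s ∈ K, s.Nonempty ∧ f = s.image fun i => T (dl i) := by
  have hTv : ∀ s ∈ K, ∀ t ∈ K, ∀ i ∈ s, ∀ j ∈ t, T (dl i) = T (dl j) → i = j := by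
    intro s hs t ht i hi j hj e
    have := hT (dl_mem.2 (hK.2 s hs _ (by simpa using hi))) (dl_mem.2 (hK.2 t ht _ (by simpa using hj))) e
    have h2 : (dl i).support = (dl j).support := by rw [this]
    simpa [supp_dl] using h2
  set F : Finset (Finset (ℕ → ℝ)) := (hK.1.toFinset.filter Finset.Nonempty).image (Finset.image fun i => T (dl i)) with hF
  have hmem : ∀ f, f ∈ F ↔ ∃ s ∈ K, s.Nonempty ∧ f = s.image fun i => T (dl i) := by
    intro f
    simp only [hF, mem_image, mem_filter, Set.Finite.mem_toFinset]
    constructor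
    · rintro ⟨s, ⟨h1, h2⟩, rfl⟩; exact ⟨s, h1, h2, rfl⟩
    · rintro ⟨s, h1, h2, rfl⟩; exact ⟨s, ⟨h1, h2⟩, rfl⟩
  refine ⟨⟨F, ?_, ?_, ?_, ?_, ?_⟩, hmem⟩
  · obtain ⟨s, h1, h2⟩ := hne
    exact ⟨_, (hmem _).2 ⟨s, h1, h2, rfl⟩⟩
  · rw [hmem]
    rintro ⟨s, h1, h2, h3⟩
    rw [eq_comm, image_eq_empty] at h3
    exact h2.ne_empty h3
  · intro f hf t ht h0
    obtain ⟨s, h1, h2, rfl⟩ := (hmem f).1 hf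
    obtain ⟨s', h3, rfl⟩ := subset_image_iff.1 ht
    exact (hmem _).2 ⟨s', hK.2 s h1 s' (by simpa using h3), by simpa using h0, rfl⟩
  · intro f hf
    obtain ⟨s, h1, h2, rfl⟩ := (hmem f).1 hf
    have hinj : Set.InjOn (fun i => T (dl i)) ↑s := fun i hi j hj e => hTv s h1 s h1 i hi j hj e
    rw [affineIndependent_iff]
    intro U u hu0 hu1
    set u' : (ℕ → ℝ) → ℝ := fun x => if hx : ∃ h : x ∈ s.image (fun i => T (dl i)), (⟨x, h⟩ : {y // y ∈ s.image (fun i => T (dl i))}) ∈ U then u ⟨x, hx.1⟩ else 0 with hu'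
    have key : ∀ {A : Type} [AddCommMonoid A] (φ : ℝ → (ℕ → ℝ) → A), (∀ x, φ 0 x = 0) →
        ∑ i ∈ s, φ (u' (T (dl i))) (T (dl i)) = ∑ x ∈ U, φ (u x) x := by
      intro A _ φ hφ
      rw [← sum_image (f := fun x => φ (u' x) x) hinj, ← sum_coe_sort]
      rw [← sum_subset (subset_univ U)]
      · refine sum_congr rfl fun x hx => ?_
        have : ∃ h : (x : ℕ → ℝ) ∈ s.image (fun i => T (dl i)), (⟨x, h⟩ : {y // y ∈ s.image (fun i => T (dl i))}) ∈ U := ⟨x.2, hx⟩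
        simp only [hu', dif_pos this]
      · intro x _ hx
        have : ¬ ∃ h : (x : ℕ → ℝ) ∈ s.image (fun i => T (dl i)), (⟨x, h⟩ : {y // y ∈ s.image (fun i => T (dl i))}) ∈ U := fun h => hx h.2
        simp only [hu', dif_neg this, hφ]
    set z : Vec := ∑ i ∈ s, u' (T (dl i)) • dl i with hz
    have hzs : z.support ⊆ s := by
      intro i hi
      by_contra hc
      apply Finsupp.mem_support_iff.1 hi
      rw [hz, Finsupp.finsetSum_apply]
      refine sum_eq_zero fun j hj => ?_
      rw [Finsupp.smul_apply, dl_apply, if_neg (fun e : j = i => hc (e ▸ hj)), smul_zero]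
    have hz0 : z = 0 := by
      refine ker_zero hK hT h1 hzs ?_ ?_
      · rw [hz, map_sum]
        simp only [map_smul, mass_dl, smul_eq_mul, mul_one]
        rw [key (fun a _ => a) (fun _ => rfl), hu0]
      · rw [hz, map_sum]
        simp only [map_smul]
        rw [key (fun a x => a • x) (fun _ => zero_smul _ _), hu1]
    intro x hx
    obtain ⟨i, hi, hix⟩ := mem_image.1 x.2
    have e1 : z i = u' (T (dl i)) := by
      rw [hz, Finsupp.finsetSum_apply, sum_eq_single i]
      · simp [dl_apply]
      · intro j _ hj; simp [dl_apply, hj]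
      · intro h; exact absurd hi h
    rw [hz0, Finsupp.zero_apply, hix] at e1
    have : ∃ h : (x : ℕ → ℝ) ∈ s.image (fun i => T (dl i)), (⟨x, h⟩ : {y // y ∈ s.image (fun i => T (dl i))}) ∈ U := ⟨x.2, hx⟩
    simp only [hu', dif_pos this] at e1
    exact e1.symm
  · intro f hf g hg
    obtain ⟨s, h1, h2, rfl⟩ := (hmem f).1 hf
    obtain ⟨t, h3, h4, rfl⟩ := (hmem g).1 hg
    have : s.image (fun i => T (dl i)) ∩ t.image (fun i => T (dl i)) = (s ∩ t).image (fun i => T (dl i)) := by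
      ext x
      simp only [mem_inter, mem_image]
      constructor
      · rintro ⟨⟨i, hi, rfl⟩, ⟨j, hj, e⟩⟩
        have := hTv t h3 s h1 j hj i hi e
        subst this
        exact ⟨j, ⟨hi, hj⟩, rfl⟩
      · rintro ⟨i, ⟨hi, hj⟩, rfl⟩; exact ⟨⟨i, hi, rfl⟩, ⟨i, hj, rfl⟩⟩
    rw [this, hull_img, hull_img, hull_img, ← hT.image_inter (full_sub hK h1) (full_sub hK h3)]
    congr 1
    ext w
    simp only [Set.mem_inter_iff, mem_R_full, subset_inter_iff]
    tauto

theorem mkG_carrier {K : Set (Finset ℕ)} (hK : Cx K) {T : Vec →ₗ[ℝ] (ℕ → ℝ)} {G : GComplex}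
    (hG : ∀ f, f ∈ G.faces ↔ ∃ s ∈ K, s.Nonempty ∧ f = s.image fun i => T (dl i)) : G.carrier = T '' R K := by
  ext x
  simp only [GComplex.carrier, Set.mem_iUnion, hG]
  constructor
  · rintro ⟨_, ⟨s, h1, h2, rfl⟩, hx⟩
    rw [hull_img] at hx
    exact Set.image_mono (full_sub hK h1) hx
  · rintro ⟨w, hw, rfl⟩
    refine ⟨_, ⟨w.support, hw.2.2, Finsupp.support_nonempty_iff.2 (ne_zero_R hw), rfl⟩, ?_⟩
    rw [hull_img]
    exact ⟨w, ⟨hw.1, hw.2.1, fun _ h => h⟩, rfl⟩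

theorem mkG_sub {K K1 : Set (Finset ℕ)} (hK : Cx K) (hK1 : Cx K1) {r : Vec →ₗ[ℝ] Vec} (hr : Set.BijOn r (R K1) (R K))
    {T : Vec →ₗ[ℝ] (ℕ → ℝ)} {G G1 : GComplex}
    (hG : ∀ f, f ∈ G.faces ↔ ∃ s ∈ K, s.Nonempty ∧ f = s.image fun i => T (dl i))
    (hG1 : ∀ f, f ∈ G1.faces ↔ ∃ s ∈ K1, s.Nonempty ∧ f = s.image fun i => (T ∘ₗ r) (dl i)) : Subdivides G1 G := by
  constructor
  · rw [mkG_carrier hK hG, mkG_carrier hK1 hG1, ← hr.image_eq, Set.image_image]; rfl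
  · intro f hf
    obtain ⟨s, h1, h2, rfl⟩ := (hG1 f).1 hf
    obtain ⟨b, hb, hbs⟩ := exists_pt h2
    have hrb := hr.mapsTo (full_sub hK1 h1 hb)
    refine ⟨_, (hG _).2 ⟨(r b).support, hrb.2.2, Finsupp.support_nonempty_iff.2 (ne_zero_R hrb), rfl⟩, ?_⟩
    rw [hull_img, hull_img, LinearMap.coe_comp, Set.image_comp]
    refine Set.image_mono ?_
    rw [R_full s, LinearMap.image_convexHull]
    refine convexHull_min ?_ (convex_full _)
    rintro _ ⟨_, ⟨v, hv, rfl⟩, rfl⟩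
    have hvs : ∀ v ∈ s, r (dl v) ∈ R K := fun v hv => hr.mapsTo (dl_mem.2 (hK1.2 s h1 _ (by simpa using hv)))
    refine ⟨(hvs v hv).1, (hvs v hv).2.1, ?_⟩
    intro i hi
    have e : (r b) i = ∑ j ∈ s, b j * (r (dl j)) i := by
      rw [lin_sum r hb.2.2, Finsupp.finsetSum_apply]; rfl
    rw [Finsupp.mem_support_iff, e]
    have hvp : 0 < b v := lt_of_le_of_ne (hb.1 v) (Ne.symm (Finsupp.mem_support_iff.1 (by rw [hbs]; exact hv)))
    have hip : 0 < (r (dl v)) i := lt_of_le_of_ne ((hvs v hv).1 i) (Ne.symm (Finsupp.mem_support_iff.1 hi))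
    refine ne_of_gt (sum_pos' (fun j hj => mul_nonneg (hb.1 j) ((hvs j hj).1 i)) ⟨v, hv, mul_pos hvp hip⟩)

def coeL : Vec →ₗ[ℝ] (ℕ → ℝ) where
  toFun w := w
  map_add' _ _ := rfl
  map_smul' _ _ := rfl

theorem coeL_inj : Function.Injective coeL := fun a b h => DFunLike.coe_injective h

theorem mkG_real {α : Type*} [DecidableEq α] {M : Finset (Finset α)} (hM : ∅ ∉ M) {e : α → ℕ} (he : Set.InjOn e ↑(verts M)) {G : GComplex}
    (hG : ∀ f, f ∈ G.faces ↔ ∃ s ∈ Lab M e, s.Nonempty ∧ f = s.image fun i => coeL (dl i)) : Realizes G M := by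
  refine ⟨fun v => coeL (dl (e v)), ?_, ?_⟩
  · intro v hv u hu h
    have := coeL_inj h
    have h2 : (dl (e v)).support = (dl (e u)).support := by rw [this]
    exact he hv hu (by simpa [supp_dl] using h2)
  · ext f
    rw [hG, mem_image]
    constructor
    · rintro ⟨s, ⟨t, ht, rfl⟩, h2, rfl⟩
      rcases ht with ht | rfl
      · exact ⟨t, ht, by rw [image_image]; rfl⟩
      · simp at h2
    · rintro ⟨t, ht, rfl⟩
      refine ⟨t.image e, ⟨t, Or.inl ht, rfl⟩, ?_, by rw [image_image]; rfl⟩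
      rw [image_nonempty, nonempty_iff_ne_empty]
      rintro rfl; exact hM ht

theorem comb_of_heq {α : Type*} [DecidableEq α] {M : Finset (Finset α)} (hM : IsComplex M) {e : α → ℕ} (he : Set.InjOn e ↑(verts M))
    {k : ℕ} (h : Sph (k+2) (Lab M e)) : IsCombSphere k M := by
  obtain ⟨Ω, hΩ, f, hf⟩ := h.eqv
  have hΩ0 : Ω.Nonempty := card_pos.1 (by omega)
  have hK := h.cx
  have hL := cx_bd Ω
  obtain ⟨K1, r, g, hES, hEq, hRef⟩ := theoremR hK hL hf
  have hK1 := hES.cx hK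
  have hrb := hES.bij hK
  have hgb := hRef.bij
  have hneK : ∃ s ∈ Lab M e, s.Nonempty := by
    obtain ⟨s, hs⟩ := hM.1
    refine ⟨s.image e, ⟨s, Or.inl hs, rfl⟩, ?_⟩
    rw [image_nonempty, nonempty_iff_ne_empty]
    rintro rfl; exact hM.2.1 hs
  have hneK1 : ∃ s ∈ K1, s.Nonempty := by
    obtain ⟨s, hs, h0⟩ := hneK
    obtain ⟨p, hp, -⟩ := exists_pt h0
    obtain ⟨w, hw, -⟩ := hrb.surjOn (full_sub hK hs hp)
    exact ⟨_, hw.2.2, Finsupp.support_nonempty_iff.2 (ne_zero_R hw)⟩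
  have hneL : ∃ s ∈ bd Ω, s.Nonempty := by
    obtain ⟨s, hs, h0⟩ := hneK1
    obtain ⟨p, hp, -⟩ := exists_pt h0
    have := hgb.mapsTo (full_sub hK1 hs hp)
    exact ⟨_, this.2.2, Finsupp.support_nonempty_iff.2 (ne_zero_R this)⟩
  have ir : Set.InjOn (coeL ∘ₗ r) (R K1) := fun a ha b hb e => hrb.injOn ha hb (coeL_inj e)
  have ig : Set.InjOn (coeL ∘ₗ g) (R K1) := fun a ha b hb e => hgb.injOn ha hb (coeL_inj e)
  obtain ⟨G1, hG1⟩ := mkG hK hneK (T := coeL) coeL_inj.injOn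
  obtain ⟨G2, hG2⟩ := mkG hL hneL (T := coeL) coeL_inj.injOn
  obtain ⟨G1', hG1'⟩ := mkG hK1 hneK1 ir
  obtain ⟨G2', hG2'⟩ := mkG hK1 hneK1 ig
  refine ⟨Ω, hΩ, G1, G1', G2, G2', mkG_real hM.2.1 he hG1, ?_, mkG_sub hK hK1 hrb hG1 hG1', mkG_sub hL hK1 hgb hG2 hG2', ?_⟩
  · refine mkG_real (by simp [stdSphere]) (e := id) Function.injective_id.injOn ?_
    rw [Lab_std Ω hΩ0]
    exact hG2
  · set D : Set ℕ := {i | {i} ∈ K1}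
    have hrD : Set.InjOn (fun i => (coeL ∘ₗ r) (dl i)) D := by
      intro i hi j hj e
      have := ir (dl_mem.2 hi) (dl_mem.2 hj) e
      have h2 : (dl i).support = (dl j).support := by rw [this]
      simpa [supp_dl] using h2
    have hgD : Set.InjOn (fun i => (coeL ∘ₗ g) (dl i)) D := by
      intro i hi j hj e
      have := ig (dl_mem.2 hi) (dl_mem.2 hj) e
      have h2 : (dl i).support = (dl j).support := by rw [this]
      simpa [supp_dl] using h2
    set φ : (ℕ → ℝ) → (ℕ → ℝ) := fun x => (coeL ∘ₗ g) (dl (Function.invFunOn (fun i => (coeL ∘ₗ r) (dl i)) D x)) with hφ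
    have hφr : ∀ i ∈ D, φ ((coeL ∘ₗ r) (dl i)) = (coeL ∘ₗ g) (dl i) := by
      intro i hi
      have := hrD.leftInvOn_invFunOn hi
      simp only [hφ]
      rw [this]
    have hsD : ∀ s ∈ K1, ∀ i ∈ s, i ∈ D := fun s hs i hi => hK1.2 s hs _ (by simpa using hi)
    have himg : ∀ s ∈ K1, (s.image fun i => (coeL ∘ₗ r) (dl i)).image φ = s.image fun i => (coeL ∘ₗ g) (dl i) := by
      intro s hs
      rw [image_image]
      exact image_congr fun i hi => hφr i (hsD s hs i hi)
    refine ⟨φ, ?_, ?_⟩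
    · have : ∀ x ∈ verts G1'.faces, ∃ i ∈ D, x = (coeL ∘ₗ r) (dl i) := by
        intro x hx
        obtain ⟨f, hf, hxf⟩ := mem_verts.1 hx
        obtain ⟨s, hs, -, rfl⟩ := (hG1' f).1 hf
        obtain ⟨i, hi, rfl⟩ := mem_image.1 hxf
        exact ⟨i, hsD s hs i hi, rfl⟩
      intro x hx y hy h
      obtain ⟨i, hi, rfl⟩ := this x hx
      obtain ⟨j, hj, rfl⟩ := this y hy
      rw [hφr i hi, hφr j hj] at h
      rw [hgD hi hj h]
    · ext f
      rw [mem_image, hG2']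
      constructor
      · rintro ⟨s, hs, h0, rfl⟩
        exact ⟨_, (hG1' _).2 ⟨s, hs, h0, rfl⟩, himg s hs⟩
      · rintro ⟨t, ht, rfl⟩
        obtain ⟨s, hs, h0, rfl⟩ := (hG1' t).1 ht
        exact ⟨s, hs, h0, himg s hs⟩

end PL
end HomologySpheres

end

open Finset
noncomputable section
namespace HomologySpheres
namespace PL
open scoped Classical

theorem bdy_formula {X : Finset ℕ} {c : Chn} (hc : ∀ s, c s ≠ 0 → s ⊆ X) (t : Finset ℕ) :
    bdy c t = ∑ v ∈ X \ t, c (insert v t) := by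
  have h1 : bdy c t = ∑ s ∈ c.support, c s * ∑ v ∈ s, (if s.erase v = t then 1 else 0) := by
    rw [bdy, lin, Finsupp.linearCombination_apply, Finsupp.sum, Finsupp.finsetSum_apply]
    refine sum_congr rfl fun s _ => ?_
    rw [Finsupp.smul_apply, smul_eq_mul, Finsupp.finsetSum_apply]
    simp only [ee, Finsupp.single_apply]
  have h2 : ∀ u, c u = ∑ s ∈ c.support, c s * (if s = u then 1 else 0) := by
    intro u
    simp only [mul_ite, mul_one, mul_zero]
    rw [sum_ite_eq']
    split_ifs with h
    · rfl
    · exact Finsupp.notMem_support_iff.1 h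
  rw [h1]
  simp_rw [h2 (insert _ t)]
  rw [sum_comm]
  refine sum_congr rfl fun s hs => ?_
  rw [← mul_sum]
  congr 1
  rw [← sum_filter, ← sum_filter]
  congr 1
  have hsX := hc s (Finsupp.mem_support_iff.1 hs)
  ext v
  simp only [mem_filter, mem_sdiff]
  constructor
  · rintro ⟨h, rfl⟩; exact ⟨⟨hsX h, by simp⟩, (insert_erase h).symm⟩
  · rintro ⟨⟨h, h'⟩, rfl⟩; exact ⟨by simp, erase_insert h'⟩

section hom
variable {α : Type*} [DecidableEq α]

def Dn (M : Finset (Finset α)) (e : α → ℕ) (c : Chn) : Finset α → ZMod 2 :=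
  fun s => if s ∈ M ∨ s = ∅ then c (s.image e) else 0

theorem face_verts {M : Finset (Finset α)} {s : Finset α} (h : s ∈ M ∨ s = ∅) : ∀ x ∈ s, x ∈ verts M := by
  rcases h with h | rfl
  · exact fun x hx => mem_verts.2 ⟨s, h, hx⟩
  · simp

theorem Dn_ok {M : Finset (Finset α)} {e : α → ℕ} (he : Set.InjOn e ↑(verts M)) {n : ℕ} {c : Chn} (hc : c ∈ Ch (Lab M e) n) :
    z2chainOK M n (Dn M e c) := by
  intro s hs
  unfold Dn at hs
  split_ifs at hs with h
  · refine ⟨?_, h⟩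
    rw [← (mem_Ch.1 hc _ hs).2, card_image_of_injOn]
    exact he.mono (face_verts h)
  · exact absurd rfl hs

theorem Dn_bdy {M : Finset (Finset α)} (hM : IsComplex M) {e : α → ℕ} (he : Set.InjOn e ↑(verts M)) {n : ℕ} {c : Chn} (hc : c ∈ Ch (Lab M e) n) :
    z2bdry M (Dn M e c) = Dn M e (bdy c) := by
  funext t
  have hX : ∀ s, c s ≠ 0 → s ⊆ (verts M).image e := by
    intro s hs
    obtain ⟨⟨u, hu, rfl⟩, -⟩ := mem_Ch.1 hc s hs
    exact image_subset_image (face_verts hu)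
  by_cases h : t ∈ M ∨ t = ∅
  · have : (verts M).image e \ t.image e = (verts M \ t).image e := by
      have hsub : t ⊆ verts M := face_verts h
      ext i
      simp only [mem_sdiff, mem_image]
      constructor
      · rintro ⟨⟨x, hx, rfl⟩, h2⟩
        exact ⟨x, ⟨hx, fun h' => h2 ⟨x, h', rfl⟩⟩, rfl⟩
      · rintro ⟨x, ⟨hx, hxt⟩, rfl⟩
        refine ⟨⟨x, hx, rfl⟩, ?_⟩
        rintro ⟨y, hy, hyx⟩
        exact hxt (by rw [← he (hsub hy) hx hyx]; exact hy)
    unfold z2bdry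
    rw [Dn, if_pos h, bdy_formula hX, this, sum_image (he.mono (by intro x hx; exact (mem_sdiff.1 hx).1))]
    refine sum_congr rfl fun v hv => ?_
    rw [Dn, ← image_insert]
    split_ifs with h'
    · rfl
    · by_contra hne
      have := (mem_Ch.1 hc _ (Ne.symm hne)).1
      refine h' ((Lab_inj he ?_).1 this)
      intro x hx
      rcases mem_insert.1 hx with rfl | hx
      · exact (mem_sdiff.1 hv).1
      · exact face_verts h x hx
  · rw [Dn, if_neg h]
    refine sum_eq_zero fun v hv => ?_
    rw [Dn, if_neg]
    rintro (h' | h')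
    · exact h (Or.inl (hM.2.2 _ h' t (subset_insert _ _) (nonempty_iff_ne_empty.2 fun h0 => h (Or.inr h0))))
    · exact insert_ne_empty _ _ h'

theorem Dn_inj {M : Finset (Finset α)} {e : α → ℕ} {n n' : ℕ} {c c' : Chn} (hc : c ∈ Ch (Lab M e) n) (hc' : c' ∈ Ch (Lab M e) n')
    (h : Dn M e c = Dn M e c') : c = c' := by
  ext s
  by_cases hs : s ∈ Lab M e
  · obtain ⟨t, ht, rfl⟩ := hs
    have := congrFun h t
    rwa [Dn, Dn, if_pos ht, if_pos ht] at this
  · have a : c s = 0 := by by_contra h0; exact hs (mem_Ch.1 hc s h0).1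
    have b : c' s = 0 := by by_contra h0; exact hs (mem_Ch.1 hc' s h0).1
    rw [a, b]

theorem Dn_surj {M : Finset (Finset α)} {e : α → ℕ} (he : Set.InjOn e ↑(verts M)) {n : ℕ} {z : Finset α → ZMod 2}
    (hz : z2chainOK M n z) : ∃ c ∈ Ch (Lab M e) n, Dn M e c = z := by
  have huniq : ∀ t u : Finset α, (t ∈ M ∨ t = ∅) → (u ∈ M ∨ u = ∅) → t.image e = u.image e → t = u := by
    intro t u ht hu h
    exact image_injOn_powerset_of_injOn he (by simpa using (show t ⊆ verts M from face_verts ht)) (by simpa using (show u ⊆ verts M from face_verts hu)) h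
  set φ : Finset ℕ → ZMod 2 := fun s => if h : ∃ t, (t ∈ M ∨ t = ∅) ∧ s = t.image e then z h.choose else 0 with hφ
  have hφi : ∀ t, (t ∈ M ∨ t = ∅) → φ (t.image e) = z t := by
    intro t ht
    have h : ∃ u, (u ∈ M ∨ u = ∅) ∧ t.image e = u.image e := ⟨t, ht, rfl⟩
    simp only [hφ, dif_pos h]
    rw [← huniq t _ ht h.choose_spec.1 h.choose_spec.2]
  have hφ0 : ∀ s, φ s ≠ 0 → ∃ t, (t ∈ M ∨ t = ∅) ∧ s = t.image e := by
    intro s hs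
    by_contra hc
    exact hs (by simp only [hφ, dif_neg hc])
  refine ⟨Finsupp.onFinset ((insert ∅ M).image (Finset.image e)) φ ?_, ?_, ?_⟩
  · intro s hs
    obtain ⟨t, ht, rfl⟩ := hφ0 s hs
    exact mem_image_of_mem _ (by rcases ht with ht | rfl <;> simp [*])
  · rw [mem_Ch]
    intro s hs
    rw [Finsupp.onFinset_apply] at hs
    obtain ⟨t, ht, rfl⟩ := hφ0 s hs
    refine ⟨⟨t, ht, rfl⟩, ?_⟩
    rw [hφi t ht] at hs
    rw [card_image_of_injOn (he.mono (face_verts ht)), (hz t hs).1]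
  · funext t
    rw [Dn, Finsupp.onFinset_apply]
    split_ifs with h
    · exact hφi t h
    · by_contra h0
      exact h (hz t (Ne.symm h0)).2

theorem Dn_zero (M : Finset (Finset α)) (e : α → ℕ) : Dn M e 0 = 0 := by
  funext t; simp [Dn]

theorem hom_of_z2 {M : Finset (Finset α)} (hM : IsComplex M) {e : α → ℕ} (he : Set.InjOn e ↑(verts M)) {d : ℕ} (h : Z2HomologySphere d M) :
    (∀ n, n ≠ d+1 → Van n (Lab M e)) ∧ ¬ Van (d+1) (Lab M e) := by
  have hcx := Lab_cx hM.2.2 e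
  constructor
  · intro n hn c hc hb
    obtain ⟨b, hb1, hb2⟩ := h.1 n (Dn M e c) hn (Dn_ok he hc) (by rw [Dn_bdy hM he hc, hb, Dn_zero])
    obtain ⟨b', hb', rfl⟩ := Dn_surj he hb1
    refine ⟨b', hb', Dn_inj (bdy_mem hcx hb') hc ?_⟩
    rw [← Dn_bdy hM he hb', hb2]
  · intro hV
    obtain ⟨z, hz1, hz2, hz3, -⟩ := h.2
    obtain ⟨c, hc, rfl⟩ := Dn_surj he hz1
    have hb : bdy c = 0 := by
      refine Dn_inj (bdy_mem hcx hc) (Submodule.zero_mem (Ch (Lab M e) d)) ?_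
      rw [← Dn_bdy hM he hc, hz2, Dn_zero]
    obtain ⟨b, hb1, hb2⟩ := hV c hc hb
    exact hz3 _ (Dn_ok he hb1) (by rw [Dn_bdy hM he hb1, hb2])

end hom

theorem main_aux {V : Type*} [DecidableEq V] (d : ℕ)
    (M : Finset (Finset V))
    (hM : IsCombManifold d M) (hn : (verts M).card = d + 9)
    (hsph : Z2HomologySphere d M) (hns : ¬ IsCombSphere d M) :
    ∀ i < d, ¬ ∃ A : Finset V, BistellarIMove d i M A := by
  rintro i hi ⟨A, hA, -, -, hβ, hα, hαc, -⟩
  have hd : 1 ≤ d := by omega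
  obtain ⟨e, he⟩ := exists_labelling (verts M)
  have hmb : ∀ x, x ∈ bcore M A ↔ x ∈ A ∧ A.erase x ∈ M := by intro x; simp [bcore]
  have hβ0 : (bcore M A).Nonempty := by
    rw [nonempty_iff_ne_empty]
    intro h
    rw [h, sdiff_empty, hA] at hαc
    omega
  obtain ⟨a, ha⟩ : (A \ bcore M A).Nonempty := card_pos.1 (by omega)
  rw [mem_sdiff] at ha
  have hAv : A ⊆ verts M := by
    intro x hx
    obtain ⟨y, hy⟩ := hβ0
    by_cases hxb : x ∈ bcore M A
    · have h2 : 1 < (bcore M A).card := by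
        by_contra h
        have h1 : (bcore M A).card ≤ 1 := by omega
        have := card_sdiff_of_subset (show bcore M A ⊆ A from fun z hz => ((hmb z).1 hz).1)
        omega
      obtain ⟨z, hz, hzx⟩ := exists_mem_ne h2 x
      exact mem_verts.2 ⟨_, ((hmb z).1 hz).2, mem_erase.2 ⟨Ne.symm hzx, hx⟩⟩
    · exact mem_verts.2 ⟨_, ((hmb y).1 hy).2, mem_erase.2 ⟨fun h => hxb (h ▸ hy), hx⟩⟩
  set B : Finset ℕ := (verts M \ A).image e with hB
  have hBc : B.card ≤ 7 := by
    refine card_image_le.trans ?_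
    rw [card_sdiff_of_subset hAv]; omega
  obtain ⟨h1, h2⟩ := hom_of_z2 hM.1 he hsph
  refine hns (comb_of_heq hM.1 he (reduce hd hBc _ (Lab M e) (e a) (man_of_comb hd hM he) (Lab_emp e) ?_ ?_ h1 h2 rfl))
  · intro h
    obtain ⟨x, hx, hxa⟩ := mem_image.1 h
    rw [mem_sdiff] at hx
    exact hx.2 (by rw [he hx.1 (hAv ha.1) hxa]; exact ha.1)
  · rintro s ⟨t, ht, rfl⟩ hdis
    have htA : t ⊆ A := by
      intro x hx
      by_contra hxA
      exact disjoint_left.1 hdis (mem_image_of_mem e hx) (mem_image_of_mem e (mem_sdiff.2 ⟨face_verts ht x hx, hxA⟩))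
    have hnb : ¬ bcore M A ⊆ t := by
      intro hbt
      rcases ht with ht | rfl
      · exact hβ (hM.1.2.2 t ht _ hbt hβ0)
      · obtain ⟨y, hy⟩ := hβ0
        exact absurd (hbt hy) (by simp)
    obtain ⟨x, hx, hxt⟩ := not_subset.1 hnb
    refine ⟨insert a t, Or.inl (hM.1.2.2 _ ((hmb x).1 hx).2 _ ?_ (insert_nonempty _ _)), by rw [image_insert]⟩
    intro y hy
    rw [mem_erase]
    rcases mem_insert.1 hy with rfl | hy
    · exact ⟨fun h => ha.2 (h ▸ hx), ha.1⟩
    · exact ⟨fun h => hxt (h ▸ hy), htA hy⟩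

end PL
end HomologySpheres

end

noncomputable section

attribute [local instance] Classical.propDecidable

namespace HomologySpheres

variable {V : Type*} [DecidableEq V] {W : Type*} [DecidableEq W]

/-- Corollary 4: a `(d+9)`-vertex combinatorial triangulation of a
`ℤ/2`-homology `d`-sphere which is not a combinatorial sphere admits no
bistellar `i`-move for any `i < d`. -/
theorem no_proper_bistellar_move {V : Type*} [DecidableEq V] (d : ℕ)
    (M : Finset (Finset V))
    (hM : IsCombManifold d M) (hn : (verts M).card = d + 9)
    (hsph : Z2HomologySphere d M) (hns : ¬ IsCombSphere d M) :
    ∀ i < d, ¬ ∃ A : Finset V, BistellarIMove d i M A := by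
  exact PL.main_aux d M hM hn hsph hns

end HomologySpheres
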